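/- Let α > 0 be fixed. With 𝒩_N(m), E_N(m), V_N(m) the number, expected number, and variance of the number of real eigenvalues of the product of m independent N×N Gaussian matrices, for any sequence of positive integers (m_N) indexed by even N with m_N/N → α as N → ∞, one has V_N(m_N)/E_N(m_N) → r(α), where r(α) := 2 − 2 s(α)/c(α), c(α) := ∫₀¹ erf(√(α/(8t))) dt, and s(α) := ∫₀¹ (α/(8πt)) Σ_{k∈ℤ} (∫_{2k−1}^{2k+1} e^{−αx²/(8t)} dx)² dt. -/

import Mathlib

open MeasureTheory ProbabilityTheory Filter

/-- The error function `erf x = (2/√π) ∫_0^x e^{-s²} ds`. -/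
noncomputable def erf (x : ℝ) : ℝ :=
  (2 / Real.sqrt Real.pi) * ∫ s in (0:ℝ)..x, Real.exp (-s ^ 2)

/-- `c(α) = ∫_0^1 erf(√(α/(8t))) dt`. -/
noncomputable def cFun (α : ℝ) : ℝ :=
  ∫ t in (0:ℝ)..1, erf (Real.sqrt (α / (8 * t)))

/-- The joint law of `m` independent `N × N` matrices with i.i.d. real Gaussian
entries of mean `0` and variance `1/N`. -/
noncomputable def ensembleMeasure (N m : ℕ) :
    Measure (Fin m → Fin N → Fin N → ℝ) :=
  Measure.pi fun _ =>
    Measure.pi fun _ => Measure.pi fun _ => gaussianReal 0 (1 / N)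

/-- The product matrix `P = X_1 ⋯ X_m`. -/
noncomputable def prodMatrix (N m : ℕ) (ω : Fin m → Fin N → Fin N → ℝ) :
    Matrix (Fin N) (Fin N) ℝ :=
  (List.ofFn fun i => Matrix.of (ω i)).prod

/-- The number of real eigenvalues of a matrix, i.e. the number of real roots of
its characteristic polynomial counted with multiplicity. -/
noncomputable def numRealEigs (N : ℕ) (P : Matrix (Fin N) (Fin N) ℝ) : ℕ :=
  (Matrix.charpoly P).roots.card

/-- The expected number of real eigenvalues of the product of `m` independent
`N × N` Gaussian matrices. -/
noncomputable def EN (N m : ℕ) : ℝ :=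
  ∫ ω, (numRealEigs N (prodMatrix N m ω) : ℝ) ∂(ensembleMeasure N m)

/-- The variance of the number of real eigenvalues. -/
noncomputable def VN (N m : ℕ) : ℝ :=
  variance (fun ω => (numRealEigs N (prodMatrix N m ω) : ℝ)) (ensembleMeasure N m)

/-- `s(α) = ∫_0^1 (α/(8πt)) Σ_{k∈ℤ} (∫_{2k-1}^{2k+1} e^{-αx²/(8t)} dx)² dt`. -/
noncomputable def sFun (α : ℝ) : ℝ :=
  ∫ t in (0:ℝ)..1, (α / (8 * Real.pi * t)) *
    ∑' k : ℤ, (∫ x in (2 * (k : ℝ) - 1)..(2 * (k : ℝ) + 1),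
      Real.exp (-(α * x ^ 2) / (8 * t))) ^ 2

set_option linter.unusedSectionVars false

section

open Set Topology
open scoped ENNReal

/-- The area formula for `C¹` maps between spaces of equal dimension, counting regular preimages. -/
theorem lintegral_abs_det_fderiv_mul_eq_lintegral_tsum_fiber
    {E : Type*} [NormedAddCommGroup E] [NormedSpace ℝ E]
    [FiniteDimensional ℝ E] [MeasurableSpace E] [BorelSpace E] (μ : Measure E)
    [μ.IsAddHaarMeasure] {f : E → E} {f' : E → E →L[ℝ] E}
    (hf : ∀ x, HasStrictFDerivAt f (f' x) x) (hc : Continuous f') (h : E → ℝ≥0∞)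
    (hh : Measurable h) :
    (Measurable fun c => ∑' x, (f ⁻¹' {c} ∩ {x | (f' x).det ≠ 0}).indicator h x) ∧
    ∫⁻ x, ENNReal.ofReal |(f' x).det| * h x ∂μ
      = ∫⁻ c, ∑' x, (f ⁻¹' {c} ∩ {x | (f' x).det ≠ 0}).indicator h x ∂μ := by
  classical
  have hdet : Continuous fun x => (f' x).det := ContinuousLinearMap.continuous_det.comp hc
  set U : Set E := {x | (f' x).det ≠ 0} with hU
  have hUo : IsOpen U := isOpen_ne_fun hdet continuous_const
  have hloc : ∀ x : U, ∃ s : Set E, IsOpen s ∧ (x : E) ∈ s ∧ InjOn f s := by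
    rintro ⟨x, hx⟩
    have hfx : HasStrictFDerivAt f
        (((f' x).toContinuousLinearEquivOfDetNeZero hx : E ≃L[ℝ] E) : E →L[ℝ] E) x := by
      simpa using hf x
    exact ⟨(hfx.toOpenPartialHomeomorph f).source, (hfx.toOpenPartialHomeomorph f).open_source,
      hfx.mem_toOpenPartialHomeomorph_source, (hfx.toOpenPartialHomeomorph f).injOn⟩
  choose s hso hxs hsi using hloc
  obtain ⟨T, hTc, hT⟩ := TopologicalSpace.isOpen_iUnion_countable s hso
  have hcov : U ⊆ ⋃ i ∈ T, s i := by
    rw [hT]; exact fun x hx => mem_iUnion.2 ⟨⟨x, hx⟩, hxs _⟩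
  have hex : ∃ S : ℕ → Set E, (∀ n, IsOpen (S n)) ∧ (∀ n, InjOn f (S n)) ∧ U ⊆ ⋃ n, S n := by
    rcases T.eq_empty_or_nonempty with h0 | h0
    · refine ⟨fun _ => ∅, fun _ => isOpen_empty, fun _ => injOn_empty _, ?_⟩
      simpa [h0] using hcov
    · obtain ⟨e, rfl⟩ := hTc.exists_eq_range h0
      refine ⟨fun n => s (e n), fun n => hso _, fun n => hsi _, ?_⟩
      simpa using hcov
  obtain ⟨S, hSo, hSi, hSc⟩ := hex
  set A : ℕ → Set E := fun n => disjointed S n ∩ U with hA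
  have hAm : ∀ n, MeasurableSet (A n) := fun n =>
    (MeasurableSet.disjointed (fun n => (hSo n).measurableSet) n).inter hUo.measurableSet
  have hAi : ∀ n, InjOn f (A n) := fun n =>
    (hSi n).mono (inter_subset_left.trans (disjointed_subset S n))
  have hAd : Pairwise (Function.onFun Disjoint A) := fun i j hij =>
    (disjoint_disjointed S hij).mono inter_subset_left inter_subset_left
  have hAU : ⋃ n, A n = U := by
    rw [hA, ← iUnion_inter, iUnion_disjointed]
    exact inter_eq_right.2 hSc
  have hfw : ∀ n, ∀ x ∈ A n, HasFDerivWithinAt f (f' x) (A n) x := fun n x _ =>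
    (hf x).hasFDerivAt.hasFDerivWithinAt
  set k : ℕ → E → ℝ≥0∞ := fun n c => ∑' x, (f ⁻¹' {c} ∩ A n).indicator h x with hk
  have hk1 : ∀ n, ∀ x ∈ A n, k n (f x) = h x := by
    intro n x hx
    simp only [hk]
    rw [tsum_eq_single x]
    · rw [indicator_of_mem]; exact ⟨rfl, hx⟩
    · intro y hy
      refine indicator_of_notMem (fun hy' => hy (hAi n hy'.2 hx hy'.1)) _
  have hk0 : ∀ n, ∀ c, c ∉ f '' A n → k n c = 0 := by
    intro n c hc
    simp only [hk]
    refine ENNReal.tsum_eq_zero.2 fun x => indicator_of_notMem (fun hx => hc ⟨x, hx.2, hx.1⟩) _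
  have hkm : ∀ n, Measurable (k n) := by
    intro n
    have hemb := measurableEmbedding_of_fderivWithin (hAm n) (hfw n) (hAi n)
    have : k n = Function.extend ((A n).domRestrict f) (fun x : A n => h x) (fun _ => 0) := by
      funext c
      by_cases hc : c ∈ f '' A n
      · obtain ⟨x, hx, rfl⟩ := hc
        rw [hk1 n x hx]
        exact (hemb.injective.extend_apply (fun x : A n => h x) (fun _ => 0) ⟨x, hx⟩).symm
      · rw [hk0 n c hc, Function.extend_apply']
        rintro ⟨⟨x, hx⟩, rfl⟩
        exact hc ⟨x, hx, rfl⟩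
    rw [this]
    exact hemb.measurable_extend (hh.comp measurable_subtype_coe) measurable_const
  have hR : (fun c => ∑' x, (f ⁻¹' {c} ∩ {x | (f' x).det ≠ 0}).indicator h x)
      = fun c => ∑' n, k n c := by
    funext c
    rw [hk, ENNReal.tsum_comm]
    refine tsum_congr fun x => ?_
    by_cases hx : x ∈ f ⁻¹' {c} ∩ U
    · have hxU : x ∈ U := hx.2
      rw [← hAU] at hxU
      obtain ⟨i, hi⟩ := mem_iUnion.1 hxU
      rw [tsum_eq_single i, indicator_of_mem hx,
        indicator_of_mem (show x ∈ f ⁻¹' {c} ∩ A i from ⟨hx.1, hi⟩)]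
      intro j hj
      refine indicator_of_notMem (fun hj' => ?_) _
      exact (disjoint_left.1 (hAd hj)) hj'.2 hi
    · rw [indicator_of_notMem hx, eq_comm]
      refine ENNReal.tsum_eq_zero.2 fun n => indicator_of_notMem (fun h' => hx ⟨h'.1, ?_⟩) _
      rw [← hAU]
      exact mem_iUnion.2 ⟨n, h'.2⟩
  refine ⟨by rw [hR]; exact Measurable.tsum hkm, ?_⟩
  rw [lintegral_congr fun c => congrFun hR c, lintegral_tsum fun n => (hkm n).aemeasurable]
  have hn : ∀ n, ∫⁻ c, k n c ∂μ = ∫⁻ x in A n, ENNReal.ofReal |(f' x).det| * h x ∂μ := by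
    intro n
    rw [← setLIntegral_eq_of_support_subset (s := f '' A n) (f := k n),
      lintegral_image_eq_lintegral_abs_det_fderiv_mul μ (hAm n) (hfw n) (hAi n)]
    · exact setLIntegral_congr_fun (hAm n) fun x hx => by simp only [hk1 n x hx]
    · intro c hc
      by_contra h'
      exact hc (hk0 n c h')
  simp_rw [hn]
  rw [← lintegral_iUnion hAm hAd, hAU, eq_comm]
  refine setLIntegral_eq_of_support_subset ?_
  intro x hx
  by_contra h'
  apply hx
  have : (f' x).det = 0 := by simpa [hU] using h'
  simp [this]

end

section

open Matrix

section CyclicDet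
variable {R : Type*} [CommRing R] {v : Type*} [Fintype v] [DecidableEq v]

/-- The determinant of a block upper triangular matrix with blocks of equal size. -/
theorem det_comp_of_upper {m : ℕ} (A : Matrix (Fin m) (Fin m) (Matrix v v R))
    (hA : ∀ i j, j < i → A i j = 0) :
    (Matrix.comp (Fin m) (Fin m) v v R A).det = ∏ i, (A i i).det := by
  have hbt : (Matrix.comp (Fin m) (Fin m) v v R A).BlockTriangular Prod.fst := by
    rintro ⟨i, x⟩ ⟨j, y⟩ hij
    simp [Matrix.comp_apply, hA i j hij]
  rw [hbt.det_fintype]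
  refine Finset.prod_congr rfl fun k _ => ?_
  let e : {a : Fin m × v // a.1 = k} ≃ v :=
    ⟨fun a => a.1.2, fun x => ⟨(k, x), rfl⟩, by rintro ⟨⟨a, b⟩, rfl⟩; rfl, fun x => rfl⟩
  rw [← Matrix.det_reindex_self e.symm (A k k)]
  congr 1
  ext ⟨⟨a, b⟩, h⟩ ⟨⟨a', b'⟩, h'⟩
  simp only at h h'
  subst h
  subst h'
  rfl

theorem det_comp_of_lower {m : ℕ} (A : Matrix (Fin m) (Fin m) (Matrix v v R))
    (hA : ∀ i j, i < j → A i j = 0) :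
    (Matrix.comp (Fin m) (Fin m) v v R A).det = ∏ i, (A i i).det := by
  have := det_comp_of_upper (fun i j => (A j i)ᵀ) (fun i j h => by simp [hA j i h])
  rw [← Matrix.det_transpose]
  simp only [Matrix.det_transpose] at this
  rw [← this]
  rfl

/-- The determinant of `ω ↦ (ω_l - Z_l ω_{l+1})_l`, with cyclic indices. -/
theorem det_one_sub_cyclic {m : ℕ} [NeZero m] (Z : Fin m → Matrix v v R) :
    (Matrix.comp (Fin m) (Fin m) v v R
      (Matrix.of fun l l' => (if l = l' then 1 else 0) - (if l' = l + 1 then Z l else 0))).det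
      = (1 - (List.ofFn Z).prod).det := by
  classical
  set zt : ℕ → Matrix v v R := fun j => ((List.ofFn Z).drop j).prod with hzt
  have hz1 : ∀ l : Fin m, zt l = Z l * zt (l + 1) := by
    intro l
    simp only [hzt]
    rw [List.drop_eq_getElem_cons (by simp), List.prod_cons]
    simp
  set k : Fin m → Matrix v v R := fun l => if l = 0 then 1 else zt l with hk
  have hkz : ∀ l, Z l * k (l + 1) = zt l := by
    intro l
    rw [hz1 l, hk]
    simp only
    split_ifs with h
    · congr 1
      have hl : (l : ℕ) + 1 = m := by
        have h2 := l.2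
        by_contra hne
        have : ((l + 1 : Fin m) : ℕ) = l + 1 := by
          rw [Fin.val_add_one_of_lt' (by omega)]
        rw [h] at this
        simp at this
      simp only [hzt, hl]
      rw [List.drop_eq_nil_of_le (by simp), List.prod_nil]
    · have : ((l + 1 : Fin m) : ℕ) = l + 1 := by
        have h2 := l.2
        rcases Nat.lt_or_ge ((l : ℕ) + 1) m with h3 | h3
        · rw [Fin.val_add_one_of_lt' h3]
        · exfalso
          apply h
          apply Fin.ext
          rw [Fin.val_add]
          have : (l : ℕ) + 1 = m := by omega
          rcases Nat.lt_or_ge 1 m with h4 | h4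
          · rw [Fin.val_one', Nat.mod_eq_of_lt h4, this]; simp
          · have : m = 1 := by omega
            subst this; simp
      rw [this]
  set L : Matrix (Fin m) (Fin m) (Matrix v v R) :=
    Matrix.of fun l l' => (if l = l' then 1 else 0) - (if l' = l + 1 then Z l else 0) with hL
  set K : Matrix (Fin m) (Fin m) (Matrix v v R) :=
    Matrix.of fun l l' => if l' = 0 then k l else if l = l' then 1 else 0 with hK
  have hLK : ∀ l l', (L * K) l l' = K l l' - Z l * K (l + 1) l' := by
    intro l l'
    rw [Matrix.mul_apply]
    simp only [hL, Matrix.of_apply, sub_mul, ite_mul, one_mul, zero_mul, Finset.sum_sub_distrib,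
      Finset.sum_ite_eq, Finset.sum_ite_eq', Finset.mem_univ, if_true]
  have hdK : (Matrix.comp (Fin m) (Fin m) v v R K).det = 1 := by
    rw [det_comp_of_lower]
    · refine Finset.prod_eq_one fun i _ => ?_
      simp only [hK, Matrix.of_apply, hk]
      split_ifs <;> simp
    · intro i j hij
      have hj : j ≠ 0 := by
        rintro rfl
        rw [Fin.lt_def] at hij
        simp at hij
      simp [hK, hj, hij.ne]
  have hmul : (Matrix.comp (Fin m) (Fin m) v v R (L * K)).det
      = (Matrix.comp (Fin m) (Fin m) v v R L).det := by
    have := map_mul (Matrix.compRingEquiv (Fin m) v R) L K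
    have h2 : Matrix.comp (Fin m) (Fin m) v v R (L * K)
      = Matrix.comp (Fin m) (Fin m) v v R L * Matrix.comp (Fin m) (Fin m) v v R K := this
    rw [h2, Matrix.det_mul, hdK, mul_one]
  rw [← hmul, det_comp_of_upper]
  · have h0 : ∀ i : Fin m, i ≠ 0 → ((L * K) i i).det = 1 := by
      intro i hi
      rw [hLK]
      have : K (i + 1) i = 0 := by
        simp only [hK, Matrix.of_apply, hi, if_false, ite_eq_right_iff]
        intro h
        exfalso
        have h1 : (1 : Fin m) = 0 := by simpa using h
        apply hi
        have := congrArg (i * ·) h1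
        simpa using this
      rw [this]
      simp [hK, hi]
    rw [Finset.prod_eq_single 0 (fun i _ hi => h0 i hi) (by simp), hLK]
    have : zt (0 : Fin m) = (List.ofFn Z).prod := by simp [hzt]
    rw [← this, ← hkz 0]
    simp [hK, hk]
  · intro i j hij
    rw [hLK]
    by_cases hj : j = 0
    · subst hj
      simp only [hK, Matrix.of_apply, if_true]
      rw [hkz i]
      simp [hk, (show i ≠ 0 from hij.ne')]
    · have h1 : ¬ (i + 1 = j) := by
        intro h
        have hlt := hij
        rw [← h] at hlt hj
        rw [Fin.lt_def] at hlt
        rcases Nat.lt_or_ge ((i : ℕ) + 1) m with h3 | h3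
        · rw [Fin.val_add_one_of_lt' h3] at hlt; omega
        · apply hj
          apply Fin.ext
          rw [Fin.val_add]
          have : (i : ℕ) + 1 = m := by have := i.2; omega
          rcases Nat.lt_or_ge 1 m with h4 | h4
          · rw [Fin.val_one', Nat.mod_eq_of_lt h4, this]; simp
          · have : m = 1 := by omega
            subst this; simp
      simp [hK, hj, h1, hij.ne']

end CyclicDet

end

section

open Matrix Polynomial
open scoped Kronecker Topology

section Sylvester
variable {ι κ : Type*} [Fintype ι] [Fintype κ] [DecidableEq ι] [DecidableEq κ]

/-- `det f(Q) = ± Res(f, χ_Q)` for monic `f` split over a domain. -/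
theorem det_aeval_eq_resultant_of_splits {K : Type*} [Field K] (f : K[X]) (hf : f.Monic)
    (hs : f.Splits) (Q : Matrix κ κ K) :
    (aeval Q f).det = (-1) ^ (f.natDegree * Fintype.card κ) * resultant f Q.charpoly := by
  have h1 := resultant_eq_prod_eval f Q.charpoly _ le_rfl hs
  rw [h1, hf.leadingCoeff, one_pow, one_mul]
  have h2 := hs.eq_prod_roots
  rw [hf.leadingCoeff, C_1, one_mul] at h2
  have hcard : f.natDegree = f.roots.card := hs.natDegree_eq_card_roots
  have h3 : ∀ s : Multiset K, ((aeval Q) (s.map (fun a => X - C a)).prod).det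
      = (-1) ^ (s.card * Fintype.card κ) * (s.map (fun a => Q.charpoly.eval a)).prod := by
    intro s
    induction s using Multiset.induction_on with
    | empty => simp
    | cons a s ih =>
      have h4 : (Q - algebraMap K (Matrix κ κ K) a).det
          = (-1) ^ Fintype.card κ * Q.charpoly.eval a := by
        rw [Matrix.eval_charpoly, ← Matrix.det_neg]
        congr 1
        rw [neg_sub]; rfl
      simp only [Multiset.map_cons, Multiset.prod_cons, map_mul, Matrix.det_mul, ih, map_sub,
        aeval_X, aeval_C, Multiset.card_cons, h4]
      ring
  rw [hcard, ← h3, ← h2]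

theorem det_aeval_eq_resultant (f : ℝ[X]) (hf : f.Monic) (Q : Matrix κ κ ℝ) :
    (aeval Q f).det = (-1) ^ (f.natDegree * Fintype.card κ) * resultant f Q.charpoly := by
  have h := det_aeval_eq_resultant_of_splits (f.map (algebraMap ℝ ℂ)) (hf.map _)
    (IsAlgClosed.splits _) (Q.map (algebraMap ℝ ℂ))
  apply (algebraMap ℝ ℂ).injective
  rw [Matrix.charpoly_map] at h
  have hr : resultant (f.map (algebraMap ℝ ℂ)) (Q.charpoly.map (algebraMap ℝ ℂ))
      = algebraMap ℝ ℂ (resultant f Q.charpoly) := by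
    simp only [natDegree_map]
    exact resultant_map_map ..
  rw [hr, natDegree_map] at h
  rw [map_mul, map_pow, map_neg, map_one, ← h, RingHom.map_det]
  congr 1
  have := Polynomial.map_aeval_eq_aeval_map (S := Matrix κ κ ℝ) (U := Matrix κ κ ℂ)
    (φ := algebraMap ℝ ℂ) (ψ := (algebraMap ℝ ℂ).mapMatrix) (by
      ext x i j
      by_cases h : i = j <;> simp [Matrix.algebraMap_matrix_apply, h]) f Q
  exact this

/-- `|det (ω ↦ ω p - Q ω)| = |Res(χ_p, χ_Q)|`. -/
theorem abs_det_kronecker_sub (p : Matrix ι ι ℝ) (Q : Matrix κ κ ℝ) :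
    |((1 : Matrix κ κ ℝ) ⊗ₖ pᵀ - Q ⊗ₖ (1 : Matrix ι ι ℝ)).det|
      = |resultant p.charpoly Q.charpoly| := by
  have h := Matrix.det_det (M := charmatrix pᵀ) (aeval Q : ℝ[X] →ₐ[ℝ] Matrix κ κ ℝ).toRingHom
  change ((aeval Q) pᵀ.charpoly).det = _ at h
  rw [Matrix.charpoly_transpose, det_aeval_eq_resultant _ p.charpoly_monic] at h
  have h2 : |resultant p.charpoly Q.charpoly|
     = |(((pᵀ.charmatrix).map (aeval Q : ℝ[X] →ₐ[ℝ] Matrix κ κ ℝ).toRingHom).comp ι ι κ κ ℝ).det| := by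
    rw [← h, abs_mul, abs_pow, abs_neg, abs_one, one_pow, one_mul]
  rw [h2, ← Matrix.det_reindex_self (Equiv.prodComm ι κ)]
  have h3 : (1 : Matrix κ κ ℝ) ⊗ₖ pᵀ - Q ⊗ₖ (1 : Matrix ι ι ℝ)
      = - ((reindex (Equiv.prodComm ι κ) (Equiv.prodComm ι κ))
          ((Matrix.comp ι ι κ κ ℝ) (pᵀ.charmatrix.map (aeval Q).toRingHom))) := by
    ext ⟨a, i⟩ ⟨b, j⟩
    by_cases hij : i = j
    · subst hij
      by_cases hab : a = b
      · subst hab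
        simp [charmatrix_apply_eq, Matrix.algebraMap_matrix_apply]
      · simp [charmatrix_apply_eq, Matrix.algebraMap_matrix_apply, hab]
    · by_cases hab : a = b
      · subst hab
        simp [charmatrix_apply_ne _ _ _ (Ne.symm hij), Matrix.algebraMap_matrix_apply, hij]
      · simp [charmatrix_apply_ne _ _ _ (Ne.symm hij), Matrix.algebraMap_matrix_apply, hij, hab]
  rw [h3, Matrix.det_neg, abs_mul, abs_pow, abs_neg, abs_one, one_pow, one_mul]

/-- The matrix of `ω ↦ (ω_l p_l - Q_l ω_{l+1})_l`. -/
noncomputable def cyclicMatrix {m : ℕ} [NeZero m] (p : Fin m → Matrix ι ι ℝ)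
    (Q : Fin m → Matrix κ κ ℝ) : Matrix (Fin m) (Fin m) (Matrix (κ × ι) (κ × ι) ℝ) :=
  Matrix.of fun l l' => (if l = l' then (1 : Matrix κ κ ℝ) ⊗ₖ (p l)ᵀ else 0)
    - (if l' = l + 1 then Q l ⊗ₖ (1 : Matrix ι ι ℝ) else 0)

theorem prod_ofFn_kronecker {m : ℕ} (A : Fin m → Matrix κ κ ℝ) (B : Fin m → Matrix ι ι ℝ) :
    (List.ofFn fun l => A l ⊗ₖ B l).prod = (List.ofFn A).prod ⊗ₖ (List.ofFn B).prod := by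
  induction m with
  | zero => simp
  | succ m ih => simp [List.ofFn_succ, ih, Matrix.mul_kronecker_mul]

theorem prod_ofFn_inv_transpose {m : ℕ} (B : Fin m → Matrix ι ι ℝ) :
    (List.ofFn fun l => ((B l)ᵀ)⁻¹).prod = ((List.ofFn B).prod)ᵀ⁻¹ := by
  induction m with
  | zero => simp
  | succ m ih => simp [List.ofFn_succ, ih, Matrix.mul_inv_rev]

theorem det_prod_ofFn {R : Type*} [CommRing R] {m : ℕ} (B : Fin m → Matrix ι ι R) :
    ((List.ofFn B).prod).det = ∏ l, (B l).det := by
  induction m with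
  | zero => simp
  | succ m ih => simp [List.ofFn_succ, ih, Fin.prod_univ_succ]

theorem det_cyclicMatrix_of_isUnit {m : ℕ} [NeZero m] (p : Fin m → Matrix ι ι ℝ)
    (Q : Fin m → Matrix κ κ ℝ) (hp : ∀ l, (p l).det ≠ 0) :
    (Matrix.comp (Fin m) (Fin m) (κ × ι) (κ × ι) ℝ (cyclicMatrix p Q)).det
      = ((1 : Matrix κ κ ℝ) ⊗ₖ (List.ofFn p).prodᵀ
          - (List.ofFn Q).prod ⊗ₖ (1 : Matrix ι ι ℝ)).det := by
  set D : Matrix (Fin m) (Fin m) (Matrix (κ × ι) (κ × ι) ℝ) :=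
    Matrix.diagonal fun l => (1 : Matrix κ κ ℝ) ⊗ₖ (p l)ᵀ with hD
  set Z : Fin m → Matrix (κ × ι) (κ × ι) ℝ := fun l => Q l ⊗ₖ ((p l)ᵀ)⁻¹ with hZ
  have hfac : cyclicMatrix p Q = D * (Matrix.of fun l l' =>
      (if l = l' then 1 else 0) - (if l' = l + 1 then Z l else 0)) := by
    ext1 l l'
    rw [hD, Matrix.diagonal_mul]
    have h1 : (1 : Matrix κ κ ℝ) ⊗ₖ (p l)ᵀ * Z l = Q l ⊗ₖ (1 : Matrix ι ι ℝ) := by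
      rw [hZ, ← Matrix.mul_kronecker_mul, one_mul, Matrix.mul_nonsing_inv]
      rw [Matrix.det_transpose]
      exact (hp l).isUnit
    simp only [cyclicMatrix, Matrix.of_apply, mul_sub, mul_ite, mul_one, mul_zero, h1]
  have hmul : ∀ A B : Matrix (Fin m) (Fin m) (Matrix (κ × ι) (κ × ι) ℝ),
      Matrix.comp (Fin m) (Fin m) (κ × ι) (κ × ι) ℝ (A * B) =
      Matrix.comp (Fin m) (Fin m) (κ × ι) (κ × ι) ℝ A
        * Matrix.comp (Fin m) (Fin m) (κ × ι) (κ × ι) ℝ B :=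
    fun A B => map_mul (Matrix.compRingEquiv (Fin m) (κ × ι) ℝ) A B
  rw [hfac, hmul, Matrix.det_mul, det_one_sub_cyclic, det_comp_of_upper]
  · have hdd : ∏ l, (D l l).det = ((1 : Matrix κ κ ℝ) ⊗ₖ (List.ofFn p).prodᵀ).det := by
      simp only [hD, Matrix.diagonal_apply_eq, Matrix.det_kronecker, Matrix.det_one, one_pow,
        one_mul, Matrix.det_transpose, det_prod_ofFn, Finset.prod_pow]
    rw [hdd, ← Matrix.det_mul, hZ, prod_ofFn_kronecker, prod_ofFn_inv_transpose, mul_sub,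
      mul_one, ← Matrix.mul_kronecker_mul, one_mul, Matrix.mul_nonsing_inv]
    rw [Matrix.det_transpose, det_prod_ofFn]
    exact (Finset.prod_ne_zero_iff.2 fun l _ => hp l).isUnit
  · intro i j hij
    simp [hD, hij.ne']

theorem continuous_prod_ofFn {X : Type*} [TopologicalSpace X] {m : ℕ}
    (f : X → Fin m → Matrix ι ι ℝ) (hf : ∀ l, Continuous fun x => f x l) :
    Continuous fun x => (List.ofFn (f x)).prod := by
  induction m with
  | zero => simpa using continuous_const
  | succ m ih =>
    simp only [List.ofFn_succ, List.prod_cons]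
    exact (hf 0).mul (ih _ fun l => hf l.succ)

theorem det_cyclicMatrix {m : ℕ} [NeZero m] (p : Fin m → Matrix ι ι ℝ)
    (Q : Fin m → Matrix κ κ ℝ) :
    (Matrix.comp (Fin m) (Fin m) (κ × ι) (κ × ι) ℝ (cyclicMatrix p Q)).det
      = ((1 : Matrix κ κ ℝ) ⊗ₖ (List.ofFn p).prodᵀ
          - (List.ofFn Q).prod ⊗ₖ (1 : Matrix ι ι ℝ)).det := by
  have hev : ∀ᶠ t : ℝ in 𝓝[≠] 0, ∀ l, (p l + Matrix.scalar ι t).det ≠ 0 := by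
    rw [Filter.eventually_all]
    intro l
    have hfin : {t : ℝ | (p l + Matrix.scalar ι t).det = 0}.Finite := by
      refine ((-p l).charpoly.roots.toFinset.finite_toSet).subset fun t ht => ?_
      simp only [Finset.mem_coe, Multiset.mem_toFinset, mem_roots (-p l).charpoly_monic.ne_zero,
        IsRoot.def, Matrix.eval_charpoly, sub_neg_eq_add]
      rw [add_comm]; exact ht
    exact (hfin.eventually_cofinite_notMem).filter_mono (nhdsNE_le_cofinite 0)
  have h1 : Filter.Tendsto (fun t : ℝ => (Matrix.comp (Fin m) (Fin m) (κ × ι) (κ × ι) ℝ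
      (cyclicMatrix (fun l => p l + Matrix.scalar ι t) Q)).det) (𝓝[≠] 0)
      (𝓝 (Matrix.comp (Fin m) (Fin m) (κ × ι) (κ × ι) ℝ (cyclicMatrix p Q)).det) := by
    have hc : Continuous fun t : ℝ => (Matrix.comp (Fin m) (Fin m) (κ × ι) (κ × ι) ℝ
        (cyclicMatrix (fun l => p l + Matrix.scalar ι t) Q)).det := by
      refine Continuous.matrix_det (continuous_matrix ?_)
      rintro ⟨l, x⟩ ⟨l', y⟩
      simp only [Matrix.comp_apply, cyclicMatrix, Matrix.of_apply, Matrix.sub_apply]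
      refine Continuous.sub ?_ continuous_const
      split_ifs
      · simp only [Matrix.kroneckerMap_apply, Matrix.transpose_apply, Matrix.add_apply,
          Matrix.scalar_apply, Matrix.diagonal_apply]
        split_ifs <;> fun_prop
      · exact continuous_const
    have := (hc.tendsto 0).mono_left (nhdsWithin_le_nhds (s := {0}ᶜ))
    simpa using this
  have h2 : Filter.Tendsto (fun t : ℝ => ((1 : Matrix κ κ ℝ) ⊗ₖ
      (List.ofFn (fun l => p l + Matrix.scalar ι t)).prodᵀ
          - (List.ofFn Q).prod ⊗ₖ (1 : Matrix ι ι ℝ)).det) (𝓝[≠] 0)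
      (𝓝 ((1 : Matrix κ κ ℝ) ⊗ₖ (List.ofFn p).prodᵀ
          - (List.ofFn Q).prod ⊗ₖ (1 : Matrix ι ι ℝ)).det) := by
    have hc : Continuous fun t : ℝ => ((1 : Matrix κ κ ℝ) ⊗ₖ
        (List.ofFn (fun l => p l + Matrix.scalar ι t)).prodᵀ
          - (List.ofFn Q).prod ⊗ₖ (1 : Matrix ι ι ℝ)).det := by
      have h3 : Continuous fun t : ℝ => (List.ofFn (fun l => p l + Matrix.scalar ι t)).prod :=
        continuous_prod_ofFn _ fun l => continuous_const.add
          (Continuous.matrix_diagonal (continuous_pi fun _ => continuous_id))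
      refine Continuous.matrix_det (continuous_matrix ?_)
      rintro ⟨l, x⟩ ⟨l', y⟩
      simp only [Matrix.kroneckerMap_apply, Matrix.transpose_apply, Matrix.sub_apply]
      exact (continuous_const.mul (h3.matrix_elem y x)).sub continuous_const
    have := (hc.tendsto 0).mono_left (nhdsWithin_le_nhds (s := {0}ᶜ))
    simpa using this
  refine tendsto_nhds_unique (h1.congr' ?_) h2
  filter_upwards [hev] with t ht
  exact det_cyclicMatrix_of_isUnit _ _ ht

/-- The linear map `ω ↦ (ω_l p_l - Q_l ω_{l+1})_l`. -/
noncomputable def cyclicLin {m : ℕ} [NeZero m] (p : Fin m → Matrix ι ι ℝ)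
    (Q : Fin m → Matrix κ κ ℝ) : (Fin m → κ → ι → ℝ) →ₗ[ℝ] (Fin m → κ → ι → ℝ) where
  toFun ω l a i := (Matrix.of (ω l) * p l - Q l * Matrix.of (ω (l + 1))) a i
  map_add' x y := by
    ext l a i
    simp only [Matrix.sub_apply, Matrix.mul_apply, Matrix.of_apply, Pi.add_apply, add_mul, mul_add,
      Finset.sum_add_distrib]
    ring
  map_smul' c x := by
    ext l a i
    simp only [Matrix.sub_apply, Matrix.mul_apply, Matrix.of_apply, Pi.smul_apply, smul_eq_mul,
      RingHom.id_apply, mul_sub, Finset.mul_sum]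
    congr 1 <;> exact Finset.sum_congr rfl fun _ _ => by ring

theorem abs_det_cyclicLin {m : ℕ} [NeZero m] (p : Fin m → Matrix ι ι ℝ)
    (Q : Fin m → Matrix κ κ ℝ) :
    |LinearMap.det (cyclicLin p Q)|
      = |resultant (List.ofFn p).prod.charpoly (List.ofFn Q).prod.charpoly| := by
  rw [← abs_det_kronecker_sub, ← det_cyclicMatrix]
  let e : (Fin m → κ → ι → ℝ) ≃ₗ[ℝ] (Fin m × κ × ι → ℝ) :=
    (LinearEquiv.piCongrRight fun _ => (LinearEquiv.curry ℝ ℝ κ ι).symm) ≪≫ₗ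
      (LinearEquiv.curry ℝ ℝ (Fin m) (κ × ι)).symm
  rw [← LinearMap.det_conj (cyclicLin p Q) e, ← LinearMap.det_toLin']
  congr 2
  apply LinearMap.ext
  intro x
  obtain ⟨ω, rfl⟩ := e.surjective x
  ext ⟨l, a, i⟩
  have he : ∀ ω l a i, e ω (l, a, i) = ω l a i := fun _ _ _ _ => rfl
  simp only [LinearMap.comp_apply, LinearEquiv.coe_coe, LinearEquiv.symm_apply_apply, he,
    Matrix.toLin'_apply, Matrix.mulVec, dotProduct, Fintype.sum_prod_type, Matrix.comp_apply,
    cyclicMatrix, Matrix.of_apply, Matrix.sub_apply, sub_mul, Finset.sum_sub_distrib, cyclicLin,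
    LinearMap.coe_mk, AddHom.coe_mk]
  change (Matrix.of (ω l) * p l - Q l * Matrix.of (ω (l + 1))) a i = _
  rw [Matrix.sub_apply, Matrix.mul_apply, Matrix.mul_apply]
  congr 1
  · rw [Finset.sum_eq_single l (fun b _ hb => by simp [hb.symm]) (by simp),
      Finset.sum_eq_single a (fun b _ hb => by simp [Matrix.kroneckerMap_apply, hb.symm]) (by simp)]
    simp [Matrix.kroneckerMap_apply, mul_comm]
  · rw [Finset.sum_eq_single (l + 1) (fun b _ hb => by simp [hb]) (by simp)]
    refine Finset.sum_congr rfl fun b _ => ?_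
    rw [Finset.sum_eq_single i (fun c _ hc => by simp [Matrix.kroneckerMap_apply, hc.symm])
      (by simp)]
    simp [Matrix.kroneckerMap_apply]

/-- The determinant of a block lower triangular endomorphism of a product. -/
theorem det_prod_lower {V W : Type*} [AddCommGroup V] [AddCommGroup W] [Module ℝ V] [Module ℝ W]
    [FiniteDimensional ℝ V] [FiniteDimensional ℝ W] (f : V × W →ₗ[ℝ] V × W) (L : W →ₗ[ℝ] W)
    (h1 : ∀ x, (f x).1 = x.1) (h2 : ∀ w, (f (0, w)).2 = L w) :
    LinearMap.det f = LinearMap.det L := by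
  let bV := Module.finBasis ℝ V
  let bW := Module.finBasis ℝ W
  rw [← LinearMap.det_toMatrix (bV.prod bW), ← LinearMap.det_toMatrix bW]
  have : LinearMap.toMatrix (bV.prod bW) (bV.prod bW) f = Matrix.fromBlocks 1 0
      (Matrix.of fun i j => bW.repr (f (bV j, 0)).2 i) (LinearMap.toMatrix bW bW L) := by
    ext (i | i) (j | j)
    · simp [LinearMap.toMatrix_apply, h1, Matrix.one_apply, Finsupp.single_apply, eq_comm]
    · simp [LinearMap.toMatrix_apply, h1]
    · simp [LinearMap.toMatrix_apply]
    · simp [LinearMap.toMatrix_apply, h2]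
  rw [this, Matrix.det_fromBlocks_zero₁₂, Matrix.det_one, one_mul]

end Sylvester

end

section

open Matrix Polynomial

section InvariantSubspace

theorem charpoly_eq_restrict_mul_mapQ {V : Type*} [AddCommGroup V] [Module ℝ V]
    [FiniteDimensional ℝ V] (W : Submodule ℝ V) (e : V →ₗ[ℝ] V) (he : W ≤ W.comap e) :
    e.charpoly = (e.restrict he).charpoly * (W.mapQ W e he).charpoly := by
  apply Polynomial.funext
  intro t
  rw [eval_mul, LinearMap.eval_charpoly, LinearMap.eval_charpoly, LinearMap.eval_charpoly]
  have he' : W ≤ W.comap (algebraMap ℝ (Module.End ℝ V) t - e) := by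
    intro x hx
    exact W.sub_mem (W.smul_mem t hx) (he hx)
  rw [LinearMap.det_eq_det_mul_det W _ he']
  congr 2
  ext x
  simp [Module.algebraMap_end_apply]

variable {κ : Type*} [Fintype κ] [DecidableEq κ]

theorem isCoprime_charpoly_of_isUnit_aeval {V : Type*} [AddCommGroup V] [Module ℝ V]
    [FiniteDimensional ℝ V] (e : V →ₗ[ℝ] V) (g : ℝ[X]) (hg : g.Monic)
    (h : IsUnit (aeval e g)) : IsCoprime g e.charpoly := by
  let b := Module.finBasis ℝ V
  have h1 := det_aeval_eq_resultant g hg (LinearMap.toMatrix b b e)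
  have h2 : IsUnit (aeval (LinearMap.toMatrix b b e) g).det := by
    have : aeval (LinearMap.toMatrix b b e) g = LinearMap.toMatrix b b (aeval e g) :=
      Polynomial.aeval_algHom_apply (LinearMap.toMatrixAlgEquiv b).toAlgHom e g
    rw [this, LinearMap.det_toMatrix]
    exact h.map LinearMap.det
  by_contra hc
  rw [← LinearMap.charpoly_toMatrix e b] at hc
  rw [h1, resultant_eq_zero_iff.2 ⟨Or.inl hg.ne_zero, hc⟩, mul_zero] at h2
  exact not_isUnit_zero h2

/-- A coprime factorization of the characteristic polynomial is realized by an invariant subspace. -/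
theorem exists_charpoly_restrict_eq {V : Type*} [AddCommGroup V] [Module ℝ V]
    [FiniteDimensional ℝ V] (e : V →ₗ[ℝ] V) (f g : ℝ[X]) (hf : f.Monic) (hg : g.Monic)
    (hfg : e.charpoly = f * g) (hc : IsCoprime f g) :
    ∃ (W : Submodule ℝ V) (he : W ≤ W.comap e), (e.restrict he).charpoly = f := by
  set W : Submodule ℝ V := LinearMap.ker (aeval e f) with hW
  have hcomm : ∀ (q r : ℝ[X]) (x : V), aeval e q (aeval e r x) = aeval e r (aeval e q x) := by
    intro q r x
    rw [← Module.End.mul_apply, ← Module.End.mul_apply, ← map_mul, ← map_mul, mul_comm]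
  have he : W ≤ W.comap e := by
    intro x hx
    have := hcomm f X x
    simp only [aeval_X] at this
    simp only [hW, Submodule.mem_comap, LinearMap.mem_ker] at hx ⊢
    rw [this, hx, map_zero]
  have hres : ∀ (q : ℝ[X]) (x : W), ((aeval (e.restrict he) q x : W) : V) = aeval e q x := by
    intro q x
    induction q using Polynomial.induction_on' with
    | add p q hp hq => simp [hp, hq]
    | monomial n a =>
      have : ∀ n : ℕ, ((((e.restrict he) ^ n) x : W) : V) = (e ^ n) x := by
        intro n
        induction n with
        | zero => rfl
        | succ n ih => rw [pow_succ', pow_succ', Module.End.mul_apply, Module.End.mul_apply,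
            LinearMap.coe_restrict_apply, ih]
      simp [aeval_monomial, this, Module.algebraMap_end_apply]
  have hquo : ∀ (q : ℝ[X]) (x : V), aeval (W.mapQ W e he) q (W.mkQ x) = W.mkQ (aeval e q x) := by
    intro q x
    induction q using Polynomial.induction_on' with
    | add p q hp hq => simp only [map_add, LinearMap.add_apply, hp, hq]
    | monomial n a =>
      have : ∀ n : ℕ, ((W.mapQ W e he) ^ n) (W.mkQ x) = W.mkQ ((e ^ n) x) := by
        intro n
        induction n with
        | zero => rfl
        | succ n ih => rw [pow_succ', pow_succ', Module.End.mul_apply, Module.End.mul_apply, ih]; rfl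
      simp only [aeval_monomial, Module.End.mul_apply, Module.algebraMap_end_apply, this, map_smul]
  obtain ⟨u, v, huv⟩ := hc
  have hCH : aeval e (f * g) = 0 := by rw [← hfg]; exact e.aeval_self_charpoly
  have h1 : IsUnit (aeval (e.restrict he : W →ₗ[ℝ] W) g) := by
    refine IsUnit.of_mul_eq_one (aeval (e.restrict he : W →ₗ[ℝ] W) v) ?_
    rw [← map_mul, mul_comm]
    ext x
    rw [hres]
    have := congrArg (fun q => aeval e q (x : V)) huv
    simp only [map_add, LinearMap.add_apply, map_one, Module.End.one_apply] at this
    have hx : aeval e (u * f) (x : V) = 0 := by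
      rw [map_mul, Module.End.mul_apply, LinearMap.mem_ker.1 x.2, map_zero]
    rw [hx, zero_add] at this
    simpa using this
  have h2 : IsUnit (aeval (W.mapQ W e he) f) := by
    refine IsUnit.of_mul_eq_one (aeval (W.mapQ W e he) u) ?_
    rw [← map_mul, mul_comm]
    refine LinearMap.ext fun y => ?_
    obtain ⟨x, rfl⟩ := W.mkQ_surjective y
    rw [hquo]
    have := congrArg (fun q => W.mkQ (aeval e q (x : V))) huv
    simp only [map_add, LinearMap.add_apply, map_one, Module.End.one_apply] at this
    have hx : W.mkQ (aeval e (v * g) (x : V)) = 0 := by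
      rw [Submodule.mkQ_apply, Submodule.Quotient.mk_eq_zero, hW, LinearMap.mem_ker,
        ← Module.End.mul_apply, ← map_mul, show f * (v * g) = v * (f * g) by ring, map_mul, hCH,
        mul_zero]
      rfl
    rw [hx, add_zero] at this
    simpa using this
  have hmul := charpoly_eq_restrict_mul_mapQ W e he
  rw [hfg] at hmul
  have c1 := isCoprime_charpoly_of_isUnit_aeval _ g hg h1
  have c2 := isCoprime_charpoly_of_isUnit_aeval _ f hf h2
  refine ⟨W, he, ?_⟩
  have d1 : (e.restrict he).charpoly ∣ f :=
    c1.symm.dvd_of_dvd_mul_right ⟨_, hmul⟩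
  have d2 : f ∣ (e.restrict he).charpoly :=
    c2.dvd_of_dvd_mul_right ⟨_, hmul.symm⟩
  exact Polynomial.eq_of_monic_of_associated (LinearMap.charpoly_monic _) hf
    (associated_of_dvd_dvd d1 d2)

/-- Matrix form of `exists_charpoly_restrict_eq`. -/
theorem exists_matrix_invariant {ι κ : Type*} [Fintype ι] [DecidableEq ι] [Fintype κ]
    [DecidableEq κ] (P : Matrix κ κ ℝ) (f g : ℝ[X]) (hf : f.Monic) (hg : g.Monic)
    (hfg : P.charpoly = f * g) (hc : IsCoprime f g) (hd : f.natDegree = Fintype.card ι) :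
    ∃ (B : Matrix κ ι ℝ) (A : Matrix ι κ ℝ) (p : Matrix ι ι ℝ), A * B = 1 ∧ P * B = B * p ∧
      p.charpoly = f := by
  obtain ⟨W, he, hW⟩ := exists_charpoly_restrict_eq (Matrix.toLin' P) f g hf hg
    (by rw [← hfg, ← LinearMap.charpoly_toMatrix _ (Pi.basisFun ℝ κ)]; simp [LinearMap.toMatrix_eq_toMatrix']) hc
  have hdim : Module.finrank ℝ W = Fintype.card ι := by
    rw [← hd, ← hW, LinearMap.charpoly_natDegree]
  let b : Module.Basis ι ℝ W := (Module.finBasisOfFinrankEq ℝ W hdim).reindex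
    (Fintype.equivFin ι).symm
  set T := (Matrix.toLin' P).restrict he
  let φ : (ι → ℝ) →ₗ[ℝ] (κ → ℝ) := W.subtype ∘ₗ b.equivFun.symm.toLinearMap
  have hφ : LinearMap.ker φ = ⊥ := by
    rw [LinearMap.ker_eq_bot]
    exact Subtype.val_injective.comp b.equivFun.symm.injective
  obtain ⟨ψ, hψ⟩ := φ.exists_leftInverse_of_injective hφ
  refine ⟨LinearMap.toMatrix' φ, LinearMap.toMatrix' ψ, LinearMap.toMatrix b b T, ?_, ?_, ?_⟩
  · rw [← LinearMap.toMatrix'_comp, hψ, LinearMap.toMatrix'_id]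
  · rw [← LinearMap.toMatrix'_toLin' P, ← LinearMap.toMatrix'_comp]
    have : LinearMap.toMatrix b b T = LinearMap.toMatrix'
        (b.equivFun.toLinearMap ∘ₗ T ∘ₗ b.equivFun.symm.toLinearMap) := by
      ext i j
      simp [LinearMap.toMatrix_apply, LinearMap.toMatrix'_apply, Pi.single_apply]
    rw [this, ← LinearMap.toMatrix'_comp]
    congr 1
    refine LinearMap.ext fun x => ?_
    simp [φ, T]
  · rw [LinearMap.charpoly_toMatrix]; exact hW

end InvariantSubspace

section Riccati
variable {ι κ : Type*} [Fintype ι] [Fintype κ] [DecidableEq ι] [DecidableEq κ]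

theorem prod_ofFn_intertwine {R : Type*} [Monoid R] {m : ℕ} (X T : Fin m → R) (S : ℕ → R)
    (h : ∀ l : Fin m, X l * S (l + 1) = S l * T l) :
    (List.ofFn X).prod * S m = S 0 * (List.ofFn T).prod := by
  induction m generalizing S with
  | zero => simp
  | succ m ih =>
    have h1 := ih (fun l => X l.succ) (fun l => T l.succ) (fun j => S (j + 1))
      (fun l => by simpa using h l.succ)
    have h0 := h 0
    simp only [Fin.val_zero, zero_add] at h0 h1
    rw [List.ofFn_succ, List.ofFn_succ, List.prod_cons, List.prod_cons, mul_assoc, h1,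
      ← mul_assoc, h0, mul_assoc]

theorem ofNat_val_add_one {m : ℕ} [NeZero m] (l : Fin m) :
    Fin.ofNat m ((l : ℕ) + 1) = l + 1 := by
  apply Fin.ext
  simp [Fin.val_add]

theorem prod_ofFn_intertwine_cyclic {R : Type*} [Monoid R] {m : ℕ} [NeZero m] (X T S : Fin m → R)
    (h : ∀ l : Fin m, X l * S (l + 1) = S l * T l) :
    (List.ofFn X).prod * S 0 = S 0 * (List.ofFn T).prod := by
  have := prod_ofFn_intertwine X T (fun j => S (Fin.ofNat m j)) (fun l => by
    simp only [ofNat_val_add_one, Fin.ofNat_val_eq_self]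
    exact h l)
  have h0 : Fin.ofNat m m = 0 := by apply Fin.ext; simp
  have h1 : Fin.ofNat m 0 = 0 := by apply Fin.ext; simp
  simpa only [h0, h1] using this

theorem prod_ofFn_fromBlocks_upper {m : ℕ} (p : Fin m → Matrix ι ι ℝ) (b : Fin m → Matrix ι κ ℝ)
    (Q : Fin m → Matrix κ κ ℝ) :
    ∃ r, (List.ofFn fun l => fromBlocks (p l) (b l) 0 (Q l)).prod
      = fromBlocks (List.ofFn p).prod r 0 (List.ofFn Q).prod := by
  induction m with
  | zero => exact ⟨0, by simp⟩
  | succ m ih =>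
    obtain ⟨r, hr⟩ := ih (fun l => p l.succ) (fun l => b l.succ) (fun l => Q l.succ)
    refine ⟨p 0 * r + b 0 * (List.ofFn fun l => Q l.succ).prod, ?_⟩
    simp [List.ofFn_succ, List.prod_cons, hr, fromBlocks_multiply]

variable {m : ℕ} [NeZero m]

/-- The action on the invariant graph of `Y`. -/
def ricP (a : Fin m → Matrix ι ι ℝ) (b : Fin m → Matrix ι κ ℝ) (Y : Fin m → Matrix κ ι ℝ) :
    Fin m → Matrix ι ι ℝ := fun l => a l + b l * Y (l + 1)

/-- The action on the quotient by the invariant graph of `Y`. -/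
def ricQ (b : Fin m → Matrix ι κ ℝ) (d : Fin m → Matrix κ κ ℝ) (Y : Fin m → Matrix κ ι ℝ) :
    Fin m → Matrix κ κ ℝ := fun l => d l - Y l * b l

/-- The lower left blocks for which the graphs of `Y` are invariant. -/
def ricC (a : Fin m → Matrix ι ι ℝ) (b : Fin m → Matrix ι κ ℝ) (d : Fin m → Matrix κ κ ℝ)
    (Y : Fin m → Matrix κ ι ℝ) : Fin m → Matrix κ ι ℝ :=
  fun l => Y l * a l + Y l * b l * Y (l + 1) - d l * Y (l + 1)

theorem charpoly_eq_of_intertwine (P T S : Matrix ι ι ℝ) (hS : IsUnit S) (h : P * S = S * T) :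
    P.charpoly = T.charpoly := by
  obtain ⟨u, rfl⟩ := hS
  have : P = u * T * (u⁻¹ : (Matrix ι ι ℝ)ˣ) := by
    rw [← h, mul_assoc, Units.mul_inv, mul_one]
  rw [this, ← Matrix.charpoly_units_conj u T]
  simp

theorem charpoly_prod_fromBlocks_ricC (a : Fin m → Matrix ι ι ℝ) (b : Fin m → Matrix ι κ ℝ)
    (d : Fin m → Matrix κ κ ℝ) (Y : Fin m → Matrix κ ι ℝ) :
    (List.ofFn fun l => fromBlocks (a l) (b l) (ricC a b d Y l) (d l)).prod.charpoly
      = (List.ofFn (ricP a b Y)).prod.charpoly * (List.ofFn (ricQ b d Y)).prod.charpoly := by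
  have h := prod_ofFn_intertwine_cyclic
    (fun l => fromBlocks (a l) (b l) (ricC a b d Y l) (d l))
    (fun l => fromBlocks (ricP a b Y l) (b l) 0 (ricQ b d Y l))
    (fun l => fromBlocks 1 0 (Y l) 1) (fun l => by
      simp only [fromBlocks_multiply, ricP, ricQ, ricC]
      congr 1
      · simp
      · simp
      · simp only [Matrix.mul_one, Matrix.mul_zero, add_zero, Matrix.mul_add, Matrix.mul_assoc]
        abel
      · simp)
  obtain ⟨r, hr⟩ := prod_ofFn_fromBlocks_upper (ricP a b Y) b (ricQ b d Y)
  rw [hr] at h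
  rw [charpoly_eq_of_intertwine _ _ _ ?_ h, Matrix.charpoly_fromBlocks_zero₂₁]
  rw [Matrix.isUnit_iff_isUnit_det, Matrix.det_fromBlocks_zero₁₂]
  simp

/-- Invariant graphs with the same characteristic polynomial, coprime to that of the quotient,
coincide. -/
theorem ricC_injective (a : Fin m → Matrix ι ι ℝ) (b : Fin m → Matrix ι κ ℝ)
    (d : Fin m → Matrix κ κ ℝ) (Y Z : Fin m → Matrix κ ι ℝ)
    (hC : ricC a b d Y = ricC a b d Z)
    (hp : (List.ofFn (ricP a b Y)).prod.charpoly = (List.ofFn (ricP a b Z)).prod.charpoly)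
    (hco : IsCoprime (List.ofFn (ricP a b Y)).prod.charpoly
      (List.ofFn (ricQ b d Y)).prod.charpoly) : Y = Z := by
  set L := cyclicLin (ricP a b Z) (ricQ b d Y) with hL
  have hdet : LinearMap.det L ≠ 0 := by
    rw [← abs_pos, hL, abs_det_cyclicLin, ← hp, abs_pos]
    exact resultant_ne_zero _ _ hco
  have hker : L (Z - Y) = 0 := by
    funext l
    have h1 : (Z l - Y l) * ricP a b Z l - ricQ b d Y l * (Z (l + 1) - Y (l + 1)) = 0 := by
      have := congrFun hC l
      simp only [ricC, ricP, ricQ] at this ⊢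
      have h2 : (Z l - Y l) * (a l + b l * Z (l + 1)) - (d l - Y l * b l) * (Z (l + 1) - Y (l + 1))
        = (Z l * a l + Z l * b l * Z (l + 1) - d l * Z (l + 1))
          - (Y l * a l + Y l * b l * Y (l + 1) - d l * Y (l + 1)) := by
        simp only [Matrix.sub_mul, Matrix.mul_sub, Matrix.mul_add, Matrix.mul_assoc]
        abel
      rw [h2, ← this, sub_self]
    exact h1
  have hbot : LinearMap.ker L = ⊥ := by
    by_contra h
    exact hdet (LinearMap.det_eq_zero_iff_ker_ne_bot.2 h)
  exact (sub_eq_zero.1 (LinearMap.ker_eq_bot'.1 hbot (Z - Y) hker)).symm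

/-- Existence of invariant graphs, given full-rank intertwining frames with invertible top block. -/
theorem exists_ricC_eq (a : Fin m → Matrix ι ι ℝ) (b : Fin m → Matrix ι κ ℝ)
    (c : Fin m → Matrix κ ι ℝ) (d : Fin m → Matrix κ κ ℝ)
    (U : ℕ → Matrix ι ι ℝ) (V : ℕ → Matrix κ ι ℝ) (p : Matrix ι ι ℝ)
    (hU : ∀ j, j ≤ m → IsUnit (U j))
    (h1 : ∀ l : Fin m, U l = a l * U (l + 1) + b l * V (l + 1))
    (h2 : ∀ l : Fin m, V l = c l * U (l + 1) + d l * V (l + 1))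
    (h3 : U 0 = U m * p) (h4 : V 0 = V m * p) :
    ∃ Y, ricC a b d Y = c ∧ (List.ofFn (ricP a b Y)).prod.charpoly = p.charpoly := by
  have hinv : ∀ j, j ≤ m → U j * (U j)⁻¹ = 1 := fun j hj =>
    Matrix.mul_nonsing_inv _ ((Matrix.isUnit_iff_isUnit_det _).1 (hU j hj))
  have hinv' : ∀ j, j ≤ m → (U j)⁻¹ * U j = 1 := fun j hj =>
    Matrix.nonsing_inv_mul _ ((Matrix.isUnit_iff_isUnit_det _).1 (hU j hj))
  set y : ℕ → Matrix κ ι ℝ := fun j => V j * (U j)⁻¹ with hy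
  have hy0 : y 0 = y m := by
    have hp : p = (U m)⁻¹ * U 0 := by rw [h3, ← Matrix.mul_assoc, hinv' m le_rfl, one_mul]
    simp only [hy, h4]
    rw [hp, Matrix.mul_assoc, Matrix.mul_assoc, hinv 0 (Nat.zero_le _), mul_one]
  have hyc : ∀ l : Fin m, y ((l + 1 : Fin m) : ℕ) = y (l + 1) := by
    intro l
    rcases Nat.lt_or_ge ((l : ℕ) + 1) m with h | h
    · rw [Fin.val_add_one_of_lt' h]
    · have hl : (l : ℕ) + 1 = m := by omega
      rw [← ofNat_val_add_one, hl]
      simp [hy0]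
  have hP : ∀ l : Fin m, ricP a b (fun l => y l) l = U l * (U (l + 1))⁻¹ := by
    intro l
    have hl : (l : ℕ) + 1 ≤ m := l.2
    simp only [ricP, hyc l]
    rw [h1 l, Matrix.add_mul, Matrix.mul_assoc, hinv _ hl, mul_one, Matrix.mul_assoc]
  refine ⟨fun l => y l, ?_, ?_⟩
  · funext l
    have hl : (l : ℕ) + 1 ≤ m := l.2
    have e1 : y l * (a l + b l * y (l + 1)) = c l + d l * y (l + 1) := by
      have e2 : a l + b l * y (l + 1) = U l * (U (l + 1))⁻¹ := by
        rw [← hP l]; simp only [ricP, hyc l]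
      rw [e2, ← Matrix.mul_assoc]
      simp only [hy]
      rw [Matrix.mul_assoc (V l), hinv' l (by omega), Matrix.mul_one, h2 l,
        Matrix.add_mul, Matrix.mul_assoc, hinv _ hl, Matrix.mul_one, Matrix.mul_assoc]
    simp only [ricC, hyc l]
    rw [Matrix.mul_assoc (y l) (b l), ← Matrix.mul_add, e1, add_sub_cancel_right]
  · have h5 := prod_ofFn_intertwine (fun l => U l * (U (l + 1))⁻¹) (fun _ => 1) U (fun l => by
      have hl : (l : ℕ) + 1 ≤ m := l.2
      rw [Matrix.mul_assoc, hinv' _ hl])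
    have h6 : (List.ofFn fun _ : Fin m => (1 : Matrix ι ι ℝ)).prod = 1 := by simp
    rw [h6, mul_one, h3] at h5
    rw [show ricP a b (fun l => y l) = fun l : Fin m => U l * (U (l + 1))⁻¹ from funext hP]
    exact charpoly_eq_of_intertwine _ _ _ (hU m le_rfl) h5

end Riccati

/-- A measurable function which is polynomial along the lines through a point where it does not
vanish is nonzero almost everywhere. -/
theorem ae_ne_zero_of_polynomial_on_lines {E : Type*} [NormedAddCommGroup E] [NormedSpace ℝ E]
    [FiniteDimensional ℝ E] [MeasurableSpace E] [BorelSpace E] (μ : Measure E)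
    [μ.IsAddHaarMeasure] (q : E → ℝ) (hq : Measurable q) (x₀ : E) (h₀ : q x₀ ≠ 0)
    (hpoly : ∀ x, ∃ r : ℝ[X], ∀ t : ℝ, q (x₀ + t • x) = r.eval t) :
    ∀ᵐ x ∂μ, q x ≠ 0 := by
  have := FiniteDimensional.proper_real E
  set Z : Set E := {x | q x = 0} with hZ
  have hZm : MeasurableSet Z := hq (measurableSet_singleton 0)
  have hjoint : MeasurableSet {z : ℝ × E | x₀ + z.1 • z.2 ∈ Z} := by
    apply (show Measurable fun z : ℝ × E => x₀ + z.1 • z.2 from ?_) hZm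
    exact (continuous_const.add (continuous_fst.smul continuous_snd)).measurable
  have h1 : ∀ x : E, ∀ᵐ t : ℝ, x₀ + t • x ∉ Z := by
    intro x
    obtain ⟨r, hr⟩ := hpoly x
    have hr0 : r ≠ 0 := by
      rintro rfl
      apply h₀
      simpa using hr 0
    have hfin : {t : ℝ | r.IsRoot t}.Finite := Polynomial.finite_setOfPred_isRoot hr0
    have : volume {t : ℝ | r.IsRoot t} = 0 := hfin.measure_zero _
    rw [ae_iff]
    convert this using 2
    ext t
    simp [hZ, hr, Polynomial.IsRoot]
  have h2 : ∀ᵐ z ∂((volume : Measure ℝ).prod μ), z ∉ {z : ℝ × E | x₀ + z.1 • z.2 ∈ Z} := by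
    have h3 : ∀ᵐ z ∂(μ.prod (volume : Measure ℝ)), x₀ + z.2 • z.1 ∉ Z := by
      rw [Measure.ae_prod_iff_ae_ae]
      · exact Filter.Eventually.of_forall h1
      · exact (measurable_swap hjoint).compl
    have h4 := (Measure.measurePreserving_swap (μ := (volume : Measure ℝ)) (ν := μ)).quasiMeasurePreserving
    exact h4.ae h3
  have h5 := Measure.ae_ae_of_ae_prod h2
  have h6 : ∀ᵐ t : ℝ, t ≠ 0 := by simp [ae_iff]
  obtain ⟨t, ht, ht0⟩ := (h5.and h6).exists
  rw [ae_iff] at ht ⊢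
  simp only [Set.mem_ofPred_eq, not_not] at ht
  have h7 : {x | x₀ + t • x ∈ Z} = (fun x => t • x) ⁻¹' ((fun x => x₀ + x) ⁻¹' Z) := rfl
  rw [h7, Measure.addHaar_preimage_smul μ ht0, measure_preimage_add] at ht
  simp only [not_not]
  rcases mul_eq_zero.1 ht with h | h
  · exact absurd h (by simp [ht0])
  · exact h

section Frames
variable {ι κ : Type*} [Fintype ι] [Fintype κ] [DecidableEq ι] [DecidableEq κ]

theorem exists_frames {m : ℕ} (X : Fin m → Matrix κ κ ℝ) (hX : IsUnit (List.ofFn X).prod)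
    (f g : ℝ[X]) (hf : f.Monic) (hg : g.Monic) (hfg : (List.ofFn X).prod.charpoly = f * g)
    (hc : IsCoprime f g) (hd : f.natDegree = Fintype.card ι) :
    ∃ (B : ℕ → Matrix κ ι ℝ) (A : ℕ → Matrix ι κ ℝ) (p : Matrix ι ι ℝ),
      (∀ j, A j * B j = 1) ∧ (∀ l : Fin m, X l * B (l + 1) = B l) ∧ B 0 = B m * p ∧
        p.charpoly = f := by
  obtain ⟨B, A, p, h1, h2, h3⟩ := exists_matrix_invariant (ι := ι) _ f g hf hg hfg hc hd
  have hu : ∀ j, IsUnit ((List.ofFn X).drop j).prod := by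
    intro j
    have : ((List.ofFn X).take j).prod * ((List.ofFn X).drop j).prod = (List.ofFn X).prod := by
      rw [← List.prod_append, List.take_append_drop]
    rw [← this] at hX
    rw [Matrix.isUnit_iff_isUnit_det, Matrix.det_mul] at hX
    rw [Matrix.isUnit_iff_isUnit_det]
    exact isUnit_of_mul_isUnit_right hX
  refine ⟨fun j => ((List.ofFn X).drop j).prod * B,
    fun j => A * (((List.ofFn X).drop j).prod)⁻¹, p, ?_, ?_, ?_, h3⟩
  · intro j
    have := Matrix.nonsing_inv_mul _ ((Matrix.isUnit_iff_isUnit_det _).1 (hu j))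
    rw [Matrix.mul_assoc, ← Matrix.mul_assoc _ _ B, this, Matrix.one_mul, h1]
  · intro l
    simp only
    rw [← Matrix.mul_assoc]
    congr 1
    rw [List.drop_eq_getElem_cons (i := (l : ℕ)) (by simp), List.prod_cons]
    simp
  · simp only [List.drop_zero, h2]
    rw [List.drop_eq_nil_of_le (by simp)]
    simp

theorem exists_ricC_eq_of_frames {m : ℕ} [NeZero m] (X : Fin m → Matrix (ι ⊕ κ) (ι ⊕ κ) ℝ)
    (B : ℕ → Matrix (ι ⊕ κ) ι ℝ) (p : Matrix ι ι ℝ) (hB : ∀ l : Fin m, X l * B (l + 1) = B l)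
    (hp : B 0 = B m * p) (hU : ∀ j, j ≤ m → IsUnit (B j).toRows₁) :
    ∃ Y, ricC (fun l => (X l).toBlocks₁₁) (fun l => (X l).toBlocks₁₂) (fun l => (X l).toBlocks₂₂) Y
        = (fun l => (X l).toBlocks₂₁) ∧
      (List.ofFn (ricP (fun l => (X l).toBlocks₁₁) (fun l => (X l).toBlocks₁₂) Y)).prod.charpoly
        = p.charpoly := by
  refine exists_ricC_eq _ _ _ _ (fun j => (B j).toRows₁) (fun j => (B j).toRows₂) p hU ?_ ?_ ?_ ?_
  · intro l
    rw [← hB l]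
    ext i j
    simp [Matrix.mul_apply, toRows₁, toBlocks₁₁, toBlocks₁₂, toRows₂]
  · intro l
    rw [← hB l]
    ext i j
    simp [Matrix.mul_apply, toRows₁, toBlocks₂₁, toBlocks₂₂, toRows₂]
  · simp only [hp]; rfl
  · simp only [hp]; rfl

/-- Conjugating frames by `G`. -/
theorem conj_frames {m : ℕ} (X : Fin m → Matrix κ κ ℝ) (B : ℕ → Matrix κ ι ℝ) (p : Matrix ι ι ℝ)
    (hB : ∀ l : Fin m, X l * B (l + 1) = B l) (hp : B 0 = B m * p) (G : Matrix κ κ ℝ)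
    (hG : IsUnit G) :
    (∀ l : Fin m, (G * X l * G⁻¹) * (G * B (l + 1)) = G * B l) ∧ G * B 0 = G * B m * p := by
  constructor
  · intro l
    have := Matrix.nonsing_inv_mul _ ((Matrix.isUnit_iff_isUnit_det _).1 hG)
    rw [Matrix.mul_assoc, ← Matrix.mul_assoc G⁻¹, this, Matrix.one_mul, Matrix.mul_assoc, hB]
  · rw [hp, Matrix.mul_assoc]

end Frames

/-- Tuples of `m` real matrices, as functions. -/
abbrev Tup (m : ℕ) (ι κ : Type*) := Fin m → ι → κ → ℝ

instance {α : Type*} [Fintype α] {G : Type*} [AddGroup G] [TopologicalSpace G] [MeasureSpace G]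
    [SigmaFinite (volume : Measure G)] [MeasurableAdd G] [(volume : Measure G).IsAddHaarMeasure] :
    (volume : Measure (α → G)).IsAddHaarMeasure := Measure.pi.isAddHaarMeasure _

section Instances
variable (m : ℕ) (ι κ : Type*) [Fintype ι] [Fintype κ]

instance : BorelSpace (Tup m ι κ) := inferInstance

instance : SecondCountableTopology (Tup m ι κ) := inferInstance

instance : (volume : Measure (Tup m ι κ)).IsAddHaarMeasure := Measure.pi.isAddHaarMeasure _

instance : SigmaFinite (volume : Measure (Tup m ι κ)) := inferInstance

end Instances

/-- The matrices of a tuple. -/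
def tm {m : ℕ} {ι κ : Type*} (X : Tup m ι κ) : Fin m → Matrix ι κ ℝ := fun l => Matrix.of (X l)

/-- The tuple of a sequence of matrices. -/
def tf {m : ℕ} {ι κ : Type*} (X : Fin m → Matrix ι κ ℝ) : Tup m ι κ := fun l i j => X l i j

@[simp] theorem tm_tf {m : ℕ} {ι κ : Type*} (X : Fin m → Matrix ι κ ℝ) : tm (tf X) = X := rfl
@[simp] theorem tf_tm {m : ℕ} {ι κ : Type*} (X : Tup m ι κ) : tf (tm X) = X := rfl

/-- The characteristic polynomial of the product of a tuple of square matrices. -/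
noncomputable def tchi {m : ℕ} {ι : Type*} [Fintype ι] [DecidableEq ι] (X : Tup m ι ι) : ℝ[X] :=
  (List.ofFn (tm X)).prod.charpoly

theorem lintegral_abs_mul_eq_lintegral_tsum_regular {E : Type*} [NormedAddCommGroup E]
    [NormedSpace ℝ E] [FiniteDimensional ℝ E] [MeasurableSpace E] [BorelSpace E] (μ : Measure E)
    [μ.IsAddHaarMeasure] {f : E → E} (hf : ContDiff ℝ 1 f) (R : E → ℝ)
    (hR : ∀ x, |(fderiv ℝ f x).det| = |R x|) (h : E → ENNReal) (hh : Measurable h)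
    (w : E → ENNReal) (hw : Measurable w) :
    (Measurable fun z => ∑' x, (f ⁻¹' {z} ∩ {x | R x ≠ 0}).indicator h x) ∧
    ∫⁻ x, ENNReal.ofReal |R x| * (h x * w (f x)) ∂μ
      = ∫⁻ z, (∑' x, (f ⁻¹' {z} ∩ {x | R x ≠ 0}).indicator h x) * w z ∂μ := by
  have hs : ∀ x, HasStrictFDerivAt f (fderiv ℝ f x) x := fun x =>
    hf.contDiffAt.hasStrictFDerivAt (by norm_num)
  have hc : Continuous (fderiv ℝ f) := hf.continuous_fderiv (by norm_num)
  have hset : ∀ z, f ⁻¹' {z} ∩ {x | (fderiv ℝ f x).det ≠ 0} = f ⁻¹' {z} ∩ {x | R x ≠ 0} :=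
    fun z => by
      congr 1; ext x
      change (fderiv ℝ f x).det ≠ 0 ↔ R x ≠ 0
      rw [← abs_pos, hR, abs_pos]
  constructor
  · have := (lintegral_abs_det_fderiv_mul_eq_lintegral_tsum_fiber μ hs hc _ hh).1
    simp only [hset] at this
    exact this
  · have := (lintegral_abs_det_fderiv_mul_eq_lintegral_tsum_fiber μ hs hc _
        (hh.mul (hw.comp hf.continuous.measurable))).2
    simp only [hset, hR] at this
    refine this.trans (lintegral_congr fun z => ?_)
    rw [← ENNReal.tsum_mul_right]
    refine tsum_congr fun x => ?_
    by_cases hx : x ∈ f ⁻¹' {z} ∩ {x | R x ≠ 0}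
    · rw [Set.indicator_of_mem hx, Set.indicator_of_mem hx]
      have : f x = z := hx.1
      simp [this]
    · rw [Set.indicator_of_notMem hx, Set.indicator_of_notMem hx, zero_mul]

section RicMap
variable {ι κ : Type*} [Fintype ι] [Fintype κ] [DecidableEq ι] [DecidableEq κ] {m : ℕ} [NeZero m]

/-- The domain of the Riccati map: the blocks `(a, b, d)` together with the graph `Y`. -/
abbrev RicDom (m : ℕ) (ι κ : Type*) := (Tup m ι ι × Tup m ι κ × Tup m κ κ) × Tup m κ ι

instance : (volume : Measure (RicDom m ι κ)).IsAddHaarMeasure := by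
  have h1 : (volume : Measure (Tup m ι κ × Tup m κ κ)).IsAddHaarMeasure :=
    Measure.prod.instIsAddHaarMeasure _ _
  have h2 : (volume : Measure (Tup m ι ι × Tup m ι κ × Tup m κ κ)).IsAddHaarMeasure :=
    Measure.prod.instIsAddHaarMeasure _ _
  exact Measure.prod.instIsAddHaarMeasure _ _

/-- The Riccati map. -/
def ricMap (x : RicDom m ι κ) : RicDom m ι κ :=
  (x.1, tf (ricC (tm x.1.1) (tm x.1.2.1) (tm x.1.2.2) (tm x.2)))

/-- The induced action on invariant graphs. -/
def ricPT (x : RicDom m ι κ) : Tup m ι ι := tf (ricP (tm x.1.1) (tm x.1.2.1) (tm x.2))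

/-- The induced action on the quotients. -/
def ricQT (x : RicDom m ι κ) : Tup m κ κ := tf (ricQ (tm x.1.2.1) (tm x.1.2.2) (tm x.2))

theorem continuous_ricPT : Continuous (ricPT : RicDom m ι κ → _) := by
  unfold ricPT tf tm ricP
  simp only [Matrix.add_apply, Matrix.mul_apply, Matrix.of_apply]
  fun_prop

theorem continuous_ricQT : Continuous (ricQT : RicDom m ι κ → _) := by
  unfold ricQT tf tm ricQ
  simp only [Matrix.sub_apply, Matrix.mul_apply, Matrix.of_apply]
  fun_prop

theorem contDiff_ricMap : ContDiff ℝ 1 (ricMap : RicDom m ι κ → _) := by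
  unfold ricMap tf tm ricC
  simp only [Matrix.sub_apply, Matrix.add_apply, Matrix.mul_apply, Matrix.of_apply]
  refine contDiff_fst.prodMk ?_
  refine contDiff_pi.2 fun l => contDiff_pi.2 fun i => contDiff_pi.2 fun j => ?_
  fun_prop

theorem ricC_add (a : Fin m → Matrix ι ι ℝ) (b : Fin m → Matrix ι κ ℝ)
    (d : Fin m → Matrix κ κ ℝ) (Y w : Fin m → Matrix κ ι ℝ) (t : ℝ) (l : Fin m) :
    ricC a b d (fun l => Y l + t • w l) l = ricC a b d Y l
      + t • (w l * ricP a b Y l - ricQ b d Y l * w (l + 1))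
      + t ^ 2 • (w l * b l * w (l + 1)) := by
  simp only [ricC, ricP, ricQ, Matrix.add_mul, Matrix.mul_add, Matrix.sub_mul, smul_sub, smul_add,
    Matrix.smul_mul, Matrix.mul_smul, Matrix.mul_assoc, pow_two, mul_smul]
  abel

theorem det_fderiv_ricMap (x : RicDom m ι κ) :
    |(fderiv ℝ ricMap x).det| = |resultant (tchi (ricPT x)) (tchi (ricQT x))| := by
  have hd : HasFDerivAt ricMap (fderiv ℝ ricMap x) x :=
    (contDiff_ricMap.differentiable (by norm_num) x).hasFDerivAt
  have h1 : ∀ y, (fderiv ℝ ricMap x y).1 = y.1 := by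
    intro y
    have e1 : HasFDerivAt (fun z : RicDom m ι κ => (ricMap z).1)
      ((ContinuousLinearMap.fst ℝ _ _).comp (fderiv ℝ ricMap x)) x := hd.fst
    have e2 : HasFDerivAt (fun z : RicDom m ι κ => (ricMap z).1)
      (ContinuousLinearMap.fst ℝ _ _) x := hasFDerivAt_fst
    have := DFunLike.congr_fun (e1.unique e2) y
    simpa using this
  have h2 : ∀ w, (fderiv ℝ ricMap x (0, w)).2
      = cyclicLin (tm (ricPT x)) (tm (ricQT x)) w := by
    intro w
    have e1 : HasDerivAt (fun t : ℝ => ricMap (x + t • ((0, w) : RicDom m ι κ)))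
        (fderiv ℝ ricMap x (0, w)) 0 := by
      have l1 : HasDerivAt (fun t : ℝ => x + t • ((0, w) : RicDom m ι κ)) (0, w) 0 := by
        simpa using ((hasDerivAt_id (0 : ℝ)).smul_const ((0, w) : RicDom m ι κ)).const_add x
      have hd' : HasFDerivAt ricMap (fderiv ℝ ricMap x) (x + (0 : ℝ) • ((0, w) : RicDom m ι κ)) := by
        simpa using hd
      exact hd'.comp_hasDerivAt (0 : ℝ) l1
    have e2 := (ContinuousLinearMap.snd ℝ (Tup m ι ι × Tup m ι κ × Tup m κ κ)
      (Tup m κ ι)).hasFDerivAt.comp_hasDerivAt (0 : ℝ) e1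
    have e3 : HasDerivAt (fun t : ℝ => (ricMap (x + t • ((0, w) : RicDom m ι κ))).2)
        (cyclicLin (tm (ricPT x)) (tm (ricQT x)) w) 0 := by
      refine hasDerivAt_pi.2 fun l => hasDerivAt_pi.2 fun i => hasDerivAt_pi.2 fun j => ?_
      have e4 : (fun t : ℝ => (ricMap (x + t • ((0, w) : RicDom m ι κ))).2 l i j)
          = fun t : ℝ => ricC (tm x.1.1) (tm x.1.2.1) (tm x.1.2.2) (tm x.2) l i j
            + t * cyclicLin (tm (ricPT x)) (tm (ricQT x)) w l i j
            + t ^ 2 * (tm w l * tm x.1.2.1 l * tm w (l + 1)) i j := by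
        funext t
        have := congrFun (congrFun (ricC_add (tm x.1.1) (tm x.1.2.1) (tm x.1.2.2) (tm x.2)
          (tm w) t l) i) j
        simp only [Matrix.add_apply, Matrix.smul_apply, smul_eq_mul] at this
        refine Eq.trans ?_ (this.trans rfl)
        simp only [ricMap, Prod.fst_add, Prod.snd_add, Prod.smul_mk, smul_zero, add_zero]
        rfl
      rw [e4]
      have e5 := (((hasDerivAt_id (0 : ℝ)).mul_const
        (cyclicLin (tm (ricPT x)) (tm (ricQT x)) w l i j)).const_add
        (ricC (tm x.1.1) (tm x.1.2.1) (tm x.1.2.2) (tm x.2) l i j)).add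
        (((hasDerivAt_id (0 : ℝ)).pow 2).mul_const
          ((tm w l * tm x.1.2.1 l * tm w (l + 1)) i j))
      simp only [id_eq, one_mul, Nat.cast_ofNat, mul_zero, zero_mul, add_zero, Nat.add_one_sub_one,
        pow_one, mul_one] at e5
      exact e5
    exact e2.unique e3
  have h3 := det_prod_lower (fderiv ℝ ricMap x : RicDom m ι κ →ₗ[ℝ] RicDom m ι κ)
    (cyclicLin (tm (ricPT x)) (tm (ricQT x))) h1 h2
  have h4 := abs_det_cyclicLin (tm (ricPT x)) (tm (ricQT x))
  rw [← h3] at h4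
  exact h4

/-- The sum of `h` over regular preimages under the Riccati map. -/
noncomputable def ricSum (h : ℝ[X] → ℝ[X] → ENNReal) (z : RicDom m ι κ) : ENNReal :=
  ∑' x, (ricMap ⁻¹' {z} ∩ {x | resultant (tchi (ricPT x)) (tchi (ricQT x)) ≠ 0}).indicator
    (fun x => h (tchi (ricPT x)) (tchi (ricQT x))) x

theorem lintegral_ricSum (h : ℝ[X] → ℝ[X] → ENNReal)
    (hh : Measurable fun z : Tup m ι ι × Tup m κ κ => h (tchi z.1) (tchi z.2))
    (w : RicDom m ι κ → ENNReal) (hw : Measurable w) :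
    Measurable (ricSum h : RicDom m ι κ → ENNReal) ∧
    ∫⁻ x : RicDom m ι κ, ENNReal.ofReal |resultant (tchi (ricPT x)) (tchi (ricQT x))|
        * (h (tchi (ricPT x)) (tchi (ricQT x)) * w (ricMap x))
      = ∫⁻ z, ricSum h z * w z :=
  lintegral_abs_mul_eq_lintegral_tsum_regular (volume : Measure (RicDom m ι κ)) contDiff_ricMap _
    det_fderiv_ricMap _
    (hh.comp (continuous_ricPT.measurable.prodMk continuous_ricQT.measurable)) w hw

end RicMap

theorem ae_eval_mvPolynomial_ne_zero {E σ : Type*} [NormedAddCommGroup E] [NormedSpace ℝ E]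
    [FiniteDimensional ℝ E] [MeasurableSpace E] [BorelSpace E] (μ : Measure E)
    [μ.IsAddHaarMeasure] (e : E →ₗ[ℝ] (σ → ℝ)) (p : MvPolynomial σ ℝ) (x₀ : E)
    (h₀ : MvPolynomial.eval (e x₀) p ≠ 0) : ∀ᵐ x ∂μ, MvPolynomial.eval (e x) p ≠ 0 := by
  refine ae_ne_zero_of_polynomial_on_lines μ (fun x => MvPolynomial.eval (e x) p) ?_ x₀ h₀ ?_
  · exact ((MvPolynomial.continuous_eval p).comp e.continuous_of_finiteDimensional).measurable
  · intro x
    refine ⟨MvPolynomial.aeval (fun s => C (e x₀ s) + X * C (e x s)) p, fun t => ?_⟩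
    have h1 : ((Polynomial.evalRingHom t).comp
        (MvPolynomial.aeval (R := ℝ) (fun s => C (e x₀ s) + X * C (e x s))).toRingHom)
        = MvPolynomial.eval (e (x₀ + t • x)) := by
      apply MvPolynomial.ringHom_ext
      · intro r; simp
      · intro s
        simp
        ring
    rw [← h1]
    rfl

section Generic
variable {ι κ : Type*} [Fintype ι] [Fintype κ] [DecidableEq ι] [DecidableEq κ] {m : ℕ}

/-- The entries of a tuple as a linear map. -/
def tupEntries (m : ℕ) (ι κ : Type*) : Tup m ι κ →ₗ[ℝ] (Fin m × ι × κ → ℝ) where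
  toFun X s := X s.1 s.2.1 s.2.2
  map_add' _ _ := rfl
  map_smul' _ _ := rfl

/-- The entries of a matrix as a linear map. -/
def matEntries (ι κ : Type*) : (ι → κ → ℝ) →ₗ[ℝ] (ι × κ → ℝ) where
  toFun X s := X s.1 s.2
  map_add' _ _ := rfl
  map_smul' _ _ := rfl

/-- The product of generic matrices. -/
noncomputable def genProd (m : ℕ) (ι : Type*) [Fintype ι] [DecidableEq ι] :
    Matrix ι ι (MvPolynomial (Fin m × ι × ι) ℝ) :=
  (List.ofFn fun l => Matrix.of fun i j => MvPolynomial.X (l, i, j)).prod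

theorem genProd_map_eval (X : Tup m ι ι) :
    (genProd m ι).map (MvPolynomial.eval (tupEntries m ι ι X)) = (List.ofFn (tm X)).prod := by
  change (MvPolynomial.eval (tupEntries m ι ι X)).mapMatrix (genProd m ι) = _
  rw [genProd, map_list_prod, List.map_ofFn]
  congr 2
  funext l
  ext i j
  simp [tm, tupEntries]

/-- Tuples whose product is invertible with separable characteristic polynomial. -/
def TupGood (X : Tup m ι ι) : Prop :=
  (tchi X).Separable ∧ (List.ofFn (tm X)).prod.det ≠ 0

theorem exists_mvPolynomial_tupGood (m : ℕ) (ι : Type*) [Fintype ι] [DecidableEq ι] :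
    ∃ q : MvPolynomial (Fin m × ι × ι) ℝ, ∀ X : Tup m ι ι,
      MvPolynomial.eval (tupEntries m ι ι X) q ≠ 0 ↔ TupGood X := by
  refine ⟨resultant (genProd m ι).charpoly (genProd m ι).charpoly.derivative
    (Fintype.card ι) (Fintype.card ι - 1) * (genProd m ι).det, fun X => ?_⟩
  rw [map_mul, ← resultant_map_map, ← Polynomial.derivative_map, ← Matrix.charpoly_map,
    genProd_map_eval, RingHom.map_det, RingHom.mapMatrix_apply, genProd_map_eval, mul_ne_zero_iff,
    TupGood, tchi]
  refine and_congr ?_ Iff.rfl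
  set χ := (List.ofFn (tm X)).prod.charpoly
  have h1 : χ.natDegree = Fintype.card ι := Matrix.charpoly_natDegree_eq_dim _
  have hχ : χ ≠ 0 := (Matrix.charpoly_monic _).ne_zero
  rw [← h1, ← Polynomial.natDegree_derivative, Ne, resultant_eq_zero_iff]
  simp [hχ, Polynomial.Separable]

theorem measurableSet_tupGood : MeasurableSet {X : Tup m ι ι | TupGood X} := by
  obtain ⟨q, hq⟩ := exists_mvPolynomial_tupGood m ι
  have : {X : Tup m ι ι | TupGood X}
      = (fun X => MvPolynomial.eval (tupEntries m ι ι X) q) ⁻¹' {0}ᶜ := by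
    ext X; exact (hq X).symm
  rw [this]
  exact ((MvPolynomial.continuous_eval q).comp
    (tupEntries m ι ι).continuous_of_finiteDimensional).measurable
      (measurableSet_singleton 0).compl

theorem ae_tupGood [NeZero m] : ∀ᵐ X : Tup m ι ι, TupGood X := by
  obtain ⟨q, hq⟩ := exists_mvPolynomial_tupGood m ι
  obtain ⟨m, rfl⟩ : ∃ k, m = k + 1 := ⟨m - 1, by have := NeZero.pos m; omega⟩
  let e := Fintype.equivFin ι
  let D : ι → ℝ := fun i => (e i : ℕ) + 1
  have hD : Function.Injective D := fun i j h => by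
    simpa [D, Fin.val_inj] using h
  let X₀ : Tup (m + 1) ι ι := tf (Fin.cons (Matrix.diagonal D) fun _ => 1)
  have hP : (List.ofFn (tm X₀)).prod = Matrix.diagonal D := by
    simp [X₀, List.ofFn_succ]
  have h0 : TupGood X₀ := by
    rw [TupGood, tchi, hP]
    constructor
    · rw [Matrix.charpoly_diagonal]
      exact Polynomial.separable_prod_X_sub_C_iff.2 hD
    · rw [Matrix.det_diagonal]
      exact Finset.prod_ne_zero_iff.2 fun i _ => by positivity
  have := ae_eval_mvPolynomial_ne_zero (volume : Measure (Tup (m + 1) ι ι))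
    (tupEntries (m + 1) ι ι) q X₀ ((hq X₀).2 h0)
  filter_upwards [this] with X hX using (hq X).1 hX

theorem ae_isUnit_matrix : ∀ᵐ G : κ → κ → ℝ, IsUnit (Matrix.of G) := by
  have := ae_eval_mvPolynomial_ne_zero (volume : Measure (κ → κ → ℝ)) (matEntries κ κ)
    (Matrix.of fun i j => MvPolynomial.X (i, j)).det (fun i j => (1 : Matrix κ κ ℝ) i j) (by
      rw [RingHom.map_det]
      convert one_ne_zero (α := ℝ) using 1
      rw [← Matrix.det_one (n := κ)]
      congr 1
      ext i j
      simp [matEntries])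
  filter_upwards [this] with G hG
  rw [Matrix.isUnit_iff_isUnit_det, isUnit_iff_ne_zero]
  rw [RingHom.map_det] at hG
  convert hG using 2
  ext i j
  simp [matEntries]

theorem ae_isUnit_toRows (B : Matrix (ι ⊕ κ) ι ℝ) (A : Matrix ι (ι ⊕ κ) ℝ) (h : A * B = 1) :
    ∀ᵐ G : (ι ⊕ κ) → (ι ⊕ κ) → ℝ, IsUnit (Matrix.of G * B).toRows₁ := by
  have key : ∀ G : (ι ⊕ κ) → (ι ⊕ κ) → ℝ, MvPolynomial.eval (matEntries _ _ G)
      ((Matrix.of fun i j => MvPolynomial.X (i, j)) *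
        (B.map MvPolynomial.C : Matrix (ι ⊕ κ) ι (MvPolynomial _ ℝ))).toRows₁.det
      = (Matrix.of G * B).toRows₁.det := by
    intro G
    rw [RingHom.map_det]
    congr 1
    ext i j
    change MvPolynomial.eval (matEntries _ _ G)
      (∑ k, MvPolynomial.X (Sum.inl i, k) * MvPolynomial.C (B k j)) = ∑ k, G (Sum.inl i) k * B k j
    simp [matEntries]
  have := ae_eval_mvPolynomial_ne_zero (volume : Measure ((ι ⊕ κ) → (ι ⊕ κ) → ℝ))
    (matEntries _ _) _ (fun i j => Matrix.fromRows A (0 : Matrix κ (ι ⊕ κ) ℝ) i j) (by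
      rw [key]
      convert one_ne_zero (α := ℝ) using 1
      rw [← Matrix.det_one (n := ι), ← h]
      congr 1)
  filter_upwards [this] with G hG
  rw [Matrix.isUnit_iff_isUnit_det, isUnit_iff_ne_zero, ← key]
  exact hG

end Generic

/-- Factorizations of `χ` into monic polynomials, the first of degree `d`. -/
def Fac (d : ℕ) (χ : ℝ[X]) : Set (ℝ[X] × ℝ[X]) :=
  {z | z.1.Monic ∧ z.2.Monic ∧ z.1 * z.2 = χ ∧ z.1.natDegree = d}

theorem encard_fac_le (d : ℕ) (χ : ℝ[X]) (hχ : χ ≠ 0) :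
    (Fac d χ).encard ≤ (2 ^ χ.natDegree : ℕ) := by
  classical
  let r : ℝ[X] × ℝ[X] → Multiset ℂ := fun z => (z.1.map (algebraMap ℝ ℂ)).roots
  have hinj : Set.InjOn r (Fac d χ) := by
    rintro z ⟨h1, h2, h3, -⟩ w ⟨k1, k2, k3, -⟩ h
    have e1 : ∀ f : ℝ[X], f.Monic → f.map (algebraMap ℝ ℂ)
        = (Multiset.map (fun a => X - C a) (f.map (algebraMap ℝ ℂ)).roots).prod := fun f hf =>
      ((IsAlgClosed.splits _).eq_prod_roots_of_monic (hf.map _))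
    have e2 : z.1 = w.1 := by
      apply Polynomial.map_injective _ (algebraMap ℝ ℂ).injective
      rw [e1 _ h1, e1 _ k1]
      simp only [r] at h
      rw [h]
    refine Prod.ext e2 ?_
    rw [← k3, e2] at h3
    exact mul_left_cancel₀ k1.ne_zero h3
  have hmaps : Set.MapsTo r (Fac d χ)
      ((χ.map (algebraMap ℝ ℂ)).roots.powerset.toFinset : Set (Multiset ℂ)) := by
    rintro z ⟨h1, h2, h3, -⟩
    simp only [Finset.mem_coe, Multiset.mem_toFinset, Multiset.mem_powerset, r]
    apply Polynomial.roots.le_of_dvd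
    · exact (Polynomial.map_ne_zero_iff (algebraMap ℝ ℂ).injective).2 hχ
    · rw [← h3, Polynomial.map_mul]
      exact dvd_mul_right _ _
  refine (Set.encard_le_encard_of_injOn hmaps hinj).trans ?_
  rw [Set.encard_coe_eq_coe_finsetCard]
  have h1 : (χ.map (algebraMap ℝ ℂ)).roots.powerset.toFinset.card ≤ 2 ^ χ.natDegree := by
    refine (Multiset.toFinset_card_le _).trans ?_
    rw [Multiset.card_powerset]
    refine Nat.pow_le_pow_right (by norm_num) ?_
    refine (Polynomial.card_roots' _).trans ?_
    rw [Polynomial.natDegree_map]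
  exact_mod_cast h1

/-- The sum of `h` over factorizations of `χ`. -/
noncomputable def facSum (d : ℕ) (h : ℝ[X] → ℝ[X] → ENNReal) (χ : ℝ[X]) : ENNReal :=
  ∑' z : Fac d χ, h z.1.1 z.1.2

theorem facSum_one_ne_top (d : ℕ) (χ : ℝ[X]) (hχ : χ ≠ 0) :
    facSum d (fun _ _ => 1) χ ≤ 2 ^ χ.natDegree := by
  rw [facSum, ENNReal.tsum_set_one]
  have := encard_fac_le d χ hχ
  exact_mod_cast (ENat.toENNReal_le.2 this)

section Blk
variable {ι κ : Type*} [Fintype ι] [Fintype κ] [DecidableEq ι] [DecidableEq κ] {m : ℕ} [NeZero m]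

/-- The blocks of a tuple. -/
def toBlk (X : Tup m (ι ⊕ κ) (ι ⊕ κ)) : RicDom m ι κ :=
  ((fun l i j => X l (.inl i) (.inl j), fun l i j => X l (.inl i) (.inr j),
    fun l i j => X l (.inr i) (.inr j)), fun l i j => X l (.inr i) (.inl j))

theorem tchi_eq_mul_of_ricMap_eq (X : Tup m (ι ⊕ κ) (ι ⊕ κ)) (x : RicDom m ι κ)
    (h : ricMap x = toBlk X) : tchi X = tchi (ricPT x) * tchi (ricQT x) := by
  rw [tchi, tchi, tchi, ricPT, ricQT, tm_tf, tm_tf, ← charpoly_prod_fromBlocks_ricC]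
  congr 3
  funext l
  have h1 : x.1 = (toBlk X).1 := by rw [← h]; rfl
  have h2 : ricC (tm x.1.1) (tm x.1.2.1) (tm x.1.2.2) (tm x.2) = tm (toBlk X).2 :=
    by rw [← h]; rfl
  rw [h2, h1]
  ext (i | i) (j | j) <;> rfl

theorem monic_tchi {ι : Type*} [Fintype ι] [DecidableEq ι] (X : Tup m ι ι) : (tchi X).Monic :=
  Matrix.charpoly_monic _

theorem natDegree_tchi {ι : Type*} [Fintype ι] [DecidableEq ι] (X : Tup m ι ι) :
    (tchi X).natDegree = Fintype.card ι := Matrix.charpoly_natDegree_eq_dim _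

/-- The fibers of the Riccati map. -/
def ricFib (X : Tup m (ι ⊕ κ) (ι ⊕ κ)) : Set (RicDom m ι κ) :=
  ricMap ⁻¹' {toBlk X} ∩ {x | resultant (tchi (ricPT x)) (tchi (ricQT x)) ≠ 0}

/-- The factorization associated with an invariant graph. -/
noncomputable def ricFac (X : Tup m (ι ⊕ κ) (ι ⊕ κ)) (x : ricFib X) :
    Fac (Fintype.card ι) (tchi X) :=
  ⟨(tchi (ricPT x.1), tchi (ricQT x.1)), monic_tchi _, monic_tchi _,
    (tchi_eq_mul_of_ricMap_eq X x.1 x.2.1).symm, natDegree_tchi _⟩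

theorem ricFac_injective (X : Tup m (ι ⊕ κ) (ι ⊕ κ)) (hX : (tchi X).Separable) :
    Function.Injective (ricFac X) := by
  rintro ⟨x, hx, hx'⟩ ⟨y, hy, hy'⟩ h
  have hp : tchi (ricPT x) = tchi (ricPT y) := congrArg (fun z : Fac (Fintype.card ι) (tchi X) => z.1.1) h
  have h1 : ricMap x = ricMap y := Eq.trans hx hy.symm
  have h2 : x.1 = y.1 := show (ricMap x).1 = (ricMap y).1 by rw [h1]
  have h3 : ricC (tm x.1.1) (tm x.1.2.1) (tm x.1.2.2) (tm x.2)
    = ricC (tm x.1.1) (tm x.1.2.1) (tm x.1.2.2) (tm y.2) := by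
    have : ricC (tm x.1.1) (tm x.1.2.1) (tm x.1.2.2) (tm x.2)
      = ricC (tm y.1.1) (tm y.1.2.1) (tm y.1.2.2) (tm y.2) :=
      show tm (ricMap x).2 = tm (ricMap y).2 by rw [h1]
    rw [this, h2]
  rw [tchi_eq_mul_of_ricMap_eq X x hx] at hX
  have h4 := ricC_injective (tm x.1.1) (tm x.1.2.1) (tm x.1.2.2) (tm x.2) (tm y.2) h3 (by
    have e := hp
    rw [tchi, tchi, ricPT, ricPT, ← h2] at e
    exact e) hX.isCoprime
  apply Subtype.ext
  exact Prod.ext h2 h4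

theorem ricSum_toBlk (h : ℝ[X] → ℝ[X] → ENNReal) (X : Tup m (ι ⊕ κ) (ι ⊕ κ)) :
    ricSum h (toBlk X) = ∑' x : ricFib X, h (ricFac X x).1.1 (ricFac X x).1.2 := by
  rw [ricSum, ← tsum_subtype]
  rfl

theorem ricSum_eq_facSum_of_surjective (h : ℝ[X] → ℝ[X] → ENNReal) (X : Tup m (ι ⊕ κ) (ι ⊕ κ))
    (hX : (tchi X).Separable) (hs : Function.Surjective (ricFac X)) :
    ricSum h (toBlk X) = facSum (Fintype.card ι) h (tchi X) := by
  rw [ricSum_toBlk, facSum]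
  exact (Equiv.ofBijective _ ⟨ricFac_injective X hX, hs⟩).tsum_eq
    (fun z : Fac (Fintype.card ι) (tchi X) => h z.1.1 z.1.2)

theorem ricFac_surjective_of_le (X : Tup m (ι ⊕ κ) (ι ⊕ κ)) (hX : (tchi X).Separable)
    (hle : facSum (Fintype.card ι) (fun _ _ => 1) (tchi X) ≤ ricSum (fun _ _ => 1) (toBlk X)) :
    Function.Surjective (ricFac X) := by
  rw [ricSum_toBlk, facSum, ENNReal.tsum_set_one, ENNReal.tsum_set_one, ENat.toENNReal_le] at hle
  have hfin : (Fac (Fintype.card ι) (tchi X)).Finite :=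
    Set.finite_of_encard_le_coe (encard_fac_le _ _ (monic_tchi X).ne_zero)
  have hrange : (Set.range fun x => (ricFac X x).1) = Fac (Fintype.card ι) (tchi X) := by
    apply hfin.eq_of_subset_of_encard_le'
    · rintro _ ⟨x, rfl⟩
      exact (ricFac X x).2
    · refine hle.trans ?_
      have hi : Function.Injective fun x => (ricFac X x).1 :=
        Subtype.val_injective.comp (ricFac_injective X hX)
      rw [← Set.image_univ, hi.encard_image, Set.encard_univ, ENat.card_coe_set_eq]
  rintro ⟨z, hz⟩
  rw [← hrange] at hz
  obtain ⟨x, hx⟩ := hz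
  exact ⟨x, Subtype.ext hx⟩

/-- Simultaneous conjugation. -/
noncomputable def conjTup {κ : Type*} [Fintype κ] [DecidableEq κ] (G : κ → κ → ℝ)
    (X : Tup m κ κ) : Tup m κ κ := tf fun l => Matrix.of G * tm X l * (Matrix.of G)⁻¹

theorem prod_conjTup {κ : Type*} [Fintype κ] [DecidableEq κ] (G : κ → κ → ℝ)
    (hG : IsUnit (Matrix.of G)) (X : Tup m κ κ) :
    (List.ofFn (tm (conjTup G X))).prod * Matrix.of G
      = Matrix.of G * (List.ofFn (tm X)).prod := by
  refine prod_ofFn_intertwine _ _ (fun _ => Matrix.of G) fun l => ?_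
  simp only [conjTup, tm_tf]
  rw [Matrix.mul_assoc _ _ (Matrix.of G),
    Matrix.nonsing_inv_mul _ ((Matrix.isUnit_iff_isUnit_det _).1 hG), Matrix.mul_one]

theorem tchi_conjTup {κ : Type*} [Fintype κ] [DecidableEq κ] (G : κ → κ → ℝ)
    (hG : IsUnit (Matrix.of G)) (X : Tup m κ κ) : tchi (conjTup G X) = tchi X :=
  charpoly_eq_of_intertwine _ _ _ hG (prod_conjTup G hG X)

theorem measurable_conjTup {κ : Type*} [Fintype κ] [DecidableEq κ] :
    Measurable fun z : (κ → κ → ℝ) × Tup m κ κ => conjTup z.1 z.2 := by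
  refine measurable_pi_lambda _ fun l => measurable_pi_lambda _ fun i => measurable_pi_lambda _
    fun j => ?_
  have h1 : ∀ i j, Measurable fun z : (κ → κ → ℝ) × Tup m κ κ => (Matrix.of z.1)⁻¹ i j := by
    intro i j
    simp only [Matrix.inv_def, Ring.inverse_eq_inv', Matrix.smul_apply, smul_eq_mul]
    refine Measurable.mul ?_ ?_
    · refine Measurable.inv ?_
      exact (Continuous.matrix_det (by exact continuous_fst)).measurable
    · exact ((Continuous.matrix_adjugate (A := fun z : (κ → κ → ℝ) × Tup m κ κ => Matrix.of z.1)
        (by exact continuous_fst)).matrix_elem i j).measurable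
  simp only [conjTup, tf, Matrix.mul_apply]
  refine Finset.measurable_sum _ fun k _ => Measurable.mul ?_ (h1 k j)
  refine Finset.measurable_sum _ fun k' _ => Measurable.mul ?_ ?_
  · exact (measurable_pi_apply _).comp ((measurable_pi_apply _).comp measurable_fst)
  · exact (measurable_pi_apply _).comp ((measurable_pi_apply _).comp
      ((measurable_pi_apply _).comp measurable_snd))

theorem ae_ricFac_conjTup_surjective (X : Tup m (ι ⊕ κ) (ι ⊕ κ)) (hX : TupGood X) :
    ∀ᵐ G : (ι ⊕ κ) → (ι ⊕ κ) → ℝ, IsUnit (Matrix.of G) ∧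
      Function.Surjective (ricFac (conjTup G X)) := by
  have hfin : (Fac (Fintype.card ι) (tchi X)).Finite :=
    Set.finite_of_encard_le_coe (encard_fac_le _ _ (monic_tchi X).ne_zero)
  have hu : IsUnit (List.ofFn (tm X)).prod := by
    rw [Matrix.isUnit_iff_isUnit_det]; exact isUnit_iff_ne_zero.2 hX.2
  have h1 : ∀ z ∈ Fac (Fintype.card ι) (tchi X), ∀ᵐ G : (ι ⊕ κ) → (ι ⊕ κ) → ℝ,
      IsUnit (Matrix.of G) → ∃ x : RicDom m ι κ, ricMap x = toBlk (conjTup G X) ∧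
        tchi (ricPT x) = z.1 := by
    rintro z ⟨z1, z2, z3, z4⟩
    have hco : IsCoprime z.1 z.2 := by
      apply Separable.isCoprime
      rw [z3]; exact hX.1
    obtain ⟨B, A, p, hAB, hB, hp, hpz⟩ := exists_frames (ι := ι) (tm X) hu z.1 z.2 z1 z2 z3.symm
      hco z4
    have h2 : ∀ᵐ G : (ι ⊕ κ) → (ι ⊕ κ) → ℝ, ∀ j, IsUnit (Matrix.of G * B j).toRows₁ :=
      ae_all_iff.2 fun j => ae_isUnit_toRows (B j) (A j) (hAB j)
    filter_upwards [h2] with G hG hGu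
    obtain ⟨c1, c2⟩ := conj_frames (tm X) B p hB hp (Matrix.of G) hGu
    obtain ⟨Y, hY1, hY2⟩ := exists_ricC_eq_of_frames (tm (conjTup G X)) (fun j => Matrix.of G * B j)
      p c1 c2 (fun j _ => hG j)
    refine ⟨((toBlk (conjTup G X)).1, tf Y), Prod.ext rfl ?_, ?_⟩
    · exact congrArg tf hY1
    · rw [← hpz, ← hY2]
      rfl
  have h2 : ∀ᵐ G : (ι ⊕ κ) → (ι ⊕ κ) → ℝ, ∀ z ∈ Fac (Fintype.card ι) (tchi X),
      IsUnit (Matrix.of G) → ∃ x : RicDom m ι κ, ricMap x = toBlk (conjTup G X) ∧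
        tchi (ricPT x) = z.1 := (ae_ball_iff hfin.countable).2 h1
  filter_upwards [h2, ae_isUnit_matrix] with G hG hGu
  refine ⟨hGu, ?_⟩
  rintro ⟨z, hz⟩
  have hz' := hz
  rw [tchi_conjTup G hGu] at hz'
  obtain ⟨x, hx1, hx2⟩ := hG z hz' hGu
  have e1 := tchi_eq_mul_of_ricMap_eq _ x hx1
  have e2 : tchi (ricQT x) = z.2 := by
    rw [← hz.2.2.1, hx2] at e1
    exact (mul_left_cancel₀ hz.1.ne_zero e1).symm
  have hsep : (tchi (ricPT x) * tchi (ricQT x)).Separable := by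
    rw [← e1, tchi_conjTup G hGu]; exact hX.1
  refine ⟨⟨x, hx1, resultant_ne_zero _ _ hsep.isCoprime⟩, ?_⟩
  apply Subtype.ext
  exact Prod.ext hx2 e2

end Blk

section
variable {ι κ : Type*} [Fintype ι] [Fintype κ] [DecidableEq ι] [DecidableEq κ] {m : ℕ} [NeZero m]

theorem conjTup_conjTup (G H : κ → κ → ℝ) (hGH : Matrix.of G * Matrix.of H = 1) (X : Tup m κ κ) :
    conjTup G (conjTup H X) = X := by
  have h1 : (Matrix.of G)⁻¹ = Matrix.of H := Matrix.inv_eq_right_inv hGH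
  have h2 : (Matrix.of H)⁻¹ = Matrix.of G := Matrix.inv_eq_left_inv hGH
  rw [conjTup, conjTup, h1, h2, tm_tf]
  conv_rhs => rw [← tf_tm X]
  congr 1
  funext l
  rw [← Matrix.mul_assoc, ← Matrix.mul_assoc, hGH, Matrix.one_mul, Matrix.mul_assoc, hGH,
    Matrix.mul_one]

/-- Conjugation as a linear map. -/
noncomputable def conjTupLin (G : κ → κ → ℝ) : Tup m κ κ →ₗ[ℝ] Tup m κ κ where
  toFun := conjTup G
  map_add' X Y := by
    change tf _ = tf _
    congr 1
    funext l
    change Matrix.of G * (tm X l + tm Y l) * _ = _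
    rw [Matrix.mul_add, Matrix.add_mul]
    rfl
  map_smul' c X := by
    change tf _ = tf _
    congr 1
    funext l
    change Matrix.of G * (c • tm X l) * _ = _
    rw [Matrix.mul_smul, Matrix.smul_mul]
    rfl

theorem quasiMeasurePreserving_conjTup (G H : κ → κ → ℝ) (hGH : Matrix.of G * Matrix.of H = 1) :
    Measure.QuasiMeasurePreserving (conjTup G : Tup m κ κ → Tup m κ κ) volume volume := by
  apply Measure.LinearMap.quasiMeasurePreserving (volume : Measure (Tup m κ κ)) (f := conjTupLin G)
  have : (conjTupLin G : Tup m κ κ →ₗ[ℝ] Tup m κ κ) * conjTupLin H = 1 := by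
    refine LinearMap.ext fun X => ?_
    exact conjTup_conjTup (m := m) G H hGH X
  intro h0
  have := congrArg LinearMap.det this
  rw [map_mul, h0, zero_mul, map_one] at this
  exact zero_ne_one this

theorem measurable_ricSum_toBlk (h : ℝ[X] → ℝ[X] → ENNReal)
    (hh : Measurable fun z : Tup m ι ι × Tup m κ κ => h (tchi z.1) (tchi z.2)) :
    Measurable fun X : Tup m (ι ⊕ κ) (ι ⊕ κ) => ricSum h (toBlk X) := by
  refine (lintegral_ricSum h hh (fun _ => 0) measurable_const).1.comp ?_
  have : Continuous (toBlk : Tup m (ι ⊕ κ) (ι ⊕ κ) → _) := by unfold toBlk; fun_prop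
  exact this.measurable

/-- Almost surely every factorization comes from an invariant graph. -/
theorem ae_ricFac_surjective : ∀ᵐ X : Tup m (ι ⊕ κ) (ι ⊕ κ),
    (tchi X).Separable ∧ Function.Surjective (ricFac X) := by
  set ν : Measure ((ι ⊕ κ) → (ι ⊕ κ) → ℝ) := (volume : Measure _).toFinite with hν
  have hac : ν ≪ volume := toFinite_absolutelyContinuous _
  set s : Tup m (ι ⊕ κ) (ι ⊕ κ) → ENNReal := fun X => ricSum (fun _ _ => 1) (toBlk X) with hs
  have hsm : Measurable s := measurable_ricSum_toBlk _ measurable_const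
  have hjm : Measurable fun z : ((ι ⊕ κ) → (ι ⊕ κ) → ℝ) × Tup m (ι ⊕ κ) (ι ⊕ κ) =>
    conjTup z.1 z.2 := measurable_conjTup
  set avg : Tup m (ι ⊕ κ) (ι ⊕ κ) → ENNReal := fun X => ∫⁻ G, s (conjTup G X) ∂ν with havg
  have havgm : Measurable avg := (hsm.comp hjm).lintegral_prod_left'
  have h1 : ∀ X : Tup m (ι ⊕ κ) (ι ⊕ κ), TupGood X → ∀ᵐ G ∂ν, IsUnit (Matrix.of G) ∧
      s (conjTup G X) = facSum (Fintype.card ι) (fun _ _ => 1) (tchi X) := by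
    intro X hX
    filter_upwards [hac.ae_le (ae_ricFac_conjTup_surjective X hX)] with G hG
    refine ⟨hG.1, ?_⟩
    rw [hs, ← tchi_conjTup G hG.1 X]
    refine ricSum_eq_facSum_of_surjective _ _ ?_ hG.2
    rw [tchi_conjTup G hG.1 X]; exact hX.1
  have h2 : ∀ X : Tup m (ι ⊕ κ) (ι ⊕ κ), TupGood X →
      avg X = facSum (Fintype.card ι) (fun _ _ => 1) (tchi X) := by
    intro X hX
    rw [havg]
    simp only
    rw [lintegral_congr_ae ((h1 X hX).mono fun G hG => hG.2)]
    simp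
  set Bad : Set (Tup m (ι ⊕ κ) (ι ⊕ κ)) := {X | TupGood X} ∩ {X | s X < avg X} with hBad
  have hBadm : MeasurableSet Bad := measurableSet_tupGood.inter (measurableSet_lt hsm havgm)
  have hgood : ∀ G (X : Tup m (ι ⊕ κ) (ι ⊕ κ)), IsUnit (Matrix.of G) →
      (TupGood (conjTup G X) ↔ TupGood X) := by
    intro G X hG
    rw [TupGood, TupGood, tchi_conjTup G hG]
    have := congrArg Matrix.det (prod_conjTup G hG X)
    rw [Matrix.det_mul, Matrix.det_mul, mul_comm] at this
    rw [mul_left_cancel₀ ((Matrix.isUnit_iff_isUnit_det _).1 hG).ne_zero this]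
  have hu : ∀ᵐ G ∂ν, IsUnit (Matrix.of G) := hac.ae_le ae_isUnit_matrix
  have h3 : ∀ X : Tup m (ι ⊕ κ) (ι ⊕ κ), ∀ᵐ G ∂ν, conjTup G X ∉ Bad := by
    intro X
    by_cases hX : TupGood X
    · filter_upwards [h1 X hX] with G hG hmem
      have hg : TupGood (conjTup G X) := (hgood G X hG.1).2 hX
      have := hmem.2
      rw [Set.mem_ofPred_eq, hG.2, h2 _ hg, tchi_conjTup G hG.1] at this
      exact lt_irrefl _ this
    · filter_upwards [hu] with G hG hmem
      exact hX ((hgood G X hG).1 hmem.1)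
  have h4 : ∀ᵐ z ∂((volume : Measure (Tup m (ι ⊕ κ) (ι ⊕ κ))).prod ν), conjTup z.2 z.1 ∉ Bad := by
    rw [Measure.ae_prod_iff_ae_ae]
    · exact Filter.Eventually.of_forall h3
    · exact (hjm.comp measurable_swap hBadm).compl
  have h5 : ∀ᵐ z ∂(ν.prod (volume : Measure (Tup m (ι ⊕ κ) (ι ⊕ κ)))), conjTup z.1 z.2 ∉ Bad :=
    (Measure.measurePreserving_swap (μ := ν)
      (ν := (volume : Measure (Tup m (ι ⊕ κ) (ι ⊕ κ))))).quasiMeasurePreserving.ae h4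
  obtain ⟨G, hG, hGu⟩ := ((Measure.ae_ae_of_ae_prod h5).and hu).exists
  have hGinv := Matrix.mul_nonsing_inv _ ((Matrix.isUnit_iff_isUnit_det _).1 hGu)
  set H : (ι ⊕ κ) → (ι ⊕ κ) → ℝ := fun i j => (Matrix.of G)⁻¹ i j with hH
  have hGH : Matrix.of G * Matrix.of H = 1 := hGinv
  have h6 := (quasiMeasurePreserving_conjTup (m := m) H G (mul_eq_one_comm.1 hGH)).ae hG
  filter_upwards [h6, ae_tupGood] with X hX hXg
  rw [conjTup_conjTup G H hGH] at hX
  refine ⟨hXg.1, ricFac_surjective_of_le X hXg.1 ?_⟩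
  rw [← h2 X hXg]
  by_contra hlt
  exact hX ⟨hXg, not_le.1 hlt⟩

end

end

section

open Matrix Polynomial
open scoped Kronecker

theorem lintegral_fin_prod {n : ℕ} {E : Type*} [MeasurableSpace E] (μ : Fin n → Measure E)
    [∀ i, SigmaFinite (μ i)] (f : Fin n → E → ENNReal) (hf : ∀ i, Measurable (f i)) :
    ∫⁻ x : Fin n → E, ∏ i, f i (x i) ∂(Measure.pi μ) = ∏ i, ∫⁻ x, f i x ∂(μ i) := by
  induction n with
  | zero => simp
  | succ n ih =>
    have hm : Measurable fun x : Fin (n + 1) → E => ∏ i, f i (x i) := by fun_prop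
    rw [← ((measurePreserving_piFinSuccAbove μ 0).symm).lintegral_comp hm]
    simp_rw [MeasurableEquiv.piFinSuccAbove_symm_apply, Fin.insertNthEquiv,
            Fin.prod_univ_succ, Fin.insertNth_zero, Equiv.coe_fn_mk, Fin.cons_succ,
            Fin.zero_succAbove, Fin.cons_zero]
    rw [← ih (fun i => μ i.succ) (fun i => f i.succ) fun i => hf i.succ]
    have hm2 : Measurable fun x : Fin n → E => ∏ i, f i.succ (x i) := by fun_prop
    exact lintegral_prod_mul (hf 0).aemeasurable hm2.aemeasurable

theorem lintegral_fintype_prod {ι : Type*} [Fintype ι] {E : Type*} [MeasurableSpace E]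
    (μ : ι → Measure E) [∀ i, SigmaFinite (μ i)] (f : ι → E → ENNReal)
    (hf : ∀ i, Measurable (f i)) :
    ∫⁻ x : ι → E, ∏ i, f i (x i) ∂(Measure.pi μ) = ∏ i, ∫⁻ x, f i x ∂(μ i) := by
  let e := (Fintype.equivFin ι).symm
  have hm : Measurable fun x : ι → E => ∏ i, f i (x i) := by fun_prop
  rw [← (measurePreserving_piCongrLeft (fun i => μ i) e).lintegral_comp hm]
  simp_rw [← e.prod_comp, MeasurableEquiv.coe_piCongrLeft, Equiv.piCongrLeft_apply_apply]
  exact lintegral_fin_prod (fun i => μ (e i)) (fun i => f (e i)) fun i => hf (e i)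

theorem pi_withDensity {ι : Type*} [Fintype ι] {E : Type*} [MeasurableSpace E]
    (μ : Measure E) [SigmaFinite μ] (f : E → ENNReal)
    (hf : Measurable f) [SigmaFinite (μ.withDensity f)] :
    Measure.pi (fun _ : ι => μ.withDensity f)
      = (Measure.pi fun _ : ι => μ).withDensity fun x => ∏ i, f (x i) := by
  refine Measure.pi_eq fun s hs => ?_
  rw [withDensity_apply _ (MeasurableSet.univ_pi hs), ← lintegral_indicator (MeasurableSet.univ_pi hs)]
  have : ∀ x : ι → E, (Set.univ.pi s).indicator (fun x => ∏ i, f (x i)) x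
      = ∏ i, (s i).indicator f (x i) := by
    intro x
    by_cases hx : x ∈ Set.univ.pi s
    · rw [Set.indicator_of_mem hx]
      exact Finset.prod_congr rfl fun i _ => (Set.indicator_of_mem (hx i trivial) f).symm
    · rw [Set.indicator_of_notMem hx]
      obtain ⟨i, hi⟩ : ∃ i, x i ∉ s i := by simpa [Set.mem_pi] using hx
      exact (Finset.prod_eq_zero (Finset.mem_univ i) (Set.indicator_of_notMem hi f)).symm
  simp_rw [this]
  rw [lintegral_fintype_prod _ _ fun i => hf.indicator (hs i)]
  exact Finset.prod_congr rfl fun i _ => by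
    rw [lintegral_indicator (hs i), withDensity_apply _ (hs i)]

/-- The law of a tuple of independent matrices with independent standard Gaussian entries. -/
noncomputable def gam (m : ℕ) (ι κ : Type*) [Fintype ι] [Fintype κ] : Measure (Tup m ι κ) :=
  Measure.pi fun _ => Measure.pi fun _ => Measure.pi fun _ => gaussianReal 0 1

instance (m : ℕ) (ι κ : Type*) [Fintype ι] [Fintype κ] : IsProbabilityMeasure (gam m ι κ) := by
  unfold gam; infer_instance

/-- The standard Gaussian density on tuples of matrices. -/
noncomputable def gw {m : ℕ} {ι κ : Type*} [Fintype ι] [Fintype κ] (X : Tup m ι κ) : ENNReal :=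
  ∏ l, ∏ i, ∏ j, gaussianPDF 0 1 (X l i j)

section
variable {m : ℕ} {ι κ : Type*} [Fintype ι] [Fintype κ]

theorem measurable_gw : Measurable (gw : Tup m ι κ → ENNReal) := by
  unfold gw
  have := measurable_gaussianPDF 0 1
  fun_prop

theorem gam_eq_withDensity : gam m ι κ = (volume : Measure (Tup m ι κ)).withDensity gw := by
  have h1 := measurable_gaussianPDF 0 1
  have e1 : gaussianReal 0 1 = (volume : Measure ℝ).withDensity (gaussianPDF 0 1) :=
    gaussianReal_of_var_ne_zero _ one_ne_zero
  have e2 : Measure.pi (fun _ : κ => gaussianReal 0 1)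
      = (volume : Measure (κ → ℝ)).withDensity (fun x => ∏ j, gaussianPDF 0 1 (x j)) := by
    have : SigmaFinite ((volume : Measure ℝ).withDensity (gaussianPDF 0 1)) := by
      rw [← e1]; infer_instance
    rw [e1, pi_withDensity _ _ h1]; rfl
  have e3 : Measure.pi (fun _ : ι => Measure.pi (fun _ : κ => gaussianReal 0 1))
      = (volume : Measure (ι → κ → ℝ)).withDensity
        (fun x => ∏ i, ∏ j, gaussianPDF 0 1 (x i j)) := by
    have : SigmaFinite ((volume : Measure (κ → ℝ)).withDensity
        (fun x => ∏ j, gaussianPDF 0 1 (x j))) := by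
      rw [← e2]; infer_instance
    rw [e2, pi_withDensity _ _ (by fun_prop)]; rfl
  have : SigmaFinite ((volume : Measure (ι → κ → ℝ)).withDensity
        (fun x => ∏ i, ∏ j, gaussianPDF 0 1 (x i j))) := by
      rw [← e3]; infer_instance
  rw [gam, e3, pi_withDensity _ _ (by fun_prop)]; rfl

theorem lintegral_gam (f : Tup m ι κ → ENNReal) (hf : Measurable f) :
    ∫⁻ X, f X ∂gam m ι κ = ∫⁻ X, gw X * f X := by
  rw [gam_eq_withDensity, lintegral_withDensity_eq_lintegral_mul _ measurable_gw hf]; rfl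

theorem lintegral_gw : ∫⁻ X : Tup m ι κ, gw X = 1 := by
  have := lintegral_gam (m := m) (ι := ι) (κ := κ) (fun _ => 1) measurable_const
  simpa using this.symm

theorem ae_gam_of_ae {p : Tup m ι κ → Prop} (h : ∀ᵐ X, p X) : ∀ᵐ X ∂gam m ι κ, p X := by
  rw [gam_eq_withDensity]
  exact (withDensity_absolutelyContinuous _ _).ae_le h

/-- The sum of the squares of the entries. -/
def nsq {ι κ : Type*} [Fintype ι] [Fintype κ] (A : Matrix ι κ ℝ) : ℝ := ∑ i, ∑ j, A i j ^ 2

theorem nsq_eq_trace (A : Matrix ι κ ℝ) : nsq A = (Aᵀ * A).trace := by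
  rw [nsq, Finset.sum_comm, Matrix.trace]
  simp [Matrix.mul_apply, pow_two]

/-- The normalization of the Gaussian density. -/
noncomputable def gkk : ENNReal := ENNReal.ofReal (√(2 * Real.pi))⁻¹

theorem gw_eq (X : Tup m ι κ) : gw X = gkk ^ (m * Fintype.card ι * Fintype.card κ)
    * ENNReal.ofReal (Real.exp (-(∑ l, nsq (tm X l)) / 2)) := by
  have h : ∀ x : ℝ, gaussianPDF 0 1 x = gkk * ENNReal.ofReal (Real.exp (-x ^ 2 / 2)) := by
    intro x
    rw [gaussianPDF, gaussianPDFReal, gkk, ENNReal.ofReal_mul (by positivity)]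
    simp
  simp_rw [gw, h, Finset.prod_mul_distrib, Finset.prod_const, Finset.card_univ, ← pow_mul,
    Fintype.card_fin]
  congr 1
  · congr 1; ring
  · have h1 : ∀ l i, ∏ j, ENNReal.ofReal (Real.exp (-X l i j ^ 2 / 2))
      = ENNReal.ofReal (Real.exp (∑ j, -X l i j ^ 2 / 2)) := fun l i => by
      rw [Real.exp_sum, ENNReal.ofReal_prod_of_nonneg fun _ _ => (Real.exp_pos _).le]
    have h2 : ∀ l, ∏ i, ENNReal.ofReal (Real.exp (∑ j, -X l i j ^ 2 / 2))
      = ENNReal.ofReal (Real.exp (∑ i, ∑ j, -X l i j ^ 2 / 2)) := fun l => by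
      rw [Real.exp_sum, ENNReal.ofReal_prod_of_nonneg fun _ _ => (Real.exp_pos _).le]
    simp_rw [h1, h2]
    rw [← ENNReal.ofReal_prod_of_nonneg fun _ _ => (Real.exp_pos _).le, ← Real.exp_sum]
    simp_rw [nsq, neg_div, Finset.sum_neg_distrib, Finset.sum_div]
    rfl

end

section
variable {m : ℕ} {ι κ : Type*} [Fintype ι] [Fintype κ] [DecidableEq ι] [DecidableEq κ]

/-- The linear map `b ↦ (A_l b_l B_l)_l`. -/
noncomputable def sandLin (A : Fin m → Matrix ι ι ℝ) (B : Fin m → Matrix κ κ ℝ) :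
    Tup m ι κ →ₗ[ℝ] Tup m ι κ where
  toFun b := tf fun l => A l * tm b l * B l
  map_add' x y := by
    change tf _ = tf _
    congr 1
    funext l
    change A l * (tm x l + tm y l) * _ = _
    rw [Matrix.mul_add, Matrix.add_mul]
    rfl
  map_smul' c x := by
    change tf _ = tf _
    congr 1
    funext l
    change A l * (c • tm x l) * _ = _
    rw [Matrix.mul_smul, Matrix.smul_mul]
    rfl

theorem det_mul_mul (A : Matrix ι ι ℝ) (B : Matrix κ κ ℝ) (f : (ι → κ → ℝ) →ₗ[ℝ] (ι → κ → ℝ))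
    (hf : ∀ b, Matrix.of (f b) = A * Matrix.of b * B) :
    LinearMap.det f = A.det ^ Fintype.card κ * B.det ^ Fintype.card ι := by
  rw [← Matrix.det_transpose B, ← Matrix.det_kronecker, ← LinearMap.det_toLin',
    ← LinearMap.det_conj f (LinearEquiv.curry ℝ ℝ ι κ).symm]
  congr 1
  apply LinearMap.ext
  intro x
  obtain ⟨b, rfl⟩ := (LinearEquiv.curry ℝ ℝ ι κ).symm.surjective x
  ext ⟨i, j⟩
  have he : ∀ b i j, (LinearEquiv.curry ℝ ℝ ι κ).symm b (i, j) = b i j := fun _ _ _ => rfl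
  simp only [LinearMap.comp_apply, LinearEquiv.coe_coe, LinearEquiv.symm_apply_apply, he,
    Matrix.toLin'_apply, Matrix.mulVec, dotProduct, Fintype.sum_prod_type,
    Matrix.kroneckerMap_apply, Matrix.transpose_apply]
  change (Matrix.of (f b)) i j = _
  rw [hf]
  simp_rw [Matrix.mul_apply, Finset.sum_mul, Matrix.of_apply]
  rw [Finset.sum_comm]
  exact Finset.sum_congr rfl fun _ _ => Finset.sum_congr rfl fun _ _ => by ring

theorem det_sandLin (A : Fin m → Matrix ι ι ℝ) (B : Fin m → Matrix κ κ ℝ) :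
    LinearMap.det (sandLin A B)
      = ∏ l, ((A l).det ^ Fintype.card κ * (B l).det ^ Fintype.card ι) := by
  let f : Fin m → (ι → κ → ℝ) →ₗ[ℝ] (ι → κ → ℝ) := fun l =>
    { toFun := fun b => fun i j => (A l * Matrix.of b * B l) i j
      map_add' := fun x y => by
        ext i j
        change (A l * (Matrix.of x + Matrix.of y) * B l) i j = _
        rw [Matrix.mul_add, Matrix.add_mul]; rfl
      map_smul' := fun c x => by
        ext i j
        change (A l * (c • Matrix.of x) * B l) i j = _
        rw [Matrix.mul_smul, Matrix.smul_mul]; rfl }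
  have h : sandLin A B = LinearMap.pi fun l => (f l).comp (LinearMap.proj l) := rfl
  rw [h, LinearMap.det_pi]
  exact Finset.prod_congr rfl fun l _ => det_mul_mul _ _ _ fun b => rfl

theorem lintegral_comp_linear {E : Type*} [NormedAddCommGroup E] [NormedSpace ℝ E]
    [FiniteDimensional ℝ E] [MeasurableSpace E] [BorelSpace E] (μ : Measure E)
    [μ.IsAddHaarMeasure] (L : E →ₗ[ℝ] E) (hL : LinearMap.det L ≠ 0) (v : E) (f : E → ENNReal)
    (hf : Measurable f) :
    ∫⁻ x, f (L x + v) ∂μ = ENNReal.ofReal |(LinearMap.det L)⁻¹| * ∫⁻ x, f x ∂μ := by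
  have h1 := Measure.map_linearMap_addHaar_eq_smul_addHaar μ hL
  have h2 : ∫⁻ x, f (x + v) ∂(μ.map L) = ∫⁻ x, f (L x + v) ∂μ :=
    lintegral_map (hf.comp (measurable_add_const v)) L.continuous_of_finiteDimensional.measurable
  rw [← h2, h1, lintegral_smul_measure, lintegral_add_right_eq_self f v, smul_eq_mul]

end

end

section

open Matrix Polynomial

section
variable {ι κ : Type*} [Fintype ι] [Fintype κ] [DecidableEq ι] [DecidableEq κ]

theorem nsq_fromBlocks (a : Matrix ι ι ℝ) (b : Matrix ι κ ℝ) (c : Matrix κ ι ℝ)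
    (d : Matrix κ κ ℝ) : nsq (fromBlocks a b c d) = nsq a + nsq b + nsq c + nsq d := by
  simp only [nsq, Fintype.sum_sum_type, fromBlocks_apply₁₁, fromBlocks_apply₁₂,
    fromBlocks_apply₂₁, fromBlocks_apply₂₂, Finset.sum_add_distrib]
  ring

theorem nsq_eq_of_intertwine (X T U V : Matrix ι ι ℝ) (hU : Uᵀ * U = 1) (hV : Vᵀ * V = 1)
    (h : X * V = U * T) : nsq X = nsq T := by
  have hV' : V * Vᵀ = 1 := mul_eq_one_comm.1 hV
  have hX : X = U * T * Vᵀ := by rw [← h, Matrix.mul_assoc, hV', Matrix.mul_one]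
  rw [nsq_eq_trace, nsq_eq_trace, hX]
  have : (U * T * Vᵀ)ᵀ * (U * T * Vᵀ) = V * (Tᵀ * T * Vᵀ) := by
    rw [transpose_mul, transpose_mul, transpose_transpose]
    calc V * (Tᵀ * Uᵀ) * (U * T * Vᵀ) = V * (Tᵀ * (Uᵀ * U) * (T * Vᵀ)) := by
          simp only [Matrix.mul_assoc]
      _ = _ := by rw [hU, Matrix.mul_one]; simp only [Matrix.mul_assoc]
  rw [this, trace_mul_comm, Matrix.mul_assoc, hV, Matrix.mul_one]

open scoped MatrixOrder Matrix.Norms.L2Operator in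
theorem exists_graph_frame (Y : Matrix κ ι ℝ) : ∃ (R : Matrix ι ι ℝ) (C : Matrix κ κ ℝ),
    Rᵀ * R = 1 + Yᵀ * Y ∧ C * Cᵀ = 1 + Y * Yᵀ ∧ |R.det| = √(1 + Yᵀ * Y).det
      ∧ |C.det| = √(1 + Yᵀ * Y).det ∧ 0 < (1 + Yᵀ * Y).det := by
  have h1 : (1 + Yᵀ * Y).PosDef := by
    have := Matrix.PosSemidef.conjTranspose_mul_mul_same (Matrix.PosSemidef.one (R := ℝ) (n := κ)) Y
    rw [Matrix.mul_one, conjTranspose_eq_transpose_of_trivial] at this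
    exact Matrix.PosDef.one.add_posSemidef this
  have h2 : (1 + Y * Yᵀ).PosSemidef := by
    have := Matrix.PosSemidef.mul_mul_conjTranspose_same (Matrix.PosSemidef.one (R := ℝ) (n := ι)) Y
    rw [Matrix.mul_one, conjTranspose_eq_transpose_of_trivial] at this
    exact (Matrix.PosDef.one.add_posSemidef this).posSemidef
  obtain ⟨R, hR⟩ := CStarAlgebra.nonneg_iff_eq_star_mul_self.mp h1.posSemidef.nonneg
  obtain ⟨B, hB⟩ := CStarAlgebra.nonneg_iff_eq_star_mul_self.mp h2.nonneg
  rw [star_eq_conjTranspose, conjTranspose_eq_transpose_of_trivial] at hR hB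
  refine ⟨R, Bᵀ, hR.symm, by rw [transpose_transpose, hB], ?_, ?_, h1.det_pos⟩
  · rw [hR, det_mul, det_transpose, Real.sqrt_mul_self_eq_abs]
  · rw [Matrix.det_one_add_mul_comm, hB, det_mul, det_transpose, Real.sqrt_mul_self_eq_abs]

/-- The orthogonal matrix whose first columns span the graph of `Y`. -/
theorem graph_frame_orthogonal (Y : Matrix κ ι ℝ) (R A : Matrix ι ι ℝ) (C D : Matrix κ κ ℝ)
    (hR : Rᵀ * R = 1 + Yᵀ * Y) (hC : C * Cᵀ = 1 + Y * Yᵀ) (hRA : R * A = 1) (hDC : D * C = 1) :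
    (fromBlocks A (-(Yᵀ * Dᵀ)) (Y * A) Dᵀ)ᵀ * fromBlocks A (-(Yᵀ * Dᵀ)) (Y * A) Dᵀ = 1 := by
  have hA : Aᵀ * (1 + Yᵀ * Y) * A = 1 := by
    rw [← hR, ← Matrix.mul_assoc, ← transpose_mul, hRA, transpose_one, Matrix.one_mul, hRA]
  have hD : D * (1 + Y * Yᵀ) * Dᵀ = 1 := by
    rw [← hC, ← Matrix.mul_assoc, hDC, Matrix.one_mul, ← transpose_mul, hDC, transpose_one]
  rw [fromBlocks_transpose, fromBlocks_multiply, ← fromBlocks_one]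
  simp only [transpose_mul, transpose_neg, transpose_transpose]
  congr 1
  · rw [← hA]; simp only [Matrix.mul_add, Matrix.add_mul, Matrix.mul_one, Matrix.mul_assoc]
  · simp [Matrix.mul_assoc]
  · simp [Matrix.mul_assoc]
  · rw [← hD]
    simp only [Matrix.mul_add, Matrix.add_mul, Matrix.mul_one, Matrix.mul_assoc, Matrix.neg_mul,
      Matrix.mul_neg, neg_neg]
    abel

theorem nsq_block_graph (Y Y' : Matrix κ ι ℝ) (R R' A A' : Matrix ι ι ℝ) (C C' D D' : Matrix κ κ ℝ)
    (hR : Rᵀ * R = 1 + Yᵀ * Y) (hC : C * Cᵀ = 1 + Y * Yᵀ) (hRA : R * A = 1) (hDC : D * C = 1)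
    (hR' : R'ᵀ * R' = 1 + Y'ᵀ * Y') (hC' : C' * C'ᵀ = 1 + Y' * Y'ᵀ) (hRA' : R' * A' = 1)
    (hDC' : D' * C' = 1) (p : Matrix ι ι ℝ) (b : Matrix ι κ ℝ) (Q : Matrix κ κ ℝ) :
    nsq (p - b * Y') + nsq b + nsq (Y * p - Q * Y' - Y * b * Y') + nsq (Q + Y * b)
      = nsq (R * p * A') + nsq (R * b * C' + (Aᵀ * Yᵀ * Q * C' - R * p * Y'ᵀ * D'ᵀ))
        + nsq (D * Q * C') := by
  have hAR : A * R = 1 := mul_eq_one_comm.1 hRA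
  have hCD : C * D = 1 := mul_eq_one_comm.1 hDC
  have e0 : nsq (0 : Matrix κ ι ℝ) = 0 := by simp [nsq]
  have e1 := nsq_fromBlocks (p - b * Y') b (Y * p - Q * Y' - Y * b * Y') (Q + Y * b)
  have e2 := nsq_fromBlocks (R * p * A')
    (R * b * C' + (Aᵀ * Yᵀ * Q * C' - R * p * Y'ᵀ * D'ᵀ)) 0 (D * Q * C')
  rw [e0, add_zero] at e2
  rw [← e1, ← e2]
  have hG1 : A * Aᵀ * (1 + Yᵀ * Y) = 1 := by
    rw [← hR, Matrix.mul_assoc, ← Matrix.mul_assoc Aᵀ, ← transpose_mul, hRA, transpose_one,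
      Matrix.one_mul, hAR]
  have hG2 : (1 + Y * Yᵀ) * (Dᵀ * D) = 1 := by
    rw [← hC, Matrix.mul_assoc, ← Matrix.mul_assoc Cᵀ, ← transpose_mul, hDC, transpose_one,
      Matrix.one_mul, hCD]
  have hpush : A * Aᵀ * Yᵀ = Yᵀ * (Dᵀ * D) := by
    calc A * Aᵀ * Yᵀ = A * Aᵀ * (Yᵀ * ((1 + Y * Yᵀ) * (Dᵀ * D))) := by rw [hG2, Matrix.mul_one]
      _ = A * Aᵀ * (1 + Yᵀ * Y) * (Yᵀ * (Dᵀ * D)) := by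
        simp only [Matrix.mul_add, Matrix.add_mul, Matrix.mul_one, Matrix.one_mul, Matrix.mul_assoc]
      _ = _ := by rw [hG1, Matrix.one_mul]
  have hsum : Y * (A * Aᵀ * Yᵀ) + Dᵀ * D = 1 := by
    rw [hpush, ← Matrix.mul_assoc, ← hG2, Matrix.add_mul, Matrix.one_mul, add_comm]
  have hcol : (1 + Y' * Y'ᵀ) * D'ᵀ = C' := by
    rw [← hC', Matrix.mul_assoc, ← transpose_mul, hDC', transpose_one, Matrix.mul_one]
  refine nsq_eq_of_intertwine _ _ _ _ (graph_frame_orthogonal Y R A C D hR hC hRA hDC)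
    (graph_frame_orthogonal Y' R' A' C' D' hR' hC' hRA' hDC') ?_
  rw [fromBlocks_multiply, fromBlocks_multiply]
  congr 1
  · simp only [Matrix.mul_zero, add_zero, ← Matrix.mul_assoc, hAR, Matrix.one_mul, Matrix.sub_mul]
    abel
  · have h1 : A * (Aᵀ * Yᵀ * Q * C') = Yᵀ * Dᵀ * (D * Q * C') := by
      have := congrArg (· * (Q * C')) hpush
      simpa only [Matrix.mul_assoc] using this
    have h2 : b * C' = b * D'ᵀ + b * Y' * Y'ᵀ * D'ᵀ := by
      conv_lhs => rw [← hcol]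
      simp only [Matrix.mul_add, Matrix.add_mul, Matrix.one_mul, Matrix.mul_assoc]
    rw [Matrix.mul_add, Matrix.mul_sub, h1]
    have h3 : A * (R * b * C') = b * C' := by
      rw [Matrix.mul_assoc R, ← Matrix.mul_assoc A, hAR, Matrix.one_mul]
    have h4 : A * (R * p * Y'ᵀ * D'ᵀ) = p * Y'ᵀ * D'ᵀ := by
      simp only [← Matrix.mul_assoc, hAR, Matrix.one_mul]
    rw [h3, h4, h2]
    simp only [Matrix.sub_mul, Matrix.mul_neg, Matrix.neg_mul, ← Matrix.mul_assoc]
    abel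
  · simp only [Matrix.mul_zero, add_zero, ← Matrix.mul_assoc, Matrix.sub_mul, Matrix.add_mul]
    have h4 : Y * A * R * p * A' = Y * p * A' := by
      rw [Matrix.mul_assoc Y A R, hAR, Matrix.mul_one]
    rw [h4]
    abel
  · have h1 : Y * A * (Aᵀ * Yᵀ * Q * C') + Dᵀ * (D * Q * C') = Q * C' := by
      have := congrArg (· * (Q * C')) hsum
      simpa only [Matrix.mul_assoc, Matrix.add_mul, Matrix.one_mul] using this
    have h2 : ∀ e : Matrix ι κ ℝ, e * C' = e * D'ᵀ + e * Y' * Y'ᵀ * D'ᵀ := by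
      intro e
      conv_lhs => rw [← hcol]
      simp only [Matrix.mul_add, Matrix.add_mul, Matrix.one_mul, Matrix.mul_assoc]
    have h2' : Q * C' = Q * D'ᵀ + Q * Y' * Y'ᵀ * D'ᵀ := by
      conv_lhs => rw [← hcol]
      simp only [Matrix.mul_add, Matrix.add_mul, Matrix.one_mul, Matrix.mul_assoc]
    have h3 : Y * A * (R * b * C') = Y * (b * C') := by
      rw [Matrix.mul_assoc R, Matrix.mul_assoc Y, ← Matrix.mul_assoc A, hAR, Matrix.one_mul]
    have h4 : Y * A * (R * p * Y'ᵀ * D'ᵀ) = Y * p * Y'ᵀ * D'ᵀ := by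
      simp only [← Matrix.mul_assoc]
      rw [Matrix.mul_assoc Y A R, hAR, Matrix.mul_one]
    rw [Matrix.mul_add, Matrix.mul_sub, h3, h4]
    calc _ = Y * (b * C') - Y * p * Y'ᵀ * D'ᵀ + Q * C' := by
          rw [h2, h2']
          simp only [Matrix.sub_mul, Matrix.mul_neg, ← Matrix.mul_assoc,
            Matrix.add_mul, Matrix.mul_add]
          abel
      _ = _ := by rw [← h1]; abel

end

theorem lintegral_triple_shear {E F G : Type*}
    [AddCommGroup E] [MeasurableSpace E] [MeasurableAdd₂ E] [MeasureSpace F]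
    [AddCommGroup G] [MeasurableSpace G] [MeasurableAdd₂ G]
    (μ : Measure E) [SigmaFinite μ] [μ.IsAddRightInvariant]
    [SigmaFinite (volume : Measure F)]
    (ρ : Measure G) [SigmaFinite ρ] [ρ.IsAddRightInvariant]
    (u : F → E) (hu : Measurable u) (v : F → G) (hv : Measurable v)
    (g : E × F × G → ENNReal) (hg : Measurable g) :
    ∫⁻ x : E × F × G, g (x.1 + u x.2.1, x.2.1, x.2.2 + v x.2.1) ∂(μ.prod (volume.prod ρ))
      = ∫⁻ p, ∫⁻ Q, ∫⁻ b, g (p, b, Q) ∂volume ∂ρ ∂μ := by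
  have hm : Measurable fun x : E × F × G => g (x.1 + u x.2.1, x.2.1, x.2.2 + v x.2.1) := by
    fun_prop
  rw [lintegral_prod_symm _ hm.aemeasurable]
  have h1 : ∀ y : F × G, ∫⁻ a, g (a + u y.1, y.1, y.2 + v y.1) ∂μ
      = ∫⁻ p, g (p, y.1, y.2 + v y.1) ∂μ := fun y =>
    lintegral_add_right_eq_self (fun p => g (p, y.1, y.2 + v y.1)) (u y.1)
  simp_rw [h1]
  have hm2 : Measurable fun y : F × G => ∫⁻ p, g (p, y.1, y.2 + v y.1) ∂μ := by
    refine Measurable.lintegral_prod_right' (f := fun z : (F × G) × E =>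
      g (z.2, z.1.1, z.1.2 + v z.1.1)) ?_
    fun_prop
  rw [lintegral_prod _ hm2.aemeasurable]
  have h2 : ∀ b : F, ∫⁻ d, ∫⁻ p, g (p, b, d + v b) ∂μ ∂ρ = ∫⁻ Q, ∫⁻ p, g (p, b, Q) ∂μ ∂ρ :=
    fun b => lintegral_add_right_eq_self (fun Q => ∫⁻ p, g (p, b, Q) ∂μ) (v b)
  simp_rw [h2]
  have hm3 : Measurable fun y : F × G => ∫⁻ p, g (p, y.1, y.2) ∂μ := by
    refine Measurable.lintegral_prod_right' (f := fun z : (F × G) × E =>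
      g (z.2, z.1.1, z.1.2)) ?_
    fun_prop
  rw [lintegral_lintegral_swap hm3.aemeasurable]
  have h3 : ∀ Q : G, ∫⁻ b, ∫⁻ p, g (p, b, Q) ∂μ = ∫⁻ p, ∫⁻ b, g (p, b, Q) ∂volume ∂μ := by
    intro Q
    refine lintegral_lintegral_swap (Measurable.aemeasurable ?_)
    change Measurable fun z : F × E => g (z.2, z.1, Q)
    fun_prop
  simp_rw [h3]
  refine lintegral_lintegral_swap (Measurable.aemeasurable ?_)
  refine Measurable.lintegral_prod_right' (f := fun z : (G × E) × F =>
      g (z.1.2, z.2, z.1.1)) ?_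
  fun_prop

section
variable {ι κ : Type*} [Fintype ι] [Fintype κ] [DecidableEq ι] [DecidableEq κ] {m : ℕ} [NeZero m]

theorem tchi_sandLin (R A : Fin m → Matrix ι ι ℝ) (h : ∀ l, R l * A l = 1) (p : Tup m ι ι) :
    tchi (sandLin R (fun l => A (l + 1)) p) = tchi p := by
  refine charpoly_eq_of_intertwine _ _ (R 0) (IsUnit.of_mul_eq_one _ (h 0)) ?_
  refine prod_ofFn_intertwine_cyclic _ _ R fun l => ?_
  change R l * tm p l * A (l + 1) * R (l + 1) = R l * tm p l
  rw [Matrix.mul_assoc, mul_eq_one_comm.1 (h (l + 1)), Matrix.mul_one]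

theorem prod_comp_add_one {M : Type*} [CommMonoid M] (f : Fin m → M) :
    ∏ l, f (l + 1) = ∏ l, f l := Equiv.prod_comp (Equiv.addRight 1) f

theorem abs_det_sandLin_conj (R A : Fin m → Matrix ι ι ℝ) (h : ∀ l, R l * A l = 1) :
    |LinearMap.det (sandLin R (fun l => A (l + 1)))| = 1 := by
  rw [det_sandLin, Finset.prod_mul_distrib,
    prod_comp_add_one (fun l => (A l).det ^ Fintype.card ι), ← Finset.prod_mul_distrib]
  rw [Finset.prod_eq_one, abs_one]
  intro l _
  rw [← mul_pow, ← det_mul, h, det_one, one_pow]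

theorem lintegral_comp_sandLin_conj (R A : Fin m → Matrix ι ι ℝ) (h : ∀ l, R l * A l = 1)
    (f : Tup m ι ι → ENNReal) (hf : Measurable f) :
    ∫⁻ p, f (sandLin R (fun l => A (l + 1)) p) = ∫⁻ p, f p := by
  have h1 := abs_det_sandLin_conj R A h
  have := lintegral_comp_linear volume (sandLin R (fun l => A (l + 1)))
    (by rw [← abs_pos, h1]; norm_num) 0 f hf
  simpa [abs_inv, h1] using this

/-- The Gaussian weight of the blocks. -/
noncomputable def blkW (z : RicDom m ι κ) : ENNReal :=
  gw z.1.1 * gw z.1.2.1 * gw z.1.2.2 * gw z.2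

theorem measurable_blkW : Measurable (blkW : RicDom m ι κ → ENNReal) := by
  unfold blkW
  have h1 := measurable_gw (m := m) (ι := ι) (κ := ι)
  have h2 := measurable_gw (m := m) (ι := ι) (κ := κ)
  have h3 := measurable_gw (m := m) (ι := κ) (κ := ι)
  have h4 := measurable_gw (m := m) (ι := κ) (κ := κ)
  exact (((h1.comp (measurable_fst.comp measurable_fst)).mul
    (h2.comp (measurable_fst.comp (measurable_snd.comp measurable_fst)))).mul
    (h4.comp (measurable_snd.comp (measurable_snd.comp measurable_fst)))).mul
    (h3.comp measurable_snd)

/-- The Jacobian weight of a graph. -/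
noncomputable def graphJ (Y : Tup m κ ι) : ENNReal :=
  ENNReal.ofReal (∏ l, (√(1 + (tm Y l)ᵀ * tm Y l).det ^ (Fintype.card ι + Fintype.card κ))⁻¹)

/-- The blocks in terms of the actions on the graph and on the quotient. -/
def unRic (Y : Tup m κ ι) (z : Tup m ι ι × Tup m ι κ × Tup m κ κ) : RicDom m ι κ :=
  ((tf fun l => tm z.1 l - tm z.2.1 l * tm Y (l + 1), z.2.1,
    tf fun l => tm z.2.2 l + tm Y l * tm z.2.1 l),
    tf fun l => tm Y l * tm z.1 l - tm z.2.2 l * tm Y (l + 1) - tm Y l * tm z.2.1 l * tm Y (l + 1))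

theorem continuous_unRic (Y : Tup m κ ι) : Continuous (unRic Y) := by
  unfold unRic tf tm
  simp only [Matrix.sub_apply, Matrix.add_apply, Matrix.mul_apply, Matrix.of_apply]
  fun_prop

theorem ricMap_eq_unRic (Y : Tup m κ ι) (x : Tup m ι ι × Tup m ι κ × Tup m κ κ) :
    ricMap (x, Y) = unRic Y (ricPT (x, Y), x.2.1, ricQT (x, Y)) := by
  obtain ⟨a, b, d⟩ := x
  refine Prod.ext (Prod.ext ?_ (Prod.ext rfl ?_)) ?_
  · change tf (tm a) = tf _
    congr 1
    funext l
    change _ = tm a l + tm b l * tm Y (l + 1) - _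
    rw [add_sub_cancel_right]
  · change tf (tm d) = tf _
    congr 1
    funext l
    change _ = tm d l - tm Y l * tm b l + _
    rw [sub_add_cancel]
  · change tf _ = tf _
    congr 1
    funext l
    change tm Y l * tm a l + tm Y l * tm b l * tm Y (l + 1) - tm d l * tm Y (l + 1)
      = tm Y l * (tm a l + tm b l * tm Y (l + 1)) - (tm d l - tm Y l * tm b l) * tm Y (l + 1)
        - tm Y l * tm b l * tm Y (l + 1)
    simp only [Matrix.mul_add, Matrix.sub_mul, Matrix.mul_assoc]
    abel

/-- In an adapted orthonormal frame the Gaussian weight factorizes. -/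
theorem blkW_unRic (Y : Tup m κ ι) (R A : Fin m → Matrix ι ι ℝ) (C D : Fin m → Matrix κ κ ℝ)
    (hR : ∀ l, (R l)ᵀ * R l = 1 + (tm Y l)ᵀ * tm Y l)
    (hC : ∀ l, C l * (C l)ᵀ = 1 + tm Y l * (tm Y l)ᵀ) (hRA : ∀ l, R l * A l = 1)
    (hDC : ∀ l, D l * C l = 1) (p : Tup m ι ι) (b : Tup m ι κ) (Q : Tup m κ κ) :
    blkW (unRic Y (p, b, Q)) = gkk ^ (m * Fintype.card κ * Fintype.card ι)
      * (gw (sandLin R (fun l => A (l + 1)) p)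
      * gw (sandLin D (fun l => C (l + 1)) Q)
      * gw (sandLin R (fun l => C (l + 1)) b + tf (fun l => (A l)ᵀ * (tm Y l)ᵀ * tm Q l * C (l + 1)
        - R l * tm p l * (tm Y (l + 1))ᵀ * (D (l + 1))ᵀ))) := by
  have key := fun l => nsq_block_graph (tm Y l) (tm Y (l + 1)) (R l) (R (l + 1)) (A l) (A (l + 1))
    (C l) (C (l + 1)) (D l) (D (l + 1)) (hR l) (hC l) (hRA l) (hDC l) (hR _) (hC _) (hRA _) (hDC _)
    (tm p l) (tm b l) (tm Q l)
  have hsum := Finset.sum_congr (rfl : (Finset.univ : Finset (Fin m)) = _) fun l _ => key l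
  simp only [Finset.sum_add_distrib] at hsum
  have hexp : ∀ x y : ℝ, ENNReal.ofReal (Real.exp x) * ENNReal.ofReal (Real.exp y)
      = ENNReal.ofReal (Real.exp (x + y)) := fun x y => by
    rw [Real.exp_add, ENNReal.ofReal_mul (Real.exp_pos _).le]
  rw [blkW]
  simp only [gw_eq]
  have e : ∀ (k1 k2 k3 k4 e1 e2 e3 e4 : ENNReal),
      k1 * e1 * (k2 * e2) * (k3 * e3) * (k4 * e4) = k4 * (k1 * k3 * k2 * (e1 * e2 * e4 * e3)) :=
    fun _ _ _ _ _ _ _ _ => by ring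
  have e' : ∀ (k1 k2 k3 k4 e1 e2 e3 : ENNReal),
      k4 * (k1 * e1 * (k3 * e3) * (k2 * e2)) = k4 * (k1 * k3 * k2 * (e1 * e2 * e3)) :=
    fun _ _ _ _ _ _ _ => by ring
  rw [e, e']
  congr 2
  simp only [hexp]
  congr 2
  rw [← add_div, ← add_div, ← add_div, ← add_div, ← add_div, ← neg_add, ← neg_add, ← neg_add,
    ← neg_add, ← neg_add]
  congr 2

end

section
variable {ι κ : Type*} [Fintype ι] [Fintype κ] [DecidableEq ι] [DecidableEq κ] {m : ℕ} [NeZero m]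

theorem lintegral_gw_sandLin_add (Y : Tup m κ ι) (R : Fin m → Matrix ι ι ℝ)
    (C : Fin m → Matrix κ κ ℝ) (hR : ∀ l, |(R l).det| = √(1 + (tm Y l)ᵀ * tm Y l).det)
    (hC : ∀ l, |(C l).det| = √(1 + (tm Y l)ᵀ * tm Y l).det)
    (hpos : ∀ l, 0 < (1 + (tm Y l)ᵀ * tm Y l).det) (v : Tup m ι κ) :
    ∫⁻ b, gw (sandLin R (fun l => C (l + 1)) b + v) = graphJ Y := by
  have hd : |LinearMap.det (sandLin R (fun l => C (l + 1)))|
      = ∏ l, √(1 + (tm Y l)ᵀ * tm Y l).det ^ (Fintype.card ι + Fintype.card κ) := by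
    rw [det_sandLin, Finset.prod_mul_distrib,
      prod_comp_add_one (fun l => (C l).det ^ Fintype.card ι), ← Finset.prod_mul_distrib,
      Finset.abs_prod]
    refine Finset.prod_congr rfl fun l _ => ?_
    rw [abs_mul, abs_pow, abs_pow, hR, hC]; ring
  have h0 : LinearMap.det (sandLin R (fun l => C (l + 1))) ≠ 0 := by
    rw [← abs_pos, hd]
    exact Finset.prod_pos fun l _ => pow_pos (Real.sqrt_pos.2 (hpos l)) _
  rw [lintegral_comp_linear volume _ h0 v gw measurable_gw, lintegral_gw, mul_one, abs_inv, hd,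
    graphJ, Finset.prod_inv_distrib]

theorem measurable_of_tchi_pair (Φ : ℝ[X] → ℝ[X] → ENNReal)
    (hΦ : Measurable fun z : Tup m ι ι × Tup m κ κ => Φ (tchi z.1) (tchi z.2)) (p : Tup m ι ι) :
    Measurable fun Q : Tup m κ κ => Φ (tchi p) (tchi Q) :=
  Measurable.of_uncurry_left (f := fun (p : Tup m ι ι) (Q : Tup m κ κ) => Φ (tchi p) (tchi Q)) hΦ

/-- Integration over all blocks having a given invariant graph. -/
theorem lintegral_blocks_of_graph (Y : Tup m κ ι) (Φ : ℝ[X] → ℝ[X] → ENNReal)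
    (hΦ : Measurable fun z : Tup m ι ι × Tup m κ κ => Φ (tchi z.1) (tchi z.2)) :
    ∫⁻ x : Tup m ι ι × Tup m ι κ × Tup m κ κ,
        Φ (tchi (ricPT (x, Y))) (tchi (ricQT (x, Y))) * blkW (ricMap (x, Y))
      = graphJ Y * (gkk ^ (m * Fintype.card κ * Fintype.card ι)
        * ∫⁻ p, ∫⁻ Q, Φ (tchi p) (tchi Q) ∂gam m κ κ ∂gam m ι ι) := by
  set g : Tup m ι ι × Tup m ι κ × Tup m κ κ → ENNReal := fun z =>
    Φ (tchi z.1) (tchi z.2.2) * blkW (unRic Y z) with hg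
  have hgm : Measurable g :=
    (hΦ.comp (measurable_fst.prodMk (measurable_snd.comp measurable_snd))).mul
      (measurable_blkW.comp (continuous_unRic Y).measurable)
  have hu : Measurable fun b : Tup m ι κ => (tf fun l => tm b l * tm Y (l + 1) : Tup m ι ι) := by
    have : Continuous fun b : Tup m ι κ => (tf fun l => tm b l * tm Y (l + 1) : Tup m ι ι) := by
      unfold tf tm
      simp only [Matrix.mul_apply, Matrix.of_apply]
      fun_prop
    exact this.measurable
  have hv : Measurable fun b : Tup m ι κ => (tf fun l => - (tm Y l * tm b l) : Tup m κ κ) := by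
    have : Continuous fun b : Tup m ι κ => (tf fun l => - (tm Y l * tm b l) : Tup m κ κ) := by
      unfold tf tm
      simp only [Matrix.neg_apply, Matrix.mul_apply, Matrix.of_apply]
      fun_prop
    exact this.measurable
  have h1 := lintegral_triple_shear (volume : Measure (Tup m ι ι)) (volume : Measure (Tup m κ κ))
    _ hu _ hv g hgm
  have h2 : ∀ x : Tup m ι ι × Tup m ι κ × Tup m κ κ,
      Φ (tchi (ricPT (x, Y))) (tchi (ricQT (x, Y))) * blkW (ricMap (x, Y))
      = g (x.1 + (tf fun l => tm x.2.1 l * tm Y (l + 1)), x.2.1,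
        x.2.2 + (tf fun l => - (tm Y l * tm x.2.1 l))) := by
    intro x
    have e : (x.2.2 + (tf fun l => - (tm Y l * tm x.2.1 l)) : Tup m κ κ) = ricQT (x, Y) := by
      funext l i j
      change x.2.2 l i j + -(tm Y l * tm x.2.1 l) i j = x.2.2 l i j - _
      rw [← sub_eq_add_neg]
    rw [e, ricMap_eq_unRic]
    rfl
  rw [lintegral_congr h2]
  refine h1.trans ?_
  choose R C hR hC hRd hCd hpos using fun l => exists_graph_frame (tm Y l)
  have hRu : ∀ l, IsUnit (R l) := fun l => by
    rw [Matrix.isUnit_iff_isUnit_det, isUnit_iff_ne_zero, ← abs_pos, hRd]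
    exact Real.sqrt_pos.2 (hpos l)
  have hCu : ∀ l, IsUnit (C l) := fun l => by
    rw [Matrix.isUnit_iff_isUnit_det, isUnit_iff_ne_zero, ← abs_pos, hCd]
    exact Real.sqrt_pos.2 (hpos l)
  have hRA : ∀ l, R l * (R l)⁻¹ = 1 := fun l =>
    Matrix.mul_nonsing_inv _ ((Matrix.isUnit_iff_isUnit_det _).1 (hRu l))
  have hDC : ∀ l, (C l)⁻¹ * C l = 1 := fun l =>
    Matrix.nonsing_inv_mul _ ((Matrix.isUnit_iff_isUnit_det _).1 (hCu l))
  set sp := (sandLin R (fun l => (R (l + 1))⁻¹) : Tup m ι ι →ₗ[ℝ] _) with hsp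
  set sq := (sandLin (fun l => (C l)⁻¹) (fun l => C (l + 1)) : Tup m κ κ →ₗ[ℝ] _) with hsq
  set K := gkk ^ (m * Fintype.card κ * Fintype.card ι) with hK
  have hKtop : K ≠ ⊤ := ENNReal.pow_ne_top ENNReal.ofReal_ne_top
  have hJtop : graphJ Y ≠ ⊤ := ENNReal.ofReal_ne_top
  have h3 : ∀ p Q, ∫⁻ b, g (p, b, Q)
      = graphJ Y * K * (gw (sp p) * (gw (sq Q) * Φ (tchi (sp p)) (tchi (sq Q)))) := by
    intro p Q
    have hm1 : Measurable fun b : Tup m ι κ => gw (sandLin R (fun l => C (l + 1)) b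
        + tf (fun l => ((R l)⁻¹)ᵀ * (tm Y l)ᵀ * tm Q l * C (l + 1)
        - R l * tm p l * (tm Y (l + 1))ᵀ * ((C (l + 1))⁻¹)ᵀ)) :=
      measurable_gw.comp (((sandLin R (fun l => C (l + 1))).continuous_of_finiteDimensional.measurable).add_const _)
    calc ∫⁻ b, g (p, b, Q) = ∫⁻ b, (Φ (tchi p) (tchi Q) * K * (gw (sp p) * gw (sq Q)))
          * gw (sandLin R (fun l => C (l + 1)) b
          + tf (fun l => ((R l)⁻¹)ᵀ * (tm Y l)ᵀ * tm Q l * C (l + 1)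
          - R l * tm p l * (tm Y (l + 1))ᵀ * ((C (l + 1))⁻¹)ᵀ)) := by
          refine lintegral_congr fun b => ?_
          change Φ (tchi p) (tchi Q) * blkW (unRic Y (p, b, Q)) = _
          rw [blkW_unRic Y R (fun l => (R l)⁻¹) C (fun l => (C l)⁻¹) hR hC hRA hDC]
          ring
      _ = _ := by
        rw [lintegral_const_mul _ hm1, lintegral_gw_sandLin_add Y R C hRd hCd hpos]
        rw [hsp, tchi_sandLin R (fun l => (R l)⁻¹) hRA, hsq,
          tchi_sandLin (fun l => (C l)⁻¹) C hDC]
        ring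
  simp_rw [h3]
  have h4 : ∀ p, ∫⁻ Q, graphJ Y * K * (gw (sp p) * (gw (sq Q) * Φ (tchi (sp p)) (tchi (sq Q))))
      = graphJ Y * K * (gw (sp p) * ∫⁻ Q, Φ (tchi (sp p)) (tchi Q) ∂gam m κ κ) := by
    intro p
    have hmQ := measurable_of_tchi_pair Φ hΦ (sp p)
    have hmQ' : Measurable fun Q : Tup m κ κ => gw Q * Φ (tchi (sp p)) (tchi Q) :=
      measurable_gw.mul hmQ
    have hsqm : Measurable sq := sq.continuous_of_finiteDimensional.measurable
    have hmQ'' : Measurable fun Q => gw (sq Q) * Φ (tchi (sp p)) (tchi (sq Q)) := hmQ'.comp hsqm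
    rw [lintegral_const_mul _ (hmQ''.const_mul _), lintegral_const_mul _ hmQ'',
      lintegral_comp_sandLin_conj (fun l => (C l)⁻¹) C hDC _ hmQ', lintegral_gam _ hmQ]
  simp_rw [h4]
  have hmp : Measurable fun p : Tup m ι ι => ∫⁻ Q, Φ (tchi p) (tchi Q) ∂gam m κ κ :=
    hΦ.lintegral_prod_right'
  have hmp' : Measurable fun p : Tup m ι ι => gw p * ∫⁻ Q, Φ (tchi p) (tchi Q) ∂gam m κ κ :=
    measurable_gw.mul hmp
  have hspm : Measurable sp := sp.continuous_of_finiteDimensional.measurable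
  have hmp'' : Measurable fun p => gw (sp p) * ∫⁻ Q, Φ (tchi (sp p)) (tchi Q) ∂gam m κ κ :=
    hmp'.comp hspm
  rw [lintegral_const_mul _ hmp'',
    lintegral_comp_sandLin_conj R (fun l => (R l)⁻¹) hRA _ hmp', lintegral_gam _ hmp, mul_assoc]

end

theorem measurePreserving_of_lintegral_eq_one {E F : Type*} [NormedAddCommGroup E]
    [NormedSpace ℝ E] [FiniteDimensional ℝ E] [MeasurableSpace E] [BorelSpace E]
    [NormedAddCommGroup F] [NormedSpace ℝ F] [FiniteDimensional ℝ F] [MeasurableSpace F]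
    [BorelSpace F] (μ : Measure E) [μ.IsAddHaarMeasure] (ν : Measure F) [ν.IsAddHaarMeasure]
    (L : E ≃ₗ[ℝ] F) (g : F → ENNReal) (hg : Measurable g) (h1 : ∫⁻ x, g (L x) ∂μ = 1)
    (h2 : ∫⁻ y, g y ∂ν = 1) : MeasurePreserving L μ ν := by
  have hL : Measurable L := L.toContinuousLinearEquiv.continuous.measurable
  have : (μ.map L).IsAddHaarMeasure := L.toContinuousLinearEquiv.isAddHaarMeasure_map μ
  have h := Measure.isAddLeftInvariant_eq_smul (μ.map L) ν
  refine ⟨hL, ?_⟩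
  have h3 := lintegral_map (μ := μ) hg hL
  rw [h1, h, lintegral_smul_measure, h2] at h3
  have h4 : (Measure.addHaarScalarFactor (μ.map L) ν) = 1 := by
    have : ((Measure.addHaarScalarFactor (μ.map L) ν : NNReal) : ENNReal) = 1 := by
      simpa [ENNReal.smul_def] using h3
    exact_mod_cast this
  rw [h, h4, one_smul]

section
variable {ι κ : Type*} [Fintype ι] [Fintype κ] [DecidableEq ι] [DecidableEq κ] {m : ℕ} [NeZero m]

/-- Splitting into blocks as a linear equivalence. -/
def toBlkEquiv : Tup m (ι ⊕ κ) (ι ⊕ κ) ≃ₗ[ℝ] RicDom m ι κ where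
  toFun := toBlk
  map_add' _ _ := rfl
  map_smul' _ _ := rfl
  invFun z := tf fun l => fromBlocks (tm z.1.1 l) (tm z.1.2.1 l) (tm z.2 l) (tm z.1.2.2 l)
  left_inv X := by
    funext l i j
    rcases i with i | i <;> rcases j with j | j <;> rfl
  right_inv z := rfl

theorem gw_eq_blkW (X : Tup m (ι ⊕ κ) (ι ⊕ κ)) : gw X = blkW (toBlk X) := by
  simp only [gw, blkW, toBlk, Fintype.prod_sum_type, Finset.prod_mul_distrib]
  ring

theorem lintegral_blkW : ∫⁻ z : RicDom m ι κ, blkW z = 1 := by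
  have a1 : ∫⁻ z : Tup m ι κ × Tup m κ κ, gw z.1 * gw z.2 = 1 := by
    refine (lintegral_prod_mul (μ := volume) (ν := volume) measurable_gw.aemeasurable
      measurable_gw.aemeasurable).trans ?_
    rw [lintegral_gw, lintegral_gw, one_mul]
  have m1 : Measurable fun z : Tup m ι κ × Tup m κ κ => gw z.1 * gw z.2 :=
    (measurable_gw.comp measurable_fst).mul (measurable_gw.comp measurable_snd)
  have a2 : ∫⁻ z : Tup m ι ι × Tup m ι κ × Tup m κ κ, gw z.1 * (gw z.2.1 * gw z.2.2) = 1 := by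
    refine (lintegral_prod_mul (μ := volume) (ν := volume)
      (measurable_gw (m := m) (ι := ι) (κ := ι)).aemeasurable m1.aemeasurable).trans ?_
    change (∫⁻ x : Tup m ι ι, gw x) * (∫⁻ z : Tup m ι κ × Tup m κ κ, gw z.1 * gw z.2) = 1
    rw [a1, lintegral_gw, one_mul]
  have m2 : Measurable fun z : Tup m ι ι × Tup m ι κ × Tup m κ κ =>
      gw z.1 * (gw z.2.1 * gw z.2.2) :=
    (measurable_gw.comp measurable_fst).mul (m1.comp measurable_snd)
  have a3 : ∫⁻ z : RicDom m ι κ, (gw z.1.1 * (gw z.1.2.1 * gw z.1.2.2)) * gw z.2 = 1 := by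
    refine (lintegral_prod_mul (μ := volume) (ν := volume) m2.aemeasurable
      (measurable_gw (m := m) (ι := κ) (κ := ι)).aemeasurable).trans ?_
    refine (congrArg₂ (· * ·) a2 lintegral_gw).trans (one_mul 1)
  rw [← a3]
  refine lintegral_congr fun z => ?_
  rw [blkW]; ring

theorem measurePreserving_toBlk :
    MeasurePreserving (toBlk : Tup m (ι ⊕ κ) (ι ⊕ κ) → RicDom m ι κ) volume volume := by
  refine measurePreserving_of_lintegral_eq_one (volume : Measure (Tup m (ι ⊕ κ) (ι ⊕ κ)))
    (volume : Measure (RicDom m ι κ)) toBlkEquiv blkW measurable_blkW ?_ lintegral_blkW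
  rw [← lintegral_gw (m := m) (ι := ι ⊕ κ) (κ := ι ⊕ κ)]
  exact lintegral_congr fun X => (gw_eq_blkW X).symm

theorem measurable_resultant : Measurable fun z : Tup m ι ι × Tup m κ κ =>
    |resultant (tchi z.1) (tchi z.2)| := by
  have h : ∀ z : Tup m ι ι × Tup m κ κ, |resultant (tchi z.1) (tchi z.2)|
      = |((Matrix.kroneckerMap (· * ·) (1 : Matrix κ κ ℝ) (List.ofFn (tm z.1)).prodᵀ
        - Matrix.kroneckerMap (· * ·) (List.ofFn (tm z.2)).prod (1 : Matrix ι ι ℝ))).det| :=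
    fun z => (abs_det_kronecker_sub _ _).symm
  simp only [h]
  refine Continuous.measurable ?_
  have c1 : Continuous fun z : Tup m ι ι × Tup m κ κ => (List.ofFn (tm z.1)).prod :=
    continuous_prod_ofFn _ fun l => (continuous_apply l).comp continuous_fst
  have c2 : Continuous fun z : Tup m ι ι × Tup m κ κ => (List.ofFn (tm z.2)).prod :=
    continuous_prod_ofFn _ fun l => (continuous_apply l).comp continuous_snd
  refine Continuous.abs (Continuous.matrix_det ?_)
  refine continuous_matrix fun i j => ?_
  simp only [Matrix.sub_apply, Matrix.kroneckerMap_apply, Matrix.transpose_apply]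
  exact ((c1.matrix_elem j.2 i.2).const_mul _ |>.sub ((c2.matrix_elem i.1 j.1).mul_const _))

/-- The constant in the factorization formula. -/
noncomputable def facC (m : ℕ) (ι κ : Type*) [Fintype ι] [Fintype κ] [DecidableEq ι] : ENNReal :=
  gkk ^ (m * Fintype.card κ * Fintype.card ι) * ∫⁻ Y : Tup m κ ι, graphJ Y

theorem ae_ricSum_eq_facSum (h : ℝ[X] → ℝ[X] → ENNReal) :
    ∀ᵐ X : Tup m (ι ⊕ κ) (ι ⊕ κ), ricSum h (toBlk X) = facSum (Fintype.card ι) h (tchi X) := by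
  filter_upwards [ae_ricFac_surjective (ι := ι) (κ := κ) (m := m)] with X hX
  exact ricSum_eq_facSum_of_surjective h X hX.1 hX.2

/-- **Factorization formula**: the expected sum over the monic degree `card ι` factors of the
characteristic polynomial of a product of Gaussian matrices. -/
theorem lintegral_facSum (h : ℝ[X] → ℝ[X] → ENNReal)
    (hh : Measurable fun z : Tup m ι ι × Tup m κ κ => h (tchi z.1) (tchi z.2)) :
    ∫⁻ X, facSum (Fintype.card ι) h (tchi X) ∂gam m (ι ⊕ κ) (ι ⊕ κ)
      = facC m ι κ * ∫⁻ p, ∫⁻ Q, ENNReal.ofReal |resultant (tchi p) (tchi Q)|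
          * h (tchi p) (tchi Q) ∂gam m κ κ ∂gam m ι ι := by
  have hae : ∀ᵐ X ∂gam m (ι ⊕ κ) (ι ⊕ κ),
      facSum (Fintype.card ι) h (tchi X) = ricSum h (toBlk X) :=
    ae_gam_of_ae ((ae_ricSum_eq_facSum h).mono fun _ h => h.symm)
  rw [lintegral_congr_ae hae, lintegral_gam _ (measurable_ricSum_toBlk h hh)]
  obtain ⟨hm, hF⟩ := lintegral_ricSum h hh blkW measurable_blkW
  have e1 : ∫⁻ X : Tup m (ι ⊕ κ) (ι ⊕ κ), gw X * ricSum h (toBlk X)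
      = ∫⁻ z : RicDom m ι κ, ricSum h z * blkW z := by
    have hm2 : Measurable fun z : RicDom m ι κ => ricSum h z * blkW z := hm.mul measurable_blkW
    rw [← measurePreserving_toBlk.lintegral_comp hm2]
    refine lintegral_congr fun X => ?_
    rw [gw_eq_blkW, mul_comm]
  rw [e1, ← hF]
  set Φ : ℝ[X] → ℝ[X] → ENNReal := fun f g => ENNReal.ofReal |resultant f g| * h f g with hΦ
  have hΦm : Measurable fun z : Tup m ι ι × Tup m κ κ => Φ (tchi z.1) (tchi z.2) :=
    measurable_resultant.ennreal_ofReal.mul hh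
  have e2 : ∫⁻ x : RicDom m ι κ, ENNReal.ofReal |resultant (tchi (ricPT x)) (tchi (ricQT x))|
        * (h (tchi (ricPT x)) (tchi (ricQT x)) * blkW (ricMap x))
      = ∫⁻ Y : Tup m κ ι, ∫⁻ x : Tup m ι ι × Tup m ι κ × Tup m κ κ,
        Φ (tchi (ricPT (x, Y))) (tchi (ricQT (x, Y))) * blkW (ricMap (x, Y)) := by
    have hmm : Measurable fun x : RicDom m ι κ =>
        Φ (tchi (ricPT x)) (tchi (ricQT x)) * blkW (ricMap x) :=
      (hΦm.comp (continuous_ricPT.measurable.prodMk continuous_ricQT.measurable)).mul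
        (measurable_blkW.comp contDiff_ricMap.continuous.measurable)
    refine Eq.trans (lintegral_congr fun x => ?_) (lintegral_prod_symm _ hmm.aemeasurable)
    rw [hΦ]; ring
  rw [e2]
  simp_rw [lintegral_blocks_of_graph _ Φ hΦm]
  have hJm : Measurable (graphJ : Tup m κ ι → ENNReal) := by
    unfold graphJ tm
    refine Measurable.ennreal_ofReal (Finset.measurable_fun_prod _ fun l _ => ?_)
    refine Measurable.inv (Measurable.pow_const (Measurable.sqrt (Continuous.measurable ?_)) _)
    refine Continuous.matrix_det (continuous_const.add ?_)
    refine continuous_matrix fun i j => ?_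
    simp only [Matrix.mul_apply, Matrix.transpose_apply, Matrix.of_apply]
    fun_prop
  rw [lintegral_mul_const _ hJm, facC]
  ring

end

/-- The sigma-algebra on real polynomials generated by the coefficients. -/
instance polyMeasurableSpace : MeasurableSpace ℝ[X] :=
  MeasurableSpace.comap (fun f i => f.coeff i) MeasurableSpace.pi

theorem measurable_coeff (i : ℕ) : Measurable fun f : ℝ[X] => f.coeff i :=
  (measurable_pi_apply i).comp (comap_measurable fun (f : ℝ[X]) i => f.coeff i)

theorem measurable_poly {E : Type*} [MeasurableSpace E] {F : E → ℝ[X]}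
    (h : ∀ i, Measurable fun x => (F x).coeff i) : Measurable F :=
  measurable_comap_iff.2 (measurable_pi_lambda _ h)

instance : MeasurableMul₂ ℝ[X] where
  measurable_mul := measurable_poly fun i => by
    simp only [coeff_mul]
    refine Finset.measurable_fun_sum _ fun x _ => ?_
    exact ((measurable_coeff _).comp measurable_fst).mul ((measurable_coeff _).comp measurable_snd)

theorem measurable_poly_eval (t : ℝ) : Measurable fun f : ℝ[X] => f.eval t := by
  refine measurable_of_tendsto_metrizable (f := fun n (f : ℝ[X]) =>
    ∑ i ∈ Finset.range n, f.coeff i * t ^ i) (fun n => ?_) ?_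
  · exact Finset.measurable_fun_sum _ fun i _ => (measurable_coeff i).mul_const _
  · rw [tendsto_pi_nhds]
    intro f
    refine tendsto_const_nhds.congr' ?_
    filter_upwards [Filter.eventually_gt_atTop f.natDegree] with n hn
    exact eval_eq_sum_range' hn t

theorem measurable_resultant_poly (a b : ℕ) :
    Measurable fun z : ℝ[X] × ℝ[X] => resultant z.1 z.2 a b := by
  unfold resultant
  simp only [Matrix.det_apply]
  refine Finset.measurable_fun_sum _ fun σ _ => Measurable.const_smul ?_ _
  refine Finset.measurable_fun_prod _ fun i _ => ?_
  simp only [sylvester, Matrix.of_apply]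
  refine Fin.addCases (fun j => ?_) (fun j => ?_) i
  all_goals
    simp only [Fin.addCases_left, Fin.addCases_right]
    split_ifs
    · first
        | exact (measurable_coeff _).comp measurable_fst
        | exact (measurable_coeff _).comp measurable_snd
    · exact measurable_const

theorem measurable_tchi {m : ℕ} {ι : Type*} [Fintype ι] [DecidableEq ι] :
    Measurable (tchi : Tup m ι ι → ℝ[X]) := by
  refine measurable_poly fun i => ?_
  have h : ∀ X : Tup m ι ι, (tchi X).coeff i = MvPolynomial.eval
      (fun z : ι × ι => (List.ofFn (tm X)).prod z.1 z.2) ((Matrix.charpoly.univ ℝ ι).coeff i) := by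
    intro X
    have h2 := Matrix.charpoly.univ_map_eval₂Hom ι (RingHom.id ℝ)
      (fun z : ι × ι => (List.ofFn (tm X)).prod z.1 z.2)
    have h3 : Matrix.of (Function.curry fun z : ι × ι => (List.ofFn (tm X)).prod z.1 z.2)
      = (List.ofFn (tm X)).prod := rfl
    rw [h3] at h2
    rw [tchi, ← h2, coeff_map]
    rfl
  simp only [h]
  refine ((MvPolynomial.continuous_eval _).comp ?_).measurable
  refine continuous_pi fun z => ?_
  exact (continuous_prod_ofFn _ fun l => continuous_apply l).matrix_elem z.1 z.2

/-- The number of distinct real roots. -/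
noncomputable def nroots (f : ℝ[X]) : ℕ := f.roots.toFinset.card

theorem le_nroots_iff (k : ℕ) (f : ℝ[X]) (hf : f ≠ 0) : k ≤ nroots f ↔
    ∃ q : Fin k → ℚ × ℚ, (∀ i j, i < j → (q i).2 < (q j).1) ∧ ∀ i, ∀ e : ℕ, ∃ t : ℚ,
      (q i).1 ≤ t ∧ t ≤ (q i).2 ∧ |f.eval (t : ℝ)| < 1 / ((e : ℝ) + 1) := by
  constructor
  · intro h
    obtain ⟨s, hs, hc⟩ := Finset.exists_subset_card_eq h
    let x := s.orderEmbOfFin hc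
    have hx : ∀ i, f.eval (x i) = 0 := fun i => by
      have := hs (s.orderEmbOfFin_mem hc i)
      rw [Multiset.mem_toFinset, mem_roots hf] at this
      exact this
    obtain ⟨ε, hε, hd⟩ : ∃ ε > 0, ∀ i j, i < j → x i + ε ≤ x j - ε := by
      have : ∀ᶠ ε in nhdsWithin (0 : ℝ) (Set.Ioi 0), ∀ i j, i < j → x i + ε ≤ x j - ε := by
        rw [Filter.eventually_all]; intro i
        rw [Filter.eventually_all]; intro j
        by_cases hij : i < j
        · have h1 := x.strictMono hij
          have : ∀ᶠ ε in nhdsWithin (0 : ℝ) (Set.Ioi 0), ε < (x j - x i) / 2 :=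
            nhdsWithin_le_nhds (Iio_mem_nhds (by linarith))
          filter_upwards [this] with ε h2 _
          linarith
        · exact Filter.Eventually.of_forall fun _ h => absurd h hij
      obtain ⟨ε, h1, h2⟩ := (this.and self_mem_nhdsWithin).exists
      exact ⟨ε, h2, h1⟩
    have h1 : ∀ i, ∃ a : ℚ, x i - ε < a ∧ (a : ℝ) < x i := fun i =>
      exists_rat_btwn (by linarith)
    have h2 : ∀ i, ∃ a : ℚ, x i < a ∧ (a : ℝ) < x i + ε := fun i =>
      exists_rat_btwn (by linarith)
    choose a ha ha' using h1
    choose b hb hb' using h2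
    refine ⟨fun i => (a i, b i), fun i j hij => ?_, fun i e => ?_⟩
    · have := hd i j hij
      have h3 : ((b i : ℚ) : ℝ) < a j := by linarith [ha j, hb' i]
      exact_mod_cast h3
    · have ho : IsOpen {t : ℝ | a i < t ∧ t < b i ∧ |f.eval t| < 1 / ((e : ℝ) + 1)} :=
        (isOpen_lt continuous_const continuous_id).inter ((isOpen_lt continuous_id
          continuous_const).inter (isOpen_lt f.continuous.abs continuous_const))
      obtain ⟨t, ht⟩ := Rat.denseRange_cast.exists_mem_open ho
        ⟨x i, ha' i, hb i, by rw [hx, abs_zero]; positivity⟩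
      exact ⟨t, by exact_mod_cast ht.1.le, by exact_mod_cast ht.2.1.le, ht.2.2⟩
  · rintro ⟨q, hq, h⟩
    have : ∀ i, ∃ x : ℝ, ((q i).1 : ℝ) ≤ x ∧ x ≤ (q i).2 ∧ f.eval x = 0 := by
      intro i
      choose t h1 h2 h3 using h i
      have hne : (Set.Icc ((q i).1 : ℝ) (q i).2).Nonempty :=
        ⟨t 0, by exact_mod_cast h1 0, by exact_mod_cast h2 0⟩
      obtain ⟨x, hx, hmin⟩ := isCompact_Icc.exists_isMinOn hne (f.continuous.abs.continuousOn)
      refine ⟨x, hx.1, hx.2, ?_⟩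
      by_contra h0
      obtain ⟨e, he⟩ := exists_nat_one_div_lt (abs_pos.2 h0)
      have h4 : |f.eval x| ≤ |f.eval (t e : ℝ)| :=
        hmin ⟨by exact_mod_cast h1 e, by exact_mod_cast h2 e⟩
      linarith [h3 e]
    choose x h1 h2 h3 using this
    have hinj : StrictMono x := fun i j hij => by
      have : (((q i).2 : ℚ) : ℝ) < (q j).1 := by exact_mod_cast hq i j hij
      linarith [h2 i, h1 j]
    have := Finset.card_le_card (s := Finset.univ.image x) (t := f.roots.toFinset) fun y hy => by
      obtain ⟨i, -, rfl⟩ := Finset.mem_image.1 hy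
      rw [Multiset.mem_toFinset, mem_roots hf]
      exact h3 i
    rwa [Finset.card_image_of_injective _ hinj.injective, Finset.card_univ, Fintype.card_fin] at this

theorem measurable_nroots : Measurable nroots := by
  have h0 : MeasurableSet {f : ℝ[X] | f = 0} := by
    have : {f : ℝ[X] | f = 0} = ⋂ i, {f | f.coeff i = 0} := by
      ext f; simp [Polynomial.ext_iff]
    rw [this]
    exact MeasurableSet.iInter fun i => measurable_coeff i (measurableSet_singleton 0)
  refine measurable_of_Ici fun k => ?_
  have : nroots ⁻¹' Set.Ici k = ({f | f = 0} ∩ {_f | k ≤ 0}) ∪ ({f | f = 0}ᶜ ∩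
      ⋃ q : Fin k → ℚ × ℚ, ({_f | ∀ i j, i < j → (q i).2 < (q j).1} ∩ ⋂ i, ⋂ e : ℕ,
        ⋃ t : ℚ, ({_f | (q i).1 ≤ t ∧ t ≤ (q i).2} ∩
          {f : ℝ[X] | |f.eval (t : ℝ)| < 1 / ((e : ℝ) + 1)}))) := by
    ext f
    by_cases hf : f = 0
    · simp [hf, nroots]
    · simp [hf, le_nroots_iff k f hf, and_assoc]
  rw [this]
  refine (h0.inter (MeasurableSet.const _)).union (h0.compl.inter (MeasurableSet.iUnion fun q =>
    (MeasurableSet.const _).inter (MeasurableSet.iInter fun i => MeasurableSet.iInter fun e =>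
      MeasurableSet.iUnion fun t => (MeasurableSet.const _).inter ?_)))
  have := (measurable_poly_eval (t : ℝ)).abs
  exact measurableSet_lt this measurable_const

theorem sum_sign_prod_sub (S : Finset ℝ) :
    ∑ i ∈ S, (SignType.sign (∏ j ∈ S.erase i, (i - j)) : ℝ) = if Even S.card then 0 else 1 := by
  induction S using Finset.induction_on_max with
  | empty => simp
  | insert M S hM ih =>
    have hMS : M ∉ S := fun h => lt_irrefl _ (hM M h)
    rw [Finset.sum_insert hMS, Finset.erase_insert hMS, Finset.card_insert_of_notMem hMS]
    have h1 : SignType.sign (∏ j ∈ S, (M - j)) = 1 :=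
      sign_pos (Finset.prod_pos fun j hj => sub_pos.2 (hM j hj))
    have h2 : ∀ i ∈ S, (SignType.sign (∏ j ∈ (insert M S).erase i, (i - j)) : ℝ)
        = -(SignType.sign (∏ j ∈ S.erase i, (i - j)) : ℝ) := by
      intro i hi
      have hne : M ≠ i := fun h => hMS (h ▸ hi)
      rw [Finset.erase_insert_of_ne hne, Finset.prod_insert (fun h => hMS (Finset.mem_of_mem_erase h)),
        sign_mul, sign_neg (sub_neg.2 (hM i hi))]
      simp
    rw [Finset.sum_congr rfl h2, Finset.sum_neg_distrib, ih, h1]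
    by_cases h : Even S.card
    · simp [h, Nat.even_add_one]
    · simp [h, Nat.even_add_one]

theorem sum_lt_neg_mul (S : Finset ℝ) (e : ℝ → ℝ) (he : ∀ a ∈ S, e a * e a = 1) :
    2 * ∑ p ∈ (S ×ˢ S) with p.1 < p.2, -(e p.1 * e p.2) = S.card - (∑ a ∈ S, e a) ^ 2 := by
  have h1 : (∑ a ∈ S, e a) ^ 2 = ∑ p ∈ S ×ˢ S, e p.1 * e p.2 := by
    rw [pow_two, Finset.sum_mul_sum, Finset.sum_product]
  have h2 : ∑ p ∈ (S ×ˢ S) with p.2 < p.1, e p.1 * e p.2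
      = ∑ p ∈ (S ×ˢ S) with p.1 < p.2, e p.1 * e p.2 := by
    refine Finset.sum_nbij' Prod.swap Prod.swap ?_ ?_ ?_ ?_ ?_
    · rintro ⟨a, b⟩ h; simp at h ⊢; tauto
    · rintro ⟨a, b⟩ h; simp at h ⊢; tauto
    · rintro ⟨a, b⟩ h; rfl
    · rintro ⟨a, b⟩ h; rfl
    · rintro ⟨a, b⟩ h; simp [mul_comm]
  have h3 : ∑ p ∈ (S ×ˢ S) with p.1 = p.2, e p.1 * e p.2 = S.card := by
    rw [Finset.sum_filter, Finset.sum_product]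
    simp only [Finset.sum_ite_eq, Finset.card_eq_sum_ones, Nat.cast_sum, Nat.cast_one]
    refine Finset.sum_congr rfl fun a ha => ?_
    simp [ha, he a ha]
  have h4 : ∑ p ∈ S ×ˢ S, e p.1 * e p.2 = ∑ p ∈ (S ×ˢ S) with p.1 < p.2, e p.1 * e p.2
      + (∑ p ∈ (S ×ˢ S) with p.2 < p.1, e p.1 * e p.2
        + ∑ p ∈ (S ×ˢ S) with p.1 = p.2, e p.1 * e p.2) := by
    simp only [Finset.sum_filter, ← Finset.sum_add_distrib]
    refine Finset.sum_congr rfl fun p _ => ?_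
    rcases lt_trichotomy p.1 p.2 with h | h | h
    · simp [h, h.not_gt, h.ne]
    · simp [h]
    · simp [h, h.not_gt, h.ne']
  rw [h1, h4, h2, h3, Finset.sum_neg_distrib]
  ring

theorem eval_pos_of_monic_of_no_roots (r : ℝ[X]) (hr : r.Monic) (h : ∀ x, r.eval x ≠ 0) (x : ℝ) :
    0 < r.eval x := by
  by_contra hx
  have hx : r.eval x < 0 := lt_of_le_of_ne (not_lt.1 hx) (h x)
  have hd : 0 < r.degree := by
    by_contra hd
    have := eq_C_of_degree_le_zero (not_lt.1 hd)
    rw [this] at hr hx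
    have h1 : r.coeff 0 = 1 := by simpa [Monic] using hr
    rw [h1] at hx
    simp at hx
    linarith
  have ht := r.tendsto_atTop_of_leadingCoeff_nonneg hd (by rw [hr.leadingCoeff]; exact zero_le_one)
  obtain ⟨y, hy, hxy⟩ := ((ht.eventually_gt_atTop 0).and (Filter.eventually_gt_atTop x)).exists
  obtain ⟨z, -, hz⟩ := intermediate_value_Icc hxy.le r.continuous.continuousOn ⟨hx.le, hy.le⟩
  exact h z hz

theorem sign_derivative_eval {χ : ℝ[X]} (hm : χ.Monic) (hs : χ.Separable)
    (x : ℝ) (hx : x ∈ χ.roots.toFinset) :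
    SignType.sign (χ.derivative.eval x)
      = SignType.sign (∏ j ∈ χ.roots.toFinset.erase x, (x - j)) := by
  set S := χ.roots.toFinset
  have hnd : χ.roots.Nodup := nodup_roots hs
  obtain ⟨r, hr, -, hr'⟩ := exists_prod_multiset_X_sub_C_mul χ
  have hprod : (χ.roots.map fun a => X - C a).prod = ∏ a ∈ S, (X - C a) := by
    rw [Finset.prod, Multiset.toFinset_val, hnd.dedup]
  rw [hprod] at hr
  have hP : (∏ a ∈ S, (X - C a)).Monic := monic_prod_of_monic _ _ fun a _ => monic_X_sub_C a
  have hrm : r.Monic := hP.of_mul_monic_left (hr ▸ hm)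
  have hr0 : ∀ y, r.eval y ≠ 0 := fun y hy => by
    have : y ∈ r.roots := (mem_roots hrm.ne_zero).2 hy
    rw [hr'] at this
    simp at this
  have h1 : χ.derivative.eval x = (∏ j ∈ S.erase x, (x - j)) * r.eval x := by
    rw [← hr, ← Finset.mul_prod_erase S _ hx]
    simp [eval_prod]
  rw [h1, sign_mul, sign_pos (eval_pos_of_monic_of_no_roots r hrm hr0 x), mul_one]

theorem card_complex_roots {χ : ℝ[X]} (hm : χ.Monic) (hs : χ.Separable) :
    χ.natDegree = χ.roots.toFinset.card
    + 2 * ((χ.map (algebraMap ℝ ℂ)).roots.toFinset.filter fun c => 0 < c.im).card := by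
  set Z := (χ.map (algebraMap ℝ ℂ)).roots.toFinset
  have hne : χ.map (algebraMap ℝ ℂ) ≠ 0 := (hm.map _).ne_zero
  have hZ : ∀ c, c ∈ Z ↔ aeval c χ = 0 := fun c => by
    rw [Multiset.mem_toFinset, mem_roots hne, IsRoot, eval_map_algebraMap]
  have hcard : Z.card = χ.natDegree := by
    rw [Multiset.toFinset_card_of_nodup (nodup_roots hs.map),
      ← (IsAlgClosed.splits (χ.map (algebraMap ℝ ℂ))).natDegree_eq_card_roots, natDegree_map]
  have hlow : (Z.filter fun c => c.im < 0).card = (Z.filter fun c => 0 < c.im).card := by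
    refine Finset.card_nbij' (starRingEnd ℂ) (starRingEnd ℂ) ?_ ?_ ?_ ?_
    · intro c hc
      simp only [Finset.coe_filter, Set.mem_ofPred_eq, hZ] at hc ⊢
      rw [aeval_conj, hc.1]
      simpa using hc.2
    · intro c hc
      simp only [Finset.coe_filter, Set.mem_ofPred_eq, hZ] at hc ⊢
      rw [aeval_conj, hc.1]
      simpa using hc.2
    · intro c _; simp
    · intro c _; simp
  have hreal : (Z.filter fun c => c.im = 0).card = χ.roots.toFinset.card := by
    refine Finset.card_nbij' Complex.re (algebraMap ℝ ℂ) ?_ ?_ ?_ ?_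
    · intro c hc
      simp only [Finset.coe_filter, Set.mem_ofPred_eq, hZ] at hc
      have h2 : c = (algebraMap ℝ ℂ) c.re := Complex.ext rfl (by simp [hc.2])
      rw [h2, aeval_algebraMap_apply] at hc
      have h3 : aeval c.re χ = 0 := by simpa using hc.1
      simpa [hm.ne_zero] using h3
    · intro c hc
      have h3 : aeval c χ = 0 := by simpa [hm.ne_zero] using hc
      simp only [Finset.coe_filter, Set.mem_ofPred_eq, hZ]
      rw [aeval_algebraMap_apply, h3]
      simp
    · intro c hc
      simp only [Finset.coe_filter, Set.mem_ofPred_eq] at hc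
      exact Complex.ext rfl (by simp [hc.2])
    · intro c _; simp
  have h4 : Z.card = (Z.filter fun c => c.im = 0).card + ((Z.filter fun c => c.im < 0).card
      + (Z.filter fun c => 0 < c.im).card) := by
    rw [Finset.card_eq_sum_ones, Finset.card_filter, Finset.card_filter, Finset.card_filter,
      ← Finset.sum_add_distrib, ← Finset.sum_add_distrib]
    refine Finset.sum_congr rfl fun c _ => ?_
    rcases lt_trichotomy c.im 0 with h | h | h
    · simp [h, h.not_gt, h.ne]
    · simp [h]
    · simp [h, h.not_gt, h.ne']
  rw [← hcard, h4, hlow, hreal]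
  ring

theorem ofReal_resultant_of_map_eq (f g : ℝ[X]) (c d : ℂ) (hf : f.Monic)
    (h : f.map (algebraMap ℝ ℂ) = (X - C c) * (X - C d)) :
    ((resultant f g : ℝ) : ℂ) = aeval c g * aeval d g := by
  have hd : f.natDegree = 2 := by
    rw [← natDegree_map_eq_of_injective (algebraMap ℝ ℂ).injective f, h,
      natDegree_mul (X_sub_C_ne_zero _) (X_sub_C_ne_zero _)]
    simp
  have h1 : ((resultant f g : ℝ) : ℂ) = resultant (f.map (algebraMap ℝ ℂ))
      (g.map (algebraMap ℝ ℂ)) := by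
    rw [natDegree_map, natDegree_map, resultant_map_map]; rfl
  have h2 := resultant_eq_prod_eval (f.map (algebraMap ℝ ℂ)) (g.map (algebraMap ℝ ℂ)) _ le_rfl
    (IsAlgClosed.splits _)
  rw [h1, h2, (hf.map _).leadingCoeff, h, roots_mul (mul_ne_zero (X_sub_C_ne_zero _)
    (X_sub_C_ne_zero _)), roots_X_sub_C, roots_X_sub_C]
  simp [eval_map_algebraMap]

/-- The monic real quadratic with root `c`. -/
noncomputable def quadC (c : ℂ) : ℝ[X] := X ^ 2 - C (2 * c.re) * X + C (‖c‖ ^ 2)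

theorem monic_quadC (c : ℂ) : (quadC c).Monic := by unfold quadC; monicity!

theorem natDegree_quadC (c : ℂ) : (quadC c).natDegree = 2 := by unfold quadC; compute_degree!

theorem map_quadC (c : ℂ) :
    (quadC c).map (algebraMap ℝ ℂ) = (X - C c) * (X - C (starRingEnd ℂ c)) := by
  have h1 : (C (2 * (c.re : ℂ)) : ℂ[X]) = C c + C (starRingEnd ℂ c) := by
    rw [← C_add, Complex.add_conj]; simp
  have h2 : (C ((‖c‖ : ℂ) ^ 2) : ℂ[X]) = C c * C (starRingEnd ℂ c) := by
    rw [← C_mul, Complex.mul_conj']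
  simp only [quadC, Polynomial.map_add, Polynomial.map_sub, Polynomial.map_pow, map_X,
    Polynomial.map_mul, map_C, Complex.coe_algebraMap, Complex.ofReal_mul, Complex.ofReal_pow,
    Complex.ofReal_ofNat, h1, h2]
  ring

theorem exists_quadC_of_no_roots (f : ℝ[X]) (hf : f.Monic) (hd : f.natDegree = 2)
    (h : ∀ x, f.eval x ≠ 0) : ∃ c : ℂ, 0 < c.im ∧ f = quadC c := by
  obtain ⟨c, hc⟩ := IsAlgClosed.exists_aeval_eq_zero ℂ f (by
    intro h0
    rw [natDegree_eq_of_degree_eq_some h0] at hd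
    exact absurd hd (by norm_num))
  have him : c.im ≠ 0 := fun h0 => by
    have h2 : c = (algebraMap ℝ ℂ) c.re := Complex.ext rfl (by simp [h0])
    rw [h2, aeval_algebraMap_apply] at hc
    exact h c.re (by simpa using hc)
  have key : ∀ c : ℂ, aeval c f = 0 → 0 < c.im → f = quadC c := fun c hc him => by
    obtain ⟨q, hq⟩ := f.quadratic_dvd_of_aeval_eq_zero_im_ne_zero hc him.ne'
    change f = quadC c * q at hq
    have hqm : q.Monic := (monic_quadC c).of_mul_monic_left (hq ▸ hf)
    have : q.natDegree = 0 := by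
      have := (monic_quadC c).natDegree_mul hqm
      rw [← hq, hd, natDegree_quadC] at this
      omega
    rw [hqm.natDegree_eq_zero.1 this, mul_one] at hq
    exact hq
  rcases lt_or_gt_of_ne him with h0 | h0
  · refine ⟨starRingEnd ℂ c, by simpa using h0, key _ ?_ (by simpa using h0)⟩
    rw [aeval_conj, hc, map_zero]
  · exact ⟨c, h0, key c hc h0⟩

theorem resultant_lin2 (a b : ℝ) (g : ℝ[X]) :
    resultant ((X - C a) * (X - C b)) g = g.eval a * g.eval b := by
  have h := ofReal_resultant_of_map_eq ((X - C a) * (X - C b)) g a b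
    ((monic_X_sub_C a).mul (monic_X_sub_C b)) (by simp)
  have h2 : ∀ x : ℝ, aeval (x : ℂ) g = ((g.eval x : ℝ) : ℂ) := fun x => by
    have := aeval_algebraMap_apply ℂ x g
    simpa using this
  rw [h2, h2] at h
  exact_mod_cast h

theorem exists_lin2_of_root (f : ℝ[X]) (hf : f.Monic) (hd : f.natDegree = 2) (hs : f.Separable)
    (h : ∃ x, f.eval x = 0) : ∃ a b, a < b ∧ f = (X - C a) * (X - C b) := by
  obtain ⟨a, ha⟩ := h
  obtain ⟨q, hq⟩ := dvd_iff_isRoot.2 ha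
  have hqm : q.Monic := (monic_X_sub_C a).of_mul_monic_left (hq ▸ hf)
  have h1 : q.natDegree = 1 := by
    have := (monic_X_sub_C a).natDegree_mul hqm
    rw [← hq, hd, natDegree_X_sub_C] at this
    omega
  obtain ⟨b, rfl⟩ : ∃ b, q = X - C b := ⟨-q.coeff 0, by
    rw [map_neg, sub_neg_eq_add]; exact hqm.eq_X_add_C h1⟩
  rw [hq] at hs
  rcases lt_trichotomy a b with h | h | h
  · exact ⟨a, b, h, hq⟩
  · subst h
    have := hs.squarefree (X - C a) dvd_rfl
    exact absurd this (not_isUnit_X_sub_C a)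
  · exact ⟨b, a, h, by rw [hq, mul_comm]⟩

theorem sum_sign_resultant (χ : ℝ[X]) (hm : χ.Monic) (hs : χ.Separable) (n : ℕ)
    (hd : χ.natDegree = 2 * n) (T : Finset (ℝ[X] × ℝ[X])) (hT : ∀ z, z ∈ T ↔ z ∈ Fac 2 χ) :
    ∑ z ∈ T, (SignType.sign (resultant z.1 z.2) : ℝ) = n := by
  classical
  set S := χ.roots.toFinset with hS
  have hmS : ∀ x, x ∈ S ↔ χ.eval x = 0 := fun x => by
    rw [hS, Multiset.mem_toFinset, mem_roots hm.ne_zero, IsRoot]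
  set e : ℝ → ℝ := fun a => (SignType.sign (χ.derivative.eval a) : ℝ) with he
  have hc := card_complex_roots hm hs
  set Z := (χ.map (algebraMap ℝ ℂ)).roots.toFinset.filter fun c => 0 < c.im with hZ
  have hmZ : ∀ c, c ∈ Z ↔ aeval c χ = 0 ∧ 0 < c.im := fun c => by
    rw [hZ, Finset.mem_filter, Multiset.mem_toFinset, mem_roots (hm.map _).ne_zero, IsRoot,
      eval_map_algebraMap]
  have hsep : ∀ z ∈ T, z.1.Separable ∧ IsCoprime z.1 z.2 := fun z hz => by
    obtain ⟨-, -, h3, -⟩ := (hT z).1 hz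
    rw [← h3] at hs
    exact ⟨hs.of_mul_left, hs.isCoprime⟩
  have hmem : ∀ f : ℝ[X], f.Monic → f.natDegree = 2 → f ∣ χ → (f, χ /ₘ f) ∈ T := fun f h1 h2 h3 => by
    rw [hT]
    have h4 : f * (χ /ₘ f) = χ := by
      have := modByMonic_add_div χ f
      rwa [(modByMonic_eq_zero_iff_dvd h1).2 h3, zero_add] at this
    exact ⟨h1, h1.of_mul_monic_left (h4.symm ▸ hm), h4, h2⟩
  have hsnd : ∀ z ∈ T, z.2 = χ /ₘ z.1 := fun z hz => by
    obtain ⟨h1, -, h3, -⟩ := (hT z).1 hz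
    rw [← h3, mul_divByMonic_cancel_left _ h1]
  -- the real pairs
  have hroot : ∀ a b : ℝ, χ.eval a = 0 → χ.eval b = 0 → a < b →
      (X - C a) * (X - C b) ∣ χ := fun a b ha hb hab =>
    (isCoprime_X_sub_C_of_isUnit_sub (isUnit_iff_ne_zero.2 (sub_ne_zero.2 hab.ne))).mul_dvd
      (dvd_iff_isRoot.2 ha) (dvd_iff_isRoot.2 hb)
  have s1 : ∑ z ∈ T with ∃ x, z.1.eval x = 0, (SignType.sign (resultant z.1 z.2) : ℝ)
      = ∑ p ∈ (S ×ˢ S) with p.1 < p.2, -(e p.1 * e p.2) := by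
    symm
    refine Finset.sum_bij (fun p _ => ((X - C p.1) * (X - C p.2),
      χ /ₘ ((X - C p.1) * (X - C p.2)))) ?_ ?_ ?_ ?_
    · rintro ⟨a, b⟩ h
      simp only [Finset.mem_filter, Finset.mem_product, hmS] at h ⊢
      refine ⟨hmem _ ((monic_X_sub_C a).mul (monic_X_sub_C b)) ?_ (hroot a b h.1.1 h.1.2 h.2),
        a, by simp⟩
      rw [natDegree_mul (X_sub_C_ne_zero _) (X_sub_C_ne_zero _)]; simp
    · rintro ⟨a, b⟩ h ⟨a', b'⟩ h' heq
      simp only [Finset.mem_filter] at h h'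
      have h1 : (X - C a) * (X - C b) = (X - C a') * (X - C b') := congrArg Prod.fst heq
      have h2 : (a - a') * (a - b') = 0 := by
        have := congrArg (eval a) h1; simpa using this.symm
      have h3 : (b - a') * (b - b') = 0 := by
        have := congrArg (eval b) h1; simpa using this.symm
      have h4 : (a' - a) * (a' - b) = 0 := by
        have := congrArg (eval a') h1; simpa using this
      have h6 := h.2
      have h7 := h'.2
      simp only [mul_eq_zero, sub_eq_zero] at h2 h3 h4
      change a < b at h6
      change a' < b' at h7
      refine Prod.ext ?_ ?_
      · rcases h2 with h2 | h2
        · exact h2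
        · rcases h4 with h4 | h4 <;> linarith
      · rcases h3 with h3 | h3
        · rcases h2 with h2 | h2 <;> linarith
        · exact h3
    · intro z hz
      simp only [Finset.mem_filter] at hz
      obtain ⟨h1, h2, h3, h4⟩ := (hT z).1 hz.1
      obtain ⟨a, b, hab, hf⟩ := exists_lin2_of_root z.1 h1 h4 (hsep z hz.1).1 hz.2
      refine ⟨(a, b), ?_, ?_⟩
      · simp only [Finset.mem_filter, Finset.mem_product, hmS]
        refine ⟨⟨?_, ?_⟩, hab⟩ <;> rw [← h3, hf] <;> simp
      · ext1
        · exact hf.symm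
        · rw [hsnd z hz.1, hf]
    · rintro ⟨a, b⟩ h
      simp only [Finset.mem_filter, Finset.mem_product, hmS] at h
      obtain ⟨g, hg⟩ := hroot a b h.1.1 h.1.2 h.2
      have h5 : χ /ₘ ((X - C a) * (X - C b)) = g := by
        rw [hg, mul_divByMonic_cancel_left _ ((monic_X_sub_C a).mul (monic_X_sub_C b))]
      change _ = (SignType.sign (resultant ((X - C a) * (X - C b))
        (χ /ₘ ((X - C a) * (X - C b)))) : ℝ)
      rw [h5, resultant_lin2]
      simp only [he]
      have h6 : χ.derivative.eval a = (a - b) * g.eval a := by rw [hg]; simp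
      have h7 : χ.derivative.eval b = (b - a) * g.eval b := by rw [hg]; simp
      have h8 := h.2
      rw [h6, h7, sign_mul, sign_mul, sign_mul, sign_neg (sub_neg.2 h8), sign_pos (sub_pos.2 h8)]
      simp
  have s2 : ∑ z ∈ T with ¬ ∃ x, z.1.eval x = 0, (SignType.sign (resultant z.1 z.2) : ℝ)
      = Z.card := by
    rw [Finset.card_eq_sum_ones, Nat.cast_sum]
    symm
    refine Finset.sum_bij (fun c _ => (quadC c, χ /ₘ quadC c)) ?_ ?_ ?_ ?_
    · intro c h
      rw [hmZ] at h
      simp only [Finset.mem_filter]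
      refine ⟨hmem _ (monic_quadC c) (natDegree_quadC c)
        (χ.quadratic_dvd_of_aeval_eq_zero_im_ne_zero h.1 h.2.ne'), ?_⟩
      rintro ⟨x, hx⟩
      have h1 : ((quadC c).map (algebraMap ℝ ℂ)).eval (x : ℂ) = 0 := by
        rw [eval_map_algebraMap]
        have := aeval_algebraMap_apply ℂ x (quadC c)
        simpa [hx] using this
      rw [map_quadC] at h1
      simp only [eval_mul, eval_sub, eval_X, eval_C, mul_eq_zero, sub_eq_zero] at h1
      have h2 := h.2.ne'
      rcases h1 with h1 | h1
      · exact h2 (by rw [← h1]; simp)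
      · have := congrArg Complex.im h1
        simp at this
        exact h2 this
    · intro c hc d hd heq
      rw [hmZ] at hc hd
      have h1 : quadC c = quadC d := congrArg Prod.fst heq
      have h2 : aeval c (quadC d) = 0 := by
        rw [← h1, ← eval_map_algebraMap, map_quadC]; simp
      rw [← eval_map_algebraMap, map_quadC] at h2
      simp only [eval_mul, eval_sub, eval_X, eval_C, mul_eq_zero, sub_eq_zero] at h2
      rcases h2 with h2 | h2
      · exact h2
      · have := congrArg Complex.im h2
        simp at this
        linarith [hc.2, hd.2]
    · intro z hz
      simp only [Finset.mem_filter, not_exists] at hz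
      obtain ⟨h1, h2, h3, h4⟩ := (hT z).1 hz.1
      obtain ⟨c, hc, hf⟩ := exists_quadC_of_no_roots z.1 h1 h4 hz.2
      refine ⟨c, (hmZ c).2 ⟨?_, hc⟩, ?_⟩
      · rw [← h3, hf, map_mul, ← eval_map_algebraMap, map_quadC]; simp
      · ext1
        · exact hf.symm
        · rw [hsnd z hz.1, hf]
    · intro c h
      have h0 := (hmZ c).1 h
      obtain ⟨g, hg⟩ := χ.quadratic_dvd_of_aeval_eq_zero_im_ne_zero h0.1 h0.2.ne'
      change χ = quadC c * g at hg
      have h5 : χ /ₘ quadC c = g := by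
        rw [hg, mul_divByMonic_cancel_left _ (monic_quadC c)]
      have hcop : IsCoprime (quadC c) g := by
        rw [hg] at hs; exact hs.isCoprime
      have h6 := ofReal_resultant_of_map_eq _ g c _ (monic_quadC c) (map_quadC c)
      rw [aeval_conj, Complex.mul_conj'] at h6
      have h7 : resultant (quadC c) g = ‖aeval c g‖ ^ 2 := by exact_mod_cast h6
      have h8 : resultant (quadC c) g ≠ 0 := resultant_ne_zero _ _ hcop
      change _ = (SignType.sign (resultant (quadC c) (χ /ₘ quadC c)) : ℝ)
      rw [h5, sign_pos]
      · simp
      · rw [h7] at h8 ⊢; positivity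
  have he1 : ∀ a ∈ S, e a * e a = 1 := fun a ha => by
    have : χ.derivative.eval a ≠ 0 := by
      have := hs.eval₂_derivative_ne_zero (RingHom.id ℝ) ((hmS a).1 ha)
      simpa using this
    rcases lt_or_gt_of_ne this with h | h
    · simp [he, sign_neg h]
    · simp [he, sign_pos h]
  have he0 : ∑ a ∈ S, e a = 0 := by
    have h1 : ∀ a ∈ S, e a = (SignType.sign (∏ j ∈ S.erase a, (a - j)) : ℝ) := fun a ha => by
      simp only [he]
      rw [sign_derivative_eval hm hs a ha]
    rw [Finset.sum_congr rfl h1, sum_sign_prod_sub, if_pos]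
    have hc' : 2 * n = S.card + 2 * Z.card := by rw [← hd]; exact hc
    rw [Nat.even_iff]; omega
  have h1 := sum_lt_neg_mul S e he1
  rw [he0] at h1
  have h2 := Finset.sum_filter_add_sum_filter_not T (fun z => ∃ x, z.1.eval x = 0)
    fun z => (SignType.sign (resultant z.1 z.2) : ℝ)
  rw [← h2, s1, s2]
  have h3 : (2 * n : ℝ) = S.card + 2 * Z.card := by rw [hd] at hc; exact_mod_cast hc
  linarith

theorem measurePreserving_gam_of_gw {m m' : ℕ} {ι κ ι' κ' : Type*} [Fintype ι] [Fintype κ]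
    [Fintype ι'] [Fintype κ'] (L : Tup m ι κ ≃ₗ[ℝ] Tup m' ι' κ') (hL : ∀ X, gw (L X) = gw X) :
    MeasurePreserving L (gam m ι κ) (gam m' ι' κ') := by
  have h1 : MeasurePreserving L (volume : Measure (Tup m ι κ)) (volume : Measure (Tup m' ι' κ')) := by
    refine measurePreserving_of_lintegral_eq_one _ _ L gw measurable_gw ?_ lintegral_gw
    simp only [hL, lintegral_gw]
  refine ⟨h1.measurable, ?_⟩
  refine Measure.ext_of_lintegral _ fun f hf => ?_
  have hm : Measurable fun X : Tup m' ι' κ' => gw X * f X := measurable_gw.mul hf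
  have hf2 : Measurable fun X => f (L X) := hf.comp h1.measurable
  rw [lintegral_map hf h1.measurable, lintegral_gam _ hf2, lintegral_gam _ hf,
    ← h1.lintegral_comp hm]
  simp only [hL]

/-- Reindexing of tuples of matrices. -/
def reindexTup (m : ℕ) {ι ι' : Type*} (e : ι ≃ ι') : Tup m ι' ι' ≃ₗ[ℝ] Tup m ι ι where
  toFun X := fun l i j => X l (e i) (e j)
  map_add' _ _ := rfl
  map_smul' _ _ := rfl
  invFun X := fun l i j => X l (e.symm i) (e.symm j)
  left_inv X := by simp
  right_inv X := by simp

theorem prod_ofFn_submatrix {m : ℕ} {ι ι' : Type*} [Fintype ι] [DecidableEq ι] [Fintype ι']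
    [DecidableEq ι'] (e : ι ≃ ι') (X : Fin m → Matrix ι' ι' ℝ) :
    (List.ofFn fun l => (X l).submatrix e e).prod = (List.ofFn X).prod.submatrix e e := by
  have := map_list_prod (Matrix.reindexAlgEquiv ℝ ℝ e.symm) (List.ofFn X)
  rw [List.map_ofFn] at this
  exact this.symm

theorem tchi_reindexTup {m : ℕ} {ι ι' : Type*} [Fintype ι] [DecidableEq ι] [Fintype ι']
    [DecidableEq ι'] (e : ι ≃ ι') (X : Tup m ι' ι') : tchi (reindexTup m e X) = tchi X := by
  rw [tchi, tchi]
  have := prod_ofFn_submatrix e (tm X)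
  have h2 : tm (reindexTup m e X) = fun l => (tm X l).submatrix e e := rfl
  rw [h2, this]
  exact Matrix.charpoly_reindex e.symm _

/-- The law of the characteristic polynomial of a product of Gaussian matrices. -/
noncomputable def chiLaw (m k : ℕ) : Measure ℝ[X] := (gam m (Fin k) (Fin k)).map tchi

instance (m k : ℕ) : IsProbabilityMeasure (chiLaw m k) :=
  Measure.isProbabilityMeasure_map measurable_tchi.aemeasurable

theorem lintegral_chiLaw {m k : ℕ} {F : ℝ[X] → ENNReal} (hF : Measurable F) :
    ∫⁻ f, F f ∂chiLaw m k = ∫⁻ X, F (tchi X) ∂gam m (Fin k) (Fin k) :=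
  lintegral_map hF measurable_tchi

theorem integral_chiLaw {m k : ℕ} {F : ℝ[X] → ℝ} (hF : Measurable F) :
    ∫ f, F f ∂chiLaw m k = ∫ X, F (tchi X) ∂gam m (Fin k) (Fin k) :=
  integral_map measurable_tchi.aemeasurable hF.aestronglyMeasurable

theorem ae_chiLaw_monic (m k : ℕ) [NeZero m] : ∀ᵐ f ∂chiLaw m k, f.Monic ∧ f.natDegree = k := by
  have e : ∀ f : ℝ[X], (f.Monic ∧ f.natDegree = k) ↔ f.coeff k = 1 ∧ ∀ i, k < i → f.coeff i = 0 := by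
    intro f
    constructor
    · rintro ⟨h1, h2⟩
      exact ⟨by rw [← h2]; exact h1, fun i hi => coeff_eq_zero_of_natDegree_lt (h2 ▸ hi)⟩
    · rintro ⟨h1, h2⟩
      have h3 : f.natDegree ≤ k := natDegree_le_iff_coeff_eq_zero.2 h2
      have h4 := natDegree_eq_of_le_of_coeff_ne_zero h3 (by rw [h1]; exact one_ne_zero)
      exact ⟨by rw [Monic, leadingCoeff, h4, h1], h4⟩
  simp only [e]
  have hs : MeasurableSet {f : ℝ[X] | f.coeff k = 1 ∧ ∀ i, k < i → f.coeff i = 0} := by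
    have : {f : ℝ[X] | f.coeff k = 1 ∧ ∀ i, k < i → f.coeff i = 0}
        = {f | f.coeff k = 1} ∩ ⋂ i, ⋂ _ : k < i, {f | f.coeff i = 0} := by ext; simp
    rw [this]
    exact (measurable_coeff k (measurableSet_singleton 1)).inter (MeasurableSet.iInter fun i =>
      MeasurableSet.iInter fun _ => measurable_coeff i (measurableSet_singleton 0))
  rw [chiLaw, ae_map_iff measurable_tchi.aemeasurable hs]
  refine Filter.Eventually.of_forall fun X => ?_
  rw [← e]
  exact ⟨monic_tchi X, by rw [natDegree_tchi, Fintype.card_fin]⟩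

section
variable {m : ℕ} [NeZero m]

theorem aemeasurable_facSum {ι κ : Type*} [Fintype ι] [Fintype κ] [DecidableEq ι] [DecidableEq κ]
    (h : ℝ[X] → ℝ[X] → ENNReal) (hh : Measurable fun z : ℝ[X] × ℝ[X] => h z.1 z.2) :
    AEMeasurable (fun X => facSum (Fintype.card ι) h (tchi X)) (gam m (ι ⊕ κ) (ι ⊕ κ)) := by
  have hh' : Measurable fun z : Tup m ι ι × Tup m κ κ => h (tchi z.1) (tchi z.2) :=
    hh.comp ((measurable_tchi.comp measurable_fst).prodMk (measurable_tchi.comp measurable_snd))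
  exact (measurable_ricSum_toBlk h hh').aemeasurable.congr (ae_gam_of_ae (ae_ricSum_eq_facSum h))

theorem measurePreserving_reindexTup {ι ι' : Type*} [Fintype ι] [Fintype ι']
    (e : ι ≃ ι') : MeasurePreserving (reindexTup m e) (gam m ι' ι') (gam m ι ι) :=
  measurePreserving_gam_of_gw (reindexTup m e) fun X => by
    simp only [gw, reindexTup]
    refine Finset.prod_congr rfl fun l _ => ?_
    refine (Equiv.prod_comp e fun i => ∏ j, gaussianPDF 0 1 (X l i (e j))).trans ?_
    exact Finset.prod_congr rfl fun i _ => Equiv.prod_comp e fun j => gaussianPDF 0 1 (X l i j)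

theorem measurableEmbedding_reindexTup {ι ι' : Type*} [Fintype ι] [Fintype ι'] (e : ι ≃ ι') :
    MeasurableEmbedding (reindexTup m e) :=
  (reindexTup m e).toContinuousLinearEquiv.toHomeomorph.measurableEmbedding

variable (a b k : ℕ)

theorem aemeasurable_facSum_fin (hk : a + b = k)
    (h : ℝ[X] → ℝ[X] → ENNReal) (hh : Measurable fun z : ℝ[X] × ℝ[X] => h z.1 z.2) :
    AEMeasurable (fun X => facSum a h (tchi X)) (gam m (Fin k) (Fin k)) := by
  have h1 := aemeasurable_facSum (m := m) (ι := Fin a) (κ := Fin b) h hh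
  have e : Fin k ≃ Fin a ⊕ Fin b := (finSumFinEquiv.trans (finCongr hk)).symm
  rw [Fintype.card_fin] at h1
  rw [← (measurePreserving_reindexTup e).aemeasurable_comp_iff (measurableEmbedding_reindexTup e)]
  refine h1.congr (Filter.Eventually.of_forall fun X => ?_)
  simp only [Function.comp, tchi_reindexTup]

theorem lintegral_chiLaw_prod {G : ℝ[X] × ℝ[X] → ENNReal} (hG : Measurable G) :
    ∫⁻ z, G z ∂(chiLaw m a).prod (chiLaw m b)
      = ∫⁻ p, ∫⁻ Q, G (tchi p, tchi Q) ∂gam m (Fin b) (Fin b) ∂gam m (Fin a) (Fin a) := by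
  rw [lintegral_prod _ hG.aemeasurable, lintegral_chiLaw hG.lintegral_prod_right']
  exact lintegral_congr fun p => lintegral_chiLaw (hG.comp measurable_prodMk_left)

theorem lintegral_facSum_fin (hk : a + b = k)
    (h : ℝ[X] → ℝ[X] → ENNReal) (hh : Measurable fun z : ℝ[X] × ℝ[X] => h z.1 z.2) :
    ∫⁻ X, facSum a h (tchi X) ∂gam m (Fin k) (Fin k)
      = facC m (Fin a) (Fin b) * ∫⁻ z, ENNReal.ofReal |resultant z.1 z.2 a b| * h z.1 z.2
          ∂(chiLaw m a).prod (chiLaw m b) := by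
  have e : Fin k ≃ Fin a ⊕ Fin b := (finSumFinEquiv.trans (finCongr hk)).symm
  have h0 := (measurePreserving_reindexTup (m := m) e).lintegral_comp_emb
    (measurableEmbedding_reindexTup e) (fun X => facSum a h (tchi X))
  have h1 := lintegral_facSum (m := m) (ι := Fin a) (κ := Fin b) h
    (hh.comp ((measurable_tchi.comp measurable_fst).prodMk (measurable_tchi.comp measurable_snd)))
  have h2 : ∫⁻ X, facSum a h (tchi X) ∂gam m (Fin a ⊕ Fin b) (Fin a ⊕ Fin b)
      = ∫⁻ X, facSum a h (tchi X) ∂gam m (Fin k) (Fin k) := by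
    refine Eq.trans (lintegral_congr fun X => ?_) h0
    rw [tchi_reindexTup]
  have hm : Measurable fun z : ℝ[X] × ℝ[X] =>
      ENNReal.ofReal |resultant z.1 z.2 a b| * h z.1 z.2 :=
    (measurable_abs.comp (measurable_resultant_poly a b)).ennreal_ofReal.mul hh
  rw [Fintype.card_fin, h2] at h1
  rw [h1, lintegral_chiLaw_prod a b hm]
  refine congrArg _ (lintegral_congr fun p => lintegral_congr fun Q => ?_)
  have e1 : (tchi p).natDegree = a := by rw [natDegree_tchi, Fintype.card_fin]
  have e2 : (tchi Q).natDegree = b := by rw [natDegree_tchi, Fintype.card_fin]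
  rw [e1, e2]
end

/-- The resultant of a quadratic with a polynomial of degree `2 * n`. -/
noncomputable def res2 (n : ℕ) (f g : ℝ[X]) : ℝ := resultant f g 2 (2 * n)

theorem measurable_res2 (n : ℕ) : Measurable fun z : ℝ[X] × ℝ[X] => res2 n z.1 z.2 :=
  measurable_resultant_poly 2 (2 * n)

theorem sign_eq_div_abs' (r : ℝ) : ((SignType.sign r : SignType) : ℝ) = r / |r| := by
  rcases lt_trichotomy r 0 with h | h | h
  · rw [sign_neg h, abs_of_neg h, div_neg, div_self h.ne]; simp
  · simp [h]
  · rw [sign_pos h, abs_of_pos h, div_self h.ne']; simp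

theorem facSum_eq_sum (d : ℕ) (χ : ℝ[X]) (T : Finset (ℝ[X] × ℝ[X]))
    (hT : ∀ z, z ∈ T ↔ z ∈ Fac d χ) (h : ℝ[X] → ℝ[X] → ENNReal) :
    facSum d h χ = ∑ z ∈ T, h z.1 z.2 := by
  have e : Fac d χ = (T : Set (ℝ[X] × ℝ[X])) := by ext z; simp [hT]
  rw [facSum, e]
  exact Finset.tsum_subtype T fun z => h z.1 z.2

theorem exists_finset_fac (d : ℕ) (χ : ℝ[X]) (hχ : χ ≠ 0) :
    ∃ T : Finset (ℝ[X] × ℝ[X]), ∀ z, z ∈ T ↔ z ∈ Fac d χ := by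
  have h : (Fac d χ).Finite := Set.encard_ne_top_iff.1
    ((encard_fac_le d χ hχ).trans_lt (by exact_mod_cast ENat.natCast_lt_top _)).ne
  exact ⟨h.toFinset, fun z => h.mem_toFinset⟩

/-- The signed weight `± sgn Res(f, g) H(fg)`, positive part. -/
noncomputable def sgnPart (n : ℕ) (s : ℝ) (H : ℝ[X] → ℝ) (f g : ℝ[X]) : ENNReal :=
  ENNReal.ofReal (s * (res2 n f g / |res2 n f g|) * H (f * g))

theorem measurable_sgnPart (n : ℕ) (s : ℝ) (H : ℝ[X] → ℝ) (hH : Measurable H) :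
    Measurable fun z : ℝ[X] × ℝ[X] => sgnPart n s H z.1 z.2 := by
  have h1 := measurable_res2 n
  have h2 : Measurable fun z : ℝ[X] × ℝ[X] => H (z.1 * z.2) := hH.comp measurable_mul
  exact ((((h1.div h1.abs).const_mul s)).mul h2).ennreal_ofReal

theorem sub_facSum_sgnPart (n : ℕ) (H : ℝ[X] → ℝ) (χ : ℝ[X]) (hm : χ.Monic) (hs : χ.Separable)
    (hd : χ.natDegree = 2 * (n + 1)) :
    (facSum 2 (sgnPart n 1 H) χ).toReal - (facSum 2 (sgnPart n (-1) H) χ).toReal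
      = ((n + 1 : ℕ) : ℝ) * H χ := by
  obtain ⟨T, hT⟩ := exists_finset_fac 2 χ hm.ne_zero
  rw [facSum_eq_sum 2 χ T hT, facSum_eq_sum 2 χ T hT, ENNReal.toReal_sum, ENNReal.toReal_sum,
    ← Finset.sum_sub_distrib, ← sum_sign_resultant χ hm hs (n + 1) hd T hT, Finset.sum_mul]
  · refine Finset.sum_congr rfl fun z hz => ?_
    obtain ⟨h1, h2, h3, h4⟩ := (hT z).1 hz
    have h5 : z.2.natDegree = 2 * n := by
      have := h1.natDegree_mul h2
      rw [h3, hd, h4] at this; omega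
    have h6 : resultant z.1 z.2 = res2 n z.1 z.2 := by rw [h4, h5]; rfl
    rw [h6, sign_eq_div_abs', sgnPart, sgnPart, h3, ENNReal.toReal_ofReal', ENNReal.toReal_ofReal']
    set x := res2 n z.1 z.2 / |res2 n z.1 z.2| * H χ
    have e1 : 1 * (res2 n z.1 z.2 / |res2 n z.1 z.2|) * H χ = x := by ring
    have e2 : -1 * (res2 n z.1 z.2 / |res2 n z.1 z.2|) * H χ = -x := by ring
    rw [e1, e2]
    rcases le_total 0 x with h | h
    · rw [max_eq_left h, max_eq_right (by linarith), sub_zero]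
    · rw [max_eq_right h, max_eq_left (by linarith)]; ring
  · exact fun _ _ => ENNReal.ofReal_ne_top
  · exact fun _ _ => ENNReal.ofReal_ne_top

section
variable {m : ℕ} [NeZero m]

/-- Integrating over factorizations is controlled by integrating. -/
theorem lintegral_resultant_mul_le (a b k : ℕ) (hk : a + b = k) (H : ℝ[X] → ENNReal)
    (hH : Measurable H) :
    facC m (Fin a) (Fin b) * ∫⁻ z, ENNReal.ofReal |resultant z.1 z.2 a b| * H (z.1 * z.2)
      ∂(chiLaw m a).prod (chiLaw m b) ≤ 2 ^ k * ∫⁻ f, H f ∂chiLaw m k := by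
  rw [← lintegral_facSum_fin a b k hk (fun f g => H (f * g)) (hH.comp measurable_mul),
    ← lintegral_const_mul _ hH, lintegral_chiLaw (hH.const_mul _)]
  refine lintegral_mono fun X => ?_
  have h1 : facSum a (fun f g => H (f * g)) (tchi X) = facSum a (fun _ _ => 1) (tchi X) * H (tchi X) := by
    rw [facSum, facSum, ← ENNReal.tsum_mul_right]
    refine tsum_congr fun z => ?_
    rw [one_mul, z.2.2.2.1]
  rw [h1]
  have h2 := facSum_one_ne_top a (tchi X) (monic_tchi X).ne_zero
  rw [natDegree_tchi, Fintype.card_fin] at h2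
  gcongr

theorem lintegral_facSum_sgnPart (n : ℕ) (s : ℝ) (H : ℝ[X] → ℝ) (hH : Measurable H) :
    ∫⁻ X, facSum 2 (sgnPart n s H) (tchi X) ∂gam m (Fin (2 * (n + 1))) (Fin (2 * (n + 1)))
      = facC m (Fin 2) (Fin (2 * n)) * ∫⁻ z, ENNReal.ofReal (s * (res2 n z.1 z.2 * H (z.1 * z.2)))
          ∂(chiLaw m 2).prod (chiLaw m (2 * n)) := by
  rw [lintegral_facSum_fin 2 (2 * n) (2 * (n + 1)) (by ring) _ (measurable_sgnPart n s H hH)]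
  refine congrArg _ (lintegral_congr fun z => ?_)
  change ENNReal.ofReal |res2 n z.1 z.2| * sgnPart n s H z.1 z.2 = _
  rw [sgnPart, ← ENNReal.ofReal_mul (abs_nonneg _)]
  congr 1
  rcases eq_or_ne (res2 n z.1 z.2) 0 with h | h
  · rw [h]; simp
  · field_simp

theorem lintegral_facSum_sgnPart_lt_top (n : ℕ) (s : ℝ) (hs : |s| = 1) (H : ℝ[X] → ℝ)
    (hH : Measurable H) (hi : Integrable H (chiLaw m (2 * (n + 1)))) :
    ∫⁻ X, facSum 2 (sgnPart n s H) (tchi X) ∂gam m (Fin (2 * (n + 1))) (Fin (2 * (n + 1))) < ⊤ := by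
  rw [lintegral_facSum_sgnPart n s H hH]
  have hH2 : Measurable fun f => ENNReal.ofReal |H f| := hH.abs.ennreal_ofReal
  have h1 := lintegral_resultant_mul_le (m := m) 2 (2 * n) (2 * (n + 1)) (by ring) _ hH2
  refine lt_of_le_of_lt (le_trans ?_ h1) ?_
  · gcongr with z
    rw [← ENNReal.ofReal_mul (abs_nonneg _)]
    refine ENNReal.ofReal_le_ofReal ((le_abs_self _).trans ?_)
    rw [abs_mul, abs_mul, hs, one_mul]; rfl
  · refine ENNReal.mul_lt_top (by simp) ?_
    have := hi.2
    rw [hasFiniteIntegral_iff_norm] at this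
    simpa using this

theorem integral_eq_sub_lintegral_sgn (n : ℕ) (H : ℝ[X] → ℝ) (hH : Measurable H)
    (hi : Integrable H (chiLaw m (2 * (n + 1)))) :
    ((n + 1 : ℕ) : ℝ) * ∫ f, H f ∂chiLaw m (2 * (n + 1))
      = (facC m (Fin 2) (Fin (2 * n))).toReal *
        ((∫⁻ z, ENNReal.ofReal (res2 n z.1 z.2 * H (z.1 * z.2))
          ∂(chiLaw m 2).prod (chiLaw m (2 * n))).toReal
        - (∫⁻ z, ENNReal.ofReal (-(res2 n z.1 z.2 * H (z.1 * z.2)))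
          ∂(chiLaw m 2).prod (chiLaw m (2 * n))).toReal) := by
  have e1 := lintegral_facSum_sgnPart (m := m) n 1 H hH
  have e2 := lintegral_facSum_sgnPart (m := m) n (-1) H hH
  simp only [one_mul, neg_mul] at e1 e2
  have f1 := lintegral_facSum_sgnPart_lt_top (m := m) n 1 (by simp) H hH hi
  have f2 := lintegral_facSum_sgnPart_lt_top (m := m) n (-1) (by simp) H hH hi
  have a1 := aemeasurable_facSum_fin (m := m) 2 (2 * n) (2 * (n + 1)) (by ring) _
    (measurable_sgnPart n 1 H hH)
  have a2 := aemeasurable_facSum_fin (m := m) 2 (2 * n) (2 * (n + 1)) (by ring) _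
    (measurable_sgnPart n (-1) H hH)
  rw [mul_sub, ← ENNReal.toReal_mul, ← ENNReal.toReal_mul, ← e1, ← e2,
    ← integral_toReal a1 (ae_lt_top' a1 f1.ne), ← integral_toReal a2 (ae_lt_top' a2 f2.ne),
    ← integral_sub (integrable_toReal_of_lintegral_ne_top a1 f1.ne)
      (integrable_toReal_of_lintegral_ne_top a2 f2.ne), integral_chiLaw hH, ← integral_const_mul]
  refine integral_congr_ae ?_
  filter_upwards [ae_gam_of_ae (ae_tupGood (m := m) (ι := Fin (2 * (n + 1))))] with X hX
  refine (sub_facSum_sgnPart n H (tchi X) (monic_tchi X) hX.1 ?_).symm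
  rw [natDegree_tchi, Fintype.card_fin]

/-- The constant in the signed factorization formula. -/
noncomputable def sgnC (m n : ℕ) : ℝ := (facC m (Fin 2) (Fin (2 * n))).toReal

theorem sgnC_ne_zero (n : ℕ) : sgnC m n ≠ 0 := by
  intro h
  have := integral_eq_sub_lintegral_sgn (m := m) n (fun _ => 1) measurable_const (integrable_const _)
  rw [sgnC] at h
  rw [h] at this
  simp at this
  norm_cast at this

theorem lintegral_res2_mul_le (n : ℕ) (H : ℝ[X] → ENNReal) (hH : Measurable H) :
    ∫⁻ z, ENNReal.ofReal |res2 n z.1 z.2| * H (z.1 * z.2) ∂(chiLaw m 2).prod (chiLaw m (2 * n))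
      ≤ (facC m (Fin 2) (Fin (2 * n)))⁻¹ * 2 ^ (2 * (n + 1)) * ∫⁻ f, H f ∂chiLaw m (2 * (n + 1)) := by
  have h0 := sgnC_ne_zero (m := m) n
  rw [sgnC, ENNReal.toReal_ne_zero] at h0
  have h1 := lintegral_resultant_mul_le (m := m) 2 (2 * n) (2 * (n + 1)) (by ring) H hH
  rw [mul_assoc]
  refine le_trans (le_of_eq ?_) (mul_le_mul_right h1 (facC m (Fin 2) (Fin (2 * n)))⁻¹)
  rw [← mul_assoc, ENNReal.inv_mul_cancel h0.1 h0.2, one_mul]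
  rfl

theorem lintegral_res2_const_ne_top (n : ℕ) :
    (facC m (Fin 2) (Fin (2 * n)))⁻¹ * 2 ^ (2 * (n + 1)) ≠ ⊤ := by
  have h0 := sgnC_ne_zero (m := m) n
  rw [sgnC, ENNReal.toReal_ne_zero] at h0
  exact ENNReal.mul_ne_top (ENNReal.inv_ne_top.2 h0.1) (by simp)

theorem integrable_res2_mul (n : ℕ) (H : ℝ[X] → ℝ) (hH : Measurable H)
    (hi : Integrable H (chiLaw m (2 * (n + 1)))) :
    Integrable (fun z : ℝ[X] × ℝ[X] => res2 n z.1 z.2 * H (z.1 * z.2))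
      ((chiLaw m 2).prod (chiLaw m (2 * n))) := by
  refine ⟨((measurable_res2 n).mul (hH.comp measurable_mul)).aestronglyMeasurable, ?_⟩
  rw [hasFiniteIntegral_iff_norm]
  have hH2 : Measurable fun f => ENNReal.ofReal |H f| := hH.abs.ennreal_ofReal
  refine lt_of_le_of_lt (le_trans (lintegral_mono fun z => ?_)
    (lintegral_res2_mul_le (m := m) n _ hH2)) (ENNReal.mul_lt_top
      (lt_top_iff_ne_top.2 (lintegral_res2_const_ne_top n)) ?_)
  · rw [← ENNReal.ofReal_mul (abs_nonneg _), ← abs_mul]; rfl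
  · have := hi.2
    rw [hasFiniteIntegral_iff_norm] at this
    simpa using this

/-- **Signed factorization formula**. -/
theorem integral_chiLaw_succ (n : ℕ) (H : ℝ[X] → ℝ) (hH : Measurable H)
    (hi : Integrable H (chiLaw m (2 * (n + 1)))) :
    ((n + 1 : ℕ) : ℝ) * ∫ f, H f ∂chiLaw m (2 * (n + 1))
      = sgnC m n * ∫ z, res2 n z.1 z.2 * H (z.1 * z.2) ∂(chiLaw m 2).prod (chiLaw m (2 * n)) := by
  rw [integral_eq_sub_lintegral_sgn n H hH hi, sgnC,
    integral_eq_lintegral_pos_part_sub_lintegral_neg_part (integrable_res2_mul n H hH hi)]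
end

theorem piFinSuccAbove_zero_symm {E : Type*} [MeasurableSpace E] (n : ℕ) (z : E × (Fin n → E)) :
    (MeasurableEquiv.piFinSuccAbove (fun _ : Fin (n + 1) => E) 0).symm z = Fin.cons z.1 z.2 := by
  have := congrFun (Fin.insertNth_zero' z.1 z.2)
  funext i
  exact this i

theorem lintegral_pi_succ {E : Type*} [MeasurableSpace E] (μ : Measure E) [SigmaFinite μ] (n : ℕ)
    (F : (Fin (n + 1) → E) → ENNReal) (hF : Measurable F) :
    ∫⁻ p, F p ∂Measure.pi (fun _ : Fin (n + 1) => μ)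
      = ∫⁻ z, F (Fin.cons z.1 z.2) ∂μ.prod (Measure.pi fun _ : Fin n => μ) := by
  have h := (measurePreserving_piFinSuccAbove (fun _ : Fin (n + 1) => μ) 0).symm
  rw [← h.lintegral_comp hF]
  exact lintegral_congr fun z => by rw [piFinSuccAbove_zero_symm]

theorem integral_pi_succ {E : Type*} [MeasurableSpace E] (μ : Measure E) [SigmaFinite μ] (n : ℕ)
    (F : (Fin (n + 1) → E) → ℝ) :
    ∫ p, F p ∂Measure.pi (fun _ : Fin (n + 1) => μ)
      = ∫ z, F (Fin.cons z.1 z.2) ∂μ.prod (Measure.pi fun _ : Fin n => μ) := by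
  have h := (measurePreserving_piFinSuccAbove (fun _ : Fin (n + 1) => μ) 0).symm
  rw [← h.integral_comp (MeasurableEquiv.measurableEmbedding _)]
  simp only [piFinSuccAbove_zero_symm]

/-- The product of the pairwise resultants of quadratics. -/
noncomputable def resProd : ∀ n : ℕ, (Fin n → ℝ[X]) → ℝ
  | 0, _ => 1
  | n + 1, p => res2 n (p 0) (∏ i, p (Fin.succ i)) * resProd n fun i => p (Fin.succ i)

theorem measurable_resProd : ∀ n, Measurable (resProd n)
  | 0 => measurable_const
  | n + 1 => by
    have h2 : Measurable fun (p : Fin (n + 1) → ℝ[X]) (i : Fin n) => p (Fin.succ i) := by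
      fun_prop
    have h1 : Measurable fun p : Fin (n + 1) → ℝ[X] => ∏ i : Fin n, p (Fin.succ i) :=
      Finset.measurable_fun_prod _ fun _ _ => measurable_pi_apply _
    have h3 := (measurable_res2 n).comp ((measurable_pi_apply (X := fun _ => ℝ[X])
      (0 : Fin (n + 1))).prodMk h1)
    exact h3.mul ((measurable_resProd n).comp h2)

/-- The law of independent quadratics. -/
noncomputable def quadLaw (m n : ℕ) : Measure (Fin n → ℝ[X]) := Measure.pi fun _ => chiLaw m 2

instance (m n : ℕ) : IsProbabilityMeasure (quadLaw m n) := by unfold quadLaw; infer_instance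

theorem chiLaw_zero (m : ℕ) : chiLaw m 0 = Measure.dirac 1 := by
  have : (tchi : Tup m (Fin 0) (Fin 0) → ℝ[X]) = fun _ => 1 := by
    funext X; exact Matrix.det_isEmpty
  rw [chiLaw, this, Measure.map_const]; simp

theorem measurable_prod_fin (n : ℕ) : Measurable fun p : Fin n → ℝ[X] => ∏ i, p i :=
  Finset.measurable_fun_prod _ fun _i _ => measurable_pi_apply _

section
variable {m : ℕ} [NeZero m]

theorem exists_lintegral_resProd_le (n : ℕ) : ∃ K : ENNReal, K ≠ ⊤ ∧ ∀ H : ℝ[X] → ENNReal,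
    Measurable H → ∫⁻ p, ENNReal.ofReal |resProd n p| * H (∏ i, p i) ∂quadLaw m n
      ≤ K * ∫⁻ f, H f ∂chiLaw m (2 * n) := by
  induction n with
  | zero =>
    refine ⟨1, by simp, fun H hH => ?_⟩
    rw [one_mul, mul_zero, chiLaw_zero, lintegral_dirac' _ hH]
    simp [resProd]
  | succ n ih =>
    obtain ⟨K, hK, h⟩ := ih
    refine ⟨K * ((facC m (Fin 2) (Fin (2 * n)))⁻¹ * 2 ^ (2 * (n + 1))),
      ENNReal.mul_ne_top hK (lintegral_res2_const_ne_top n), fun H hH => ?_⟩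
    have hR := (measurable_resProd n).abs.ennreal_ofReal
    have m1 : Measurable fun p => ENNReal.ofReal |resProd (n + 1) p| * H (∏ i, p i) :=
      (measurable_resProd (n + 1)).abs.ennreal_ofReal.mul (hH.comp (measurable_prod_fin _))
    have m2 : Measurable fun z : ℝ[X] × ℝ[X] => ENNReal.ofReal |res2 n z.1 z.2| * H (z.1 * z.2) :=
      (measurable_res2 n).abs.ennreal_ofReal.mul (hH.comp measurable_mul)
    have m3 : Measurable fun z : ℝ[X] × (Fin n → ℝ[X]) =>
        ENNReal.ofReal |resProd (n + 1) (Fin.cons z.1 z.2)|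
          * H (∏ i, (Fin.cons z.1 z.2 : Fin (n + 1) → ℝ[X]) i) :=
      m1.comp (by
        refine measurable_pi_lambda _ fun i => ?_
        refine Fin.cases ?_ (fun i => ?_) i
        · exact measurable_fst
        · exact (measurable_pi_apply i).comp measurable_snd)
    rw [quadLaw, lintegral_pi_succ _ _ _ m1, lintegral_prod _ m3.aemeasurable, mul_assoc]
    refine le_trans ?_ (mul_le_mul_right (lintegral_res2_mul_le (m := m) n H hH) K)
    rw [lintegral_prod _ m2.aemeasurable, ← lintegral_const_mul _ m2.lintegral_prod_right']
    refine lintegral_mono fun p => ?_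
    refine le_trans (le_of_eq (lintegral_congr fun q => ?_)) (h _ (m2.comp measurable_prodMk_left))
    simp only [resProd, Fin.cons_zero, Fin.cons_succ, Fin.prod_univ_succ, abs_mul]
    rw [ENNReal.ofReal_mul (abs_nonneg _)]
    ring

theorem integrable_resProd_mul (n : ℕ) (H : ℝ[X] → ℝ) (hH : Measurable H)
    (hi : Integrable H (chiLaw m (2 * n))) :
    Integrable (fun p => resProd n p * H (∏ i, p i)) (quadLaw m n) := by
  refine ⟨((measurable_resProd n).mul (hH.comp (measurable_prod_fin n))).aestronglyMeasurable, ?_⟩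
  rw [hasFiniteIntegral_iff_norm]
  obtain ⟨K, hK, h⟩ := exists_lintegral_resProd_le (m := m) n
  refine lt_of_le_of_lt (le_trans (lintegral_mono fun p => ?_) (h _ hH.abs.ennreal_ofReal))
    (ENNReal.mul_lt_top (lt_top_iff_ne_top.2 hK) ?_)
  · rw [← ENNReal.ofReal_mul (abs_nonneg _), ← abs_mul]; rfl
  · have := hi.2
    rw [hasFiniteIntegral_iff_norm] at this
    simpa using this

/-- The law of the characteristic polynomial as a signed mixture of products of quadratics. -/
theorem exists_integral_chiLaw_eq (n : ℕ) : ∃ c : ℝ, ∀ H : ℝ[X] → ℝ, Measurable H →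
    Integrable H (chiLaw m (2 * n)) →
    ∫ f, H f ∂chiLaw m (2 * n) = c * ∫ p, resProd n p * H (∏ i, p i) ∂quadLaw m n := by
  induction n with
  | zero =>
    refine ⟨1, fun H hH _ => ?_⟩
    rw [one_mul, mul_zero, chiLaw_zero, integral_dirac' _ _ hH.stronglyMeasurable]
    simp [resProd]
  | succ n ih =>
    obtain ⟨c, hc⟩ := ih
    refine ⟨((n + 1 : ℕ) : ℝ)⁻¹ * (sgnC m n * c), fun H hH hi => ?_⟩
    have h1 := integral_chiLaw_succ (m := m) n H hH hi
    have hI := integrable_res2_mul n H hH hi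
    rw [integral_prod _ hI] at h1
    have h2 : ∫ p, ∫ q, res2 n p q * H (p * q) ∂chiLaw m (2 * n) ∂chiLaw m 2
        = ∫ p, c * ∫ q, resProd n q * (res2 n p (∏ i, q i) * H (p * ∏ i, q i)) ∂quadLaw m n
          ∂chiLaw m 2 := by
      refine integral_congr_ae ?_
      filter_upwards [hI.prod_right_ae] with p hp
      exact hc _ (((measurable_res2 n).mul (hH.comp measurable_mul)).comp measurable_prodMk_left) hp
    have hJ := integrable_resProd_mul (m := m) (n + 1) H hH hi
    have hJ2 : Integrable (fun z : ℝ[X] × (Fin n → ℝ[X]) =>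
        resProd n z.2 * (res2 n z.1 (∏ i, z.2 i) * H (z.1 * ∏ i, z.2 i)))
        ((chiLaw m 2).prod (quadLaw m n)) := by
      have h := (measurePreserving_piFinSuccAbove (fun _ : Fin (n + 1) => chiLaw m 2) 0).symm
      refine (h.integrable_comp_of_integrable hJ).congr (Filter.Eventually.of_forall fun z => ?_)
      simp only [Function.comp, piFinSuccAbove_zero_symm, resProd, Fin.cons_zero, Fin.cons_succ, Fin.prod_univ_succ]
      ring
    have h3 : ∫ p, resProd (n + 1) p * H (∏ i, p i) ∂quadLaw m (n + 1)
        = ∫ p, ∫ q, resProd n q * (res2 n p (∏ i, q i) * H (p * ∏ i, q i)) ∂quadLaw m n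
          ∂chiLaw m 2 := by
      rw [quadLaw, integral_pi_succ, ← integral_prod _ hJ2]
      refine integral_congr_ae (Filter.Eventually.of_forall fun z => ?_)
      simp only [resProd, Fin.cons_zero, Fin.cons_succ, Fin.prod_univ_succ]
      ring
    rw [h2, integral_const_mul, ← h3] at h1
    rw [mul_assoc, mul_assoc, ← h1, ← mul_assoc, inv_mul_cancel₀ (by positivity), one_mul]
end

/-- The coefficients of `X ^ b` modulo a monic quadratic. -/
noncomputable def qr (p : ℝ[X]) : ℕ → Fin 2 → ℝ
  | 0 => ![1, 0]
  | b + 1 => ![-(p.coeff 0 * qr p b 1), qr p b 0 - p.coeff 1 * qr p b 1]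

theorem monic_quad_eq (p : ℝ[X]) (hp : p.Monic) (hd : p.natDegree = 2) :
    p = X ^ 2 + C (p.coeff 1) * X + C (p.coeff 0) := by
  conv_lhs => rw [p.as_sum_range_C_mul_X_pow, hd]
  have : p.coeff 2 = 1 := by rw [← hd]; exact hp
  simp [Finset.sum_range_succ, this]
  ring

theorem modByMonic_eq_lin (p : ℝ[X]) (hp : p.Monic) (hd : p.natDegree = 2) (q f : ℝ[X]) (u v : ℝ)
    (h : C u * X + C v + p * q = f) : f %ₘ p = C u * X + C v := by
  refine (div_modByMonic_unique q _ hp ⟨h, ?_⟩).2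
  rw [degree_eq_natDegree hp.ne_zero, hd]
  exact lt_of_le_of_lt degree_linear_le (by norm_num)

theorem X_pow_modByMonic (p : ℝ[X]) (hp : p.Monic) (hd : p.natDegree = 2) (b : ℕ) :
    (X ^ b : ℝ[X]) %ₘ p = C (qr p b 1) * X + C (qr p b 0) := by
  induction b with
  | zero => exact modByMonic_eq_lin p hp hd 0 _ _ _ (by simp [qr])
  | succ b ih =>
    have h1 := modByMonic_add_div (X ^ b) p
    rw [ih] at h1
    refine modByMonic_eq_lin p hp hd (X * (X ^ b /ₘ p) + C (qr p b 1)) _ _ _ ?_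
    have h2 := monic_quad_eq p hp hd
    simp only [qr, Matrix.cons_val_zero, Matrix.cons_val_one, C_neg, C_sub, C_mul]
    rw [pow_succ']
    linear_combination X * h1 + C (qr p b 1) * h2

theorem coeff_X_pow_modByMonic (p : ℝ[X]) (hp : p.Monic) (hd : p.natDegree = 2) (b : ℕ) (s : Fin 2) :
    ((X ^ b : ℝ[X]) %ₘ p).coeff s = qr p b s := by
  rw [X_pow_modByMonic p hp hd]
  fin_cases s <;> simp

theorem det_coeff_of_monic {n : ℕ} (q : Fin 2 × Fin n → ℝ[X]) (hm : ∀ b, (q b).Monic)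
    (hd : ∀ b, (q b).natDegree = 2 * (b.2 : ℕ) + b.1) :
    (Matrix.of fun b b' : Fin 2 × Fin n => (q b').coeff (2 * (b.2 : ℕ) + b.1)).det = 1 := by
  let e : Fin 2 × Fin n ≃ Fin (n * 2) := (Equiv.prodComm _ _).trans finProdFinEquiv
  have he : ∀ b, ((e b : Fin (n * 2)) : ℕ) = 2 * (b.2 : ℕ) + b.1 := fun b => by
    simp [e, finProdFinEquiv]; ring
  rw [← Matrix.det_submatrix_equiv_self e.symm, Matrix.det_of_isUpperTriangular]
  · refine Finset.prod_eq_one fun i _ => ?_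
    simp only [Matrix.submatrix_apply, Matrix.of_apply]
    rw [← hd]; exact hm _
  · intro i j hij
    simp only [Matrix.submatrix_apply, Matrix.of_apply]
    refine coeff_eq_zero_of_natDegree_lt ?_
    rw [hd, ← he, ← he]
    simpa using hij

/-- The matrix of the reduction of polynomials of degree less than `2 n` modulo `n` quadratics. -/
noncomputable def redMat {n : ℕ} (p : Fin n → ℝ[X]) : Matrix (Fin 2 × Fin n) (Fin 2 × Fin n) ℝ :=
  Matrix.of fun r b => qr (p r.2) (2 * (b.2 : ℕ) + b.1) r.1

theorem det_redMat_eq_of_monic {n : ℕ} (p : Fin n → ℝ[X]) (hp : ∀ i, (p i).Monic)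
    (hpd : ∀ i, (p i).natDegree = 2) (q : Fin 2 × Fin n → ℝ[X]) (hm : ∀ b, (q b).Monic)
    (hd : ∀ b, (q b).natDegree = 2 * (b.2 : ℕ) + b.1) :
    (redMat p).det = (Matrix.of fun r b : Fin 2 × Fin n => (q b %ₘ p r.2).coeff r.1).det := by
  rw [← mul_one (redMat p).det, ← det_coeff_of_monic q hm hd, ← Matrix.det_mul]
  congr 1
  ext r b'
  simp only [Matrix.mul_apply, redMat, Matrix.of_apply]
  have h1 : q b' = ∑ b : Fin 2 × Fin n, C ((q b').coeff (2 * (b.2 : ℕ) + b.1))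
      * X ^ (2 * (b.2 : ℕ) + b.1) := by
    let e : Fin 2 × Fin n ≃ Fin (n * 2) := (Equiv.prodComm _ _).trans finProdFinEquiv
    have he : ∀ b, ((e b : Fin (n * 2)) : ℕ) = 2 * (b.2 : ℕ) + b.1 := fun b => by
      simp [e, finProdFinEquiv]; ring
    have h2 : (q b').natDegree < n * 2 := by rw [hd, ← he]; exact (e b').2
    conv_lhs => rw [(q b').as_sum_range_C_mul_X_pow' h2, Finset.sum_range]
    rw [← Equiv.sum_comp e]
    simp only [he]
  have h3 : q b' %ₘ p r.2 = ∑ b : Fin 2 × Fin n, ((q b').coeff (2 * (b.2 : ℕ) + b.1)) •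
      ((X ^ (2 * (b.2 : ℕ) + (b.1 : ℕ)) : ℝ[X]) %ₘ p r.2) := by
    have : ∀ f, f %ₘ p r.2 = modByMonicHom (p r.2) f := fun f => rfl
    rw [this]
    conv_lhs => rw [h1]
    rw [map_sum]
    refine Finset.sum_congr rfl fun b _ => ?_
    rw [← smul_eq_C_mul, map_smul, this]
  rw [h3, finsetSum_coeff]
  refine Finset.sum_congr rfl fun b _ => ?_
  rw [coeff_smul, coeff_X_pow_modByMonic _ (hp _) (hpd _), smul_eq_mul, mul_comm]

theorem resultant_quad (f g : ℝ[X]) (hf : f.Monic) (hfd : f.natDegree = 2) (hg : g.Monic)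
    (hgd : g.natDegree = 2) : resultant f g 2 2 =
    (f.coeff 0 - g.coeff 0) ^ 2 - g.coeff 1 * (f.coeff 1 - g.coeff 1) * (f.coeff 0 - g.coeff 0)
      + g.coeff 0 * (f.coeff 1 - g.coeff 1) ^ 2 := by
  have h1 : f.coeff 2 = 1 := by rw [← hfd]; exact hf
  have h2 : g.coeff 2 = 1 := by rw [← hgd]; exact hg
  rw [resultant, Matrix.det_succ_row_zero]
  simp [sylvester, Fin.sum_univ_succ, Matrix.det_succ_row_zero, Fin.addCases, Fin.succAbove, h1, h2]
  ring

/-- Multiplication by the quadratic `f` modulo the quadratic `p`. -/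
noncomputable def mulModMat (f p : ℝ[X]) : Matrix (Fin 2) (Fin 2) ℝ :=
  !![f.coeff 0 - p.coeff 0, -(p.coeff 0 * (f.coeff 1 - p.coeff 1));
    f.coeff 1 - p.coeff 1, f.coeff 0 - p.coeff 0 - p.coeff 1 * (f.coeff 1 - p.coeff 1)]

theorem coeff_mul_X_pow_modByMonic (f p : ℝ[X]) (hf : f.Monic) (hfd : f.natDegree = 2)
    (hp : p.Monic) (hd : p.natDegree = 2) (b : ℕ) (s : Fin 2) :
    ((f * X ^ b : ℝ[X]) %ₘ p).coeff s = ∑ s', mulModMat f p s s' * qr p b s' := by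
  have h1 := modByMonic_add_div (X ^ b) p
  rw [X_pow_modByMonic p hp hd] at h1
  have h2 := monic_quad_eq p hp hd
  have h3 := monic_quad_eq f hf hfd
  have h4 : ((f * X ^ b : ℝ[X]) %ₘ p) = C (mulModMat f p 1 0 * qr p b 0
      + mulModMat f p 1 1 * qr p b 1) * X + C (mulModMat f p 0 0 * qr p b 0
      + mulModMat f p 0 1 * qr p b 1) := by
    refine modByMonic_eq_lin p hp hd (C (qr p b 1) * X + C (qr p b 0)
      + (X ^ b /ₘ p) * f + C ((f.coeff 1 - p.coeff 1) * qr p b 1)) _ _ _ ?_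
    simp only [mulModMat, Matrix.of_apply, Matrix.cons_val_zero, Matrix.cons_val_one, C_neg, C_sub,
      C_mul, C_add, Matrix.cons_val', Matrix.cons_val_fin_one]
    linear_combination f * h1 + (C (qr p b 1) * X + C (qr p b 0)) * (h2 - h3)
      + C (qr p b 1) * (C (f.coeff 1) - C (p.coeff 1)) * h2
  rw [h4, Fin.sum_univ_two]
  fin_cases s <;> simp

theorem det_mulModMat (f p : ℝ[X]) (hf : f.Monic) (hfd : f.natDegree = 2)
    (hp : p.Monic) (hd : p.natDegree = 2) : (mulModMat f p).det = resultant f p 2 2 := by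
  rw [resultant_quad f p hf hfd hp hd, mulModMat, Matrix.det_fin_two_of]
  ring

/-- Splitting off the first slot. -/
def slotEquiv (n : ℕ) : Fin 2 ⊕ (Fin 2 × Fin n) ≃ Fin 2 × Fin (n + 1) where
  toFun := Sum.elim (fun s => (s, 0)) fun z => (z.1, z.2.succ)
  invFun z := Fin.cases (Sum.inl z.1) (fun i => Sum.inr (z.1, i)) z.2
  left_inv z := by rcases z with s | z <;> rfl
  right_inv z := by
    obtain ⟨s, i⟩ := z
    refine Fin.cases ?_ (fun i => ?_) i <;> rfl

theorem natDegree_prod_quad {n : ℕ} (p : Fin n → ℝ[X]) (hp : ∀ i, (p i).Monic)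
    (hd : ∀ i, (p i).natDegree = 2) : (∏ i, p i).natDegree = 2 * n := by
  rw [natDegree_prod_of_monic _ _ fun i _ => hp i]
  simp [hd, mul_comm]

theorem res2_prod {n : ℕ} (f : ℝ[X]) (p : Fin n → ℝ[X]) (hfd : f.natDegree = 2)
    (hp : ∀ i, (p i).Monic) (hd : ∀ i, (p i).natDegree = 2) :
    res2 n f (∏ i, p i) = ∏ i, resultant f (p i) 2 2 := by
  have h := resultant_prod_right Finset.univ f p 2 hfd.le (by simp [fun i => (hp i).leadingCoeff])
  rw [natDegree_prod_quad p hp hd] at h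
  simp only [hd] at h
  exact h

theorem det_redMat : ∀ (n : ℕ) (p : Fin n → ℝ[X]), (∀ i, (p i).Monic) →
    (∀ i, (p i).natDegree = 2) → (redMat p).det = resProd n p
  | 0, p, _, _ => by simp [resProd]
  | n + 1, p, hp, hd => by
    rw [det_redMat_eq_of_monic p hp hd (fun b => Fin.cases (X ^ (b.1 : ℕ))
        (fun j => p 0 * X ^ (2 * (j : ℕ) + (b.1 : ℕ))) b.2),
      ← Matrix.det_submatrix_equiv_self (slotEquiv n), resProd,
      ← det_redMat n _ (fun i => hp _) (fun i => hd _), res2_prod _ _ (hd 0) (fun i => hp _)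
      fun i => hd _]
    · set D : Matrix (Fin 2 × Fin n) (Fin 2 × Fin n) ℝ :=
        Matrix.blockDiagonal fun i : Fin n => mulModMat (p 0) (p i.succ)
      trans (Matrix.fromBlocks (1 : Matrix (Fin 2) (Fin 2) ℝ) 0
        (Matrix.of fun r s => qr (p r.2.succ) s r.1) (D * redMat fun i => p i.succ)).det
      · congr 1
        ext r b
        rcases r with s | ⟨s, i⟩ <;> rcases b with t | ⟨t, j⟩
        · simp only [slotEquiv, Matrix.submatrix_apply, Equiv.coe_fn_mk, Sum.elim_inl, Matrix.of_apply,
            Fin.cases_zero, Matrix.fromBlocks_apply₁₁]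
          rw [coeff_X_pow_modByMonic _ (hp _) (hd _)]
          fin_cases s <;> fin_cases t <;> simp [qr]
        · simp only [slotEquiv, Matrix.submatrix_apply, Equiv.coe_fn_mk, Sum.elim_inl, Matrix.of_apply,
            Fin.cases_succ, Matrix.fromBlocks_apply₁₂, Sum.elim_inr]
          rw [(modByMonic_eq_zero_iff_dvd (hp 0)).2 (dvd_mul_right _ _)]
          simp
        · simp only [slotEquiv, Matrix.submatrix_apply, Equiv.coe_fn_mk, Sum.elim_inl, Matrix.of_apply,
            Fin.cases_zero, Matrix.fromBlocks_apply₂₁, Sum.elim_inr]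
          rw [coeff_X_pow_modByMonic _ (hp _) (hd _)]
        · simp only [slotEquiv, Matrix.submatrix_apply, Equiv.coe_fn_mk, Matrix.of_apply,
            Fin.cases_succ, Matrix.fromBlocks_apply₂₂, Sum.elim_inr]
          rw [coeff_mul_X_pow_modByMonic _ _ (hp _) (hd _) (hp _) (hd _), Matrix.mul_apply,
            Fintype.sum_prod_type]
          refine Finset.sum_congr rfl fun s' _ => ?_
          rw [Finset.sum_eq_single i]
          · simp [D, redMat, Matrix.blockDiagonal_apply]
          · intro k _ hk; simp [D, Matrix.blockDiagonal_apply, Ne.symm hk]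
          · simp
      · rw [Matrix.det_fromBlocks_zero₁₂, Matrix.det_one, one_mul, Matrix.det_mul,
          Matrix.det_blockDiagonal]
        congr 1
        exact Finset.prod_congr rfl fun i _ => det_mulModMat _ _ (hp _) (hd _) (hp _) (hd _)
    · rintro ⟨t, j⟩
      refine Fin.cases ?_ (fun j => ?_) j
      · exact monic_X_pow _
      · exact (hp 0).mul (monic_X_pow _)
    · rintro ⟨t, j⟩
      refine Fin.cases ?_ (fun j => ?_) j
      · simp
      · simp only [Fin.cases_succ]
        rw [(hp 0).natDegree_mul (monic_X_pow _), hd, natDegree_X_pow, Fin.val_succ]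
        ring

/-- The discriminant of a monic quadratic. -/
noncomputable def dsc (f : ℝ[X]) : ℝ := f.coeff 1 ^ 2 - 4 * f.coeff 0

theorem measurable_dsc : Measurable dsc :=
  ((measurable_coeff 1).pow_const 2).sub ((measurable_coeff 0).const_mul 4)

/-- The weight of a quadratic: `z` when it has two real roots and `1` otherwise. -/
noncomputable def wq (z : ℝ) (f : ℝ[X]) : ℝ := if 0 < dsc f then z else 1

theorem measurable_wq (z : ℝ) : Measurable (wq z) :=
  Measurable.ite (measurableSet_lt measurable_const measurable_dsc) measurable_const
    measurable_const

theorem nroots_quad (p : ℝ[X]) (hp : p.Monic) (hd : p.natDegree = 2) (h0 : dsc p ≠ 0) :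
    nroots p = if 0 < dsc p then 2 else 0 := by
  have h2 := monic_quad_eq p hp hd
  split_ifs with h
  · set s := √(dsc p)
    have hs : s ^ 2 = dsc p := Real.sq_sqrt h.le
    have hs0 : s ≠ 0 := (Real.sqrt_pos.2 h).ne'
    have e : p = (X - C ((-p.coeff 1 + s) / 2)) * (X - C ((-p.coeff 1 - s) / 2)) := by
      have e1 : C ((-p.coeff 1 + s) / 2) + C ((-p.coeff 1 - s) / 2) = (-C (p.coeff 1) : ℝ[X]) := by
        rw [← C_add, ← C_neg]; congr 1; ring
      have e2 : C ((-p.coeff 1 + s) / 2) * C ((-p.coeff 1 - s) / 2) = (C (p.coeff 0) : ℝ[X]) := by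
        rw [← C_mul]; congr 1
        have : p.coeff 0 = (p.coeff 1 ^ 2 - s ^ 2) / 4 := by rw [hs, dsc]; ring
        rw [this]; ring
      conv_lhs => rw [h2]
      linear_combination X * e1 - e2
    rw [nroots, e, roots_mul (by rw [← e]; exact hp.ne_zero), roots_X_sub_C, roots_X_sub_C,
      Multiset.toFinset_add, Multiset.toFinset_singleton, Multiset.toFinset_singleton,
      Finset.card_union_of_disjoint, Finset.card_singleton, Finset.card_singleton]
    rw [Finset.disjoint_singleton]
    intro h
    apply hs0
    linarith
  · rw [nroots, Finset.card_eq_zero, Multiset.toFinset_eq_empty, Multiset.eq_zero_iff_forall_notMem]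
    intro x hx
    have hx : p.eval x = 0 := (mem_roots'.1 hx).2
    rw [h2] at hx
    simp only [eval_add, eval_pow, eval_X, eval_mul, eval_C] at hx
    have : dsc p < 0 := lt_of_le_of_ne (not_lt.1 h) h0
    unfold dsc at this
    nlinarith [sq_nonneg (2 * x + p.coeff 1)]

theorem dsc_ne_zero_of_separable (p : ℝ[X]) (hp : p.Monic) (hd : p.natDegree = 2)
    (hs : p.Separable) : dsc p ≠ 0 := by
  intro h
  have e : p = (X + C (p.coeff 1 / 2)) * (X + C (p.coeff 1 / 2)) := by
    conv_lhs => rw [monic_quad_eq p hp hd]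
    have e1 : C (p.coeff 1 / 2) + C (p.coeff 1 / 2) = (C (p.coeff 1) : ℝ[X]) := by
      rw [← C_add]; congr 1; ring
    have e2 : C (p.coeff 1 / 2) * C (p.coeff 1 / 2) = (C (p.coeff 0) : ℝ[X]) := by
      rw [← C_mul]; congr 1
      unfold dsc at h; linarith
    linear_combination -X * e1 - e2
  have := hs.squarefree _ (dvd_of_eq e.symm)
  exact (irreducible_of_degree_eq_one (degree_X_add_C _)).not_isUnit this

theorem nroots_mul_of_isCoprime (f g : ℝ[X]) (hf : f ≠ 0) (hg : g ≠ 0) (h : IsCoprime f g) :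
    nroots (f * g) = nroots f + nroots g := by
  rw [nroots, roots_mul (mul_ne_zero hf hg), Multiset.toFinset_add, Finset.card_union_of_disjoint]
  · rfl
  · rw [Finset.disjoint_left]
    intro x hx hy
    obtain ⟨a, b, hab⟩ := h
    have hx : f.eval x = 0 := (mem_roots'.1 (Multiset.mem_toFinset.1 hx)).2
    have hy : g.eval x = 0 := (mem_roots'.1 (Multiset.mem_toFinset.1 hy)).2
    have := congrArg (eval x) hab
    simp [hx, hy] at this

theorem nroots_prod_quad : ∀ (n : ℕ) (p : Fin n → ℝ[X]), (∀ i, (p i).Monic) →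
    (∀ i, (p i).natDegree = 2) → (∀ i, dsc (p i) ≠ 0) → resProd n p ≠ 0 →
    nroots (∏ i, p i) = 2 * ∑ i, if 0 < dsc (p i) then 1 else 0
  | 0, p, _, _, _, _ => by simp [nroots]
  | n + 1, p, hp, hd, h0, hR => by
    rw [resProd] at hR
    have ih := nroots_prod_quad n (fun i => p i.succ) (fun i => hp _) (fun i => hd _)
      (fun i => h0 _) (right_ne_zero_of_mul hR)
    have hdg := natDegree_prod_quad (fun i : Fin n => p i.succ) (fun i => hp _) (fun i => hd _)
    have hmn : (∏ i : Fin n, p i.succ).Monic := monic_prod_of_monic _ _ fun i _ => hp _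
    have hc : IsCoprime (p 0) (∏ i : Fin n, p i.succ) := by
      rw [← isUnit_resultant_iff_isCoprime (hp 0), isUnit_iff_ne_zero, hd, hdg]
      exact left_ne_zero_of_mul hR
    rw [Fin.prod_univ_succ, nroots_mul_of_isCoprime _ _ (hp 0).ne_zero hmn.ne_zero hc, ih,
      nroots_quad _ (hp 0) (hd 0) (h0 0), Fin.sum_univ_succ, mul_add]
    congr 1
    split_ifs <;> rfl

theorem pow_nroots_prod_quad {n : ℕ} (z : ℝ) (p : Fin n → ℝ[X]) (hp : ∀ i, (p i).Monic)
    (hd : ∀ i, (p i).natDegree = 2) (h0 : ∀ i, dsc (p i) ≠ 0) :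
    resProd n p * z ^ (nroots (∏ i, p i) / 2) = resProd n p * ∏ i, wq z (p i) := by
  by_cases hR : resProd n p = 0
  · rw [hR, zero_mul, zero_mul]
  · rw [nroots_prod_quad n p hp hd h0 hR, Nat.mul_div_cancel_left _ two_pos,
      ← Finset.prod_pow_eq_pow_sum]
    congr 1
    refine Finset.prod_congr rfl fun i _ => ?_
    unfold wq
    split_ifs <;> simp

theorem ae_chiLaw_dsc (m : ℕ) [NeZero m] : ∀ᵐ f ∂chiLaw m 2, dsc f ≠ 0 := by
  rw [chiLaw, ae_map_iff (p := fun f => dsc f ≠ 0) measurable_tchi.aemeasurable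
    (measurable_dsc (measurableSet_singleton 0)).compl]
  filter_upwards [ae_gam_of_ae ae_tupGood] with X hX
  exact dsc_ne_zero_of_separable _ (monic_tchi X) (by rw [natDegree_tchi, Fintype.card_fin]) hX.1

theorem ae_quadLaw (m n : ℕ) [NeZero m] : ∀ᵐ p ∂quadLaw m n,
    ∀ i, (p i).Monic ∧ (p i).natDegree = 2 ∧ dsc (p i) ≠ 0 := by
  rw [ae_all_iff]
  intro i
  refine (measurePreserving_eval (fun _ : Fin n => chiLaw m 2) i).quasiMeasurePreserving.ae
    (p := fun f => f.Monic ∧ f.natDegree = 2 ∧ dsc f ≠ 0) ?_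
  filter_upwards [ae_chiLaw_monic m 2, ae_chiLaw_dsc m] with f h1 h2
  exact ⟨h1.1, h1.2, h2⟩

theorem nroots_le (f : ℝ[X]) : nroots f ≤ f.natDegree :=
  (Multiset.toFinset_card_le _).trans (card_roots' f)

/-- The generating function of the number of real roots. -/
noncomputable def genFun (m n : ℕ) (z : ℝ) : ℝ := ∫ f, z ^ (nroots f / 2) ∂chiLaw m (2 * n)

theorem measurable_pow_nroots (z : ℝ) : Measurable fun f : ℝ[X] => z ^ (nroots f / 2) :=
  (Measurable.of_discrete (f := fun k : ℕ => z ^ (k / 2))).comp measurable_nroots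

theorem integrable_pow_nroots (m n : ℕ) [NeZero m] (z : ℝ) :
    Integrable (fun f : ℝ[X] => z ^ (nroots f / 2)) (chiLaw m (2 * n)) := by
  refine Integrable.of_bound (measurable_pow_nroots z).aestronglyMeasurable ((1 + |z|) ^ n) ?_
  filter_upwards [ae_chiLaw_monic m (2 * n)] with f hf
  have h : nroots f / 2 ≤ n := by have := nroots_le f; rw [hf.2] at this; omega
  rw [norm_pow, Real.norm_eq_abs]
  exact (pow_le_pow_left₀ (abs_nonneg z) (by linarith) _).trans
    (pow_le_pow_right₀ (by linarith [abs_nonneg z]) h)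

theorem exists_genFun_eq (m n : ℕ) [NeZero m] : ∃ c : ℝ, ∀ z, genFun m n z
    = c * ∫ p, (redMat p).det * ∏ i, wq z (p i) ∂quadLaw m n := by
  obtain ⟨c, hc⟩ := exists_integral_chiLaw_eq (m := m) n
  refine ⟨c, fun z => ?_⟩
  rw [genFun, hc _ (measurable_pow_nroots z) (integrable_pow_nroots m n z)]
  congr 1
  refine integral_congr_ae ?_
  filter_upwards [ae_quadLaw m n] with p hp
  rw [pow_nroots_prod_quad z p (fun i => (hp i).1) (fun i => (hp i).2.1) fun i => (hp i).2.2,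
    det_redMat n p (fun i => (hp i).1) fun i => (hp i).2.1]

section Pfaffian
variable {n : ℕ}

/-- The alternating sum of products of two-variable kernels over all arrangements. -/
noncomputable def altSum (F : Fin n → Fin n ⊕ Fin n → Fin n ⊕ Fin n → ℝ) : ℝ :=
  ∑ σ : Equiv.Perm (Fin n ⊕ Fin n), (Equiv.Perm.sign σ : ℝ) *
    ∏ i, F i (σ (Sum.inl i)) (σ (Sum.inr i))

theorem altSum_eq_zero_of_symm (F : Fin n → Fin n ⊕ Fin n → Fin n ⊕ Fin n → ℝ) (a : Fin n)
    (h : ∀ x y, F a x y = F a y x) : altSum F = 0 := by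
  have e : altSum F = -altSum F := by
    conv_lhs => rw [altSum, ← Equiv.sum_comp (Equiv.mulRight (Equiv.swap (Sum.inl a) (Sum.inr a)))]
    rw [altSum, ← Finset.sum_neg_distrib]
    refine Finset.sum_congr rfl fun σ _ => ?_
    simp only [Equiv.coe_mulRight, Equiv.Perm.sign_mul, Equiv.Perm.sign_swap (Sum.inl_ne_inr : (Sum.inl a : Fin n ⊕ Fin n) ≠ Sum.inr a),
      Equiv.Perm.mul_apply]
    push_cast
    rw [mul_neg_one, neg_mul]
    congr 2
    refine Finset.prod_congr rfl fun i _ => ?_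
    by_cases hi : i = a
    · subst hi
      rw [Equiv.swap_apply_left, Equiv.swap_apply_right, h]
    · rw [Equiv.swap_apply_of_ne_of_ne, Equiv.swap_apply_of_ne_of_ne] <;> simp [hi]
  linarith

theorem altSum_update_sub (F : Fin n → Fin n ⊕ Fin n → Fin n ⊕ Fin n → ℝ) (a : Fin n)
    (G : Fin n ⊕ Fin n → Fin n ⊕ Fin n → ℝ) :
    altSum F - altSum (Function.update F a G) = altSum (Function.update F a (F a - G)) := by
  simp only [altSum, ← Finset.sum_sub_distrib]
  refine Finset.sum_congr rfl fun σ _ => ?_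
  rw [← mul_sub]
  congr 1
  rw [← Finset.mul_prod_erase _ _ (Finset.mem_univ a), ← Finset.mul_prod_erase _ _ (Finset.mem_univ a),
    ← Finset.mul_prod_erase Finset.univ (fun i => Function.update F a (F a - G) i _ _) (Finset.mem_univ a)]
  have h : ∀ K : Fin n ⊕ Fin n → Fin n ⊕ Fin n → ℝ, ∏ i ∈ Finset.univ.erase a,
      Function.update F a K i (σ (Sum.inl i)) (σ (Sum.inr i)) = ∏ i ∈ Finset.univ.erase a,
      F i (σ (Sum.inl i)) (σ (Sum.inr i)) := fun K => Finset.prod_congr rfl fun i hi => by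
    rw [Function.update_of_ne (Finset.ne_of_mem_erase hi)]
  rw [h, h, Function.update_self, Function.update_self, Pi.sub_apply, Pi.sub_apply, sub_mul]

theorem altSum_congr_symm (F G : Fin n → Fin n ⊕ Fin n → Fin n ⊕ Fin n → ℝ)
    (h : ∀ i x y, F i x y - G i x y = F i y x - G i y x) : altSum F = altSum G := by
  have key : ∀ S : Finset (Fin n), altSum F = altSum fun i => if i ∈ S then G i else F i := by
    intro S
    induction S using Finset.induction_on with
    | empty => simp
    | insert a S ha ih =>
      rw [ih]
      have e : (fun i => if i ∈ insert a S then G i else F i)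
          = Function.update (fun i => if i ∈ S then G i else F i) a (G a) := by
        funext i
        by_cases hi : i = a
        · subst hi; simp
        · simp [hi]
      rw [e, ← sub_eq_zero, altSum_update_sub]
      refine altSum_eq_zero_of_symm _ a fun x y => ?_
      simp only [Function.update_self, ha, if_false, Pi.sub_apply]
      exact h a x y
  simpa using key Finset.univ

theorem altSum_bipartite (φ : Matrix (Fin n) (Fin n) ℝ) :
    altSum (fun _ x y => Sum.elim (fun i => Sum.elim (fun _ => 0) (fun j => φ i j) y)
      (fun _ => 0) x) = n.factorial * φ.det := by
  classical
  have h1 : altSum (fun _ : Fin n => fun x y : Fin n ⊕ Fin n =>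
      Sum.elim (fun i => Sum.elim (fun _ => 0) (fun j => φ i j) y) (fun _ => 0) x)
      = ∑ s : Equiv.Perm (Fin n) × Equiv.Perm (Fin n), (Equiv.Perm.sign s.1 : ℝ) *
        (Equiv.Perm.sign s.2 : ℝ) * ∏ i, φ (s.1 i) (s.2 i) := by
    symm
    rw [altSum]
    refine Finset.sum_of_injOn (fun s => Equiv.Perm.sumCongr s.1 s.2) ?_ (by simp) ?_ ?_
    · intro a _ b _ hab
      exact Equiv.Perm.sumCongrHom_injective hab
    · intro σ _ hσ
      by_cases h : ∀ i, (σ (Sum.inl i)).isLeft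
      · exfalso
        apply hσ
        have : σ ∈ (Equiv.Perm.sumCongrHom (Fin n) (Fin n)).range := by
          apply Equiv.Perm.mem_sumCongrHom_range_of_perm_mapsTo_inl
          rintro _ ⟨i, rfl⟩
          have := h i
          rw [Sum.isLeft_iff] at this
          obtain ⟨y, hy⟩ := this
          exact ⟨y, hy.symm⟩
        obtain ⟨s, hs⟩ := this
        exact ⟨s, by simp, hs⟩
      · push Not at h
        obtain ⟨i, hi⟩ := h
        rw [Finset.prod_eq_zero (Finset.mem_univ i), mul_zero]
        cases hc : σ (Sum.inl i) with
        | inl y => rw [hc] at hi; simp at hi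
        | inr y => rfl
    · intro s _
      simp [Equiv.Perm.sumCongr]
  rw [h1, Fintype.sum_prod_type]
  have h2 : ∀ s : Equiv.Perm (Fin n), ∑ t : Equiv.Perm (Fin n), (Equiv.Perm.sign s : ℝ) *
      (Equiv.Perm.sign t : ℝ) * ∏ i, φ (s i) (t i) = φ.det := by
    intro s
    rw [← Matrix.det_transpose, Matrix.det_apply', ← Equiv.sum_comp (Equiv.mulRight s)]
    refine Finset.sum_congr rfl fun t _ => ?_
    rw [Equiv.coe_mulRight, Equiv.Perm.sign_mul]
    rw [← Equiv.prod_comp s (fun i => φᵀ (t i) i)]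
    have h3 : (Equiv.Perm.sign s : ℝ) * (Equiv.Perm.sign s : ℝ) = 1 := by
      rw [← Int.cast_mul, Int.cast_eq_one, ← Units.val_mul, Int.units_mul_self, Units.val_one]
    push_cast
    simp only [Matrix.transpose_apply, Function.comp_apply]
    linear_combination ((Equiv.Perm.sign t : ℝ) * ∏ i, φ (s i) (t (s i))) * h3
  simp only [h2]
  simp [Fintype.card_perm]
end Pfaffian

end

section

open Matrix Polynomial
open scoped ENNReal

/-- All moments are finite. -/
def AllMom {Ω : Type*} [MeasurableSpace Ω] (μ : Measure Ω) (f : Ω → ℝ) : Prop :=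
  ∀ k : ℕ, MemLp f k μ

section AllMom
variable {Ω : Type*} [MeasurableSpace Ω] {μ : Measure Ω} {f g : Ω → ℝ}

theorem AllMom.integrable (h : AllMom μ f) : Integrable f μ := by
  have := h 1; rwa [Nat.cast_one, memLp_one_iff_integrable] at this

theorem AllMom.add (hf : AllMom μ f) (hg : AllMom μ g) : AllMom μ fun x => f x + g x :=
  fun k => (hf k).add (hg k)

theorem AllMom.neg (hf : AllMom μ f) : AllMom μ fun x => -f x := fun k => (hf k).neg

theorem AllMom.sub (hf : AllMom μ f) (hg : AllMom μ g) : AllMom μ fun x => f x - g x :=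
  fun k => (hf k).sub (hg k)

theorem AllMom.mul (hf : AllMom μ f) (hg : AllMom μ g) : AllMom μ fun x => f x * g x := by
  intro k
  have : ENNReal.HolderTriple ((2 * k : ℕ) : ℝ≥0∞) ((2 * k : ℕ) : ℝ≥0∞) (k : ℝ≥0∞) := by
    constructor
    push_cast
    rw [ENNReal.mul_inv (by simp) (by simp), ← two_mul, ← mul_assoc,
      ENNReal.mul_inv_cancel (by simp) (by simp), one_mul]
  exact MemLp.mul' (hg (2 * k)) (hf (2 * k))

theorem AllMom.sum {ι : Type*} (s : Finset ι) {f : ι → Ω → ℝ} (h : ∀ i ∈ s, AllMom μ (f i)) :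
    AllMom μ fun x => ∑ i ∈ s, f i x := fun k => memLp_finsetSum s fun i hi => h i hi k

theorem AllMom.of_bound [IsFiniteMeasure μ] (hm : Measurable f) (C : ℝ) (h : ∀ x, |f x| ≤ C) :
    AllMom μ f := fun _ => MemLp.of_bound hm.aestronglyMeasurable C (Filter.Eventually.of_forall h)

theorem AllMom.comp {Ω' : Type*} [MeasurableSpace Ω'] {ν : Measure Ω'} {T : Ω' → Ω}
    (hf : AllMom μ f) (hT : MeasurePreserving T ν μ) : AllMom ν fun x => f (T x) :=
  fun k => (hf k).comp_measurePreserving hT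

theorem AllMom.of_map {Ω' : Type*} [MeasurableSpace Ω'] {ν : Measure Ω'} {T : Ω' → Ω}
    (hT : Measurable T) (hf : Measurable f) (h : AllMom ν fun x => f (T x)) :
    AllMom (ν.map T) f := fun k =>
  (memLp_map_measure_iff hf.aestronglyMeasurable hT.aemeasurable).2 (h k)

theorem allMom_gaussian : AllMom (gaussianReal 0 1) fun x => x := fun k => by
  have := memLp_id_gaussianReal (μ := 0) (v := 1) (k : NNReal)
  rwa [ENNReal.coe_natCast] at this

theorem allMom_prod_ofFn {κ : Type*} [Fintype κ] [DecidableEq κ] [IsFiniteMeasure μ] :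
    ∀ (k : ℕ) (A : Ω → Fin k → Matrix κ κ ℝ), (∀ l i j, AllMom μ fun x => A x l i j) →
    ∀ i j, AllMom μ fun x => (List.ofFn (A x)).prod i j
  | 0, A, _, i, j => by
    simp only [List.ofFn_zero, List.prod_nil]
    exact AllMom.of_bound measurable_const _ fun _ => le_rfl
  | k + 1, A, h, i, j => by
    have ih := allMom_prod_ofFn k (fun x l => A x l.succ) fun l => h l.succ
    simp only [List.ofFn_succ, List.prod_cons, Matrix.mul_apply]
    exact AllMom.sum _ fun s _ => (h 0 i s).mul (ih s j)
end AllMom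

theorem allMom_entry {m : ℕ} {ι κ : Type*} [Fintype ι] [Fintype κ] (l : Fin m) (i : ι) (j : κ) :
    AllMom (gam m ι κ) fun X => tm X l i j := by
  have h1 : MeasurePreserving (fun X : Tup m ι κ => X l i j) (gam m ι κ) (gaussianReal 0 1) := by
    have a := measurePreserving_eval (fun _ : Fin m => Measure.pi fun _ : ι =>
      Measure.pi fun _ : κ => gaussianReal 0 1) l
    have b := measurePreserving_eval (fun _ : ι => Measure.pi fun _ : κ => gaussianReal 0 1) i
    have c := measurePreserving_eval (fun _ : κ => gaussianReal 0 1) j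
    exact c.comp (b.comp a)
  exact allMom_gaussian.comp h1

theorem allMom_prod_tm {m : ℕ} {κ : Type*} [Fintype κ] [DecidableEq κ] (i j : κ) :
    AllMom (gam m κ κ) fun X => (List.ofFn (tm X)).prod i j :=
  allMom_prod_ofFn m tm allMom_entry i j

theorem tchi_coeff_zero {m : ℕ} (X : Tup m (Fin 2) (Fin 2)) :
    (tchi X).coeff 0 = (List.ofFn (tm X)).prod.det := by
  rw [tchi, Matrix.charpoly_fin_two]; simp

theorem tchi_coeff_one {m : ℕ} (X : Tup m (Fin 2) (Fin 2)) :
    (tchi X).coeff 1 = -(List.ofFn (tm X)).prod.trace := by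
  rw [tchi, Matrix.charpoly_fin_two]; simp [coeff_C]

theorem measurable_qr (b : ℕ) : ∀ s, Measurable fun f : ℝ[X] => qr f b s := by
  induction b with
  | zero => intro s; exact measurable_const
  | succ b ih =>
    intro s
    have h0 := measurable_coeff 0
    have h1 := measurable_coeff 1
    fin_cases s
    · exact (h0.mul (ih 1)).neg
    · exact (ih 0).sub (h1.mul (ih 1))

section
variable {m : ℕ}

theorem allMom_coeff_zero : AllMom (chiLaw m 2) fun f => f.coeff 0 := by
  refine AllMom.of_map measurable_tchi (measurable_coeff 0) ?_
  simp only [tchi_coeff_zero, Matrix.det_fin_two]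
  exact ((allMom_prod_tm 0 0).mul (allMom_prod_tm 1 1)).sub
    ((allMom_prod_tm 0 1).mul (allMom_prod_tm 1 0))

theorem allMom_coeff_one : AllMom (chiLaw m 2) fun f => f.coeff 1 := by
  refine AllMom.of_map measurable_tchi (measurable_coeff 1) ?_
  simp only [tchi_coeff_one, Matrix.trace_fin_two]
  exact ((allMom_prod_tm 0 0).add (allMom_prod_tm 1 1)).neg

theorem allMom_qr (b : ℕ) : ∀ s, AllMom (chiLaw m 2) fun f => qr f b s := by
  induction b with
  | zero =>
    intro s
    exact AllMom.of_bound measurable_const |(![1, 0] : Fin 2 → ℝ) s| fun _ => le_rfl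
  | succ b ih =>
    intro s
    fin_cases s
    · exact (allMom_coeff_zero.mul (ih 1)).neg
    · exact (ih 0).sub (allMom_coeff_one.mul (ih 1))

theorem allMom_wq (z : ℝ) : AllMom (chiLaw m 2) (wq z) := by
  refine AllMom.of_bound (measurable_wq z) (1 + |z|) fun f => ?_
  unfold wq
  split_ifs
  · linarith
  · simp

/-- The mixed moments of the reductions of two powers. -/
noncomputable def qmom (m : ℕ) (z : ℝ) (b c : ℕ) : ℝ :=
  ∫ f, wq z f * (qr f b 0 * qr f c 1) ∂chiLaw m 2

/-- The even numbers followed by the odd numbers. -/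
def parIx {n : ℕ} : Fin n ⊕ Fin n → ℕ
  | Sum.inl j => 2 * (j : ℕ)
  | Sum.inr j => 2 * (j : ℕ) + 1

theorem integral_det_redMat (n : ℕ) (z : ℝ) :
    ∫ p, (redMat p).det * ∏ i, wq z (p i) ∂quadLaw m n
      = altSum fun _ : Fin n => fun x y => qmom m z (parIx x) (parIx y) := by
  let e : Fin n ⊕ Fin n ≃ Fin 2 × Fin n :=
    { toFun := Sum.elim (fun j => (0, j)) fun j => (1, j)
      invFun := fun z => if z.1 = 0 then Sum.inl z.2 else Sum.inr z.2
      left_inv := by rintro (x | x) <;> simp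
      right_inv := by rintro ⟨t, j⟩; fin_cases t <;> simp }
  have h1 : ∀ p : Fin n → ℝ[X], (redMat p).det * ∏ i, wq z (p i)
      = ∑ σ : Equiv.Perm (Fin n ⊕ Fin n), (Equiv.Perm.sign σ : ℝ) *
        ∏ i, wq z (p i) * (qr (p i) (parIx (σ (Sum.inl i))) 0 * qr (p i) (parIx (σ (Sum.inr i))) 1) := by
    intro p
    rw [← Matrix.det_submatrix_equiv_self e, ← Matrix.det_transpose, Matrix.det_apply',
      Finset.sum_mul]
    refine Finset.sum_congr rfl fun σ _ => ?_
    rw [mul_assoc, Fintype.prod_sum_type, Finset.prod_mul_distrib, Finset.prod_mul_distrib, mul_comm (∏ i, wq z (p i))]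
    congr 3
    · refine Finset.prod_congr rfl fun i _ => ?_
      rcases σ (Sum.inl i) with j | j <;> simp [redMat, e, parIx]
    · refine Finset.prod_congr rfl fun i _ => ?_
      rcases σ (Sum.inr i) with j | j <;> simp [redMat, e, parIx]
  simp only [h1]
  rw [integral_finsetSum]
  · rw [altSum]
    refine Finset.sum_congr rfl fun σ _ => ?_
    rw [integral_const_mul]
    congr 1
    exact integral_fintype_prod_eq_prod (μ := fun _ : Fin n => chiLaw m 2)
      (f := fun i (g : ℝ[X]) => wq z g * (qr g (parIx (σ (Sum.inl i))) 0 * qr g (parIx (σ (Sum.inr i))) 1))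
  · intro σ _
    refine Integrable.const_mul ?_ _
    exact Integrable.fintype_prod (μ := fun _ : Fin n => chiLaw m 2)
      (f := fun i (g : ℝ[X]) => wq z g * (qr g (parIx (σ (Sum.inl i))) 0 * qr g (parIx (σ (Sum.inr i))) 1))
      fun i => ((allMom_wq z).mul ((allMom_qr _ 0).mul (allMom_qr _ 1))).integrable
end

end

section

open Matrix Polynomial

/-- Multiplication of the first matrix of a tuple by an orthogonal matrix. -/
def rotTup (m : ℕ) {ι : Type*} [Fintype ι] [DecidableEq ι] (O : Matrix ι ι ℝ) (hO : Oᵀ * O = 1) :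
    Tup m ι ι ≃ₗ[ℝ] Tup m ι ι where
  toFun X := tf fun l => if l.val = 0 then O * tm X l else tm X l
  map_add' X Y := by
    funext l i j
    by_cases h : l.val = 0 <;> simp [tf, tm, h, Matrix.mul_apply, mul_add, Finset.sum_add_distrib]
  map_smul' c X := by
    funext l i j
    by_cases h : l.val = 0 <;>
      simp [tf, tm, h, Matrix.mul_apply, Finset.mul_sum, mul_left_comm]
  invFun X := tf fun l => if l.val = 0 then Oᵀ * tm X l else tm X l
  left_inv X := by
    funext l i j
    change (if l.val = 0 then Oᵀ * (if l.val = 0 then O * tm X l else tm X l) else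
      if l.val = 0 then O * tm X l else tm X l) i j = X l i j
    split_ifs
    · rw [← Matrix.mul_assoc, hO, Matrix.one_mul]; rfl
    · rfl
  right_inv X := by
    have hO' := mul_eq_one_comm.1 hO
    funext l i j
    change (if l.val = 0 then O * (if l.val = 0 then Oᵀ * tm X l else tm X l) else
      if l.val = 0 then Oᵀ * tm X l else tm X l) i j = X l i j
    split_ifs
    · rw [← Matrix.mul_assoc, hO', Matrix.one_mul]; rfl
    · rfl

section
variable {m : ℕ} {ι : Type*} [Fintype ι] [DecidableEq ι]

theorem prod_tm_rotTup [NeZero m] (O : Matrix ι ι ℝ) (hO : Oᵀ * O = 1) (X : Tup m ι ι) :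
    (List.ofFn (tm (rotTup m O hO X))).prod = O * (List.ofFn (tm X)).prod := by
  obtain ⟨k, rfl⟩ : ∃ k, m = k + 1 := ⟨m - 1, by have := NeZero.pos m; omega⟩
  simp only [rotTup, LinearEquiv.coe_mk, LinearMap.coe_mk, AddHom.coe_mk, tm_tf, List.ofFn_succ,
    List.prod_cons, ← Matrix.mul_assoc]
  simp

theorem gw_rotTup (O : Matrix ι ι ℝ) (hO : Oᵀ * O = 1) (X : Tup m ι ι) :
    gw (rotTup m O hO X) = gw X := by
  rw [gw_eq, gw_eq]
  have : ∀ l, nsq (tm (rotTup m O hO X) l) = nsq (tm X l) := by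
    intro l
    rw [nsq_eq_trace, nsq_eq_trace]
    simp only [rotTup, LinearEquiv.coe_mk, LinearMap.coe_mk, AddHom.coe_mk, tm_tf]
    split_ifs
    · rw [Matrix.transpose_mul, Matrix.mul_assoc, ← Matrix.mul_assoc Oᵀ, hO, Matrix.one_mul]
    · rfl
  simp only [this]

theorem measurePreserving_rotTup (O : Matrix ι ι ℝ) (hO : Oᵀ * O = 1) :
    MeasurePreserving (rotTup m O hO) (gam m ι ι) (gam m ι ι) :=
  measurePreserving_gam_of_gw _ (gw_rotTup O hO)

theorem measurableEmbedding_rotTup (O : Matrix ι ι ℝ) (hO : Oᵀ * O = 1) :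
    MeasurableEmbedding (rotTup m O hO) :=
  (rotTup m O hO).toContinuousLinearEquiv.toHomeomorph.measurableEmbedding

theorem integral_rotTup [NeZero m] (O : Matrix ι ι ℝ) (hO : Oᵀ * O = 1)
    (f : Matrix ι ι ℝ → ℝ) :
    ∫ X, f (O * (List.ofFn (tm X)).prod) ∂gam m ι ι = ∫ X, f (List.ofFn (tm X)).prod ∂gam m ι ι := by
  rw [← (measurePreserving_rotTup O hO).integral_comp (measurableEmbedding_rotTup O hO)
    (fun X => f (List.ofFn (tm X)).prod)]
  simp only [prod_tm_rotTup]

end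

theorem qr_neg (f g : ℝ[X]) (h0 : g.coeff 0 = f.coeff 0) (h1 : g.coeff 1 = -f.coeff 1) (b : ℕ) :
    qr g b 0 = (-1) ^ b * qr f b 0 ∧ qr g b 1 = -((-1) ^ b * qr f b 1) := by
  induction b with
  | zero => simp [qr]
  | succ b ih =>
    simp only [qr, Matrix.cons_val_zero, Matrix.cons_val_one, h0, h1, ih.1, ih.2, pow_succ]
    constructor <;> ring

section
variable {m : ℕ} [NeZero m]

theorem measurable_qmom_integrand (z : ℝ) (b c : ℕ) :
    Measurable fun f : ℝ[X] => wq z f * (qr f b 0 * qr f c 1) :=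
  (measurable_wq z).mul ((measurable_qr b 0).mul (measurable_qr c 1))

theorem qmom_eq_zero (z : ℝ) (b c : ℕ) (h : Even (b + c)) : qmom m z b c = 0 := by
  have hO : ((-1 : Matrix (Fin 2) (Fin 2) ℝ))ᵀ * (-1) = 1 := by simp
  have e : qmom m z b c = -qmom m z b c := by
    conv_lhs => rw [qmom, integral_chiLaw (measurable_qmom_integrand z b c)]
    rw [qmom, integral_chiLaw (measurable_qmom_integrand z b c)]
    have := integral_rotTup (m := m) (-1) hO
      fun P => wq z P.charpoly * (qr P.charpoly b 0 * qr P.charpoly c 1)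
    simp only [tchi] at this ⊢
    refine this.symm.trans ?_
    rw [← integral_neg]
    refine integral_congr_ae (Filter.Eventually.of_forall fun X => ?_)
    simp only
    set P := (List.ofFn (tm X)).prod
    have h0 : (-1 * P).charpoly.coeff 0 = P.charpoly.coeff 0 := by
      rw [Matrix.charpoly_fin_two, Matrix.charpoly_fin_two]
      simp [Matrix.det_fin_two]
    have h1 : (-1 * P).charpoly.coeff 1 = -P.charpoly.coeff 1 := by
      rw [Matrix.charpoly_fin_two, Matrix.charpoly_fin_two]
      simp [coeff_C]
    have hw : wq z (-1 * P).charpoly = wq z P.charpoly := by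
      unfold wq dsc; rw [h0, h1]; simp
    rw [hw, (qr_neg _ _ h0 h1 b).1, (qr_neg _ _ h0 h1 c).2]
    have h2 : (-1 : ℝ) ^ b * (-1) ^ c = 1 := by rw [← pow_add, h.neg_one_pow]
    linear_combination (-(wq z P.charpoly * (qr P.charpoly b 0 * qr P.charpoly c 1))) * h2
  linarith

/-- The skew pairing of the powers. -/
noncomputable def skewMat (m n : ℕ) (z : ℝ) : Matrix (Fin n) (Fin n) ℝ :=
  Matrix.of fun i j => qmom m z (2 * i) (2 * j + 1) - qmom m z (2 * j + 1) (2 * i)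

theorem exists_genFun_eq_det (n : ℕ) : ∃ c : ℝ, ∀ z, genFun m n z = c * (skewMat m n z).det := by
  obtain ⟨c, hc⟩ := exists_genFun_eq m n
  refine ⟨c * n.factorial, fun z => ?_⟩
  rw [hc, integral_det_redMat, mul_assoc, ← altSum_bipartite]
  congr 1
  refine altSum_congr_symm _ _ fun _ x y => ?_
  rcases x with i | i <;> rcases y with j | j
  · simp only [parIx, Sum.elim_inl]
    rw [qmom_eq_zero, qmom_eq_zero] <;> exact ⟨i + j, by ring⟩
  · simp [parIx, skewMat]
  · simp [parIx, skewMat]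
  · simp only [parIx, Sum.elim_inr]
    rw [qmom_eq_zero, qmom_eq_zero] <;> exact ⟨i + j + 1, by ring⟩
end

section Sym
variable {R : Type*} [CommRing R]

/-- The value at `(u, v)` of the homogenization of degree `n` of a polynomial. -/
noncomputable def homEval (n : ℕ) (u v : R[X]) (f : R[X]) : R[X] :=
  ∑ j ∈ Finset.range (n + 1), C (f.coeff j) * (u ^ j * v ^ (n - j))

theorem homEval_linear_mul (n : ℕ) (u v f : R[X]) (hf : f.natDegree ≤ n) (a b : R) :
    homEval (n + 1) u v ((C a * X + C b) * f) = (C a * u + C b * v) * homEval n u v f := by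
  have h0 : f.coeff (n + 1) = 0 := coeff_eq_zero_of_natDegree_lt (by omega)
  have e : ∀ j, ((C a * X + C b) * f).coeff (j + 1) = a * f.coeff j + b * f.coeff (j + 1) := by
    intro j
    rw [add_mul, coeff_add, mul_assoc, coeff_C_mul, coeff_X_mul, coeff_C_mul]
  have e0 : ((C a * X + C b) * f).coeff 0 = b * f.coeff 0 := by
    rw [add_mul, coeff_add, mul_assoc, coeff_C_mul, coeff_X_mul_zero, coeff_C_mul]; ring
  have e1 : homEval n u v f * v = ∑ j ∈ Finset.range (n + 1 + 1),
      C (f.coeff j) * (u ^ j * v ^ (n + 1 - j)) := by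
    rw [Finset.sum_range_succ, h0, C_0, zero_mul, add_zero, homEval, Finset.sum_mul]
    refine Finset.sum_congr rfl fun j hj => ?_
    rw [Nat.succ_sub (Finset.mem_range_succ_iff.1 hj), pow_succ]; ring
  have e2 : homEval n u v f * u = ∑ j ∈ Finset.range (n + 1),
      C (f.coeff j) * (u ^ (j + 1) * v ^ (n + 1 - (j + 1))) := by
    rw [homEval, Finset.sum_mul]
    refine Finset.sum_congr rfl fun j _ => ?_
    rw [Nat.add_sub_add_right, pow_succ]; ring
  have e3 : (C a * u + C b * v) * homEval n u v f
      = C a * (homEval n u v f * u) + C b * (homEval n u v f * v) := by ring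
  rw [e3, e1, e2, homEval, Finset.sum_range_succ', e0, Finset.sum_range_succ' _ (n + 1)]
  simp only [e]
  simp only [C_add, C_mul, add_mul, mul_add (C b), Finset.sum_add_distrib, Finset.mul_sum, mul_assoc]
  ring

theorem natDegree_lin_pow_mul_le (a b : R) (k : ℕ) (f : R[X]) (n : ℕ) (hf : f.natDegree ≤ n) :
    ((C a * X + C b) ^ k * f).natDegree ≤ k + n := by
  refine natDegree_mul_le.trans (Nat.add_le_add ?_ hf)
  exact (natDegree_pow_le).trans (by
    have : (C a * X + C b).natDegree ≤ 1 := natDegree_linear_le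
    nlinarith)

theorem homEval_linear_pow_mul (u v f : R[X]) (a b : R) (n : ℕ) (hf : f.natDegree ≤ n) (k : ℕ) :
    homEval (k + n) u v ((C a * X + C b) ^ k * f) = (C a * u + C b * v) ^ k * homEval n u v f := by
  induction k with
  | zero => simp
  | succ k ih =>
    rw [pow_succ', mul_assoc, show k + 1 + n = (k + n) + 1 by ring,
      homEval_linear_mul _ _ _ _ (natDegree_lin_pow_mul_le a b k f n hf), ih, pow_succ', mul_assoc]

/-- The polynomial of a row of the symmetric power of a matrix. -/
noncomputable def symRow (P : Matrix (Fin 2) (Fin 2) R) (k l : ℕ) : R[X] :=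
  (C (P 0 0) * X + C (P 0 1)) ^ k * (C (P 1 0) * X + C (P 1 1)) ^ l

theorem homEval_symRow (u v : R[X]) (P : Matrix (Fin 2) (Fin 2) R) (k l : ℕ) :
    homEval (k + l) u v (symRow P k l)
      = (C (P 0 0) * u + C (P 0 1) * v) ^ k * (C (P 1 0) * u + C (P 1 1) * v) ^ l := by
  have h := homEval_linear_pow_mul u v 1 (P 1 0) (P 1 1) 0 (by simp) l
  have h2 := natDegree_lin_pow_mul_le (P 1 0) (P 1 1) l 1 0 (by simp)
  have h1 : homEval 0 u v 1 = 1 := by simp [homEval]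
  rw [h1, mul_one, mul_one] at h
  rw [mul_one] at h2
  rw [symRow, homEval_linear_pow_mul _ _ _ _ _ _ (by simpa using h2)]
  rw [add_zero] at h
  rw [h]

/-- The symmetric power of a matrix. -/
noncomputable def symM (N : ℕ) (P : Matrix (Fin 2) (Fin 2) R) :
    Matrix (Fin (N + 1)) (Fin (N + 1)) R :=
  Matrix.of fun k l => (symRow P k (N - k)).coeff l

theorem symM_mul (N : ℕ) (P Q : Matrix (Fin 2) (Fin 2) R) :
    symM N (P * Q) = symM N P * symM N Q := by
  ext k l
  have hk : (k : ℕ) + (N - k) = N := by have := k.2; omega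
  have h := homEval_symRow (C (Q 0 0) * X + C (Q 0 1)) (C (Q 1 0) * X + C (Q 1 1)) P k (N - k)
  have e : symRow (P * Q) k (N - k) = homEval N (C (Q 0 0) * X + C (Q 0 1))
      (C (Q 1 0) * X + C (Q 1 1)) (symRow P k (N - k)) := by
    rw [hk] at h
    rw [h, symRow]
    simp only [Matrix.mul_apply, Fin.sum_univ_two, C_add, C_mul]
    congr 2 <;> ring
  simp only [symM, Matrix.of_apply, Matrix.mul_apply]
  rw [e, homEval, finsetSum_coeff, Finset.sum_range]
  refine Finset.sum_congr rfl fun j _ => ?_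
  rw [coeff_C_mul]; rfl

theorem symM_one (N : ℕ) : symM N (1 : Matrix (Fin 2) (Fin 2) R) = 1 := by
  ext k l
  simp [symM, symRow, coeff_X_pow, Matrix.one_apply, Fin.ext_iff, eq_comm]

theorem trace_symM_of_triangular (N : ℕ) (T : Matrix (Fin 2) (Fin 2) R) (h : T 1 0 = 0) :
    (symM N T).trace = ∑ k ∈ Finset.range (N + 1), T 0 0 ^ k * T 1 1 ^ (N - k) := by
  rw [Matrix.trace, Finset.sum_range]
  refine Finset.sum_congr rfl fun k _ => ?_
  simp only [Matrix.diag_apply, symM, Matrix.of_apply, symRow, h, C_0, zero_mul, zero_add]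
  rw [← C_pow, coeff_mul_C]
  congr 1
  have := coeff_pow_of_natDegree_le (p := C (T 0 0) * X + C (T 0 1)) (m := k) (n := 1)
    natDegree_linear_le
  simpa using this

theorem symM_map {S : Type*} [CommRing S] (φ : R →+* S) (N : ℕ) (P : Matrix (Fin 2) (Fin 2) R) :
    symM N (P.map φ) = (symM N P).map φ := by
  ext k l
  simp [symM, symRow, ← coeff_map]

end Sym

theorem exists_triangular (P : Matrix (Fin 2) (Fin 2) ℂ) :
    ∃ S T : Matrix (Fin 2) (Fin 2) ℂ, IsUnit S ∧ T 1 0 = 0 ∧ P * S = S * T := by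
  by_cases h : P 1 0 = 0
  · exact ⟨1, P, isUnit_one, h, by simp⟩
  obtain ⟨s, hs⟩ := IsAlgClosed.exists_pow_nat_eq ((P 0 0 - P 1 1) ^ 2 + 4 * P 0 1 * P 1 0) two_pos
  set t := (P 0 0 - P 1 1 + s) / 2 with ht
  refine ⟨!![t, 1; P 1 0, 0], !![t + P 1 1, 1; 0, P 0 0 - t], ?_, by simp, ?_⟩
  · rw [Matrix.isUnit_iff_isUnit_det, Matrix.det_fin_two_of, isUnit_iff_ne_zero]
    simpa using h
  · have h1 : t ^ 2 = (P 0 0 - P 1 1) * t + P 0 1 * P 1 0 := by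
      rw [ht]; linear_combination (1 / 4) * hs
    ext i j
    fin_cases i <;> fin_cases j <;> simp [Matrix.mul_apply, Fin.sum_univ_two]
    · linear_combination -h1
    · ring

theorem qr_eigen (p : ℝ[X]) (x y : ℂ) (h1 : (p.coeff 1 : ℂ) = -(x + y)) (h0 : (p.coeff 0 : ℂ) = x * y)
    (b : ℕ) : ((qr p b 1 : ℝ) : ℂ) * x + ((qr p b 0 : ℝ) : ℂ) = x ^ b := by
  induction b with
  | zero => simp [qr]
  | succ b ih =>
    simp only [qr, Matrix.cons_val_zero, Matrix.cons_val_one]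
    push_cast
    rw [h1, h0, pow_succ, ← ih]; ring

theorem qr_succ_eq_sum (p : ℝ[X]) (x y : ℂ) (h1 : (p.coeff 1 : ℂ) = -(x + y))
    (h0 : (p.coeff 0 : ℂ) = x * y) (b : ℕ) :
    ((qr p (b + 1) 1 : ℝ) : ℂ) = ∑ k ∈ Finset.range (b + 1), x ^ k * y ^ (b - k) := by
  induction b with
  | zero => simp [qr]
  | succ b ih =>
    have h2 := qr_eigen p x y h1 h0 (b + 1)
    have h3 : ((qr p (b + 1 + 1) 1 : ℝ) : ℂ)
        = x ^ (b + 1) + y * ((qr p (b + 1) 1 : ℝ) : ℂ) := by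
      rw [qr]
      simp only [Matrix.cons_val_one, Matrix.cons_val_fin_one]
      push_cast
      rw [h1, ← h2]; ring
    rw [h3, ih, Finset.sum_range_succ _ (b + 1), Nat.sub_self, pow_zero, mul_one, add_comm,
      Finset.mul_sum]
    congr 1
    refine Finset.sum_congr rfl fun k hk => ?_
    rw [Nat.succ_sub (Finset.mem_range_succ_iff.1 hk), pow_succ]; ring

theorem trace_symM (N : ℕ) (P : Matrix (Fin 2) (Fin 2) ℝ) :
    (symM N P).trace = qr P.charpoly (N + 1) 1 := by
  obtain ⟨S, T, hS, hT, hPS⟩ := exists_triangular (P.map (algebraMap ℝ ℂ))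
  have hdet : (P.map (algebraMap ℝ ℂ)).det = T.det := by
    have := congrArg Matrix.det hPS
    rw [Matrix.det_mul, Matrix.det_mul, mul_comm] at this
    exact ((Matrix.isUnit_iff_isUnit_det _).1 hS).mul_left_cancel this
  have hd := (Matrix.isUnit_iff_isUnit_det _).1 hS
  have hP : P.map (algebraMap ℝ ℂ) = S * T * S⁻¹ := by
    rw [← hPS, Matrix.mul_assoc, Matrix.mul_nonsing_inv _ hd, Matrix.mul_one]
  have htr : (P.map (algebraMap ℝ ℂ)).trace = T.trace := by
    rw [hP, Matrix.trace_mul_comm, ← Matrix.mul_assoc, Matrix.nonsing_inv_mul _ hd, Matrix.one_mul]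
  have h0 : ((P.charpoly.coeff 0 : ℝ) : ℂ) = T 0 0 * T 1 1 := by
    rw [Matrix.det_fin_two, Matrix.det_fin_two, hT] at hdet
    rw [Matrix.charpoly_fin_two]
    simp only [Matrix.map_apply, Complex.coe_algebraMap] at hdet
    simp [Matrix.det_fin_two, hdet]
  have h1 : ((P.charpoly.coeff 1 : ℝ) : ℂ) = -(T 0 0 + T 1 1) := by
    rw [Matrix.trace_fin_two, Matrix.trace_fin_two] at htr
    rw [Matrix.charpoly_fin_two]
    simp only [Matrix.map_apply, Complex.coe_algebraMap] at htr
    simp [Matrix.trace_fin_two, coeff_C, ← htr]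
  apply Complex.ofReal_injective
  rw [qr_succ_eq_sum _ _ _ h1 h0, ← trace_symM_of_triangular N T hT]
  have e1 : (symM N (P.map (algebraMap ℝ ℂ))).trace = (symM N T).trace := by
    rw [hP, symM_mul, symM_mul, Matrix.trace_mul_comm, ← Matrix.mul_assoc, ← symM_mul,
      Matrix.nonsing_inv_mul _ hd, symM_one, Matrix.one_mul]
  rw [← e1, symM_map]
  simp [Matrix.trace]

theorem integral_list_prod_pi {Ω κ : Type*} [MeasurableSpace Ω] [Fintype κ] [DecidableEq κ]
    (μ : Measure Ω) [IsProbabilityMeasure μ] (G : Ω → Matrix κ κ ℝ)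
    (hG : ∀ i j, AllMom μ fun x => G x i j) :
    ∀ (m : ℕ) (i j : κ), ∫ X : Fin m → Ω, (List.ofFn fun l : Fin m => G (X l)).prod i j ∂Measure.pi (fun _ : Fin m => μ)
      = ((Matrix.of fun i j => ∫ x, G x i j ∂μ) ^ m) i j
  | 0, i, j => by simp
  | m + 1, i, j => by
    have hA : ∀ s t, AllMom (Measure.pi fun _ : Fin m => μ) fun X =>
        (List.ofFn fun l : Fin m => G (X l)).prod s t :=
      allMom_prod_ofFn m (fun (X : Fin m → Ω) l => G (X l)) fun l i j =>
        (hG i j).comp (measurePreserving_eval (fun _ : Fin m => μ) l)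
    rw [integral_pi_succ μ m (fun (X : Fin (m + 1) → Ω) => (List.ofFn fun l : Fin (m + 1) => G (X l)).prod i j)]
    simp only [List.ofFn_succ, List.prod_cons, Matrix.mul_apply, Fin.cons_zero, Fin.cons_succ]
    rw [integral_finsetSum _ fun s _ => (hG i s).integrable.mul_prod (hA s j).integrable, pow_succ',
      Matrix.mul_apply]
    refine Finset.sum_congr rfl fun s _ => ?_
    rw [integral_prod_mul (fun x => G x i s) (fun (X : Fin m → Ω) => (List.ofFn fun l : Fin m => G (X l)).prod s j),
      integral_list_prod_pi μ G hG m s j]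
    rfl

/-- A determinant power times a symmetric power. -/
noncomputable def detSym (b N : ℕ) (P : Matrix (Fin 2) (Fin 2) ℝ) :
    Matrix (Fin (N + 1)) (Fin (N + 1)) ℝ := P.det ^ b • symM N P

theorem detSym_mul (b N : ℕ) (P Q : Matrix (Fin 2) (Fin 2) ℝ) :
    detSym b N (P * Q) = detSym b N P * detSym b N Q := by
  rw [detSym, Matrix.det_mul, mul_pow, symM_mul, detSym, detSym, Matrix.smul_mul, Matrix.mul_smul,
    smul_smul]

theorem detSym_list_prod (b N : ℕ) (L : List (Matrix (Fin 2) (Fin 2) ℝ)) :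
    detSym b N L.prod = (L.map (detSym b N)).prod := by
  induction L with
  | nil => simp [detSym, symM_one]
  | cons P L ih => rw [List.prod_cons, detSym_mul, ih, List.map_cons, List.prod_cons]

section
variable {Ω : Type*} [MeasurableSpace Ω] {μ : Measure Ω}

theorem AllMom.const [IsFiniteMeasure μ] (c : ℝ) : AllMom μ fun _ => c :=
  AllMom.of_bound measurable_const |c| fun _ => le_rfl

theorem AllMom.pow [IsFiniteMeasure μ] {f : Ω → ℝ} (hf : AllMom μ f) (k : ℕ) :
    AllMom μ fun x => f x ^ k := by
  induction k with
  | zero => simpa using AllMom.const (μ := μ) 1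
  | succ k ih => simpa only [pow_succ] using ih.mul hf

theorem allMom_coeff_mul [IsFiniteMeasure μ] {f g : Ω → ℝ[X]} (hf : ∀ j, AllMom μ fun x => (f x).coeff j)
    (hg : ∀ j, AllMom μ fun x => (g x).coeff j) (j : ℕ) : AllMom μ fun x => (f x * g x).coeff j := by
  simp only [coeff_mul]
  exact AllMom.sum _ fun s _ => (hf _).mul (hg _)

theorem allMom_coeff_pow [IsFiniteMeasure μ] {f : Ω → ℝ[X]} (hf : ∀ j, AllMom μ fun x => (f x).coeff j)
    (k : ℕ) : ∀ j, AllMom μ fun x => (f x ^ k).coeff j := by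
  induction k with
  | zero => intro j; simpa using AllMom.const (μ := μ) ((1 : ℝ[X]).coeff j)
  | succ k ih => intro j; simpa only [pow_succ] using allMom_coeff_mul ih hf j

theorem allMom_coeff_lin [IsFiniteMeasure μ] {u v : Ω → ℝ} (hu : AllMom μ u) (hv : AllMom μ v) (j : ℕ) :
    AllMom μ fun x => (C (u x) * X + C (v x)).coeff j := by
  rcases j with _ | _ | j
  · simpa using hv
  · simpa [coeff_C] using hu
  · simpa [coeff_C, coeff_X] using AllMom.const (μ := μ) 0

theorem allMom_detSym [IsFiniteMeasure μ] {P : Ω → Matrix (Fin 2) (Fin 2) ℝ}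
    (hP : ∀ i j, AllMom μ fun x => P x i j) (b N : ℕ) (k l : Fin (N + 1)) :
    AllMom μ fun x => detSym b N (P x) k l := by
  simp only [detSym, Matrix.smul_apply, smul_eq_mul, Matrix.det_fin_two, symM, Matrix.of_apply, symRow]
  refine AllMom.mul (((((hP 0 0).mul (hP 1 1)).sub ((hP 0 1).mul (hP 1 0)))).pow b) ?_
  exact allMom_coeff_mul (allMom_coeff_pow (allMom_coeff_lin (hP 0 0) (hP 0 1)) _)
    (allMom_coeff_pow (allMom_coeff_lin (hP 1 0) (hP 1 1)) _) _
end

/-- The standard Gaussian measure on square arrays of order two. -/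
noncomputable def gmat2 : Measure (Fin 2 → Fin 2 → ℝ) :=
  Measure.pi fun _ => Measure.pi fun _ => gaussianReal 0 1

instance : IsProbabilityMeasure gmat2 := by unfold gmat2; infer_instance

theorem allMom_gmat2 (i j : Fin 2) : AllMom gmat2 fun x => x i j := by
  have b := measurePreserving_eval (fun _ : Fin 2 => Measure.pi fun _ : Fin 2 => gaussianReal 0 1) i
  have c := measurePreserving_eval (fun _ : Fin 2 => gaussianReal 0 1) j
  exact allMom_gaussian.comp (c.comp b)

/-- The mean of `detSym` for a Gaussian matrix. -/
noncomputable def meanDetSym (b N : ℕ) : Matrix (Fin (N + 1)) (Fin (N + 1)) ℝ :=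
  Matrix.of fun k l => ∫ x, detSym b N (Matrix.of x) k l ∂gmat2

theorem integral_detSym_prod (m b N : ℕ) (k l : Fin (N + 1)) :
    ∫ X, detSym b N (List.ofFn (tm X)).prod k l ∂gam m (Fin 2) (Fin 2) = (meanDetSym b N ^ m) k l := by
  have h := integral_list_prod_pi gmat2 (fun x => detSym b N (Matrix.of x))
    (fun i j => allMom_detSym (P := fun x => Matrix.of x) allMom_gmat2 b N i j) m k l
  rw [meanDetSym, ← h]
  refine integral_congr_ae (Filter.Eventually.of_forall fun X => ?_)
  simp only [detSym_list_prod, List.map_ofFn]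
  rfl

theorem symM_mul_meanDetSym (b N : ℕ) (O : Matrix (Fin 2) (Fin 2) ℝ) (hO : Oᵀ * O = 1)
    (hd : O.det = 1) : symM N O * meanDetSym b N = meanDetSym b N := by
  have e : ∀ k l, meanDetSym b N k l
      = ∫ X, detSym b N (List.ofFn (tm X)).prod k l ∂gam 1 (Fin 2) (Fin 2) := by
    intro k l; rw [integral_detSym_prod, pow_one]
  ext k l
  rw [e k l, ← integral_rotTup O hO fun P => detSym b N P k l]
  simp only [detSym_mul, Matrix.mul_apply]
  rw [integral_finsetSum _ fun s _ =>
    ((AllMom.const _).mul (allMom_detSym allMom_prod_tm b N s l)).integrable]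
  refine Finset.sum_congr rfl fun s _ => ?_
  rw [integral_const_mul, e s l, detSym, hd, one_pow, one_smul]

theorem meanDetSym_apply (b c : ℕ) (j l : Fin (2 * c + 1)) :
    ((2 * c).choose j : ℝ) * meanDetSym b (2 * c) j l
      = meanDetSym b (2 * c) (Fin.last _) l * ((X ^ 2 + 1 : ℝ[X]) ^ c).coeff j := by
  set M := meanDetSym b (2 * c) with hM
  have key : (∑ s : Fin (2 * c + 1), C (((2 * c).choose s : ℝ) * M s l) * X ^ (s : ℕ))
      = C (M (Fin.last _) l) * (X ^ 2 + 1 : ℝ[X]) ^ c := by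
    refine Polynomial.funext fun t => ?_
    have hpos : 0 < 1 + t ^ 2 := by positivity
    set r := √(1 + t ^ 2) with hr
    have hr0 : 0 < r := Real.sqrt_pos.2 hpos
    have hr2 : r ^ 2 = 1 + t ^ 2 := Real.sq_sqrt hpos.le
    have h1 : (t / r) * (t / r) + (1 / r) * (1 / r) = 1 := by
      field_simp; linarith
    have hO : (!![t / r, 1 / r; -(1 / r), t / r])ᵀ * !![t / r, 1 / r; -(1 / r), t / r] = 1 := by
      ext i j
      fin_cases i <;> fin_cases j <;> simp [Matrix.mul_apply, Fin.sum_univ_two] <;>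
        (simp only [one_div] at h1; linarith)
    have h := congrFun (congrFun (symM_mul_meanDetSym b (2 * c) _ hO (by
      rw [Matrix.det_fin_two_of]; linarith)) (Fin.last _)) l
    rw [Matrix.mul_apply] at h
    simp only [symM, Matrix.of_apply, symRow, Fin.val_last, Nat.sub_self, pow_zero, mul_one] at h
    simp only [Matrix.cons_val_zero, Matrix.cons_val_one, Matrix.cons_val_fin_one] at h
    have hc : ∀ s : Fin (2 * c + 1), ((C (t / r) * X + C (1 / r) : ℝ[X]) ^ (2 * c)).coeff s
        = ((2 * c).choose s : ℝ) * t ^ (s : ℕ) / r ^ (2 * c) := by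
      intro s
      have hs : (s : ℕ) ≤ 2 * c := Nat.lt_succ_iff.1 s.2
      have e : (C (t / r) * X + C (1 / r) : ℝ[X]) ^ (2 * c)
          = C (1 / r ^ (2 * c)) * ((X + 1 : ℝ[X]) ^ (2 * c)).comp (C t * X) := by
        simp only [pow_comp, add_comp, X_comp, one_comp]
        rw [← _root_.one_div_pow, C_pow, ← mul_pow]
        congr 1
        rw [mul_add, ← mul_assoc, ← C_mul, mul_one]
        congr 3; ring
      rw [e, coeff_C_mul, comp_C_mul_X_coeff, coeff_X_add_one_pow]
      ring
    simp only [hc] at h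
    simp only [eval_finsetSum, eval_mul, eval_C, eval_pow, eval_X, eval_add, eval_one]
    rw [hM, ← h, Finset.sum_mul]
    refine Finset.sum_congr rfl fun s _ => ?_
    have : (t ^ 2 + 1) ^ c = r ^ (2 * c) := by rw [pow_mul, hr2, add_comm]
    rw [this]
    field_simp
  have := congrArg (fun p => p.coeff j) key
  simp only [finsetSum_coeff, coeff_C_mul, coeff_X_pow] at this
  rw [← this, Finset.sum_eq_single j]
  · simp
  · intro s _ hs; rw [if_neg fun h => hs (Fin.ext h).symm]; ring
  · simp

theorem trace_vecMulVec_pow {ι : Type*} [Fintype ι] [DecidableEq ι] (x u : ι → ℝ) (m : ℕ) :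
    ((Matrix.of fun i j => x i * u j) ^ (m + 1)).trace = (∑ i, u i * x i) ^ (m + 1) := by
  have h : (Matrix.of fun i j => x i * u j) ^ (m + 1)
      = (∑ i, u i * x i) ^ m • Matrix.of fun i j => x i * u j := by
    induction m with
    | zero => simp
    | succ m ih =>
      rw [pow_succ, ih, Matrix.smul_mul, pow_succ, mul_smul]
      congr 1
      ext i j
      simp only [Matrix.mul_apply, Matrix.of_apply, Matrix.smul_apply, smul_eq_mul, Finset.sum_mul]
      exact Finset.sum_congr rfl fun s _ => by ring
  rw [h, Matrix.trace_smul, pow_succ, smul_eq_mul, Matrix.trace]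
  congr 1
  exact Finset.sum_congr rfl fun s _ => by simp [mul_comm]

theorem trace_meanDetSym_pow (b c m : ℕ) [NeZero m] :
    (meanDetSym b (2 * c) ^ m).trace
      = (∫ x : Fin 2 → Fin 2 → ℝ, (Matrix.of x).det ^ b * (x 0 0 ^ 2 + x 0 1 ^ 2) ^ c ∂gmat2) ^ m := by
  obtain ⟨k, rfl⟩ : ∃ k, m = k + 1 := ⟨m - 1, by have := NeZero.pos m; omega⟩
  have hch : ∀ j : Fin (2 * c + 1), ((2 * c).choose j : ℝ) ≠ 0 := fun j =>
    Nat.cast_ne_zero.2 (Nat.choose_pos (Nat.lt_succ_iff.1 j.2)).ne'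
  have hM : meanDetSym b (2 * c) = Matrix.of fun (j l : Fin (2 * c + 1)) =>
      ((X ^ 2 + 1 : ℝ[X]) ^ c).coeff j / ((2 * c).choose j : ℝ) * meanDetSym b (2 * c) (Fin.last _) l := by
    ext j l
    rw [Matrix.of_apply, div_mul_eq_mul_div, eq_div_iff (hch j), mul_comm, meanDetSym_apply, mul_comm]
  rw [hM, trace_vecMulVec_pow]
  congr 1
  simp only [meanDetSym, Matrix.of_apply]
  simp only [← integral_mul_const]
  rw [← integral_finsetSum _ fun s _ => ((allMom_detSym (P := fun x => Matrix.of x) allMom_gmat2 b _ _ s).mul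
    (AllMom.const _)).integrable]
  refine integral_congr_ae (Filter.Eventually.of_forall fun x => ?_)
  simp only [detSym, Matrix.smul_apply, smul_eq_mul, symM, Matrix.of_apply, symRow, Fin.val_last,
    Nat.sub_self, pow_zero, mul_one, mul_assoc]
  rw [← Finset.mul_sum]
  congr 1
  have hc : ∀ s : Fin (2 * c + 1), ((C (x 0 0) * X + C (x 0 1) : ℝ[X]) ^ (2 * c)).coeff s
      = ((2 * c).choose s : ℝ) * x 0 0 ^ (s : ℕ) * x 0 1 ^ (2 * c - s) := by
    intro s
    rw [show (C (x 0 0) * X + C (x 0 1) : ℝ[X]) = (X + C (x 0 1)).comp (C (x 0 0) * X) by simp,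
      ← pow_comp, comp_C_mul_X_coeff, coeff_X_add_C_pow]
    ring
  simp only [hc]
  have hq : ((X ^ 2 + 1 : ℝ[X]) ^ c).natDegree ≤ 2 * c := by
    refine natDegree_pow_le.trans ?_
    have : (X ^ 2 + 1 : ℝ[X]).natDegree ≤ 2 := by compute_degree
    nlinarith
  have hmon : ((X ^ 2 + 1 : ℝ[X]) ^ c).coeff (2 * c) = 1 := by
    have h1 : (X ^ 2 + 1 : ℝ[X]).Monic := by monicity!
    have h2 : (X ^ 2 + 1 : ℝ[X]).natDegree = 2 := by compute_degree!
    have h3 := (h1.pow c).coeff_natDegree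
    rwa [h1.natDegree_pow, h2, mul_comm] at h3
  have e1 : ∀ s : Fin (2 * c + 1), ((2 * c).choose s : ℝ) * x 0 0 ^ (s : ℕ) * x 0 1 ^ (2 * c - s)
      * (((X ^ 2 + 1 : ℝ[X]) ^ c).coeff s / ((2 * c).choose s : ℝ))
      = ((X ^ 2 + 1 : ℝ[X]) ^ c).coeff s * (x 0 0 ^ (s : ℕ) * x 0 1 ^ (2 * c - s)) := by
    intro s
    have := hch s
    field_simp
  simp only [e1]
  rw [← Finset.sum_range fun s => ((X ^ 2 + 1 : ℝ[X]) ^ c).coeff s * (x 0 0 ^ s * x 0 1 ^ (2 * c - s))]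
  by_cases hb : x 0 1 = 0
  · rw [Finset.sum_eq_single (2 * c), hmon, hb]
    · simp [pow_mul]
    · intro s hs hsc
      have : 2 * c - s ≠ 0 := by have := Finset.mem_range.1 hs; omega
      rw [hb, zero_pow this]; ring
    · simp
  · have h4 := eval_eq_sum_range' (Nat.lt_succ_of_le hq) (x 0 0 / x 0 1)
    have h5 : (x 0 0 ^ 2 + x 0 1 ^ 2) ^ c
        = x 0 1 ^ (2 * c) * ((X ^ 2 + 1 : ℝ[X]) ^ c).eval (x 0 0 / x 0 1) := by
      simp only [eval_pow, eval_add, eval_X, eval_one, pow_mul, ← mul_pow]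
      congr 1
      field_simp
    rw [h5, h4, Finset.mul_sum]
    refine Finset.sum_congr rfl fun s hs => ?_
    have : x 0 1 ^ (2 * c) = x 0 1 ^ (2 * c - s) * x 0 1 ^ s := by
      rw [← pow_add]; congr 1; have := Finset.mem_range.1 hs; omega
    rw [this, div_pow]
    field_simp

/-- The standard Gaussian measure on the line. -/
noncomputable abbrev gau : Measure ℝ := gaussianReal 0 1

theorem map_const_mul_gau (c : ℝ) :
    gau.map (fun x => c * x) = gaussianReal 0 (NNReal.mk (c ^ 2) (sq_nonneg c)) := by
  rw [gaussianReal_map_const_mul, mul_zero, mul_one]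

theorem map_linear_gau_prod (p q : ℝ) :
    (gau.prod gau).map (fun s : ℝ × ℝ => p * s.1 + q * s.2) = gau.map fun x => √(p ^ 2 + q ^ 2) * x := by
  have h1 : (gau.prod gau).map (fun s : ℝ × ℝ => p * s.1 + q * s.2)
      = (gau.map fun x => p * x) ∗ (gau.map fun x => q * x) := by
    have hp : Measurable fun x : ℝ => p * x := measurable_const_mul p
    have hq : Measurable fun x : ℝ => q * x := measurable_const_mul q
    rw [Measure.conv, Measure.map_prod_map _ _ hp hq,
      Measure.map_map measurable_add (hp.prodMap hq)]
    rfl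
  rw [h1, map_const_mul_gau, map_const_mul_gau, map_const_mul_gau, gaussianReal_conv_gaussianReal,
    add_zero]
  congr 1
  ext
  simp [Real.sq_sqrt (by positivity : 0 ≤ p ^ 2 + q ^ 2)]

theorem integral_linear_gau_prod (p q : ℝ) (b : ℕ) :
    ∫ s : ℝ × ℝ, (p * s.1 + q * s.2) ^ b ∂gau.prod gau = √(p ^ 2 + q ^ 2) ^ b * ∫ x, x ^ b ∂gau := by
  have hm : Measurable fun s : ℝ × ℝ => p * s.1 + q * s.2 := by fun_prop
  rw [← integral_map (φ := fun s : ℝ × ℝ => p * s.1 + q * s.2) (f := fun x => x ^ b) hm.aemeasurable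
    (by fun_prop), map_linear_gau_prod, integral_map (by fun_prop) (by fun_prop)]
  simp only [mul_pow]
  rw [integral_const_mul]

/-- The moments of a Gaussian variable. -/
noncomputable def gmom (b : ℕ) : ℝ := ∫ x, x ^ b ∂gau

theorem gmom_odd (b : ℕ) (hb : Odd b) : gmom b = 0 := by
  have h : gau.map (fun x => (-1 : ℝ) * x) = gau := by
    rw [map_const_mul_gau]
    congr 1
    ext; simp
  have h2 : gmom b = -gmom b := by
    conv_lhs => rw [gmom, ← h, integral_map (by fun_prop) (by fun_prop)]
    simp only [neg_one_mul, hb.neg_pow]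
    rw [integral_neg]; rfl
  linarith

/-- The even moments of the norm of a planar Gaussian variable. -/
noncomputable def rmom (j : ℕ) : ℝ := ∫ r : ℝ × ℝ, (r.1 ^ 2 + r.2 ^ 2) ^ j ∂gau.prod gau

theorem allMom_fst {Ω Ω' : Type*} [MeasurableSpace Ω] [MeasurableSpace Ω'] {μ : Measure Ω}
    {ν : Measure Ω'} [IsProbabilityMeasure ν] [SFinite μ] {f : Ω → ℝ} (h : AllMom μ f) :
    AllMom (μ.prod ν) fun z => f z.1 := h.comp measurePreserving_fst

theorem allMom_snd {Ω Ω' : Type*} [MeasurableSpace Ω] [MeasurableSpace Ω'] {μ : Measure Ω}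
    {ν : Measure Ω'} [IsProbabilityMeasure μ] [SFinite ν] {f : Ω' → ℝ} (h : AllMom ν f) :
    AllMom (μ.prod ν) fun z => f z.2 := h.comp measurePreserving_snd

theorem integral_gmat2 (f : ℝ → ℝ → ℝ → ℝ → ℝ) :
    ∫ x : Fin 2 → Fin 2 → ℝ, f (x 0 0) (x 0 1) (x 1 0) (x 1 1) ∂gmat2
      = ∫ z : (ℝ × ℝ) × ℝ × ℝ, f z.1.1 z.1.2 z.2.1 z.2.2 ∂(gau.prod gau).prod (gau.prod gau) := by
  have h1 := measurePreserving_finTwoArrow gau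
  have h2 := measurePreserving_finTwoArrow (Measure.pi fun _ : Fin 2 => gau)
  have h3 := (h1.prod h1).comp h2
  rw [← h3.integral_comp (((MeasurableEquiv.finTwoArrow.prodCongr
    MeasurableEquiv.finTwoArrow).measurableEmbedding).comp (MeasurableEquiv.measurableEmbedding _))]
  rfl

theorem integral_det_pow_mul (b c : ℕ) :
    ∫ x : Fin 2 → Fin 2 → ℝ, (Matrix.of x).det ^ b * (x 0 0 ^ 2 + x 0 1 ^ 2) ^ c ∂gmat2
      = if Even b then rmom (b / 2 + c) * gmom b else 0 := by
  simp only [Matrix.det_fin_two, Matrix.of_apply]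
  rw [integral_gmat2 fun p q r s => (p * s - q * r) ^ b * (p ^ 2 + q ^ 2) ^ c]
  have a1 : AllMom gau fun x => x := allMom_gaussian
  have a2 : AllMom (gau.prod gau) fun z => z.1 := allMom_fst a1
  have a3 : AllMom (gau.prod gau) fun z => z.2 := allMom_snd a1
  have hint : AllMom ((gau.prod gau).prod (gau.prod gau)) fun z : (ℝ × ℝ) × ℝ × ℝ =>
      (z.1.1 * z.2.2 - z.1.2 * z.2.1) ^ b * (z.1.1 ^ 2 + z.1.2 ^ 2) ^ c :=
    AllMom.mul (((allMom_fst a2).mul (allMom_snd a3)).sub ((allMom_fst a3).mul (allMom_snd a2)) |>.pow b)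
      (((allMom_fst a2).pow 2).add ((allMom_fst a3).pow 2) |>.pow c)
  rw [integral_prod _ hint.integrable]
  have hin : ∀ r : ℝ × ℝ, ∫ s : ℝ × ℝ, (r.1 * s.2 - r.2 * s.1) ^ b * (r.1 ^ 2 + r.2 ^ 2) ^ c
      ∂gau.prod gau = √(r.1 ^ 2 + r.2 ^ 2) ^ b * gmom b * (r.1 ^ 2 + r.2 ^ 2) ^ c := by
    intro r
    rw [integral_mul_const]
    congr 1
    have := integral_linear_gau_prod (-r.2) r.1 b
    rw [neg_sq, add_comm] at this
    rw [gmom, ← this]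
    exact integral_congr_ae (Filter.Eventually.of_forall fun s => by simp only; ring)
  simp only [hin]
  split_ifs with h
  · obtain ⟨i, rfl⟩ := h.exists_two_nsmul
    rw [nsmul_eq_mul, Nat.cast_ofNat, Nat.mul_div_cancel_left _ two_pos, rmom, ← integral_mul_const]
    refine integral_congr_ae (Filter.Eventually.of_forall fun r => ?_)
    simp only
    rw [pow_mul, Real.sq_sqrt (by positivity), pow_add]; ring
  · rw [gmom_odd b (Nat.not_even_iff_odd.1 h)]; simp

theorem integral_det_qr (m b c : ℕ) [NeZero m] :
    ∫ f, f.coeff 0 ^ b * qr f (2 * c + 1) 1 ∂chiLaw m 2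
      = if Even b then (rmom (b / 2 + c) * gmom b) ^ m else 0 := by
  have h := trace_meanDetSym_pow b c m
  rw [integral_det_pow_mul] at h
  have hm : Measurable fun f : ℝ[X] => f.coeff 0 ^ b * qr f (2 * c + 1) 1 :=
    ((measurable_coeff 0).pow_const b).mul (measurable_qr _ 1)
  rw [integral_chiLaw hm]
  have e : ∀ X : Tup m (Fin 2) (Fin 2), (tchi X).coeff 0 ^ b * qr (tchi X) (2 * c + 1) 1
      = ∑ k, detSym b (2 * c) (List.ofFn (tm X)).prod k k := by
    intro X
    rw [tchi_coeff_zero, tchi, ← trace_symM, Matrix.trace, Finset.mul_sum]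
    rfl
  simp only [e]
  rw [integral_finsetSum _ fun s _ => (allMom_detSym allMom_prod_tm b _ s s).integrable]
  simp only [integral_detSym_prod]
  rw [Matrix.trace] at h
  simp only [Matrix.diag_apply] at h
  rw [h]
  split_ifs
  · rfl
  · exact zero_pow (NeZero.ne m)

theorem qr_skew (f : ℝ[X]) (b d : ℕ) :
    qr f b 0 * qr f (b + d) 1 - qr f (b + d) 0 * qr f b 1 = f.coeff 0 ^ b * qr f d 1 := by
  induction b with
  | zero => simp [qr]
  | succ b ih =>
    rw [show b + 1 + d = b + d + 1 by ring]
    simp only [qr, Matrix.cons_val_zero, Matrix.cons_val_one, Matrix.cons_val_fin_one]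
    rw [pow_succ]
    linear_combination f.coeff 0 * ih

theorem qmom_one_skew {m : ℕ} [NeZero m] (b c : ℕ) : qmom m 1 b c - qmom m 1 c b
    = ∫ f, (qr f b 0 * qr f c 1 - qr f c 0 * qr f b 1) ∂chiLaw m 2 := by
  have hw : ∀ f, wq 1 f = 1 := fun f => by unfold wq; split_ifs <;> rfl
  simp only [qmom, hw, one_mul]
  rw [integral_sub ((allMom_qr b 0).mul (allMom_qr c 1)).integrable
    ((allMom_qr c 0).mul (allMom_qr b 1)).integrable]

theorem skewMat_one {m n : ℕ} [NeZero m] (i j : Fin n) : skewMat m n 1 i j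
    = if i ≤ j then gmom (2 * i) ^ m * rmom j ^ m else 0 := by
  rw [skewMat, Matrix.of_apply, qmom_one_skew]
  split_ifs with h
  · have h' : (i : ℕ) ≤ j := h
    have e : 2 * (j : ℕ) + 1 = 2 * i + (2 * (j - i) + 1) := by omega
    rw [e]
    simp only [qr_skew]
    rw [integral_det_qr, if_pos (even_two_mul _), Nat.mul_div_cancel_left _ two_pos,
      Nat.add_sub_cancel' h', mul_pow, mul_comm]
  · have h' : (j : ℕ) < i := Fin.lt_def.1 (not_le.1 h)
    have e : 2 * (i : ℕ) = 2 * j + 1 + (2 * (i - j - 1) + 1) := by omega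
    rw [e]
    have : ∀ f : ℝ[X], qr f (2 * j + 1 + (2 * (i - j - 1) + 1)) 0 * qr f (2 * j + 1) 1
        - qr f (2 * j + 1) 0 * qr f (2 * j + 1 + (2 * (i - j - 1) + 1)) 1
        = -(f.coeff 0 ^ (2 * (j : ℕ) + 1) * qr f (2 * (i - j - 1) + 1) 1) := by
      intro f; rw [← qr_skew]; ring
    simp only [this]
    rw [integral_neg, integral_det_qr, if_neg (by simp), neg_zero]

/-- The law of a product of independent standard Gaussian variables. -/
noncomputable def plaw (m : ℕ) : Measure ℝ :=
  (Measure.pi fun _ : Fin m => gau).map fun v => ∏ l, v l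

theorem measurable_finProd (m : ℕ) : Measurable fun v : Fin m → ℝ => ∏ l, v l := by fun_prop

instance (m : ℕ) : IsProbabilityMeasure (plaw m) :=
  Measure.isProbabilityMeasure_map (measurable_finProd m).aemeasurable

theorem measurable_X_sub_C : Measurable fun x : ℝ => (X - C x : ℝ[X]) :=
  measurable_poly fun i => by
    simp only [coeff_sub, coeff_C]
    split_ifs <;> fun_prop

theorem tchi_fin_one {m : ℕ} (Y : Tup m (Fin 1) (Fin 1)) : tchi Y = X - C (∏ l, Y l 0 0) := by
  have h : ∀ (k : ℕ) (A : Fin k → Matrix (Fin 1) (Fin 1) ℝ),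
      (List.ofFn A).prod 0 0 = ∏ l, A l 0 0 := by
    intro k
    induction k with
    | zero => intro A; simp
    | succ k ih => intro A; simp [List.ofFn_succ, Matrix.mul_apply, ih, Fin.prod_univ_succ]
  rw [tchi, Matrix.charpoly, Matrix.det_fin_one, Matrix.charmatrix_apply_eq, h]
  rfl

theorem chiLaw_one (m : ℕ) : chiLaw m 1 = (plaw m).map fun x => X - C x := by
  have h : MeasurePreserving (fun (Y : Tup m (Fin 1) (Fin 1)) l => Y l 0 0) (gam m (Fin 1) (Fin 1))
      (Measure.pi fun _ : Fin m => gau) := by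
    refine measurePreserving_pi (f := fun _ (y : Fin 1 → Fin 1 → ℝ) => y 0 0) _ _ fun l => ?_
    exact (measurePreserving_eval (fun _ : Fin 1 => gau) 0).comp
      (measurePreserving_eval (fun _ : Fin 1 => Measure.pi fun _ : Fin 1 => gau) 0)
  rw [plaw, Measure.map_map measurable_X_sub_C (measurable_finProd m), ← h.map_eq,
    Measure.map_map (measurable_X_sub_C.comp (measurable_finProd m)) h.measurable, chiLaw]
  congr 1
  funext Y
  exact tchi_fin_one Y

theorem facC_one (m : ℕ) : facC m (Fin 1) (Fin 1) = ENNReal.ofReal (√(Real.pi / 2) ^ m) := by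
  have h1 : ∀ Y : Tup m (Fin 1) (Fin 1), graphJ Y
      = ∏ l, ∏ i, ∏ j, ENNReal.ofReal ((1 + Y l i j ^ 2)⁻¹) := by
    intro Y
    rw [graphJ, ENNReal.ofReal_prod_of_nonneg fun l _ => by positivity]
    refine Finset.prod_congr rfl fun l _ => ?_
    simp only [Finset.univ_unique, Fin.default_eq_zero, Finset.prod_singleton, Matrix.det_fin_one,
      Matrix.add_apply, Matrix.one_apply_eq, Matrix.mul_apply, Matrix.transpose_apply,
      Finset.sum_singleton, Fintype.card_fin]
    rw [Real.sq_sqrt (by nlinarith [mul_self_nonneg (tm Y l 0 0)]), ← sq]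
    rfl
  have hm : Measurable fun t : ℝ => ENNReal.ofReal ((1 + t ^ 2)⁻¹) := by fun_prop
  have h0 : ∫⁻ t : ℝ, ENNReal.ofReal ((1 + t ^ 2)⁻¹) = ENNReal.ofReal Real.pi := by
    rw [← ofReal_integral_eq_lintegral_ofReal integrable_inv_one_add_sq
      (Filter.Eventually.of_forall fun t => by positivity), integral_univ_inv_one_add_sq]
  rw [facC]
  simp only [h1, Fintype.card_fin, mul_one]
  rw [volume_pi, lintegral_fintype_prod (fun _ : Fin m => (volume : Measure (Fin 1 → Fin 1 → ℝ)))
    (fun _ y => ∏ i, ∏ j, ENNReal.ofReal ((1 + y i j ^ 2)⁻¹)) fun _ => by fun_prop]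
  simp only [volume_pi]
  rw [lintegral_fintype_prod (fun _ : Fin 1 => (Measure.pi fun _ : Fin 1 => (volume : Measure ℝ)))
    (fun _ y => ∏ j, ENNReal.ofReal ((1 + y j ^ 2)⁻¹)) fun _ => by fun_prop,
    lintegral_fintype_prod (fun _ : Fin 1 => (volume : Measure ℝ))
    (fun _ y => ENNReal.ofReal ((1 + y ^ 2)⁻¹)) fun _ => hm, h0]
  simp only [Finset.prod_const, Finset.card_univ, Fintype.card_fin, pow_one]
  rw [← mul_pow, gkk, ← ENNReal.ofReal_mul (by positivity), ENNReal.ofReal_pow (by positivity)]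
  congr 2
  rw [Real.sqrt_div Real.pi_pos.le, Real.sqrt_mul (by norm_num)]
  have h2 : √Real.pi ^ 2 = Real.pi := Real.sq_sqrt Real.pi_pos.le
  have h3 : √Real.pi ≠ 0 := (Real.sqrt_pos.2 Real.pi_pos).ne'
  field_simp
  linarith

theorem resultant_X_sub_C_X_sub_C (x y : ℝ) :
    resultant (X - C x) (X - C y) 1 1 = x - y := by
  rw [resultant_X_sub_C_left _ _ _ (natDegree_X_sub_C_le y)]
  simp

theorem facSum_quad_const (f : ℝ[X]) (hf : f.Monic) (hd : f.natDegree = 2) (h0 : dsc f ≠ 0)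
    (c : ENNReal) : facSum 1 (fun _ _ => c) f = if 0 < dsc f then 2 * c else 0 := by
  have hlin : ∀ z ∈ Fac 1 f, ∃ x y : ℝ, z = (X - C x, X - C y) := by
    rintro ⟨p, q⟩ ⟨h1, h2, h3, h4⟩
    have hq : q.natDegree = 1 := by
      have h5 : (p * q).natDegree = p.natDegree + q.natDegree := h1.natDegree_mul h2
      change p * q = f at h3
      change p.natDegree = 1 at h4
      rw [h3, hd, h4] at h5; omega
    refine ⟨-p.coeff 0, -q.coeff 0, ?_⟩
    simp only [C_neg, sub_neg_eq_add, Prod.mk.injEq]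
    exact ⟨h1.eq_X_add_C h4, h2.eq_X_add_C hq⟩
  have hcoef : ∀ x y : ℝ, ((X - C x) * (X - C y) : ℝ[X]) = X ^ 2 + C (-(x + y)) * X + C (x * y) := by
    intro x y; rw [C_neg, C_add, C_mul]; ring
  have h2 := monic_quad_eq f hf hd
  have hc1 : ∀ x y : ℝ, ((X - C x) * (X - C y) : ℝ[X]) = f ↔ x + y = -f.coeff 1 ∧ x * y = f.coeff 0 := by
    intro x y
    constructor
    · intro h
      rw [← h, hcoef]
      simp [coeff_X, coeff_C]
    · rintro ⟨h3, h4⟩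
      rw [hcoef, h3, h4, neg_neg, ← h2]
  have hdsc : ∀ x y : ℝ, ((X - C x) * (X - C y) : ℝ[X]) = f → dsc f = (x - y) ^ 2 := by
    intro x y h
    obtain ⟨h3, h4⟩ := (hc1 x y).1 h
    rw [dsc, ← h4]; linear_combination (f.coeff 1 - x - y) * h3
  split_ifs with h
  · set s := √(dsc f)
    have hs : s ^ 2 = dsc f := Real.sq_sqrt h.le
    have hs0 : s ≠ 0 := (Real.sqrt_pos.2 h).ne'
    set a := (-f.coeff 1 + s) / 2 with ha
    set b := (-f.coeff 1 - s) / 2 with hb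
    have hab : a + b = -f.coeff 1 := by rw [ha, hb]; ring
    have hab2 : a * b = f.coeff 0 := by rw [ha, hb]; rw [dsc] at hs; linear_combination (-1 / 4) * hs
    have hne : a ≠ b := fun h => hs0 (by linarith)
    rw [facSum_eq_sum 1 f {(X - C a, X - C b), (X - C b, X - C a)}, Finset.sum_pair, two_mul]
    · intro h
      exact hne (by simpa using (Prod.mk.inj h).1)
    · intro z
      simp only [Finset.mem_insert, Finset.mem_singleton]
      constructor
      · rintro (rfl | rfl)
        · exact ⟨monic_X_sub_C _, monic_X_sub_C _, (hc1 a b).2 ⟨hab, hab2⟩, natDegree_X_sub_C _⟩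
        · exact ⟨monic_X_sub_C _, monic_X_sub_C _, (hc1 b a).2 ⟨by rw [add_comm, hab],
            by rw [mul_comm, hab2]⟩, natDegree_X_sub_C _⟩
      · intro hz
        obtain ⟨x, y, rfl⟩ := hlin z hz
        obtain ⟨h3, h4⟩ := (hc1 x y).1 hz.2.2.1
        have h5 : (x - a) * (x - b) = 0 := by
          linear_combination x * h3 - h4 - x * hab + hab2
        rcases mul_eq_zero.1 h5 with h6 | h6
        · left
          have hx : x = a := by linarith
          have hy : y = b := by linarith
          rw [hx, hy]
        · right
          have hx : x = b := by linarith
          have hy : y = a := by linarith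
          rw [hx, hy]
  · rw [facSum_eq_sum 1 f ∅, Finset.sum_empty]
    intro z
    simp only [Finset.notMem_empty, false_iff]
    intro hz
    obtain ⟨x, y, rfl⟩ := hlin z hz
    have := hdsc x y hz.2.2.1
    exact h (lt_of_le_of_ne (this ▸ sq_nonneg _) h0.symm)

theorem facSum_congr_mul (f : ℝ[X]) (G : ℝ[X] → ENNReal) :
    facSum 1 (fun p q => G (p * q)) f = facSum 1 (fun _ _ => G f) f := by
  unfold facSum
  exact tsum_congr fun z => congrArg G z.2.2.2.1

theorem two_mul_lintegral_real_quad {m : ℕ} [NeZero m] (G : ℝ[X] → ENNReal) (hG : Measurable G) :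
    2 * ∫⁻ f, (if 0 < dsc f then G f else 0) ∂chiLaw m 2
      = ENNReal.ofReal (√(Real.pi / 2) ^ m) * ∫⁻ z : ℝ × ℝ, ENNReal.ofReal |z.1 - z.2|
          * G ((X - C z.1) * (X - C z.2)) ∂(plaw m).prod (plaw m) := by
  have hG2 : Measurable fun z : ℝ[X] × ℝ[X] => G (z.1 * z.2) := hG.comp measurable_mul
  have h := lintegral_facSum_fin (m := m) 1 1 2 rfl (fun p q => G (p * q)) hG2
  have hite : Measurable fun f => if 0 < dsc f then G f else 0 :=
    Measurable.ite (measurableSet_lt measurable_const measurable_dsc) hG measurable_const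
  have hae : ∀ᵐ Y ∂gam m (Fin 2) (Fin 2), facSum 1 (fun p q => G (p * q)) (tchi Y)
      = 2 * if 0 < dsc (tchi Y) then G (tchi Y) else 0 := by
    have h3 := ae_of_ae_map measurable_tchi.aemeasurable (ae_chiLaw_dsc m)
    filter_upwards [h3] with Y h3
    rw [facSum_congr_mul, facSum_quad_const _ (monic_tchi Y) (by rw [natDegree_tchi, Fintype.card_fin]) h3]
    split_ifs <;> simp
  have hite' : Measurable fun Y : Tup m (Fin 2) (Fin 2) => if 0 < dsc (tchi Y) then G (tchi Y) else 0 :=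
    hite.comp measurable_tchi
  rw [lintegral_congr_ae hae, lintegral_const_mul _ hite',
    ← lintegral_chiLaw hite, facC_one] at h
  rw [h, chiLaw_one]
  congr 1
  have hM : MeasurePreserving (fun x : ℝ => (X - C x : ℝ[X])) (plaw m) ((plaw m).map fun x => X - C x) :=
    ⟨measurable_X_sub_C, rfl⟩
  have hm : Measurable fun z : ℝ[X] × ℝ[X] => ENNReal.ofReal |resultant z.1 z.2 1 1| * G (z.1 * z.2) :=
    (measurable_abs.comp (measurable_resultant_poly 1 1)).ennreal_ofReal.mul hG2
  rw [← (hM.prod hM).lintegral_comp hm]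
  refine lintegral_congr fun z => ?_
  simp only [Prod.map_fst, Prod.map_snd, resultant_X_sub_C_X_sub_C]

theorem two_mul_integral_real_quad {m : ℕ} [NeZero m] (F : ℝ[X] → ℝ) (hF : Measurable F)
    (hF1 : Integrable F (chiLaw m 2))
    (hF2 : Integrable (fun z : ℝ × ℝ => |z.1 - z.2| * F ((X - C z.1) * (X - C z.2)))
      ((plaw m).prod (plaw m))) :
    2 * ∫ f, (if 0 < dsc f then F f else 0) ∂chiLaw m 2
      = √(Real.pi / 2) ^ m * ∫ z : ℝ × ℝ, |z.1 - z.2|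
          * F ((X - C z.1) * (X - C z.2)) ∂(plaw m).prod (plaw m) := by
  have hs : MeasurableSet {f | 0 < dsc f} := measurableSet_lt measurable_const measurable_dsc
  have hI : Integrable (fun f => if 0 < dsc f then F f else 0) (chiLaw m 2) := by
    refine (hF1.indicator hs).congr (Filter.Eventually.of_forall fun f => ?_)
    simp [Set.indicator_apply]
  have key : ∀ s : ℝ, ∫⁻ f, ENNReal.ofReal (s * if 0 < dsc f then F f else 0) ∂chiLaw m 2
      = ENNReal.ofReal (√(Real.pi / 2) ^ m / 2) * ∫⁻ z : ℝ × ℝ,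
        ENNReal.ofReal (s * (|z.1 - z.2| * F ((X - C z.1) * (X - C z.2)))) ∂(plaw m).prod (plaw m) := by
    intro s
    have h := two_mul_lintegral_real_quad (m := m) (fun f => ENNReal.ofReal (s * F f))
      (hF.const_mul s).ennreal_ofReal
    have h1 : ∀ f : ℝ[X], ENNReal.ofReal (s * if 0 < dsc f then F f else 0)
        = if 0 < dsc f then ENNReal.ofReal (s * F f) else 0 := by
      intro f; split_ifs <;> simp
    have h2 : ∀ z : ℝ × ℝ, ENNReal.ofReal (s * (|z.1 - z.2| * F ((X - C z.1) * (X - C z.2))))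
        = ENNReal.ofReal |z.1 - z.2| * ENNReal.ofReal (s * F ((X - C z.1) * (X - C z.2))) := by
      intro z; rw [← ENNReal.ofReal_mul (abs_nonneg _)]; congr 1; ring
    simp only [h1, h2]
    rw [ENNReal.ofReal_div_of_pos two_pos, div_eq_mul_inv, mul_right_comm, ← h, ENNReal.ofReal_ofNat,
      mul_comm, ← mul_assoc, ENNReal.inv_mul_cancel (by simp) (by simp), one_mul]
  have k1 := key 1
  have k2 := key (-1)
  simp only [one_mul, neg_one_mul] at k1 k2
  rw [integral_eq_lintegral_pos_part_sub_lintegral_neg_part hI,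
    integral_eq_lintegral_pos_part_sub_lintegral_neg_part hF2, k1, k2, ENNReal.toReal_mul,
    ENNReal.toReal_mul, ENNReal.toReal_ofReal (by positivity)]
  ring

/-- The skew form of the reductions of two powers modulo a quadratic. -/
noncomputable def qskew (b c : ℕ) (f : ℝ[X]) : ℝ := qr f b 0 * qr f c 1 - qr f c 0 * qr f b 1

theorem measurable_qskew (b c : ℕ) : Measurable (qskew b c) :=
  ((measurable_qr b 0).mul (measurable_qr c 1)).sub ((measurable_qr c 0).mul (measurable_qr b 1))

theorem allMom_qskew {m : ℕ} (b c : ℕ) : AllMom (chiLaw m 2) (qskew b c) :=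
  ((allMom_qr b 0).mul (allMom_qr c 1)).sub ((allMom_qr c 0).mul (allMom_qr b 1))

theorem qskew_linear (b c : ℕ) (x y : ℝ) :
    (y - x) * qskew b c ((X - C x) * (X - C y)) = x ^ b * y ^ c - x ^ c * y ^ b := by
  set p : ℝ[X] := (X - C x) * (X - C y) with hp
  have hcoef : p = X ^ 2 + C (-(x + y)) * X + C (x * y) := by
    rw [hp, C_neg, C_add, C_mul]; ring
  have h1 : p.coeff 1 = -(x + y) := by rw [hcoef]; simp [coeff_C]
  have h0 : p.coeff 0 = x * y := by rw [hcoef]; simp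
  have ex : ∀ k, qr p k 1 * x + qr p k 0 = x ^ k := fun k => by
    exact_mod_cast qr_eigen p x y (by rw [h1]; push_cast; rfl) (by rw [h0]; push_cast; rfl) k
  have ey : ∀ k, qr p k 1 * y + qr p k 0 = y ^ k := fun k => by
    exact_mod_cast qr_eigen p y x (by rw [h1]; push_cast; ring) (by rw [h0]; push_cast; ring) k
  rw [← ex, ← ex, ← ey, ← ey, qskew]
  ring

/-- The part of the skew pairing carried by the quadratics with real roots. -/
noncomputable def realMat (m n : ℕ) : Matrix (Fin n) (Fin n) ℝ :=
  Matrix.of fun i j => ∫ f, (if 0 < dsc f then qskew (2 * i) (2 * j + 1) f else 0) ∂chiLaw m 2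

theorem skewMat_eq (m n : ℕ) (z : ℝ) : skewMat m n z = skewMat m n 1 + (z - 1) • realMat m n := by
  have h : ∀ (z : ℝ) (b c : ℕ), qmom m z b c - qmom m z c b = ∫ f, wq z f * qskew b c f ∂chiLaw m 2 := by
    intro z b c
    rw [qmom, qmom, ← integral_sub ((allMom_wq z).mul ((allMom_qr b 0).mul (allMom_qr c 1))).integrable
      ((allMom_wq z).mul ((allMom_qr c 0).mul (allMom_qr b 1))).integrable]
    exact integral_congr_ae (Filter.Eventually.of_forall fun f => by simp only [qskew]; ring)
  have hs : MeasurableSet {f | 0 < dsc f} := measurableSet_lt measurable_const measurable_dsc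
  ext i j
  simp only [Matrix.add_apply, Matrix.smul_apply, realMat, skewMat, Matrix.of_apply, smul_eq_mul, h]
  rw [← integral_const_mul, ← integral_add]
  · refine integral_congr_ae (Filter.Eventually.of_forall fun f => ?_)
    simp only [wq]
    split_ifs <;> ring
  · exact ((allMom_wq 1).mul (allMom_qskew (m := m) (2 * (i : ℕ)) (2 * (j : ℕ) + 1))).integrable
  · refine (((allMom_qskew (m := m) (2 * (i : ℕ)) (2 * (j : ℕ) + 1)).integrable.indicator hs).congr
      (Filter.Eventually.of_forall fun f => ?_)).const_mul _
    simp [Set.indicator_apply]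

theorem allMom_plaw (m : ℕ) : AllMom (plaw m) fun x => x := by
  refine AllMom.of_map (measurable_finProd m) measurable_id ?_
  have h := allMom_prod_ofFn (κ := Fin 1) (μ := Measure.pi fun _ : Fin m => gau) m
    (fun v l => Matrix.of fun _ _ => v l)
    (fun l _ _ => allMom_gaussian.comp (measurePreserving_eval (fun _ : Fin m => gau) l)) 0 0
  refine (fun k => (memLp_congr_ae (Filter.Eventually.of_forall fun v => ?_)).1 (h k))
  have h2 : ∀ (k : ℕ) (A : Fin k → Matrix (Fin 1) (Fin 1) ℝ),
      (List.ofFn A).prod 0 0 = ∏ l, A l 0 0 := by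
    intro k
    induction k with
    | zero => intro A; simp
    | succ k ih => intro A; simp [List.ofFn_succ, Matrix.mul_apply, ih, Fin.prod_univ_succ]
  simp [h2]

/-- The symmetrized comparison of the moduli of two numbers. -/
noncomputable def absLt (x y : ℝ) : ℝ := (1 + Real.sign (|y| - |x|)) / 2

theorem measurable_sign : Measurable Real.sign :=
  Measurable.ite measurableSet_Iio measurable_const
    (Measurable.ite measurableSet_Ioi measurable_const measurable_const)

theorem abs_sign_le (x : ℝ) : |Real.sign x| ≤ 1 := by
  rcases lt_trichotomy x 0 with h | h | h
  · rw [Real.sign_of_neg h]; simp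
  · rw [h, Real.sign_zero]; simp
  · rw [Real.sign_of_pos h]; simp

theorem pow_mul_absLt (x y : ℝ) (c : ℕ) (hc : Odd c) :
    y ^ c * ((Real.sign (y - x) + Real.sign (y + x)) / 2) = |y| ^ c * absLt x y := by
  have hsx : ∀ x y : ℝ, Real.sign (y - x) + Real.sign (y + x)
      = Real.sign (y - |x|) + Real.sign (y + |x|) := by
    intro x y
    rcases abs_choice x with h | h <;> rw [h]
    rw [sub_neg_eq_add, ← sub_eq_add_neg]; ring
  rw [hsx, absLt]
  rcases lt_trichotomy y 0 with h | h | h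
  · rw [abs_of_neg h, hc.neg_pow, Real.sign_of_neg (by linarith [abs_nonneg x] : y - |x| < 0),
      show y + |x| = -(-y - |x|) by ring, Real.sign_neg]; ring
  · rw [h, abs_zero, zero_pow hc.pos.ne']; ring
  · rw [abs_of_pos h, Real.sign_of_pos (by linarith [abs_nonneg x] : 0 < y + |x|)]; ring

theorem map_neg_gau : gau.map (fun x => -x) = gau := by
  have h : gau.map (fun x => (-1 : ℝ) * x) = gau := by
    rw [map_const_mul_gau]
    congr 1
    ext; simp
  simpa using h

theorem measurePreserving_neg_plaw (m : ℕ) [NeZero m] :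
    MeasurePreserving (fun x => -x) (plaw m) (plaw m) := by
  obtain ⟨k, rfl⟩ : ∃ k, m = k + 1 := ⟨m - 1, by have := NeZero.pos m; omega⟩
  have h : MeasurePreserving (fun (v : Fin (k + 1) → ℝ) l => if l = 0 then -v l else v l)
      (Measure.pi fun _ => gau) (Measure.pi fun _ => gau) := by
    refine measurePreserving_pi (f := fun l x => if l = 0 then -x else x) _ _ fun l => ?_
    split_ifs
    · exact ⟨measurable_neg, map_neg_gau⟩
    · exact MeasurePreserving.id _
  refine ⟨measurable_neg, ?_⟩
  conv_rhs => rw [plaw, ← h.map_eq, Measure.map_map (measurable_finProd _) h.measurable]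
  rw [plaw, Measure.map_map measurable_neg (measurable_finProd _)]
  congr 1
  funext v
  simp [Fin.prod_univ_succ, Fin.succ_ne_zero]

/-- The weighted comparison of two independent products of Gaussian variables. -/
noncomputable def cmpInt (m b c : ℕ) : ℝ :=
  ∫ z : ℝ × ℝ, |z.1| ^ b * |z.2| ^ c * absLt z.1 z.2 ∂(plaw m).prod (plaw m)

theorem realMat_apply {m n : ℕ} [NeZero m] (i j : Fin n) :
    realMat m n i j = √(Real.pi / 2) ^ m * cmpInt m (2 * i) (2 * j + 1) := by
  set b := 2 * (i : ℕ) with hb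
  set c := 2 * (j : ℕ) + 1 with hc
  have hbe : Even b := even_two_mul _
  have hco : Odd c := odd_two_mul_add_one _
  set M := (plaw m).prod (plaw m) with hM
  have a1 : AllMom M fun z => z.1 := allMom_fst (allMom_plaw m)
  have a2 : AllMom M fun z => z.2 := allMom_snd (allMom_plaw m)
  have as : ∀ g : ℝ × ℝ → ℝ, Measurable g → AllMom M fun z => Real.sign (g z) := fun g hg =>
    AllMom.of_bound (measurable_sign.comp hg) 1 fun z => abs_sign_le _
  have m1 : Measurable fun z : ℝ × ℝ => z.2 - z.1 := by fun_prop
  have m2 : Measurable fun z : ℝ × ℝ => z.2 + z.1 := by fun_prop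
  have hpt : ∀ z : ℝ × ℝ, |z.1 - z.2| * qskew b c ((X - C z.1) * (X - C z.2))
      = Real.sign (z.2 - z.1) * (z.1 ^ b * z.2 ^ c) - Real.sign (z.2 - z.1) * (z.1 ^ c * z.2 ^ b) := by
    intro z
    rw [← mul_sub, ← qskew_linear, ← mul_assoc, abs_sub_comm]
    congr 1
    rcases lt_trichotomy (z.2 - z.1) 0 with h | h | h
    · rw [Real.sign_of_neg h, abs_of_neg h]; ring
    · rw [h]; simp
    · rw [Real.sign_of_pos h, abs_of_pos h]; ring
  have A1 := (as _ m1).mul ((a1.pow b).mul (a2.pow c))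
  have A2 := (as _ m1).mul ((a1.pow c).mul (a2.pow b))
  have A3 := (as _ m2).mul ((a1.pow b).mul (a2.pow c))
  have h := two_mul_integral_real_quad (m := m) (qskew b c) (measurable_qskew b c)
    (allMom_qskew b c).integrable ((A1.sub A2).integrable.congr
      (Filter.Eventually.of_forall fun z => (hpt z).symm))
  simp only [hpt] at h
  rw [integral_sub A1.integrable A2.integrable] at h
  have hswap : ∫ z : ℝ × ℝ, Real.sign (z.2 - z.1) * (z.1 ^ c * z.2 ^ b) ∂M
      = -∫ z : ℝ × ℝ, Real.sign (z.2 - z.1) * (z.1 ^ b * z.2 ^ c) ∂M := by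
    rw [hM, ← integral_prod_swap, ← integral_neg]
    refine integral_congr_ae (Filter.Eventually.of_forall fun z => ?_)
    simp only [Prod.fst_swap, Prod.snd_swap]
    rw [show z.1 - z.2 = -(z.2 - z.1) by ring, Real.sign_neg]; ring
  have hrefl : ∫ z : ℝ × ℝ, Real.sign (z.2 - z.1) * (z.1 ^ b * z.2 ^ c) ∂M
      = ∫ z : ℝ × ℝ, Real.sign (z.2 + z.1) * (z.1 ^ b * z.2 ^ c) ∂M := by
    have hp := (MeasurePreserving.id (plaw m)).prod (measurePreserving_neg_plaw m)
    have he : MeasurableEmbedding (Prod.map id (fun x : ℝ => -x) : ℝ × ℝ → ℝ × ℝ) :=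
      ((MeasurableEquiv.refl ℝ).prodCongr (MeasurableEquiv.neg ℝ)).measurableEmbedding
    conv_lhs => rw [hM, ← hp.integral_comp he]
    refine integral_congr_ae (Filter.Eventually.of_forall fun z => ?_)
    simp only [Prod.map_fst, Prod.map_snd, id]
    rw [hco.neg_pow, show -z.2 - z.1 = -(z.2 + z.1) by ring, Real.sign_neg]; ring
  have hsum : cmpInt m b c = (∫ z : ℝ × ℝ, Real.sign (z.2 - z.1) * (z.1 ^ b * z.2 ^ c) ∂M
      + ∫ z : ℝ × ℝ, Real.sign (z.2 + z.1) * (z.1 ^ b * z.2 ^ c) ∂M) / 2 := by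
    rw [← integral_add A1.integrable A3.integrable, ← integral_div]
    refine integral_congr_ae (Filter.Eventually.of_forall fun z => ?_)
    simp only
    rw [mul_assoc, ← pow_mul_absLt _ _ _ hco, hbe.pow_abs]
    ring
  rw [realMat, Matrix.of_apply, ← hb, ← hc, hsum, ← hrefl]
  rw [hswap] at h
  linarith

/-- The absolute moments of a Gaussian variable. -/
noncomputable def amom (s : ℕ) : ℝ := ∫ x, |x| ^ s ∂gau

theorem gmom_two_mul (i : ℕ) : gmom (2 * i) = amom (2 * i) := by
  simp only [gmom, amom, (even_two_mul i).pow_abs]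

theorem amom_pos (s : ℕ) : 0 < amom s := by
  have hi : Integrable (fun x : ℝ => |x| ^ s) gau := by
    have := ((allMom_gaussian.pow s).integrable).abs
    simpa [abs_pow] using this
  rw [amom, integral_pos_iff_support_of_nonneg (fun x => by positivity) hi]
  have : gau {0}ᶜ ≤ gau (Function.support fun x : ℝ => |x| ^ s) := by
    refine measure_mono fun x hx => ?_
    simp only [Function.mem_support]
    exact pow_ne_zero _ (abs_ne_zero.2 hx)
  refine lt_of_lt_of_le ?_ this
  have hna : NullSingletonClass gau := nullSingletonClass_gaussianReal one_ne_zero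
  rw [prob_compl_eq_one_sub (measurableSet_singleton _), measure_singleton]
  simp

theorem integral_gau (f : ℝ → ℝ) :
    ∫ x, f x ∂gau = (√(2 * Real.pi))⁻¹ * ∫ x, Real.exp (-x ^ 2 / 2) * f x := by
  rw [integral_gaussianReal_eq_integral_smul one_ne_zero, ← integral_const_mul]
  refine integral_congr_ae (Filter.Eventually.of_forall fun x => ?_)
  simp [gaussianPDFReal]
  ring

theorem amom_odd_eq (j : ℕ) : amom (2 * j + 1)
    = (√(2 * Real.pi))⁻¹ * (2 * ∫ r in Set.Ioi (0 : ℝ), Real.exp (-r ^ 2 / 2) * r ^ (2 * j + 1)) := by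
  rw [amom, integral_gau, ← integral_comp_abs (f := fun r => Real.exp (-r ^ 2 / 2) * r ^ (2 * j + 1))]
  simp only [sq_abs]

theorem rmom_eq_radial (j : ℕ) :
    rmom j = ∫ r in Set.Ioi (0 : ℝ), Real.exp (-r ^ 2 / 2) * r ^ (2 * j + 1) := by
  have hg : gau = volume.withDensity (gaussianPDF 0 1) := gaussianReal_of_var_ne_zero 0 one_ne_zero
  have hm : Measurable (gaussianPDF 0 1) := measurable_gaussianPDF 0 1
  have hpi := Real.pi_pos
  have hs : √(2 * Real.pi) * √(2 * Real.pi) = 2 * Real.pi := Real.mul_self_sqrt (by positivity)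
  rw [rmom, hg, prod_withDensity hm hm,
    integral_withDensity_eq_integral_toReal_smul (by fun_prop)
      (Filter.Eventually.of_forall fun z => ENNReal.mul_lt_top (by simp [gaussianPDF]) (by simp [gaussianPDF])),
    ← Measure.volume_eq_prod, ← integral_comp_polarCoord_symm]
  have : ∀ p : ℝ × ℝ, p.1 • ((gaussianPDF 0 1 (polarCoord.symm p).1
      * gaussianPDF 0 1 (polarCoord.symm p).2).toReal
      • ((polarCoord.symm p).1 ^ 2 + (polarCoord.symm p).2 ^ 2) ^ j)
      = (Real.exp (-p.1 ^ 2 / 2) * p.1 ^ (2 * j + 1)) * (2 * Real.pi)⁻¹ := by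
    intro p
    have hc := Real.sin_sq_add_cos_sq p.2
    have h2 : (p.1 * Real.cos p.2) ^ 2 + (p.1 * Real.sin p.2) ^ 2 = p.1 ^ 2 := by
      rw [mul_pow, mul_pow, ← mul_add, add_comm, hc, mul_one]
    have h3 : Real.exp (-p.1 ^ 2 / 2)
        = Real.exp (-(p.1 * Real.cos p.2) ^ 2 / 2) * Real.exp (-(p.1 * Real.sin p.2) ^ 2 / 2) := by
      rw [← Real.exp_add, ← h2]; congr 1; ring
    rw [ENNReal.toReal_mul, toReal_gaussianPDF, toReal_gaussianPDF]
    simp only [polarCoord_symm_apply, smul_eq_mul, gaussianPDFReal, h2, sub_zero, NNReal.coe_one,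
      mul_one]
    rw [h3, show (2 * Real.pi)⁻¹ = (√(2 * Real.pi))⁻¹ * (√(2 * Real.pi))⁻¹ by rw [← mul_inv, hs]]
    ring
  simp only [this]
  rw [polarCoord_target, Measure.volume_eq_prod,
    setIntegral_prod_mul (fun r => Real.exp (-r ^ 2 / 2) * r ^ (2 * j + 1)) fun _ => (2 * Real.pi)⁻¹]
  simp only [integral_const, measureReal_restrict_apply MeasurableSet.univ, Set.univ_inter,
    Real.volume_real_Ioo, smul_eq_mul]
  rw [max_eq_left (by linarith), show Real.pi - -Real.pi = 2 * Real.pi by ring,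
    mul_inv_cancel₀ (by positivity), mul_one]

theorem rmom_eq (j : ℕ) : rmom j = √(Real.pi / 2) * amom (2 * j + 1) := by
  have hpi := Real.pi_pos
  rw [amom_odd_eq, rmom_eq_radial, ← mul_assoc, ← mul_assoc, ← Real.sqrt_inv,
    ← Real.sqrt_mul (by positivity), show Real.pi / 2 * (2 * Real.pi)⁻¹ = (1 / 2) ^ 2 by field_simp,
    Real.sqrt_sq (by norm_num)]
  ring

section
variable {n : Type*} [Fintype n] [DecidableEq n]

theorem eval_det_one_add_X_smul (M : Matrix n n ℝ) (w : ℝ) :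
    (det (1 + (X : ℝ[X]) • M.map C)).eval w = det (1 + w • M) := by
  rw [← coe_evalRingHom, RingHom.map_det]
  congr 1
  ext i j
  simp only [RingHom.mapMatrix_apply, Matrix.map_apply, Matrix.add_apply, Matrix.smul_apply,
    smul_eq_mul, coe_evalRingHom, eval_add, eval_mul, eval_X, eval_C, Matrix.one_apply]
  split_ifs <;> simp

theorem two_mul_coeff_two_det_one_add (M : Matrix n n ℝ) :
    2 * (det (1 + (X : ℝ[X]) • M.map C)).coeff 2 = M.trace ^ 2 - (M * M).trace := by
  set D := det (1 + (X : ℝ[X]) • M.map C) with hD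
  have h1 : D = 1 + M.trace • X + D.divX.divX * X ^ 2 := det_one_add_X_smul M
  set E := D.divX.divX with hE
  set D2 := det (1 + (X : ℝ[X]) • (-(M * M)).map C) with hD2
  have h2 : D2 = 1 + (-(M * M)).trace • X + D2.divX.divX * X ^ 2 := det_one_add_X_smul _
  set F := D2.divX.divX
  have h1' : D.comp (-X) = 1 - M.trace • X + E.comp (-X) * X ^ 2 := by
    conv_lhs => rw [h1]
    simp [sub_eq_add_neg]
  have h2' : D2.comp (X ^ 2) = 1 - (M * M).trace • X ^ 2 + F.comp (X ^ 2) * X ^ 4 := by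
    conv_lhs => rw [h2]
    simp [sub_eq_add_neg, trace_neg, ← pow_mul]
  have hprod : D * D.comp (-X) = D2.comp (X ^ 2) := by
    refine Polynomial.funext fun w => ?_
    simp only [eval_mul, eval_comp, eval_neg, eval_X, eval_pow, hD, hD2, eval_det_one_add_X_smul]
    rw [← det_mul]
    congr 1
    simp only [add_mul, mul_add, one_mul, mul_one, mul_neg, smul_mul_assoc,
      mul_smul_comm, smul_add, smul_smul, neg_smul, smul_neg, pow_two]
    abel
  have hc : D.coeff 2 = E.eval 0 := by
    rw [hE, ← coeff_zero_eq_eval_zero, coeff_divX, coeff_divX]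
  rw [h1', h2', h1] at hprod
  simp only [smul_eq_C_mul] at hprod
  set t := M.trace
  set s := (M * M).trace
  have key : E + E.comp (-X) - C t ^ 2 + X ^ 2 * (E * E.comp (-X)) + C t * X * (E.comp (-X) - E)
      = - C s + F.comp (X ^ 2) * X ^ 2 := by
    have hX : (X : ℝ[X]) ^ 2 ≠ 0 := pow_ne_zero _ X_ne_zero
    refine mul_left_cancel₀ hX ?_
    linear_combination hprod
  have := congrArg (Polynomial.eval 0) key
  simp at this
  rw [hc]
  linarith
end

/-- The normalized comparison integrals. -/
noncomputable def pij (m i j : ℕ) : ℝ :=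
  cmpInt m (2 * i) (2 * j + 1) / (amom (2 * i) ^ m * amom (2 * j + 1) ^ m)

/-- The kernel of the point process of real roots. -/
noncomputable def realKer (m i j : ℕ) : ℝ := pij m i j - if j = 0 then 0 else pij m i (j - 1)

/-- The matrix of the kernel of the point process of real roots. -/
noncomputable def realKerMat (m n : ℕ) : Matrix (Fin n) (Fin n) ℝ :=
  Matrix.of fun i j => realKer m i j

theorem sum_realKer (m i j : ℕ) : ∑ k ∈ Finset.range (j + 1), realKer m i k = pij m i j := by
  induction j with
  | zero => simp [realKer]
  | succ j ih => rw [Finset.sum_range_succ, ih, realKer]; simp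

theorem genFun_eq_det (m n : ℕ) [NeZero m] (z : ℝ) :
    genFun m n z = (1 + (z - 1) • realKerMat m n).det := by
  let U : Matrix (Fin n) (Fin n) ℝ := Matrix.of fun i j => if i ≤ j then 1 else 0
  let d₁ : Fin n → ℝ := fun i => gmom (2 * i) ^ m
  let d₂ : Fin n → ℝ := fun j => rmom j ^ m
  have h1 : skewMat m n 1 = diagonal d₁ * U * diagonal d₂ := by
    ext i j
    rw [mul_diagonal, diagonal_mul, skewMat_one]
    simp [U, d₁, d₂]
  have h2 : realMat m n = diagonal d₁ * (realKerMat m n * U) * diagonal d₂ := by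
    ext i j
    have hs : (realKerMat m n * U) i j = pij m i j := by
      rw [← sum_realKer, Matrix.mul_apply]
      have : ∀ k : Fin n, realKerMat m n i k * U k j
          = (fun k : ℕ => if k ≤ j then realKer m i k else 0) k := fun k => by
        simp [U, realKerMat]
      rw [Finset.sum_congr rfl fun k _ => this k,
        Fin.sum_univ_eq_sum_range (fun k : ℕ => if k ≤ j then realKer m i k else 0),
        ← Finset.sum_filter]
      congr 1
      ext k
      simp only [Finset.mem_filter, Finset.mem_range]
      omega
    rw [mul_diagonal, diagonal_mul, hs, realMat_apply, pij]
    simp only [d₁, d₂, gmom_two_mul, rmom_eq, mul_pow]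
    have ha := amom_pos (2 * i)
    have hb := amom_pos (2 * j + 1)
    field_simp
  have h3 : ∀ z, skewMat m n z = diagonal d₁ * ((1 + (z - 1) • realKerMat m n) * U) * diagonal d₂ := by
    intro z
    rw [skewMat_eq, h1, h2]
    simp only [add_mul, mul_add, one_mul, smul_mul_assoc, mul_smul_comm]
  obtain ⟨c, hc⟩ := exists_genFun_eq_det (m := m) n
  have h4 : ∀ z, genFun m n z = (c * (diagonal d₁).det * U.det * (diagonal d₂).det)
      * (1 + (z - 1) • realKerMat m n).det := by
    intro z
    rw [hc, h3, det_mul, det_mul, det_mul]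
    ring
  have h5 := h4 1
  simp only [genFun, one_pow, integral_const, probReal_univ, smul_eq_mul, mul_one, sub_self, zero_smul,
    add_zero, det_one] at h5
  rw [h4, ← h5, one_mul]

theorem genFun_eq_sum (m n : ℕ) [NeZero m] (w : ℝ) : genFun m n (1 + w)
    = ∑ k ∈ Finset.range (n + 1), (∫ f, ((nroots f / 2).choose k : ℝ) ∂chiLaw m (2 * n)) * w ^ k := by
  have hm : ∀ k, Measurable fun f : ℝ[X] => ((nroots f / 2).choose k : ℝ) := fun k =>
    (measurable_of_countable fun j : ℕ => ((j / 2).choose k : ℝ)).comp measurable_nroots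
  have hle : ∀ᵐ f ∂chiLaw m (2 * n), nroots f / 2 ≤ n := by
    filter_upwards [ae_chiLaw_monic m (2 * n)] with f hf
    have := nroots_le f
    rw [hf.2] at this; omega
  have hi : ∀ k, Integrable (fun f : ℝ[X] => ((nroots f / 2).choose k : ℝ)) (chiLaw m (2 * n)) := by
    intro k
    refine Integrable.of_bound (hm k).aestronglyMeasurable ((n.choose k : ℕ) : ℝ) ?_
    filter_upwards [hle] with f hf
    rw [Real.norm_natCast]
    exact_mod_cast Nat.choose_le_choose k hf
  simp only [← integral_mul_const]
  rw [← integral_finsetSum _ fun k _ => (hi k).mul_const _, genFun]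
  refine integral_congr_ae ?_
  filter_upwards [hle] with f hf
  rw [add_comm, add_pow, ← Finset.sum_subset (Finset.range_subset_range.2 (Nat.succ_le_succ hf))]
  · exact Finset.sum_congr rfl fun k _ => by rw [one_pow]; ring
  · intro k _ hk
    rw [Nat.choose_eq_zero_of_lt (by simpa using hk)]; simp

theorem integral_choose_nroots (m n : ℕ) [NeZero m] (k : ℕ) (hk : k ≤ n) :
    ∫ f, ((nroots f / 2).choose k : ℝ) ∂chiLaw m (2 * n)
      = (det (1 + (X : ℝ[X]) • (realKerMat m n).map C)).coeff k := by
  have h : (∑ k ∈ Finset.range (n + 1),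
      C (∫ f, ((nroots f / 2).choose k : ℝ) ∂chiLaw m (2 * n)) * X ^ k)
      = det (1 + (X : ℝ[X]) • (realKerMat m n).map C) := by
    refine Polynomial.funext fun w => ?_
    rw [eval_det_one_add_X_smul, eval_finsetSum]
    have := genFun_eq_sum m n w
    rw [genFun_eq_det, add_sub_cancel_left] at this
    rw [this]
    simp
  rw [← h, finsetSum_coeff]
  simp [coeff_C_mul, coeff_X_pow, Nat.lt_succ_of_le hk]

theorem even_natDegree_of_roots_eq_zero : ∀ (d : ℕ) (q : ℝ[X]), q.natDegree = d → q ≠ 0 →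
    q.roots = 0 → Even d := by
  intro d
  induction d using Nat.strong_induction_on with
  | _ d ih =>
    intro q hd hq hr
    rcases Nat.eq_zero_or_pos d with rfl | hpos
    · exact Even.zero
    obtain ⟨p, hp, r, rfl⟩ := WfDvdMonoid.exists_irreducible_factor
      (not_isUnit_of_natDegree_pos q (hd ▸ hpos)) hq
    have hp0 := left_ne_zero_of_mul hq
    have hr0 := right_ne_zero_of_mul hq
    rw [roots_mul hq, add_eq_zero] at hr
    rw [natDegree_mul hp0 hr0] at hd
    have h1 : p.natDegree ≠ 1 := fun h => by
      obtain ⟨x, hx⟩ := exists_root_of_degree_eq_one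
        ((degree_eq_iff_natDegree_eq_of_pos one_pos).2 h)
      have := (mem_roots hp0).2 hx
      rw [hr.1] at this
      exact Multiset.notMem_zero _ this
    have h2 := hp.natDegree_le_two
    have h3 := hp.natDegree_pos
    have := ih r.natDegree (by omega) r rfl hr0 hr.2
    rw [← hd, show p.natDegree = 2 by omega]
    exact even_two.add this

theorem even_card_roots {p : ℝ[X]} {n : ℕ} (hp : p ≠ 0) (hd : p.natDegree = 2 * n) :
    Even p.roots.card := by
  obtain ⟨q, h1, h2, h3⟩ := exists_prod_multiset_X_sub_C_mul p
  have hq : q ≠ 0 := by rintro rfl; exact hp (by rw [← h1, mul_zero])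
  have := even_natDegree_of_roots_eq_zero _ q rfl hq h3
  rw [hd] at h2
  exact (Nat.even_add.1 (h2 ▸ even_two_mul n)).2 this

theorem card_roots_charpoly_smul {n : Type*} [Fintype n] [DecidableEq n] (A : Matrix n n ℝ)
    {c : ℝ} (hc : c ≠ 0) : (c • A).charpoly.roots.card = A.charpoly.roots.card := by
  have h : (c • A).charpoly = A.charpoly.scaleRoots c := by
    refine Polynomial.funext fun x => ?_
    obtain ⟨y, rfl⟩ : ∃ y, x = c * y := ⟨c⁻¹ * x, by field_simp⟩
    rw [scaleRoots_eval_mul, Matrix.charpoly_natDegree_eq_dim, eval_charpoly, eval_charpoly,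
      ← det_smul, smul_sub]
    congr 2
    ext i j
    simp [Matrix.scalar_apply, diagonal_apply]
  rw [h, roots_scaleRoots _ hc.isUnit, Multiset.card_map]

theorem prod_ofFn_smul {R n : Type*} [CommRing R] [Fintype n] [DecidableEq n] (c : R) :
    ∀ (m : ℕ) (A : Fin m → Matrix n n R), (List.ofFn fun i => c • A i).prod
      = c ^ m • (List.ofFn A).prod
  | 0, A => by simp
  | m + 1, A => by
    simp only [List.ofFn_succ, List.prod_cons]
    rw [prod_ofFn_smul c m fun i => A i.succ, smul_mul_smul_comm, pow_succ']

theorem map_mul_gaussian (N : ℕ) :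
    (gaussianReal 0 1).map (fun x => (√(N : ℝ))⁻¹ * x) = gaussianReal 0 (1 / N) := by
  rw [gaussianReal_map_const_mul]
  congr 1
  · simp
  · ext
    simp

theorem measurePreserving_scale (N m : ℕ) :
    MeasurePreserving (fun (X : Tup m (Fin N) (Fin N)) l i j => (√(N : ℝ))⁻¹ * X l i j)
      (gam m (Fin N) (Fin N)) (ensembleMeasure N m) :=
  measurePreserving_pi (f := fun _ (A : Fin N → Fin N → ℝ) i j => (√(N : ℝ))⁻¹ * A i j) _ _ fun _ =>
    measurePreserving_pi (f := fun _ (v : Fin N → ℝ) j => (√(N : ℝ))⁻¹ * v j) _ _ fun _ =>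
      measurePreserving_pi (f := fun _ x => (√(N : ℝ))⁻¹ * x) _ _ fun _ =>
        ⟨by fun_prop, map_mul_gaussian N⟩

theorem measurableEmbedding_scale {N : ℕ} (hN : 0 < N) (m : ℕ) :
    MeasurableEmbedding (fun (X : Tup m (Fin N) (Fin N)) l i j => (√(N : ℝ))⁻¹ * X l i j) := by
  refine Topology.IsClosedEmbedding.measurableEmbedding ?_
  have h : (√(N : ℝ))⁻¹ ≠ 0 := by positivity
  exact (Homeomorph.smulOfNeZero (α := Tup m (Fin N) (Fin N)) _ h).isClosedEmbedding

theorem numRealEigs_scale {N m : ℕ} (hN : 0 < N) (X : Tup m (Fin N) (Fin N)) :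
    numRealEigs N (prodMatrix N m fun l i j => (√(N : ℝ))⁻¹ * X l i j) = (tchi X).roots.card := by
  have h : (√(N : ℝ))⁻¹ ≠ 0 := by positivity
  rw [numRealEigs, tchi, ← card_roots_charpoly_smul (List.ofFn (tm X)).prod (pow_ne_zero m h),
    ← prod_ofFn_smul]
  rfl

theorem ae_card_roots_tchi (m n : ℕ) [NeZero m] : ∀ᵐ X ∂gam m (Fin (2 * n)) (Fin (2 * n)),
    ((tchi X).roots.card : ℝ) = 2 * ((nroots (tchi X) / 2 : ℕ) : ℝ) := by
  filter_upwards [ae_gam_of_ae ae_tupGood] with X hX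
  have h1 : nroots (tchi X) = (tchi X).roots.card :=
    Multiset.toFinset_card_of_nodup (nodup_roots hX.1)
  have h2 := even_card_roots (monic_tchi X).ne_zero
    (by rw [natDegree_tchi, Fintype.card_fin] : (tchi X).natDegree = 2 * n)
  rw [h1]
  exact_mod_cast (Nat.two_mul_div_two_of_even h2).symm

theorem measurable_half_nroots : Measurable fun f : ℝ[X] => ((nroots f / 2 : ℕ) : ℝ) :=
  (measurable_of_countable fun j : ℕ => ((j / 2 : ℕ) : ℝ)).comp measurable_nroots

theorem ae_half_nroots_le (m n : ℕ) [NeZero m] : ∀ᵐ f ∂chiLaw m (2 * n), nroots f / 2 ≤ n := by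
  filter_upwards [ae_chiLaw_monic m (2 * n)] with f hf
  have := nroots_le f
  rw [hf.2] at this; omega

theorem EN_eq_integral (m n : ℕ) (hn : 0 < n) [NeZero m] :
    EN (2 * n) m = 2 * ∫ f, ((nroots f / 2 : ℕ) : ℝ) ∂chiLaw m (2 * n) := by
  rw [EN, ← (measurePreserving_scale (2 * n) m).integral_comp
    (measurableEmbedding_scale (by omega) m), ← integral_const_mul,
    integral_chiLaw (measurable_half_nroots.const_mul 2)]
  refine integral_congr_ae ?_
  filter_upwards [ae_card_roots_tchi m n] with X hX
  rw [numRealEigs_scale (by omega), hX]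

theorem VN_eq_variance (m n : ℕ) (hn : 0 < n) [NeZero m] :
    VN (2 * n) m = 4 * variance (fun f => ((nroots f / 2 : ℕ) : ℝ)) (chiLaw m (2 * n)) := by
  have h1 : VN (2 * n) m = variance (fun X => ((tchi X).roots.card : ℝ))
      (gam m (Fin (2 * n)) (Fin (2 * n))) := by
    have hp := measurePreserving_scale (2 * n) m
    have he := measurableEmbedding_scale (N := 2 * n) (by omega) m
    simp only [VN, variance, evariance, ← hp.lintegral_comp_emb he, ← hp.integral_comp he,
      numRealEigs_scale (N := 2 * n) (by omega)]
  rw [h1, variance_congr (ae_card_roots_tchi m n), variance_const_mul]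
  rw [chiLaw, variance_map measurable_half_nroots.aemeasurable measurable_tchi.aemeasurable]
  norm_num
  rfl

theorem EN_eq_trace (m n : ℕ) (hn : 0 < n) [NeZero m] :
    EN (2 * n) m = 2 * (realKerMat m n).trace := by
  have h := integral_choose_nroots m n 1 hn
  rw [coeff_det_one_add_X_smul_one] at h
  rw [EN_eq_integral m n hn, ← h]
  simp only [Nat.choose_one_right]

theorem VN_eq_trace (m n : ℕ) (hn : 1 < n) [NeZero m] : VN (2 * n) m
    = 4 * ((realKerMat m n).trace - (realKerMat m n * realKerMat m n).trace) := by
  have h1 := integral_choose_nroots m n 1 hn.le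
  have h2 := integral_choose_nroots m n 2 hn
  rw [coeff_det_one_add_X_smul_one] at h1
  simp only [Nat.choose_one_right] at h1
  have h3 := two_mul_coeff_two_det_one_add (realKerMat m n)
  have hmem : ∀ p, MemLp (fun f : ℝ[X] => ((nroots f / 2 : ℕ) : ℝ)) p (chiLaw m (2 * n)) := fun p =>
    MemLp.of_bound measurable_half_nroots.aestronglyMeasurable n <| by
      filter_upwards [ae_half_nroots_le m n] with f hf
      rw [Real.norm_natCast]
      exact_mod_cast hf
  rw [← h2] at h3
  have h4 : ∫ f, ((nroots f / 2).choose 2 : ℝ) ∂chiLaw m (2 * n)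
      = ((∫ f, ((nroots f / 2 : ℕ) : ℝ) ^ 2 ∂chiLaw m (2 * n))
        - ∫ f, ((nroots f / 2 : ℕ) : ℝ) ∂chiLaw m (2 * n)) / 2 := by
    rw [← integral_sub (hmem 2).integrable_sq ((hmem 1).integrable le_rfl), ← integral_div]
    refine integral_congr_ae (Filter.Eventually.of_forall fun f => ?_)
    simp only [Nat.cast_choose_two]
    ring
  rw [VN_eq_variance m n (by omega), variance_eq_sub (hmem 2)]
  simp only [Pi.pow_apply]
  rw [h4, h1] at h3
  rw [h1]
  linarith

end

section

theorem integrable_abs_pow (s : ℕ) : Integrable (fun x : ℝ => |x| ^ s) gau := by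
  have := ((allMom_gaussian.pow s).integrable).abs
  simpa [abs_pow] using this

theorem amom_eq_gamma (s : ℕ) : amom s
    = (√(2 * Real.pi))⁻¹ * 2 * ((1 / 2 : ℝ) ^ (-((s : ℝ) + 1) / 2) * (1 / 2) * Real.Gamma ((s + 1) / 2)) := by
  rw [amom, integral_gau, mul_assoc]
  have h := integral_comp_abs (f := fun r => Real.exp (-r ^ 2 / 2) * r ^ s)
  simp only [sq_abs] at h
  rw [h, ← integral_rpow_mul_exp_neg_mul_rpow (p := 2) (q := s) (b := 1 / 2) (by norm_num)
    (by have : (0 : ℝ) ≤ s := s.cast_nonneg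
        linarith) (by norm_num)]
  congr 2
  refine setIntegral_congr_fun measurableSet_Ioi fun x _ => ?_
  simp only [Real.rpow_natCast, Real.rpow_two]
  rw [mul_comm]
  congr 2
  ring

theorem amom_add_two (s : ℕ) : amom (s + 2) = (s + 1) * amom s := by
  have hs : (0 : ℝ) ≤ s := s.cast_nonneg
  rw [amom_eq_gamma, amom_eq_gamma]
  push_cast
  rw [show ((s : ℝ) + 2 + 1) / 2 = (s + 1) / 2 + 1 by ring, Real.Gamma_add_one (by positivity),
    show -((s : ℝ) + 2 + 1) / 2 = -(s + 1) / 2 - 1 by ring, Real.rpow_sub (by norm_num), Real.rpow_one]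
  ring

theorem abs_pow_add_two (x : ℝ) (s : ℕ) : |x| ^ (s + 2) = |x| ^ s * x ^ 2 := by
  rw [pow_add, sq_abs]

theorem abs_pow_add_four (x : ℝ) (s : ℕ) : |x| ^ (s + 2 + 2) = |x| ^ s * x ^ 4 := by
  rw [abs_pow_add_two, abs_pow_add_two]; ring

theorem integrable_tilt_quad (s : ℕ) (a b c : ℝ) :
    Integrable (fun x : ℝ => |x| ^ s * (a + b * x ^ 2 + c * x ^ 4)) gau := by
  refine (((integrable_abs_pow s).const_mul a).add (((integrable_abs_pow (s + 2)).const_mul b).add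
    ((integrable_abs_pow (s + 2 + 2)).const_mul c))).congr (Filter.Eventually.of_forall fun x => ?_)
  simp only [Pi.add_apply, abs_pow_add_four, abs_pow_add_two]
  ring

theorem integral_tilt_quad (s : ℕ) (a b c : ℝ) :
    ∫ x, |x| ^ s * (a + b * x ^ 2 + c * x ^ 4) ∂gau
      = (a + b * (s + 1) + c * ((s + 1) * (s + 3))) * amom s := by
  have h : ∀ x : ℝ, |x| ^ s * (a + b * x ^ 2 + c * x ^ 4)
      = a * |x| ^ s + b * |x| ^ (s + 2) + c * |x| ^ (s + 2 + 2) := fun x => by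
    rw [abs_pow_add_four, abs_pow_add_two]; ring
  simp only [h]
  have i0 := (integrable_abs_pow s).const_mul a
  have i2 := (integrable_abs_pow (s + 2)).const_mul b
  have i4 := (integrable_abs_pow (s + 2 + 2)).const_mul c
  rw [integral_add (f := fun x => a * |x| ^ s + b * |x| ^ (s + 2)) (i0.add i2) i4,
    integral_add i0 i2, integral_const_mul, integral_const_mul, integral_const_mul]
  change a * amom s + b * amom _ + c * amom _ = _
  rw [amom_add_two (s + 2), amom_add_two s]
  push_cast
  ring

theorem integral_tilt_fourth (s : ℕ) : ∫ x, |x| ^ s * (x ^ 2 / (s + 1) - 1) ^ 4 ∂gau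
    = (12 / (s + 1) ^ 2 + 48 / (s + 1) ^ 3) * amom s := by
  have hs : (s : ℝ) + 1 ≠ 0 := by positivity
  set N : ℝ := s + 1 with hN
  have h : ∀ x : ℝ, |x| ^ s * (x ^ 2 / N - 1) ^ 4
      = |x| ^ s * (1 + (-4 / N) * x ^ 2 + (6 / N ^ 2) * x ^ 4)
        + |x| ^ (s + 2 + 2) * (0 + (-4 / N ^ 3) * x ^ 2 + (1 / N ^ 4) * x ^ 4) := fun x => by
    rw [abs_pow_add_four]
    field_simp
    ring
  simp only [h]
  rw [integral_add (integrable_tilt_quad _ _ _ _) (integrable_tilt_quad _ _ _ _), integral_tilt_quad, integral_tilt_quad, amom_add_two,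
    amom_add_two]
  push_cast
  have e : (s : ℝ) = N - 1 := by rw [hN]; ring
  rw [e]
  field_simp
  ring

theorem integrable_tilt_fourth (s : ℕ) :
    Integrable (fun x : ℝ => |x| ^ s * (x ^ 2 / (s + 1) - 1) ^ 4) gau := by
  have ha : AllMom gau fun x => x ^ 2 / (s + 1) - 1 := by
    have := ((allMom_gaussian.pow 2).mul (AllMom.const (s + 1 : ℝ)⁻¹)).sub (AllMom.const 1)
    simpa [div_eq_mul_inv] using this
  have hb : AllMom gau fun x => |x| ^ s := fun k => by
    have := ((allMom_gaussian.pow s) k).abs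
    exact (memLp_congr_ae (Filter.Eventually.of_forall fun x => by simp [abs_pow])).1 this
  exact (hb.mul (ha.pow 4)).integrable

theorem integral_tilt_cube_le (s : ℕ) :
    ∫ x, |x| ^ s * |x ^ 2 / (s + 1) - 1| ^ 3 ∂gau ≤ 31 * amom s / ((s + 1) * √(s + 1)) := by
  have hs : (0 : ℝ) < s + 1 := by positivity
  set N : ℝ := s + 1 with hN
  have hr : 0 < √N := Real.sqrt_pos.2 hs
  have hrr : √N * √N = N := Real.mul_self_sqrt hs.le
  have h2 : ∀ x : ℝ, |x| ^ s * (x ^ 2 / N - 1) ^ 2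
      = |x| ^ s * (1 + (-2 / N) * x ^ 2 + (1 / N ^ 2) * x ^ 4) := fun x => by
    field_simp; ring
  have i2 : Integrable (fun x : ℝ => |x| ^ s * (x ^ 2 / N - 1) ^ 2) gau := by
    simp only [h2]; exact integrable_tilt_quad _ _ _ _
  have i4 := integrable_tilt_fourth s
  rw [← hN] at i4
  have hle : ∀ x : ℝ, |x| ^ s * |x ^ 2 / N - 1| ^ 3
      ≤ (1 / (2 * √N)) * (|x| ^ s * (x ^ 2 / N - 1) ^ 2) + (√N / 2) * (|x| ^ s * (x ^ 2 / N - 1) ^ 4) := by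
    intro x
    set q := x ^ 2 / N - 1
    have h1 : |q| ^ 3 ≤ (1 / (2 * √N)) * q ^ 2 + (√N / 2) * q ^ 4 := by
      have e : (1 / (2 * √N)) * q ^ 2 + (√N / 2) * q ^ 4 - |q| ^ 3
          = |q| ^ 2 * (√N * |q| - 1) ^ 2 / (2 * √N) := by
        rw [← sq_abs q, show q ^ 4 = |q| ^ 4 by rw [Even.pow_abs (by decide)]]
        field_simp
        ring
      have : 0 ≤ |q| ^ 2 * (√N * |q| - 1) ^ 2 / (2 * √N) := by positivity
      linarith
    calc _ ≤ |x| ^ s * ((1 / (2 * √N)) * q ^ 2 + (√N / 2) * q ^ 4) := by gcongr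
      _ = _ := by ring
  have hmono := integral_mono_of_nonneg (Filter.Eventually.of_forall fun x : ℝ => by positivity)
    ((i2.const_mul _).add (i4.const_mul _)) (Filter.Eventually.of_forall hle)
  refine hmono.trans ?_
  simp only [Pi.add_apply]
  rw [integral_add (i2.const_mul _) (i4.const_mul _), integral_const_mul, integral_const_mul]
  have i4' := integral_tilt_fourth s
  rw [← hN] at i4'
  rw [i4']
  simp only [h2]
  rw [integral_tilt_quad]
  have e : (s : ℝ) = N - 1 := by rw [hN]; ring
  have hN1 : 1 ≤ N := by rw [hN]; linarith [(Nat.cast_nonneg s : (0 : ℝ) ≤ s)]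
  rw [e]
  have ha := amom_pos s
  have hN0 : N ≠ 0 := hs.ne'
  rw [show (1 / (2 * √N)) * ((1 + -2 / N * (N - 1 + 1) + 1 / N ^ 2 * ((N - 1 + 1) * (N - 1 + 3))) * amom s)
      = amom s / (N * √N) by field_simp; ring]
  have h5 : √N / 2 * ((12 / N ^ 2 + 48 / N ^ 3) * amom s) = (6 + 24 / N) * amom s / (N * √N) := by
    rw [div_mul_eq_mul_div, div_eq_div_iff (by norm_num) (by positivity)]
    have : √N * (12 / N ^ 2 + 48 / N ^ 3) * (N * √N) = (√N * √N) * N * (12 / N ^ 2 + 48 / N ^ 3) := by ring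
    rw [show √N * ((12 / N ^ 2 + 48 / N ^ 3) * amom s) * (N * √N)
      = (√N * √N) * N * (12 / N ^ 2 + 48 / N ^ 3) * amom s by ring, hrr]
    field_simp
    ring
  rw [h5, ← add_div]
  have : 24 / N ≤ 24 := div_le_self (by norm_num) hN1
  gcongr
  nlinarith

theorem norm_exp_mul_log_sub_le (a : ℂ) (ha : a.re = 0) : ∃ K : ℝ, 0 ≤ K ∧ ∀ y : ℝ, 0 ≤ y →
    ‖Complex.exp (a * Real.log y) - (1 + a * (y - 1) + a * (a - 1) / 2 * (y - 1) ^ 2)‖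
      ≤ K * |y - 1| ^ 3 := by
  set A := ‖a‖ with hA
  have hA0 : 0 ≤ A := norm_nonneg a
  refine ⟨(8 * A ^ 3 * Real.exp A + 2 * A + 9 * A ^ 2) + (16 + 4 * A + A * (A + 1)), by positivity,
    fun y hy => ?_⟩
  set q := y - 1 with hq
  have hqc : ((y : ℂ) - 1) = (q : ℂ) := by rw [hq]; push_cast; rfl
  rw [hqc]
  by_cases hs : |q| ≤ 1 / 2
  · set l := Real.log y with hl
    have hq1 : |-q| < 1 := by rw [abs_neg]; linarith
    have h0 := Real.abs_log_sub_add_sum_range_le hq1 2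
    have hlog : |l - q + q ^ 2 / 2| ≤ 2 * |q| ^ 3 := by
      simp only [Finset.sum_range_succ, Finset.sum_range_zero, abs_neg] at h0
      have e1 : (1 : ℝ) - -q = y := by rw [hq]; ring
      rw [e1] at h0
      have e2 : l - q + q ^ 2 / 2 = 0 + (-q) ^ (0 + 1) / ((0 : ℕ) + 1) + (-q) ^ (1 + 1) / ((1 : ℕ) + 1)
          + Real.log y := by rw [hl]; push_cast; ring
      rw [e2]
      refine h0.trans ?_
      rw [div_le_iff₀ (by linarith)]
      have : 0 ≤ |q| ^ 3 * (1 - 2 * |q|) := mul_nonneg (by positivity) (by linarith)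
      norm_num
      linarith
    have hq0 := abs_nonneg q
    have hq2 : |q| ^ 2 = q ^ 2 := sq_abs q
    have hlq : |l - q| ≤ 3 / 2 * |q| ^ 2 := by
      have : l - q = (l - q + q ^ 2 / 2) - q ^ 2 / 2 := by ring
      rw [this]
      refine (abs_sub _ _).trans ?_
      rw [abs_of_nonneg (by positivity : (0 : ℝ) ≤ q ^ 2 / 2)]
      have : 0 ≤ |q| ^ 2 * (1 - 2 * |q|) := mul_nonneg (by positivity) (by linarith)
      have : |q| ^ 3 = |q| ^ 2 * |q| := by ring
      linarith
    have hl2 : |l| ≤ 2 * |q| := by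
      have : l = (l - q) + q := by ring
      rw [this]
      refine (abs_add_le _ _).trans ?_
      nlinarith
    have hexp := Complex.norm_exp_sub_sum_le_norm_mul_exp (a * l) 3
    have hw : ‖a * (l : ℂ)‖ ≤ A * (2 * |q|) := by
      rw [norm_mul, Complex.norm_real, Real.norm_eq_abs]; gcongr
    have hw1 : ‖a * (l : ℂ)‖ ≤ A := hw.trans (by nlinarith)
    have hA1 : ‖Complex.exp (a * l) - ∑ k ∈ Finset.range 3, (a * (l : ℂ)) ^ k / (k.factorial : ℂ)‖
        ≤ 8 * A ^ 3 * Real.exp A * |q| ^ 3 := by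
      refine hexp.trans ?_
      calc _ ≤ (A * (2 * |q|)) ^ 3 * Real.exp A := by gcongr
        _ = _ := by ring
    have hA2 : ‖a * ((l - q + q ^ 2 / 2 : ℝ) : ℂ)‖ ≤ 2 * A * |q| ^ 3 := by
      rw [norm_mul, Complex.norm_real, Real.norm_eq_abs]
      calc _ ≤ A * (2 * |q| ^ 3) := by gcongr
        _ = _ := by ring
    have hA3 : ‖a ^ 2 / 2 * (((l - q) * (l + q) : ℝ) : ℂ)‖ ≤ 9 * A ^ 2 * |q| ^ 3 := by
      rw [norm_mul, norm_div, norm_pow, Complex.norm_real, Real.norm_eq_abs, abs_mul]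
      have : |l + q| ≤ 3 * |q| := (abs_add_le _ _).trans (by linarith)
      calc A ^ 2 / ‖(2 : ℂ)‖ * (|l - q| * |l + q|)
          ≤ A ^ 2 / ‖(2 : ℂ)‖ * ((3 / 2 * |q| ^ 2) * (3 * |q|)) := by gcongr
        _ = 9 / 4 * A ^ 2 * |q| ^ 3 := by rw [Complex.norm_ofNat]; ring
        _ ≤ _ := by gcongr; norm_num
    have hsplit : Complex.exp (a * l) - (1 + a * q + a * (a - 1) / 2 * (q : ℂ) ^ 2)
        = (Complex.exp (a * l) - ∑ k ∈ Finset.range 3, (a * (l : ℂ)) ^ k / (k.factorial : ℂ))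
          + a * ((l - q + q ^ 2 / 2 : ℝ) : ℂ) + a ^ 2 / 2 * (((l - q) * (l + q) : ℝ) : ℂ) := by
      simp only [Finset.sum_range_succ, Finset.sum_range_zero, Nat.factorial]
      push_cast
      ring
    rw [hsplit]
    refine (norm_add₃_le.trans (add_le_add_three hA1 hA2 hA3)).trans ?_
    have : 0 ≤ (16 + 4 * A + A * (A + 1)) * |q| ^ 3 := by positivity
    nlinarith
  · push Not at hs
    have hq0 := abs_nonneg q
    have h1 : ‖Complex.exp (a * Real.log y)‖ = 1 := by
      rw [Complex.norm_exp]; simp [ha]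
    have h2 : ‖a * (q : ℂ)‖ = A * |q| := by rw [norm_mul, Complex.norm_real, Real.norm_eq_abs]
    have h4 : 1 ≤ 8 * |q| ^ 3 := by nlinarith [mul_pos (sub_pos.2 hs) (sub_pos.2 hs), pow_nonneg hq0 2]
    have h5 : |q| ≤ 4 * |q| ^ 3 := by nlinarith [mul_pos (sub_pos.2 hs) (sub_pos.2 hs), pow_nonneg hq0 2]
    have h6 : |q| ^ 2 ≤ 2 * |q| ^ 3 := by nlinarith [pow_nonneg hq0 2]
    have h3' : ‖a * (a - 1) / 2 * (q : ℂ) ^ 2‖ ≤ A * (A + 1) / 2 * |q| ^ 2 := by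
      rw [norm_mul, norm_div, norm_mul, norm_pow, Complex.norm_real, Real.norm_eq_abs,
        Complex.norm_ofNat]
      have : ‖a - 1‖ ≤ A + 1 := (norm_sub_le _ _).trans (by simp [hA])
      gcongr
    have hA5 : A * |q| ≤ A * (4 * |q| ^ 3) := by gcongr
    have : ‖Complex.exp (a * Real.log y) - (1 + a * q + a * (a - 1) / 2 * (q : ℂ) ^ 2)‖
        ≤ 1 + (1 + A * |q| + A * (A + 1) / 2 * |q| ^ 2) := by
      refine (norm_sub_le _ _).trans (add_le_add h1.le (norm_add₃_le.trans
        (add_le_add_three (by simp) h2.le h3')))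
    have h7 : 0 ≤ (8 * A ^ 3 * Real.exp A + 2 * A + 9 * A ^ 2) * |q| ^ 3 := by positivity
    nlinarith

/-- The normalized characteristic function of the logarithm of the modulus of a tilted Gaussian. -/
noncomputable def tiltChar (a : ℂ) (s : ℕ) : ℂ :=
  (∫ x, ((|x| ^ s : ℝ) : ℂ) * Complex.exp (a * Real.log (x ^ 2 / (s + 1))) ∂gau) / amom s

theorem norm_tiltChar_sub_le (a : ℂ) (ha : a.re = 0) : ∃ K : ℝ, ∀ s : ℕ,
    ‖tiltChar a s - (1 + a * (a - 1) / ((s : ℂ) + 1))‖ ≤ K / (((s : ℝ) + 1) * √((s : ℝ) + 1)) := by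
  obtain ⟨K, hK0, hK⟩ := norm_exp_mul_log_sub_le a ha
  refine ⟨31 * K, fun s => ?_⟩
  have hs : (0 : ℝ) < s + 1 := by positivity
  have hA := amom_pos s
  have hAc : (amom s : ℂ) ≠ 0 := by exact_mod_cast hA.ne'
  have hsc : ((s : ℂ) + 1) ≠ 0 := by exact_mod_cast hs.ne'
  set y : ℝ → ℝ := fun x => x ^ 2 / (s + 1) with hy
  have hq1 : ∀ x : ℝ, |x| ^ s * (y x - 1) = |x| ^ s * (-1 + 1 / (s + 1) * x ^ 2 + 0 * x ^ 4) := fun x => by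
    simp only [hy]; ring
  have hq2 : ∀ x : ℝ, |x| ^ s * (y x - 1) ^ 2
      = |x| ^ s * (1 + (-2 / (s + 1)) * x ^ 2 + (1 / (s + 1) ^ 2) * x ^ 4) := fun x => by
    simp only [hy]; field_simp; ring
  have i0 : Integrable (fun x : ℝ => ((|x| ^ s : ℝ) : ℂ)) gau := (integrable_abs_pow s).ofReal
  have i1 : Integrable (fun x : ℝ => ((|x| ^ s * (y x - 1) : ℝ) : ℂ)) gau := by
    simp only [hq1]; exact (integrable_tilt_quad _ _ _ _).ofReal
  have i2 : Integrable (fun x : ℝ => ((|x| ^ s * (y x - 1) ^ 2 : ℝ) : ℂ)) gau := by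
    simp only [hq2]; exact (integrable_tilt_quad _ _ _ _).ofReal
  have ie : Integrable (fun x : ℝ => ((|x| ^ s : ℝ) : ℂ) * Complex.exp (a * Real.log (y x))) gau := by
    refine i0.norm.mono' (by fun_prop) (Eventually.of_forall fun x => ?_)
    rw [norm_mul, Complex.norm_exp]; simp [ha]
  have e1 : ∫ x, ((|x| ^ s * (y x - 1) : ℝ) : ℂ) ∂gau = 0 := by
    rw [integral_complex_ofReal]
    simp only [hq1]
    rw [integral_tilt_quad]
    have : (-1 + 1 / ((s : ℝ) + 1) * (s + 1) + 0 * ((s + 1) * (s + 3))) * amom s = 0 := by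
      field_simp; ring
    rw [this]; simp
  have e2 : ∫ x, ((|x| ^ s * (y x - 1) ^ 2 : ℝ) : ℂ) ∂gau = 2 / ((s : ℂ) + 1) * amom s := by
    rw [integral_complex_ofReal]
    simp only [hq2]
    rw [integral_tilt_quad]
    have : (1 + -2 / (s + 1) * (s + 1) + 1 / (s + 1) ^ 2 * (((s : ℝ) + 1) * (s + 3))) * amom s
        = 2 / (s + 1) * amom s := by field_simp; ring
    rw [this]; push_cast; rfl
  have e0 : ∫ x, ((|x| ^ s : ℝ) : ℂ) ∂gau = amom s := by
    rw [integral_complex_ofReal]; rfl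
  have ip : Integrable (fun x : ℝ => ((|x| ^ s : ℝ) : ℂ)
      * (1 + a * (y x - 1) + a * (a - 1) / 2 * ((y x : ℂ) - 1) ^ 2)) gau := by
    refine ((i0.add (i1.const_mul a)).add (i2.const_mul (a * (a - 1) / 2))).congr
      (Eventually.of_forall fun x => ?_)
    simp only [Pi.add_apply]; push_cast; ring
  have ep : ∫ x, ((|x| ^ s : ℝ) : ℂ) * (1 + a * (y x - 1) + a * (a - 1) / 2 * ((y x : ℂ) - 1) ^ 2) ∂gau
      = (1 + a * (a - 1) / ((s : ℂ) + 1)) * amom s := by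
    have : ∀ x : ℝ, ((|x| ^ s : ℝ) : ℂ) * (1 + a * (y x - 1) + a * (a - 1) / 2 * ((y x : ℂ) - 1) ^ 2)
        = ((|x| ^ s : ℝ) : ℂ) + a * ((|x| ^ s * (y x - 1) : ℝ) : ℂ)
          + (a * (a - 1) / 2) * ((|x| ^ s * (y x - 1) ^ 2 : ℝ) : ℂ) := fun x => by push_cast; ring
    simp only [this]
    have i01 : Integrable (fun x : ℝ => ((|x| ^ s : ℝ) : ℂ) + a * ((|x| ^ s * (y x - 1) : ℝ) : ℂ)) gau :=
      i0.add (i1.const_mul a)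
    rw [integral_add i01 (i2.const_mul _), integral_add i0 (i1.const_mul a), integral_const_mul,
      integral_const_mul, e0, e1, e2]
    field_simp
    ring
  have hdiff : tiltChar a s - (1 + a * (a - 1) / ((s : ℂ) + 1))
      = (∫ x, (((|x| ^ s : ℝ) : ℂ) * (Complex.exp (a * Real.log (y x))
        - (1 + a * (y x - 1) + a * (a - 1) / 2 * ((y x : ℂ) - 1) ^ 2))) ∂gau) / amom s := by
    simp only [mul_sub]
    rw [integral_sub ie (by simpa only [mul_sub] using ip)]
    have := ep
    simp only [mul_sub] at this
    rw [this, sub_div, tiltChar]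
    field_simp
    ring
  rw [hdiff, norm_div, Complex.norm_real, Real.norm_of_nonneg hA.le, div_le_iff₀ hA]
  refine (norm_integral_le_integral_norm _).trans ?_
  have hle : ∀ x : ℝ, ‖((|x| ^ s : ℝ) : ℂ) * (Complex.exp (a * Real.log (y x))
        - (1 + a * (y x - 1) + a * (a - 1) / 2 * ((y x : ℂ) - 1) ^ 2))‖
      ≤ K * (|x| ^ s * |x ^ 2 / (s + 1) - 1| ^ 3) := fun x => by
    rw [norm_mul, Complex.norm_real, Real.norm_of_nonneg (by positivity)]
    calc _ ≤ |x| ^ s * (K * |y x - 1| ^ 3) := by gcongr; exact hK _ (by positivity)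
      _ = _ := by ring
  have ic : Integrable (fun x : ℝ => |x| ^ s * |x ^ 2 / (s + 1) - 1| ^ 3) gau := by
    have ha : AllMom gau fun x => x ^ 2 / (s + 1) - 1 := by
      have := ((allMom_gaussian.pow 2).mul (AllMom.const (s + 1 : ℝ)⁻¹)).sub (AllMom.const 1)
      simpa [div_eq_mul_inv] using this
    refine ((allMom_gaussian.pow s).mul (ha.pow 3)).integrable.abs.congr (Eventually.of_forall fun x => ?_)
    simp only [abs_mul, abs_pow]
  refine (integral_mono_of_nonneg (Eventually.of_forall fun x => norm_nonneg _) (ic.const_mul K)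
    (Eventually.of_forall hle)).trans ?_
  rw [integral_const_mul]
  calc _ ≤ K * (31 * amom s / ((s + 1) * √(s + 1))) := by gcongr; exact integral_tilt_cube_le s
    _ = _ := by ring

theorem tendsto_pow_exp_of_tendsto_mul_sub_one {F : ℕ → ℂ} {m : ℕ → ℕ} {L : ℂ}
    (hF : Tendsto F atTop (nhds 1)) (h : Tendsto (fun n => (m n : ℂ) * (F n - 1)) atTop (nhds L)) :
    Tendsto (fun n => F n ^ m n) atTop (nhds (Complex.exp L)) := by
  have hd : DifferentiableAt ℂ Complex.log 1 := (Complex.hasDerivAt_log (by simp)).differentiableAt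
  have hG : Tendsto (fun n => dslope Complex.log 1 (F n)) atTop (nhds 1) := by
    have := (continuousAt_dslope_same.2 hd).tendsto.comp hF
    rwa [dslope_same, (Complex.hasDerivAt_log (by simp)).deriv, inv_one] at this
  have hl : Tendsto (fun n => (m n : ℂ) * Complex.log (F n)) atTop (nhds L) := by
    have := h.mul hG
    rw [mul_one] at this
    refine this.congr fun n => ?_
    have h2 := sub_smul_dslope Complex.log 1 (F n)
    rw [Complex.log_one, sub_zero, smul_eq_mul] at h2
    rw [mul_assoc, h2]
  have h0 : ∀ᶠ n in atTop, F n ≠ 0 := hF.eventually_ne one_ne_zero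
  refine ((Complex.continuous_exp.tendsto L).comp hl).congr' ?_
  filter_upwards [h0] with n hn
  simp only [Function.comp]
  rw [Complex.exp_nat_mul, Complex.exp_log hn]

theorem tendsto_tiltChar_pow (a : ℂ) (ha : a.re = 0) {s m : ℕ → ℕ} {v : ℝ}
    (hs : Tendsto s atTop atTop)
    (h : Tendsto (fun n => (m n : ℝ) / (s n + 1)) atTop (nhds v)) :
    Tendsto (fun n => tiltChar a (s n) ^ m n) atTop (nhds (Complex.exp (v * (a * (a - 1))))) := by
  obtain ⟨K, hK⟩ := norm_tiltChar_sub_le a ha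
  have hs1 : Tendsto (fun n => (s n : ℝ) + 1) atTop atTop :=
    tendsto_atTop_add_const_right _ _ (tendsto_natCast_atTop_atTop.comp hs)
  have hinv : Tendsto (fun n => 1 / ((s n : ℝ) + 1)) atTop (nhds 0) := hs1.const_div_atTop 1
  have hsq : Tendsto (fun n => K / √((s n : ℝ) + 1)) atTop (nhds 0) :=
    (Real.tendsto_sqrt_atTop.comp hs1).const_div_atTop K
  have hc : Tendsto (fun n => ((1 / ((s n : ℝ) + 1) : ℝ) : ℂ) * (a * (a - 1))) atTop (nhds 0) := by
    have := ((Complex.continuous_ofReal.tendsto 0).comp hinv).mul_const (a * (a - 1))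
    simpa using this
  have hr : Tendsto (fun n => tiltChar a (s n) - (1 + a * (a - 1) / ((s n : ℂ) + 1))) atTop (nhds 0) := by
    refine squeeze_zero_norm (fun n => hK (s n)) ?_
    have := hinv.mul hsq
    rw [zero_mul] at this
    refine this.congr fun n => ?_
    field_simp
  have hmr : Tendsto (fun n => (m n : ℂ) * (tiltChar a (s n) - (1 + a * (a - 1) / ((s n : ℂ) + 1))))
      atTop (nhds 0) := by
    have := h.mul hsq
    rw [mul_zero] at this
    refine squeeze_zero_norm (fun n => ?_) this
    rw [norm_mul, Complex.norm_natCast]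
    calc _ ≤ (m n : ℝ) * (K / (((s n : ℝ) + 1) * √((s n : ℝ) + 1))) := by gcongr; exact hK _
      _ = _ := by field_simp
  refine tendsto_pow_exp_of_tendsto_mul_sub_one ?_ ?_
  · have := (hr.add hc).add_const 1
    rw [zero_add, zero_add] at this
    refine this.congr fun n => ?_
    push_cast
    ring
  · have := hmr.add (((Complex.continuous_ofReal.tendsto v).comp h).mul_const (a * (a - 1)))
    rw [zero_add] at this
    refine this.congr fun n => ?_
    simp only [Function.comp]
    push_cast
    ring

theorem tendsto_mul_log_add_div {b m : ℕ → ℕ} {v : ℝ} (d : ℝ) (hb : Tendsto b atTop atTop)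
    (h : Tendsto (fun n => (m n : ℝ) / (b n + 1)) atTop (nhds v)) :
    Tendsto (fun n => (m n : ℝ) * (Real.log (b n + 1 + d) - Real.log (b n + 1))) atTop (nhds (v * d)) := by
  have hs1 : Tendsto (fun n => (b n : ℝ) + 1) atTop atTop :=
    tendsto_atTop_add_const_right _ _ (tendsto_natCast_atTop_atTop.comp hb)
  have hx : Tendsto (fun n => (1 + d / ((b n : ℝ) + 1))) atTop (nhds 1) := by
    have := (hs1.const_div_atTop d).const_add 1
    rwa [add_zero] at this
  have hD := Real.hasDerivAt_log (one_ne_zero (α := ℝ))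
  have hG : Tendsto (fun n => dslope Real.log 1 (1 + d / ((b n : ℝ) + 1))) atTop (nhds 1) := by
    have := (continuousAt_dslope_same.2 hD.differentiableAt).tendsto.comp hx
    rwa [dslope_same, hD.deriv, inv_one] at this
  have := (h.mul_const d).mul hG
  rw [mul_one] at this
  refine this.congr' ?_
  filter_upwards [hx.eventually (lt_mem_nhds one_pos)] with n hn
  have h2 := sub_smul_dslope Real.log 1 (1 + d / ((b n : ℝ) + 1))
  rw [Real.log_one, sub_zero, smul_eq_mul, add_sub_cancel_left] at h2
  have hp : (0 : ℝ) < b n + 1 := by positivity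
  have h3 : Real.log (b n + 1 + d) - Real.log (b n + 1) = Real.log (1 + d / ((b n : ℝ) + 1)) := by
    rw [show (b n : ℝ) + 1 + d = (b n + 1) * (1 + d / ((b n : ℝ) + 1)) by field_simp,
      Real.log_mul hp.ne' hn.ne']
    ring
  rw [h3, ← h2]
  ring

theorem integral_prod_plaw {𝕜 : Type*} [RCLike 𝕜] (m : ℕ) (f : ℝ →* 𝕜) (hf : Measurable f) :
    ∫ x, f x ∂plaw m = (∫ x, f x ∂gau) ^ m := by
  rw [plaw, integral_map (measurable_finProd m).aemeasurable hf.aestronglyMeasurable]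
  simp only [map_prod]
  rw [integral_fintype_prod_eq_prod (μ := fun _ : Fin m => gau) (f := fun _ : Fin m => (f : ℝ → 𝕜)),
    Finset.prod_const, Finset.card_univ, Fintype.card_fin]

/-- The power of the modulus as a monoid homomorphism. -/
noncomputable def absPowHom (s : ℕ) : ℝ →* ℝ := (powMonoidHom s).comp (absHom : ℝ →*₀ ℝ).toMonoidHom

theorem integral_abs_pow_plaw (m s : ℕ) : ∫ x, |x| ^ s ∂plaw m = amom s ^ m :=
  integral_prod_plaw m (absPowHom s) (measurable_id.abs.pow_const s)

/-- The Mellin weight of exponent `s + iθ` as a monoid homomorphism. -/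
noncomputable def mellinHom (s : ℕ) (hs : 0 < s) (θ : ℝ) : ℝ →* ℂ where
  toFun x := ((|x| ^ s : ℝ) : ℂ) * Complex.exp ((θ * Complex.I) * Real.log |x|)
  map_one' := by simp
  map_mul' x y := by
    by_cases hx : x = 0
    · simp [hx, hs.ne']
    by_cases hy : y = 0
    · simp [hy, hs.ne']
    rw [abs_mul, Real.log_mul (abs_ne_zero.2 hx) (abs_ne_zero.2 hy)]
    push_cast
    rw [mul_add, Complex.exp_add]
    ring

theorem measurable_mellinHom (s : ℕ) (hs : 0 < s) (θ : ℝ) : Measurable (mellinHom s hs θ) := by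
  have : Measurable fun x : ℝ =>
      ((|x| ^ s : ℝ) : ℂ) * Complex.exp ((θ * Complex.I) * Real.log |x|) := by fun_prop
  exact this

theorem integral_mellinHom (s : ℕ) (hs : 0 < s) (θ : ℝ) :
    ∫ x, mellinHom s hs θ x ∂gau
      = amom s * (Complex.exp ((θ * Complex.I / 2) * Real.log (s + 1)) * tiltChar (θ * Complex.I / 2) s) := by
  have hA : (amom s : ℂ) ≠ 0 := by exact_mod_cast (amom_pos s).ne'
  rw [tiltChar, mul_div_assoc', mul_div_cancel₀ _ hA, ← integral_const_mul]
  refine integral_congr_ae (Eventually.of_forall fun x => ?_)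
  change ((|x| ^ s : ℝ) : ℂ) * _ = _
  by_cases hx : x = 0
  · simp [hx, hs.ne']
  have hs1 : (0 : ℝ) < s + 1 := by positivity
  dsimp only
  rw [Real.log_div (by positivity) hs1.ne', mul_left_comm, ← Complex.exp_add, ← sq_abs x, Real.log_pow]
  congr 2
  push_cast
  ring

/-- The weight tilting a pair of products of Gaussians. -/
noncomputable def pairWeight (m b c : ℕ) (z : ℝ × ℝ) : ℝ :=
  |z.1| ^ b * |z.2| ^ c / (amom b ^ m * amom c ^ m)

theorem pairWeight_nonneg (m b c : ℕ) (z : ℝ × ℝ) : 0 ≤ pairWeight m b c z := by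
  have := amom_pos b
  have := amom_pos c
  unfold pairWeight; positivity

theorem measurable_pairWeight (m b c : ℕ) : Measurable (pairWeight m b c) := by
  unfold pairWeight; fun_prop

theorem integrable_abs_pow_plaw (m s : ℕ) : Integrable (fun x : ℝ => |x| ^ s) (plaw m) := by
  have := (((allMom_plaw m).pow s).integrable).abs
  simpa [abs_pow] using this

theorem integrable_pairWeight (m b c : ℕ) :
    Integrable (pairWeight m b c) ((plaw m).prod (plaw m)) :=
  ((integrable_abs_pow_plaw m b).mul_prod (integrable_abs_pow_plaw m c)).div_const _

theorem integral_pairWeight (m b c : ℕ) : ∫ z, pairWeight m b c z ∂(plaw m).prod (plaw m) = 1 := by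
  have h1 := amom_pos b
  have h2 := amom_pos c
  simp only [pairWeight]
  rw [integral_div, integral_prod_mul (fun x : ℝ => |x| ^ b) (fun x : ℝ => |x| ^ c),
    integral_abs_pow_plaw, integral_abs_pow_plaw, div_self (by positivity)]

/-- The tilted law of a pair of products of Gaussians. -/
noncomputable def tiltPair (m b c : ℕ) : Measure (ℝ × ℝ) :=
  ((plaw m).prod (plaw m)).withDensity fun z => ENNReal.ofReal (pairWeight m b c z)

instance (m b c : ℕ) : IsProbabilityMeasure (tiltPair m b c) := by
  constructor
  rw [tiltPair, withDensity_apply _ MeasurableSet.univ, Measure.restrict_univ,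
    ← ofReal_integral_eq_lintegral_ofReal (integrable_pairWeight m b c)
      (Eventually.of_forall fun z => pairWeight_nonneg m b c z), integral_pairWeight, ENNReal.ofReal_one]

theorem integral_tiltPair {E : Type*} [NormedAddCommGroup E] [NormedSpace ℝ E] (m b c : ℕ)
    (f : ℝ × ℝ → E) :
    ∫ z, f z ∂tiltPair m b c = ∫ z, pairWeight m b c z • f z ∂(plaw m).prod (plaw m) := by
  rw [tiltPair, integral_withDensity_eq_integral_toReal_smul
    (measurable_pairWeight m b c).ennreal_ofReal (Eventually.of_forall fun z => ENNReal.ofReal_lt_top)]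
  simp only [ENNReal.toReal_ofReal (pairWeight_nonneg m b c _)]

theorem measurable_logRatio : Measurable fun z : ℝ × ℝ => Real.log |z.2| - Real.log |z.1| := by
  fun_prop

/-- The tilted law of the logarithm of the ratio of two products of Gaussians. -/
noncomputable def ratioLaw (m b c : ℕ) : Measure ℝ :=
  (tiltPair m b c).map fun z => Real.log |z.2| - Real.log |z.1|

instance (m b c : ℕ) : IsProbabilityMeasure (ratioLaw m b c) :=
  Measure.isProbabilityMeasure_map measurable_logRatio.aemeasurable

theorem charFun_ratioLaw (m b c : ℕ) (hb : 0 < b) (hc : 0 < c) (θ : ℝ) :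
    charFun (ratioLaw m b c) θ = tiltChar (θ * Complex.I / 2) c ^ m
      * tiltChar (-θ * Complex.I / 2) b ^ m
      * Complex.exp ((θ * Complex.I / 2) * ((m : ℝ) * (Real.log (c + 1) - Real.log (b + 1)) : ℝ)) := by
  have hm : Measurable fun x : ℝ => Complex.exp (θ * x * Complex.I) := by fun_prop
  have h1 : (amom b : ℂ) ≠ 0 := by exact_mod_cast (amom_pos b).ne'
  have h2 : (amom c : ℂ) ≠ 0 := by exact_mod_cast (amom_pos c).ne'
  rw [charFun_apply_real, ratioLaw, integral_map measurable_logRatio.aemeasurable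
    hm.aestronglyMeasurable, integral_tiltPair]
  have : ∀ z : ℝ × ℝ, pairWeight m b c z
      • Complex.exp (θ * ((Real.log |z.2| - Real.log |z.1| : ℝ) : ℂ) * Complex.I)
      = mellinHom b hb (-θ) z.1 * mellinHom c hc θ z.2 / (amom b ^ m * amom c ^ m) := fun z => by
    change _ = ((|z.1| ^ b : ℝ) : ℂ) * Complex.exp (((-θ : ℝ) * Complex.I) * Real.log |z.1|)
      * (((|z.2| ^ c : ℝ) : ℂ) * Complex.exp ((θ * Complex.I) * Real.log |z.2|)) / _
    rw [mul_mul_mul_comm, ← Complex.exp_add, pairWeight, Complex.real_smul]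
    have he : θ * ((Real.log |z.2| - Real.log |z.1| : ℝ) : ℂ) * Complex.I
        = (((-θ : ℝ) * Complex.I) * Real.log |z.1|) + ((θ * Complex.I) * Real.log |z.2|) := by
      push_cast; ring
    rw [he]
    push_cast
    ring
  simp only [this]
  rw [integral_div, integral_prod_mul, integral_prod_plaw _ _ (measurable_mellinHom _ _ _),
    integral_prod_plaw _ _ (measurable_mellinHom _ _ _), integral_mellinHom, integral_mellinHom,
    mul_pow, mul_pow, mul_pow, mul_pow, ← Complex.exp_nat_mul, ← Complex.exp_nat_mul]
  have he : Complex.exp ((θ * Complex.I / 2) * ((m : ℝ) * (Real.log (c + 1) - Real.log (b + 1)) : ℝ))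
      = Complex.exp (m * (((-θ : ℝ) * Complex.I / 2) * Real.log (b + 1)))
        * Complex.exp (m * ((θ * Complex.I / 2) * Real.log (c + 1))) := by
    rw [← Complex.exp_add]
    congr 1
    push_cast
    ring
  rw [he]
  push_cast
  field_simp

theorem pij_eq_integral (m i j : ℕ) (hi : 0 < i) :
    pij m i j = ∫ x, (1 + Real.sign x) / 2 ∂ratioLaw m (2 * i) (2 * j + 1) := by
  have hm : Measurable fun x : ℝ => (1 + Real.sign x) / 2 := (measurable_sign.const_add 1).div_const 2
  rw [ratioLaw, integral_map measurable_logRatio.aemeasurable hm.aestronglyMeasurable,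
    integral_tiltPair, pij, cmpInt, ← integral_div]
  refine integral_congr_ae (Eventually.of_forall fun z => ?_)
  simp only [pairWeight, smul_eq_mul, absLt]
  by_cases h1 : z.1 = 0
  · simp [h1, hi.ne']
  by_cases h2 : z.2 = 0
  · simp [h2]
  have p1 := abs_pos.2 h1
  have p2 := abs_pos.2 h2
  have : Real.sign (|z.2| - |z.1|) = Real.sign (Real.log |z.2| - Real.log |z.1|) := by
    rcases lt_trichotomy |z.2| |z.1| with h | h | h
    · rw [Real.sign_of_neg (sub_neg.2 h), Real.sign_of_neg (sub_neg.2 (Real.log_lt_log p2 h))]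
    · simp [h]
    · rw [Real.sign_of_pos (sub_pos.2 h), Real.sign_of_pos (sub_pos.2 (Real.log_lt_log p1 h))]
  rw [this]
  ring

theorem ratioLaw_le_pij (m i j : ℕ) (hi : 0 < i) :
    (ratioLaw m (2 * i) (2 * j + 1)).real (Set.Ioi 0) ≤ pij m i j
      ∧ pij m i j ≤ (ratioLaw m (2 * i) (2 * j + 1)).real (Set.Ici 0) := by
  have hg : Integrable (fun x => (1 + Real.sign x) / 2) (ratioLaw m (2 * i) (2 * j + 1)) := by
    refine Integrable.of_bound ((measurable_sign.const_add 1).div_const 2).aestronglyMeasurable 1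
      (Eventually.of_forall fun x => ?_)
    rw [Real.norm_eq_abs, abs_le]
    have := abs_le.1 (abs_sign_le x)
    constructor <;> linarith
  rw [pij_eq_integral m i j hi, ← integral_indicator_one measurableSet_Ioi,
    ← integral_indicator_one measurableSet_Ici]
  constructor
  · refine integral_mono ((integrable_const (1 : ℝ)).indicator measurableSet_Ioi) hg fun x => ?_
    rcases lt_trichotomy x 0 with h | h | h
    · simp [Set.indicator, Real.sign_of_neg h, not_lt.2 h.le]
    · simp [h]
    · simp [Set.indicator, Real.sign_of_pos h, h]
  · refine integral_mono hg ((integrable_const (1 : ℝ)).indicator measurableSet_Ici) fun x => ?_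
    rcases lt_trichotomy x 0 with h | h | h
    · simp [Set.indicator, Real.sign_of_neg h, not_le.2 h]
    · simp [h]; norm_num
    · simp [Set.indicator, Real.sign_of_pos h, h.le]

theorem tendsto_pij {i j m : ℕ → ℕ} {v : NNReal} (hv : v ≠ 0) (d : ℝ) (hi : Tendsto i atTop atTop)
    (hd : ∀ᶠ n in atTop, 2 * (j n : ℝ) + 1 = 2 * i n + d)
    (h : Tendsto (fun n => (m n : ℝ) / (2 * i n + 1)) atTop (nhds v)) :
    Tendsto (fun n => pij (m n) (i n) (j n)) atTop
      (nhds ((gaussianReal (v * d / 2) v).real (Set.Ioi 0))) := by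
  have hb : Tendsto (fun n => 2 * i n) atTop atTop := hi.const_mul_atTop' two_pos
  have hib : Tendsto (fun n => 2 * (i n : ℝ) + 1) atTop atTop :=
    tendsto_atTop_add_const_right _ _
      ((tendsto_natCast_atTop_atTop.comp hi).const_mul_atTop two_pos)
  have hcr : Tendsto (fun n => ((2 * j n + 1 : ℕ) : ℝ)) atTop atTop := by
    refine (tendsto_atTop_add_const_right _ (d - 1) hib).congr' ?_
    filter_upwards [hd] with n hn
    push_cast
    rw [hn]; ring
  have hc : Tendsto (fun n => 2 * j n + 1) atTop atTop := tendsto_natCast_atTop_iff.1 hcr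
  have hmb : Tendsto (fun n => (m n : ℝ) / ((2 * i n : ℕ) + 1)) atTop (nhds v) := by
    simpa using h
  have hmc : Tendsto (fun n => (m n : ℝ) / ((2 * j n + 1 : ℕ) + 1)) atTop (nhds v) := by
    have hx : Tendsto (fun n => (1 + d / (2 * (i n : ℝ) + 1))) atTop (nhds 1) := by
      have := (hib.const_div_atTop d).const_add 1
      rwa [add_zero] at this
    have := h.div hx one_ne_zero
    rw [div_one] at this
    refine this.congr' ?_
    filter_upwards [hd] with n hn
    have hp : (0 : ℝ) < 2 * i n + 1 := by positivity
    have : ((2 * j n + 1 : ℕ) : ℝ) + 1 = (2 * i n + 1) * (1 + d / (2 * (i n : ℝ) + 1)) := by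
      push_cast
      rw [hn]
      field_simp
      ring
    rw [this]
    simp only [Pi.div_apply]
    rw [div_div]
  have hlog := tendsto_mul_log_add_div d hb hmb
  let P : ℕ → ProbabilityMeasure ℝ := fun n => ⟨ratioLaw (m n) (2 * i n) (2 * j n + 1), inferInstance⟩
  let P₀ : ProbabilityMeasure ℝ := ⟨gaussianReal (v * d / 2) v, inferInstance⟩
  have hweak : Tendsto P atTop (nhds P₀) := by
    rw [ProbabilityMeasure.tendsto_iff_tendsto_charFun]
    intro θ
    change Tendsto (fun n => charFun (ratioLaw (m n) (2 * i n) (2 * j n + 1)) θ) atTop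
      (nhds (charFun (gaussianReal (v * d / 2) v) θ))
    have h1 := tendsto_tiltChar_pow (θ * Complex.I / 2) (by simp) hc hmc
    have h2 := tendsto_tiltChar_pow (-θ * Complex.I / 2) (by simp) hb hmb
    have h3 := ((Complex.continuous_exp.comp ((continuous_const (y := θ * Complex.I / 2)).mul
      Complex.continuous_ofReal)).tendsto (v * d)).comp hlog
    have hlim := (h1.mul h2).mul h3
    have he : charFun (gaussianReal (v * d / 2) v) θ
        = Complex.exp ((v : ℝ) * (θ * Complex.I / 2 * (θ * Complex.I / 2 - 1)))
          * Complex.exp ((v : ℝ) * (-θ * Complex.I / 2 * (-θ * Complex.I / 2 - 1)))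
          * Complex.exp (θ * Complex.I / 2 * ((v * d : ℝ) : ℂ)) := by
      rw [charFun_gaussianReal, ← Complex.exp_add, ← Complex.exp_add]
      congr 1
      push_cast
      ring_nf
      rw [Complex.I_sq]
      ring
    rw [he]
    refine hlim.congr' ?_
    filter_upwards [hd, hi.eventually_gt_atTop 0] with n hn hin
    rw [charFun_ratioLaw _ _ _ (by omega) (by omega)]
    simp only [Function.comp, Pi.mul_apply]
    have : ((2 * j n + 1 : ℕ) : ℝ) + 1 = (2 * i n : ℕ) + 1 + d := by
      push_cast
      rw [hn]; ring
    rw [this]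
  have := nullSingletonClass_gaussianReal (μ := v * d / 2) hv
  have hfr : ∀ s : Set ℝ, frontier s = {0} → Tendsto
      (fun n => (ratioLaw (m n) (2 * i n) (2 * j n + 1)).real s) atTop
      (nhds ((gaussianReal (v * d / 2) v).real s)) := fun s hs => by
    have := ProbabilityMeasure.tendsto_measure_of_null_frontier_of_tendsto' hweak (E := s)
      (by rw [hs]; exact measure_singleton (μ := gaussianReal (v * d / 2) v) 0)
    exact (ENNReal.tendsto_toReal (measure_ne_top _ _)).comp this
  have hIci : (gaussianReal (v * d / 2) v).real (Set.Ici 0)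
      = (gaussianReal (v * d / 2) v).real (Set.Ioi 0) := measureReal_congr Ioi_ae_eq_Ici.symm
  refine tendsto_of_tendsto_of_tendsto_of_le_of_le' (hfr _ frontier_Ioi)
    (by rw [← hIci]; exact hfr _ frontier_Ici) ?_ ?_
  · filter_upwards [hi.eventually_gt_atTop 0] with n hin using (ratioLaw_le_pij _ _ _ hin).1
  · filter_upwards [hi.eventually_gt_atTop 0] with n hin using (ratioLaw_le_pij _ _ _ hin).2

/-- The limit of the kernel of the point process of real roots at offset `k`. -/
noncomputable def limKer (v : ℝ) (k : ℤ) : ℝ :=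
  √(v / (8 * Real.pi)) * ∫ x in (2 * (k : ℝ) - 1)..(2 * (k : ℝ) + 1), Real.exp (-(v * x ^ 2) / 8)

theorem gaussianReal_Ioi_sub (v : NNReal) (hv : v ≠ 0) (k : ℤ) :
    (gaussianReal (v * (2 * k + 1) / 2) v).real (Set.Ioi 0)
      - (gaussianReal (v * (2 * k - 1) / 2) v).real (Set.Ioi 0) = limKer v k := by
  have hv0 : (0 : ℝ) < v := by positivity
  have hshift : ∀ μ : ℝ, (gaussianReal μ v).real (Set.Ioi 0) = (gaussianReal 0 v).real (Set.Ioi (-μ)) := by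
    intro μ
    have h : gaussianReal μ v = (gaussianReal 0 v).map (fun x => x + μ) := by
      rw [gaussianReal_map_add_const, zero_add]
    rw [h, map_measureReal_apply (measurable_add_const μ) measurableSet_Ioi]
    congr 1
    ext x
    simp [neg_lt_iff_pos_add]
  have hab : -((v : ℝ) * (2 * k + 1) / 2) ≤ -(v * (2 * k - 1) / 2) := by
    have : (v : ℝ) * (2 * k - 1) ≤ v * (2 * k + 1) := by gcongr; linarith
    linarith
  rw [hshift, hshift, ← measureReal_sdiff (Set.Ioi_subset_Ioi hab) measurableSet_Ioi, Set.Ioi_sdiff_Ioi,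
    measureReal_def, gaussianReal_apply_eq_integral 0 hv, ENNReal.toReal_ofReal
      (integral_nonneg fun x => gaussianPDFReal_nonneg _ _ _), ← intervalIntegral.integral_of_le hab,
    limKer]
  have hsub := intervalIntegral.integral_comp_mul_left (a := 2 * (k : ℝ) - 1) (b := 2 * k + 1)
    (fun y => Real.exp (-y ^ 2 / (2 * v))) (c := -(v / 2 : ℝ)) (by simp [hv0.ne'])
  have hexp : ∀ x : ℝ, Real.exp (-(-(v / 2 : ℝ) * x) ^ 2 / (2 * v)) = Real.exp (-(v * x ^ 2) / 8) := by
    intro x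
    congr 1
    field_simp
    ring
  simp only [hexp] at hsub
  rw [hsub, intervalIntegral.integral_symm]
  simp only [gaussianPDFReal, sub_zero]
  rw [intervalIntegral.integral_const_mul]
  have hpi := Real.pi_pos
  have hc : √(v / (8 * Real.pi)) = (√(2 * Real.pi * v))⁻¹ * (v / 2) := by
    rw [← Real.sqrt_inv, ← Real.sqrt_sq (by positivity : (0 : ℝ) ≤ v / 2), ← Real.sqrt_mul (by positivity)]
    congr 1
    field_simp
    ring
  rw [hc, smul_eq_mul]
  have e1 : -(v / 2 : ℝ) * (2 * k - 1) = -(v * (2 * k - 1) / 2) := by ring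
  have e2 : -(v / 2 : ℝ) * (2 * k + 1) = -(v * (2 * k + 1) / 2) := by ring
  rw [e1, e2]
  field_simp

theorem limKer_neg (v : ℝ) (k : ℤ) : limKer v (-k) = limKer v k := by
  have h := intervalIntegral.integral_comp_neg (a := 2 * (k : ℝ) - 1) (b := 2 * k + 1)
    (fun x => Real.exp (-(v * x ^ 2) / 8))
  simp only [neg_sq] at h
  rw [limKer, limKer, h]
  push_cast
  congr 2 <;> ring

theorem tendsto_realKer {i j m : ℕ → ℕ} {v : ℝ} (hv : 0 < v) (k : ℤ) (hi : Tendsto i atTop atTop)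
    (hd : ∀ᶠ n in atTop, (j n : ℤ) = i n + k)
    (h : Tendsto (fun n => (m n : ℝ) / (2 * i n + 1)) atTop (nhds v)) :
    Tendsto (fun n => realKer (m n) (i n) (j n)) atTop (nhds (limKer v k)) := by
  lift v to NNReal using hv.le
  have hv0 : v ≠ 0 := by exact_mod_cast hv.ne'
  rw [← gaussianReal_Ioi_sub v hv0]
  have hlarge : ∀ᶠ n in atTop, 1 ≤ j n := by
    filter_upwards [hd, hi.eventually_gt_atTop k.natAbs] with n hn hin
    omega
  have h1 := tendsto_pij hv0 (2 * k + 1) hi (j := j) (by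
    filter_upwards [hd] with n hn
    have : (j n : ℝ) = i n + k := by exact_mod_cast hn
    rw [this]; ring) h
  have h2 := tendsto_pij hv0 (2 * k - 1) hi (j := fun n => j n - 1) (by
    filter_upwards [hd, hlarge] with n hn hl
    have : (j n : ℝ) = i n + k := by exact_mod_cast hn
    rw [Nat.cast_sub hl, this]; push_cast; ring) h
  refine (h1.sub h2).congr' ?_
  filter_upwards [hlarge] with n hl
  rw [realKer, if_neg (by omega)]

theorem absLt_nonneg (x y : ℝ) : 0 ≤ absLt x y := by
  have := abs_le.1 (abs_sign_le (|y| - |x|))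
  unfold absLt; linarith

theorem absLt_le_one (x y : ℝ) : absLt x y ≤ 1 := by
  have := abs_le.1 (abs_sign_le (|y| - |x|))
  unfold absLt; linarith

theorem sq_mul_absLt_le (x y : ℝ) : |x| ^ 2 * absLt x y ≤ |y| ^ 2 := by
  rcases lt_or_ge |y| |x| with h | h
  · rw [absLt, Real.sign_of_neg (sub_neg.2 h)]
    simp [sq_nonneg]
  · calc _ ≤ |x| ^ 2 * 1 := by gcongr; exact absLt_le_one x y
      _ ≤ _ := by rw [mul_one]; gcongr

theorem cmpInt_nonneg (m b c : ℕ) : 0 ≤ cmpInt m b c :=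
  integral_nonneg fun z => mul_nonneg (by positivity) (absLt_nonneg _ _)

theorem integral_abs_pow_mul (m b c : ℕ) :
    ∫ z : ℝ × ℝ, |z.1| ^ b * |z.2| ^ c ∂(plaw m).prod (plaw m) = amom b ^ m * amom c ^ m := by
  rw [integral_prod_mul (fun x : ℝ => |x| ^ b) (fun x : ℝ => |x| ^ c),
    integral_abs_pow_plaw, integral_abs_pow_plaw]

theorem cmpInt_le (m b c : ℕ) : cmpInt m b c ≤ amom b ^ m * amom c ^ m := by
  rw [← integral_abs_pow_mul]
  refine integral_mono_of_nonneg (Eventually.of_forall fun z =>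
      mul_nonneg (by positivity) (absLt_nonneg _ _))
    ((integrable_abs_pow_plaw m b).mul_prod (integrable_abs_pow_plaw m c))
    (Eventually.of_forall fun z => mul_le_of_le_one_right (by positivity) (absLt_le_one _ _))

theorem cmpInt_add_two_le (m b c : ℕ) : cmpInt m (b + 2) c ≤ amom b ^ m * amom (c + 2) ^ m := by
  rw [← integral_abs_pow_mul]
  refine integral_mono_of_nonneg (Eventually.of_forall fun z =>
      mul_nonneg (by positivity) (absLt_nonneg _ _))
    ((integrable_abs_pow_plaw m b).mul_prod (integrable_abs_pow_plaw m (c + 2)))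
    (Eventually.of_forall fun z => ?_)
  calc |z.1| ^ (b + 2) * |z.2| ^ c * absLt z.1 z.2
      = |z.1| ^ b * |z.2| ^ c * (|z.1| ^ 2 * absLt z.1 z.2) := by ring
    _ ≤ |z.1| ^ b * |z.2| ^ c * |z.2| ^ 2 := by gcongr; exact sq_mul_absLt_le _ _
    _ = _ := by ring

theorem pij_nonneg (m i j : ℕ) : 0 ≤ pij m i j := by
  have := amom_pos (2 * i)
  have := amom_pos (2 * j + 1)
  exact div_nonneg (cmpInt_nonneg _ _ _) (by positivity)

theorem pij_le_one (m i j : ℕ) : pij m i j ≤ 1 := by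
  have := amom_pos (2 * i)
  have := amom_pos (2 * j + 1)
  exact div_le_one_of_le₀ (cmpInt_le _ _ _) (by positivity)

theorem pij_succ_le (m i j : ℕ) : pij m (i + 1) j ≤ ((2 * j + 2) / (2 * i + 1)) ^ m := by
  have h1 := amom_pos (2 * i)
  have h2 := amom_pos (2 * j + 1)
  have e1 := amom_add_two (2 * i)
  have e2 := amom_add_two (2 * j + 1)
  have := cmpInt_add_two_le m (2 * i) (2 * j + 1)
  rw [pij, mul_add_one, e1]
  calc _ ≤ amom (2 * i) ^ m * amom (2 * j + 1 + 2) ^ m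
        / ((((2 * i : ℕ) + 1) * amom (2 * i)) ^ m * amom (2 * j + 1) ^ m) := by gcongr
    _ = _ := by
      rw [e2, ← mul_pow, ← mul_pow, ← div_pow]
      congr 1
      push_cast
      field_simp
      ring

theorem abs_realKer_le_one (m i j : ℕ) : |realKer m i j| ≤ 1 := by
  have h1 := pij_nonneg m i j
  have h2 := pij_le_one m i j
  have h3 := pij_nonneg m i (j - 1)
  have h4 := pij_le_one m i (j - 1)
  rw [realKer, abs_le]
  split_ifs <;> constructor <;> linarith

theorem abs_realKer_le (m i j : ℕ) :
    |realKer m (i + 1) j| ≤ ((2 * j + 2) / (2 * i + 1)) ^ m := by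
  have h1 := pij_nonneg m (i + 1) j
  have h2 := pij_succ_le m i j
  have h3 := pij_nonneg m (i + 1) (j - 1)
  have h4 : pij m (i + 1) (j - 1) ≤ ((2 * j + 2) / (2 * i + 1)) ^ m := by
    refine (pij_succ_le m i (j - 1)).trans ?_
    have : ((j - 1 : ℕ) : ℝ) ≤ j := by exact_mod_cast Nat.sub_le j 1
    gcongr
  rw [realKer, abs_le]
  split_ifs <;> constructor <;> linarith

theorem abs_realKer_le_exp {m n i j : ℕ} {β : ℝ} (hβ : 0 ≤ β) (hm : β * (2 * n) ≤ m) (hj : j ≤ i)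
    (hi : i < n) : |realKer m i j| ≤ Real.exp (-β * (2 * ((i : ℝ) - j) - 3)) := by
  by_cases hk : i ≤ j + 1
  · refine (abs_realKer_le_one m i j).trans (Real.one_le_exp ?_)
    have : (i : ℝ) ≤ j + 1 := by exact_mod_cast hk
    nlinarith
  obtain ⟨i, rfl⟩ : ∃ i', i = i' + 1 := ⟨i - 1, by omega⟩
  have hij : (j : ℝ) + 1 ≤ i := by exact_mod_cast (by omega : j + 1 ≤ i)
  have hin : (i : ℝ) + 2 ≤ n := by exact_mod_cast (by omega : i + 2 ≤ n)
  have hp : (0 : ℝ) < 2 * i + 1 := by positivity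
  refine (abs_realKer_le m i j).trans ?_
  set r : ℝ := 2 * (((i + 1 : ℕ) : ℝ) - j) - 3 with hr
  have hr0 : 0 ≤ r := by rw [hr]; push_cast; linarith
  have h1 : ((2 * j + 2) / (2 * i + 1) : ℝ) ≤ Real.exp (-(r / (2 * i + 1))) := by
    refine le_trans (le_of_eq ?_) (Real.add_one_le_exp _)
    rw [hr]
    push_cast
    field_simp
    ring
  calc ((2 * j + 2) / (2 * i + 1) : ℝ) ^ m ≤ Real.exp (-(r / (2 * i + 1))) ^ m := by gcongr
    _ = Real.exp (-(m * r / (2 * i + 1))) := by rw [← Real.exp_nat_mul]; congr 1; ring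
    _ ≤ _ := by
      rw [Real.exp_le_exp, neg_mul, neg_le_neg_iff, le_div_iff₀ hp]
      calc β * r * (2 * i + 1) ≤ β * r * (2 * n) := by gcongr; linarith
        _ = β * (2 * n) * r := by ring
        _ ≤ m * r := by gcongr

theorem abs_realKer_mul_le {m n i j : ℕ} {β : ℝ} (hβ : 0 ≤ β) (hm : β * (2 * n) ≤ m) (hi : i < n)
    (hj : j < n) : |realKer m i j * realKer m j i| ≤ Real.exp (-β * (2 * |(j : ℝ) - i| - 3)) := by
  rw [abs_mul]
  rcases le_total i j with h | h
  · rw [abs_of_nonneg (sub_nonneg.2 (by exact_mod_cast h))]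
    exact (mul_le_of_le_one_left (abs_nonneg _) (abs_realKer_le_one _ _ _)).trans
      (abs_realKer_le_exp hβ hm h hj)
  · rw [abs_of_nonpos (sub_nonpos.2 (by exact_mod_cast h)), neg_sub]
    exact (mul_le_of_le_one_right (abs_nonneg _) (abs_realKer_le_one _ _ _)).trans
      (abs_realKer_le_exp hβ hm h hi)

theorem integral_comp_floor (F : ℕ → ℝ) (n : ℕ) (hn : 0 < n) :
    ∫ t in (0 : ℝ)..1, F ⌊t * n⌋₊ = (∑ i ∈ Finset.range n, F i) / n := by
  have hn0 : (n : ℝ) ≠ 0 := by exact_mod_cast hn.ne'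
  have hcongr : ∀ i : ℕ, Set.EqOn (fun _ => F i) (fun x : ℝ => F ⌊x⌋₊)
      (Set.Ioo (i : ℝ) ((i + 1 : ℕ) : ℝ)) := fun i x hx => by
    have : ⌊x⌋₊ = i := (Nat.floor_eq_iff (i.cast_nonneg.trans hx.1.le)).2
      ⟨hx.1.le, by exact_mod_cast hx.2⟩
    simp only [this]
  have hle : ∀ i : ℕ, (i : ℝ) ≤ ((i + 1 : ℕ) : ℝ) := fun i => by push_cast; linarith
  have h := intervalIntegral.sum_integral_adjacent_intervals (f := fun x : ℝ => F ⌊x⌋₊) (μ := volume)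
    (a := fun i : ℕ => (i : ℝ)) (n := n) fun i _ =>
      (intervalIntegrable_const (c := F i)).congr_uIoo (by rw [Set.uIoo_of_le (hle i)]; exact hcongr i)
  have hi : ∀ i : ℕ, ∫ x in (i : ℝ)..((i + 1 : ℕ) : ℝ), F ⌊x⌋₊ = F i := fun i => by
    rw [← intervalIntegral.integral_congr_Ioo_of_le (hle i) (hcongr i),
      intervalIntegral.integral_const]
    simp
  simp only [hi] at h
  rw [h, intervalIntegral.integral_comp_mul_right (fun x => F ⌊x⌋₊) hn0, smul_eq_mul]
  simp
  ring

theorem tendsto_sum_div {F : ℕ → ℕ → ℝ} {Φ : ℝ → ℝ} (B : ℝ)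
    (hB : ∀ᶠ n in atTop, ∀ i < n, |F n i| ≤ B)
    (hlim : ∀ t ∈ Set.Ioo (0 : ℝ) 1, Tendsto (fun n : ℕ => F n ⌊t * n⌋₊) atTop (nhds (Φ t))) :
    Tendsto (fun n : ℕ => (∑ i ∈ Finset.range n, F n i) / n) atTop (nhds (∫ t in (0 : ℝ)..1, Φ t)) := by
  have h : Tendsto (fun n : ℕ => ∫ t in Set.Ioo (0 : ℝ) 1, F n ⌊t * n⌋₊) atTop
      (nhds (∫ t in Set.Ioo (0 : ℝ) 1, Φ t)) := by
    refine tendsto_integral_filter_of_dominated_convergence (fun _ => B) ?_ ?_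
      (integrable_const B) ?_
    · refine Eventually.of_forall fun n => Measurable.aestronglyMeasurable ?_
      exact measurable_from_nat.comp (Nat.measurable_floor.comp (measurable_id.mul_const _))
    · filter_upwards [hB, eventually_gt_atTop 0] with n hn hn0
      refine (ae_restrict_iff' measurableSet_Ioo).2 (Eventually.of_forall fun t ht => hn _ ?_)
      have hnr : (0 : ℝ) < n := by exact_mod_cast hn0
      rw [Nat.floor_lt (mul_nonneg ht.1.le hnr.le)]
      exact mul_lt_of_lt_one_left hnr ht.2
    · exact (ae_restrict_iff' measurableSet_Ioo).2 (Eventually.of_forall hlim)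
  rw [intervalIntegral.integral_of_le zero_le_one, integral_Ioc_eq_integral_Ioo]
  refine h.congr' ?_
  filter_upwards [eventually_gt_atTop 0] with n hn
  rw [← integral_comp_floor _ n hn, intervalIntegral.integral_of_le zero_le_one,
    integral_Ioc_eq_integral_Ioo]

theorem sum_range_eq_tsum_int (F : ℕ → ℝ) (n i : ℕ) : ∑ j ∈ Finset.range n, F j
    = ∑' k : ℤ, if 0 ≤ (i : ℤ) + k ∧ (i : ℤ) + k < n then F ((i : ℤ) + k).toNat else 0 := by
  have h : (∑' k : ℤ, if 0 ≤ (i : ℤ) + k ∧ (i : ℤ) + k < n then F ((i : ℤ) + k).toNat else 0)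
      = ∑' z : ℤ, if 0 ≤ z ∧ z < n then F z.toNat else 0 :=
    (Equiv.addLeft (i : ℤ)).tsum_eq fun z : ℤ => if 0 ≤ z ∧ z < n then F z.toNat else 0
  rw [h, tsum_eq_sum (s := (Finset.range n).map Nat.castEmbedding), Finset.sum_map]
  · refine Finset.sum_congr rfl fun j hj => ?_
    simp only [Nat.castEmbedding_apply, Int.toNat_natCast]
    rw [if_pos ⟨by positivity, by exact_mod_cast Finset.mem_range.1 hj⟩]
  · intro z hz
    rw [if_neg]
    rintro ⟨h0, h1⟩
    refine hz (Finset.mem_map.2 ⟨z.toNat, Finset.mem_range.2 (by omega), ?_⟩)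
    simp [Int.toNat_of_nonneg h0]

theorem summable_exp_abs {β : ℝ} (hβ : 0 < β) :
    Summable fun k : ℤ => Real.exp (-β * (2 * |(k : ℝ)| - 3)) := by
  have h : Summable fun k : ℕ => Real.exp (-β * (2 * (k : ℝ) - 3)) := by
    have := (Real.summable_exp_nat_mul_iff.2 (by linarith : -(2 * β) < 0)).mul_left (Real.exp (3 * β))
    refine this.congr fun k => ?_
    rw [← Real.exp_add]
    congr 1
    ring
  refine Summable.of_nat_of_neg ?_ ?_
  · simpa using h
  · simpa using h

theorem tendsto_floor_mul {t : ℝ} (ht : 0 < t) : Tendsto (fun n : ℕ => ⌊t * n⌋₊) atTop atTop :=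
  tendsto_nat_floor_atTop.comp (tendsto_natCast_atTop_atTop.const_mul_atTop ht)

theorem tendsto_ratio_floor {α : ℝ} {m : ℕ → ℕ}
    (hlim : Tendsto (fun n : ℕ => (m n : ℝ) / (2 * n : ℕ)) atTop (nhds α))
    {t : ℝ} (ht : 0 < t) :
    Tendsto (fun n : ℕ => (m n : ℝ) / (2 * ⌊t * n⌋₊ + 1)) atTop (nhds (α / t)) := by
  have h1 : Tendsto (fun n : ℕ => (⌊t * n⌋₊ : ℝ) / n) atTop (nhds t) :=
    (tendsto_nat_floor_mul_div_atTop ht.le).comp tendsto_natCast_atTop_atTop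
  have h2 : Tendsto (fun n : ℕ => (1 : ℝ) / (2 * n)) atTop (nhds 0) :=
    (tendsto_natCast_atTop_atTop.const_mul_atTop two_pos).const_div_atTop 1
  have h3 := h1.add h2
  rw [add_zero] at h3
  refine (hlim.div h3 ht.ne').congr' ?_
  filter_upwards [eventually_gt_atTop 0] with n hn
  have : (0 : ℝ) < n := by exact_mod_cast hn
  simp only [Pi.div_apply]
  push_cast
  field_simp

theorem tendsto_realKer_floor {α : ℝ} (hα : 0 < α) {m : ℕ → ℕ}
    (hlim : Tendsto (fun n : ℕ => (m n : ℝ) / (2 * n : ℕ)) atTop (nhds α))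
    {t : ℝ} (ht : 0 < t) (k : ℤ) :
    Tendsto (fun n : ℕ => realKer (m n) ⌊t * n⌋₊ ((⌊t * n⌋₊ : ℤ) + k).toNat) atTop
      (nhds (limKer (α / t) k)) := by
  have hf := tendsto_floor_mul ht
  refine tendsto_realKer (div_pos hα ht) k hf ?_ (tendsto_ratio_floor hlim ht)
  filter_upwards [hf.eventually_gt_atTop k.natAbs] with n hn
  omega

theorem tendsto_realKer_floor_swap {α : ℝ} (hα : 0 < α) {m : ℕ → ℕ}
    (hlim : Tendsto (fun n : ℕ => (m n : ℝ) / (2 * n : ℕ)) atTop (nhds α))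
    {t : ℝ} (ht : 0 < t) (k : ℤ) :
    Tendsto (fun n : ℕ => realKer (m n) ((⌊t * n⌋₊ : ℤ) + k).toNat ⌊t * n⌋₊) atTop
      (nhds (limKer (α / t) k)) := by
  have hf := tendsto_floor_mul ht
  have hr := tendsto_ratio_floor hlim ht
  have hev : ∀ᶠ n : ℕ in atTop, (((⌊t * n⌋₊ : ℤ) + k).toNat : ℤ) = ⌊t * n⌋₊ + k := by
    filter_upwards [hf.eventually_gt_atTop k.natAbs] with n hn
    omega
  have hT : Tendsto (fun n : ℕ => ((⌊t * n⌋₊ : ℤ) + k).toNat) atTop atTop := by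
    refine tendsto_atTop.2 fun b => ?_
    filter_upwards [hf.eventually_gt_atTop (k.natAbs + b)] with n hn
    omega
  rw [← limKer_neg]
  refine tendsto_realKer (div_pos hα ht) (-k) hT (hev.mono fun n hn => by rw [hn]; ring) ?_
  have hfr : Tendsto (fun n : ℕ => 2 * (⌊t * n⌋₊ : ℝ) + 1) atTop atTop :=
    tendsto_atTop_add_const_right _ _
      ((tendsto_natCast_atTop_atTop.comp hf).const_mul_atTop two_pos)
  have hx := (hfr.const_div_atTop (2 * k : ℝ)).const_add 1
  rw [add_zero] at hx
  have := hr.div hx one_ne_zero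
  rw [div_one] at this
  refine this.congr' ?_
  filter_upwards [hev] with n hn
  have hn' : ((((⌊t * n⌋₊ : ℤ) + k).toNat : ℕ) : ℝ) = ⌊t * n⌋₊ + k := by exact_mod_cast hn
  have hp : 2 * (⌊t * n⌋₊ : ℝ) + 1 ≠ 0 := by positivity
  simp only [Pi.div_apply]
  rw [hn', div_div]
  congr 1
  field_simp
  ring

theorem tendsto_trace_realKerMat {α : ℝ} (hα : 0 < α) {m : ℕ → ℕ}
    (hlim : Tendsto (fun n : ℕ => (m n : ℝ) / (2 * n : ℕ)) atTop (nhds α)) :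
    Tendsto (fun n : ℕ => (realKerMat (m n) n).trace / n) atTop
      (nhds (∫ t in (0 : ℝ)..1, limKer (α / t) 0)) := by
  have h := tendsto_sum_div (F := fun n i => realKer (m n) i i) (Φ := fun t => limKer (α / t) 0) 1
    (Eventually.of_forall fun n i _ => abs_realKer_le_one _ _ _)
    (fun t ht => by simpa using tendsto_realKer_floor hα hlim ht.1 0)
  refine h.congr fun n => ?_
  rw [Finset.sum_range]
  rfl

theorem tendsto_trace_realKerMat_sq {α : ℝ} (hα : 0 < α) {m : ℕ → ℕ}
    (hlim : Tendsto (fun n : ℕ => (m n : ℝ) / (2 * n : ℕ)) atTop (nhds α)) :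
    Tendsto (fun n : ℕ => (realKerMat (m n) n * realKerMat (m n) n).trace / n) atTop
      (nhds (∫ t in (0 : ℝ)..1, ∑' k : ℤ, limKer (α / t) k ^ 2)) := by
  have hβ : 0 < α / 2 := by positivity
  set bd : ℤ → ℝ := fun k => Real.exp (-(α / 2) * (2 * |(k : ℝ)| - 3)) with hbd
  have hm : ∀ᶠ n : ℕ in atTop, α / 2 * (2 * n) ≤ m n := by
    filter_upwards [hlim.eventually (lt_mem_nhds (by linarith : α / 2 < α)),
      eventually_gt_atTop 0] with n hn hn0
    have : (0 : ℝ) < 2 * n := by positivity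
    rw [Nat.cast_mul, Nat.cast_ofNat, lt_div_iff₀ this] at hn
    exact hn.le
  set G : ℕ → ℕ → ℤ → ℝ := fun n i k => if 0 ≤ (i : ℤ) + k ∧ (i : ℤ) + k < n then
    realKer (m n) i ((i : ℤ) + k).toNat * realKer (m n) ((i : ℤ) + k).toNat i else 0 with hG
  have hGb : ∀ᶠ n in atTop, ∀ i < n, ∀ k, ‖G n i k‖ ≤ bd k := by
    filter_upwards [hm] with n hn i hi k
    simp only [hG]
    split_ifs with hk
    · have := abs_realKer_mul_le hβ.le hn hi (by omega : ((i : ℤ) + k).toNat < n)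
      have hc : ((((i : ℤ) + k).toNat : ℕ) : ℝ) = i + k := by
        exact_mod_cast Int.toNat_of_nonneg hk.1
      rwa [hc, add_sub_cancel_left] at this
    · rw [norm_zero]; exact (Real.exp_pos _).le
  have h := tendsto_sum_div (F := fun n i => ∑' k, G n i k)
    (Φ := fun t => ∑' k : ℤ, limKer (α / t) k ^ 2) (∑' k, bd k) ?_ ?_
  · refine h.congr fun n => ?_
    congr 1
    rw [Finset.sum_range]
    refine Finset.sum_congr rfl fun i _ => ?_
    simp only [hG]
    rw [← sum_range_eq_tsum_int (fun j => realKer (m n) i j * realKer (m n) j i), Finset.sum_range]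
    rfl
  · filter_upwards [hGb] with n hn i hi
    exact tsum_of_norm_bounded (summable_exp_abs hβ).hasSum (hn i hi)
  · intro t ht
    refine tendsto_tsum_of_dominated_convergence (summable_exp_abs hβ) (fun k => ?_) ?_
    · have h2 := (tendsto_realKer_floor hα hlim ht.1 k).mul (tendsto_realKer_floor_swap hα hlim ht.1 k)
      rw [← sq] at h2
      refine h2.congr' ?_
      have hf := tendsto_floor_mul ht.1
      have h1t : 0 < 1 - t := by linarith [ht.2]
      filter_upwards [hf.eventually_gt_atTop k.natAbs,
        (tendsto_natCast_atTop_atTop.const_mul_atTop h1t).eventually_gt_atTop (k : ℝ)] with n hn hk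
      simp only [hG]
      rw [if_pos]
      refine ⟨by omega, ?_⟩
      have hfl : (⌊t * n⌋₊ : ℝ) ≤ t * n := Nat.floor_le (by have := ht.1; positivity)
      have : (⌊t * n⌋₊ : ℝ) + k < n := by linarith
      exact_mod_cast this
    · filter_upwards [hGb, eventually_gt_atTop 0] with n hn hn0 k
      refine hn _ ?_ k
      have hnr : (0 : ℝ) < n := by exact_mod_cast hn0
      rw [Nat.floor_lt (mul_nonneg ht.1.le hnr.le)]
      exact mul_lt_of_lt_one_left hnr ht.2

theorem limKer_zero (v : ℝ) (hv : 0 < v) : limKer v 0 = erf √(v / 8) := by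
  have hw : 0 < √(v / 8) := Real.sqrt_pos.2 (by positivity)
  have hw2 : √(v / 8) ^ 2 = v / 8 := Real.sq_sqrt (by positivity)
  set w := √(v / 8) with hwd
  have hsub := intervalIntegral.integral_comp_mul_left (a := -1) (b := 1)
    (fun y => Real.exp (-y ^ 2)) (c := w) hw.ne'
  have hexp : ∀ x : ℝ, Real.exp (-(w * x) ^ 2) = Real.exp (-(v * x ^ 2) / 8) := fun x => by
    congr 1
    rw [mul_pow, hw2]
    ring
  simp only [hexp, mul_neg, mul_one] at hsub
  have hneg := intervalIntegral.integral_comp_neg (a := 0) (b := w) fun y => Real.exp (-y ^ 2)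
  simp only [neg_sq, neg_zero] at hneg
  have hint : ∀ a b : ℝ, IntervalIntegrable (fun y => Real.exp (-y ^ 2)) volume a b := fun a b =>
    (by fun_prop : Continuous fun y : ℝ => Real.exp (-y ^ 2)).intervalIntegrable a b
  have hadd := intervalIntegral.integral_add_adjacent_intervals (hint (-w) 0) (hint 0 w)
  have hc : √(v / (8 * Real.pi)) = w * (√Real.pi)⁻¹ := by
    rw [hwd, ← Real.sqrt_inv, ← Real.sqrt_mul (by positivity)]
    congr 1
    field_simp
  rw [limKer, erf, hc]
  norm_num only [Int.cast_zero, mul_zero, zero_sub, zero_add]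
  rw [hsub, ← hadd, ← hneg, smul_eq_mul]
  field_simp
  ring

theorem cFun_eq (α : ℝ) (hα : 0 < α) : cFun α = ∫ t in (0 : ℝ)..1, limKer (α / t) 0 := by
  refine intervalIntegral.integral_congr_Ioo_of_le zero_le_one fun t ht => ?_
  rw [limKer_zero _ (div_pos hα ht.1), div_div, mul_comm t]

theorem sFun_eq (α : ℝ) (hα : 0 < α) :
    sFun α = ∫ t in (0 : ℝ)..1, ∑' k : ℤ, limKer (α / t) k ^ 2 := by
  refine intervalIntegral.integral_congr_Ioo_of_le zero_le_one fun t ht => ?_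
  have ht0 := ht.1
  have hpi := Real.pi_pos
  rw [← tsum_mul_left]
  refine tsum_congr fun k => ?_
  rw [limKer, mul_pow, Real.sq_sqrt (by positivity), div_div]
  congr 2
  · ring
  · congr 1
    ext x
    congr 1
    field_simp

theorem erf_pos {x : ℝ} (hx : 0 < x) : 0 < erf x := by
  have hpi := Real.pi_pos
  refine mul_pos (by positivity) (intervalIntegral.intervalIntegral_pos_of_pos_on
    ((by fun_prop : Continuous fun y : ℝ => Real.exp (-y ^ 2)).intervalIntegrable _ _)
    (fun y _ => Real.exp_pos _) hx)

theorem cFun_pos (α : ℝ) (hα : 0 < α) : 0 < cFun α := by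
  have hpi := Real.pi_pos
  have hexp : Continuous fun y : ℝ => Real.exp (-y ^ 2) := by fun_prop
  have hcont : Continuous erf :=
    (intervalIntegral.continuous_primitive (fun a b => hexp.intervalIntegrable a b) 0).const_mul _
  have hle : ∀ x : ℝ, 0 ≤ x → erf x ≤ 2 / √Real.pi * ∫ y, Real.exp (-y ^ 2) := by
    intro x hx
    rw [erf, intervalIntegral.integral_of_le hx]
    refine mul_le_mul_of_nonneg_left ?_ (by positivity)
    refine setIntegral_le_integral ?_ (Eventually.of_forall fun y => (Real.exp_pos _).le)
    simpa using integrable_exp_neg_mul_sq one_pos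
  have hnn : ∀ x : ℝ, 0 ≤ x → 0 ≤ erf x := fun x hx => by
    rcases hx.eq_or_lt with rfl | h
    · simp [erf]
    · exact (erf_pos h).le
  refine intervalIntegral.intervalIntegral_pos_of_pos_on ?_ (fun t ht =>
    erf_pos (Real.sqrt_pos.2 (div_pos hα (mul_pos (by norm_num) ht.1)))) one_pos
  refine (intervalIntegrable_const (c := 2 / √Real.pi * ∫ y, Real.exp (-y ^ 2))).mono_fun
    (Measurable.aestronglyMeasurable (by
      have := hcont.measurable
      fun_prop)) (Eventually.of_forall fun t => ?_)
  change ‖erf √(α / (8 * t))‖ ≤ ‖_‖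
  rw [Real.norm_of_nonneg (hnn _ (Real.sqrt_nonneg _))]
  exact (hle _ (Real.sqrt_nonneg _)).trans (le_abs_self _)

end

/-- In the critical regime `m = αN`, the ratio of the variance to the
expected number of real eigenvalues converges to `r(α) = 2 - 2 s(α)/c(α)`. -/
theorem variance_over_mean_real_eigenvalues_critical (α : ℝ) (hα : 0 < α)
    (m : ℕ → ℕ) (hm : ∀ n, 0 < m n)
    (hlim : Tendsto (fun n : ℕ => (m n : ℝ) / (2 * n : ℕ)) atTop (nhds α)) :
    Tendsto (fun n : ℕ => VN (2 * n) (m n) / EN (2 * n) (m n)) atTop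
      (nhds (2 - 2 * sFun α / cFun α)) := by
  have hc := cFun_pos α hα
  have h1 := tendsto_trace_realKerMat hα hlim
  have h2 := tendsto_trace_realKerMat_sq hα hlim
  rw [← cFun_eq α hα] at h1
  rw [← sFun_eq α hα] at h2
  refine (tendsto_const_nhds.sub ((h2.const_mul 2).div h1 hc.ne')).congr' ?_
  filter_upwards [h1.eventually (lt_mem_nhds hc), eventually_gt_atTop 1] with n hn hn1
  have : NeZero (m n) := ⟨(hm n).ne'⟩
  have hn0 : (0 : ℝ) < n := by positivity
  have ht : (realKerMat (m n) n).trace ≠ 0 := fun h => by simp [h] at hn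
  rw [EN_eq_trace (m n) n (by omega), VN_eq_trace (m n) n hn1]
  simp only [Pi.div_apply]
  field_simp
  ring
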